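/- Let u_n be the largest atom of S_n and π the prime-counting function. Then π(u_n)/n tends to 3 as n → ∞. -/

import Mathlib

open Filter Pointwise

/-- `nthPrime n` is the `n`-th prime number (1-indexed): `nthPrime 1 = 2`, etc. -/
noncomputable def nthPrime (n : ℕ) : ℕ := Nat.nth Nat.Prime (n - 1)

/-- `S n` is the additive submonoid of `ℕ` generated by the primes `q ≥ nthPrime n`. -/
def S (n : ℕ) : AddSubmonoid ℕ :=
  AddSubmonoid.closure {q : ℕ | q.Prime ∧ nthPrime n ≤ q}

/-- `frob n` is the Frobenius number of `S n`: the largest natural number not in `S n`. -/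
noncomputable def frob (n : ℕ) : ℕ := sSup {m : ℕ | m ∉ S n}

/-- `genus n` is the number of natural numbers not in `S n`. -/
noncomputable def genus (n : ℕ) : ℕ := {m : ℕ | m ∉ S n}.ncard

/-- `atoms n` is the minimal generating set `S n \ {0} \ ((S n \ {0}) + (S n \ {0}))`. -/
def atoms (n : ℕ) : Set ℕ :=
  ((S n : Set ℕ) \ {0}) \ (((S n : Set ℕ) \ {0}) + ((S n : Set ℕ) \ {0}))

/-- `u n` is the largest atom of `S n`. -/
noncomputable def u (n : ℕ) : ℕ := sSup (atoms n)

/-- `e n` is the embedding dimension of `S n`: the number of atoms. -/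
noncomputable def e (n : ℕ) : ℕ := (atoms n).ncard

namespace PrimeSemi
open Finset

/-- The additive character `x ↦ exp (2πix)` of `ℝ`, with values in `ℂ`. -/
noncomputable def ex (x : ℝ) : ℂ := Complex.exp ((2 * Real.pi * x : ℝ) * Complex.I)

theorem ex_add (x y : ℝ) : ex (x + y) = ex x * ex y := by
  simp only [ex, ← Complex.exp_add]
  congr 1
  push_cast
  ring

@[simp] theorem ex_zero : ex 0 = 1 := by simp [ex]

@[simp] theorem norm_ex (x : ℝ) : ‖ex x‖ = 1 := Complex.norm_exp_ofReal_mul_I _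

@[simp] theorem ex_int (n : ℤ) : ex n = 1 := by
  rw [ex, Complex.exp_eq_one_iff]
  exact ⟨n, by push_cast; ring⟩

@[simp] theorem ex_nat (n : ℕ) : ex n = 1 := by simpa using ex_int n

theorem ex_add_int (x : ℝ) (n : ℤ) : ex (x + n) = ex x := by rw [ex_add, ex_int, mul_one]

theorem ex_neg (x : ℝ) : ex (-x) = (starRingEnd ℂ) (ex x) := by
  rw [ex, ex, ← Complex.exp_conj, map_mul, Complex.conj_ofReal, Complex.conj_I]
  congr 1
  push_cast
  ring

theorem ex_nat_mul (n : ℕ) (x : ℝ) : ex (n * x) = ex x ^ n := by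
  rw [ex, ex, ← Complex.exp_nat_mul]
  congr 1
  push_cast
  ring

theorem ex_eq_one_iff (x : ℝ) : ex x = 1 ↔ ∃ n : ℤ, x = n := by
  constructor
  · intro h
    rw [ex, Complex.exp_eq_one_iff] at h
    obtain ⟨n, hn⟩ := h
    refine ⟨n, ?_⟩
    have h1 : ((2 * Real.pi * x : ℝ) : ℂ) = ((2 * Real.pi * n : ℝ) : ℂ) := by
      apply mul_right_cancel₀ Complex.I_ne_zero
      rw [hn]
      push_cast
      ring
    have h2 := Complex.ofReal_injective h1
    have := Real.pi_pos
    exact mul_left_cancel₀ (by positivity) h2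
  · rintro ⟨n, rfl⟩
    exact ex_int n

theorem norm_ex_sub_one_eq (x : ℝ) : ‖ex x - 1‖ = 2 * |Real.sin (Real.pi * x)| := by
  rw [ex, mul_comm, Complex.norm_exp_I_mul_ofReal_sub_one]
  rw [norm_mul, Real.norm_eq_abs, Real.norm_eq_abs]
  norm_num
  congr 1
  ring_nf

theorem norm_ex_sub_one_le (x : ℝ) : ‖ex x - 1‖ ≤ 2 * Real.pi * |x| := by
  rw [norm_ex_sub_one_eq]
  have h := Real.abs_sin_le_abs (x := Real.pi * x)
  rw [abs_mul, abs_of_pos Real.pi_pos] at h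
  linarith

theorem norm_ex_sub_ex_le (x y : ℝ) : ‖ex x - ex y‖ ≤ 2 * Real.pi * |x - y| := by
  have : ex x - ex y = (ex (x - y) - 1) * ex y := by
    rw [sub_mul, ← ex_add]
    simp
  rw [this, norm_mul, norm_ex, mul_one]
  exact norm_ex_sub_one_le _

/-- The distance to the nearest integer. -/
noncomputable def nn (x : ℝ) : ℝ := |x - round x|

theorem nn_nonneg (x : ℝ) : 0 ≤ nn x := abs_nonneg _

theorem nn_le_half (x : ℝ) : nn x ≤ 1 / 2 := abs_sub_round x

theorem nn_le_abs_sub (x : ℝ) (n : ℤ) : nn x ≤ |x - n| := round_le x n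

theorem nn_le_abs (x : ℝ) : nn x ≤ |x| := by simpa using nn_le_abs_sub x 0

theorem nn_add_int (x : ℝ) (n : ℤ) : nn (x + n) = nn x := by
  simp [nn]

theorem nn_add_le (x y : ℝ) : nn (x + y) ≤ nn x + |y| := by
  refine (nn_le_abs_sub (x + y) (round x)).trans ?_
  rw [nn]
  calc |x + y - round x| = |(x - round x) + y| := by congr 1; ring
    _ ≤ _ := abs_add_le _ _

theorem nn_of_abs_le_half {x : ℝ} (hx : |x| ≤ 1 / 2) : nn x = |x| := by
  apply le_antisymm (nn_le_abs x)
  rw [nn]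
  by_cases h0 : round x = 0
  · simp [h0]
  · have h1 : (1 : ℝ) ≤ |(round x : ℝ)| := by
      exact_mod_cast Int.one_le_abs h0
    have := abs_sub_abs_le_abs_sub ((round x : ℝ)) x
    rw [abs_sub_comm] at this
    linarith

theorem nn_int_div_ge {a : ℤ} {q : ℕ} (hq : 0 < q) (h : ¬ (q : ℤ) ∣ a) :
    1 / (q : ℝ) ≤ nn ((a : ℝ) / q) := by
  rw [nn]
  set m := round ((a : ℝ) / q)
  have hq' : (0 : ℝ) < q := by exact_mod_cast hq
  have h1 : a - m * q ≠ 0 := by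
    intro h2
    exact h ⟨m, by linarith⟩
  have h2 : (1 : ℝ) ≤ |((a - m * q : ℤ) : ℝ)| := by exact_mod_cast Int.one_le_abs h1
  have h3 : (a : ℝ) / q - m = ((a - m * q : ℤ) : ℝ) / q := by
    push_cast
    field_simp
  rw [h3, abs_div, abs_of_pos hq']
  gcongr

theorem four_mul_nn_le (x : ℝ) : 4 * nn x ≤ ‖ex x - 1‖ := by
  have h1 : ex x = ex (x - round x) := by
    have := ex_add_int (x - round x) (round x)
    rw [← this]; simp
  rw [h1, norm_ex_sub_one_eq]
  have h2 : nn x = |x - round x| := rfl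
  have h4 := nn_le_half x
  have h3 : 2 / Real.pi * (Real.pi * nn x) ≤ Real.sin (Real.pi * nn x) :=
    Real.mul_le_sin (by have := Real.pi_pos; have := nn_nonneg x; positivity)
      (by have := Real.pi_pos; nlinarith)
  have h5 : |Real.sin (Real.pi * (x - round x))| = |Real.sin (Real.pi * nn x)| := by
    rw [h2]
    rcases abs_choice (x - round x) with h | h
    · rw [h]
    · rw [h, mul_neg, Real.sin_neg, abs_neg]
  rw [h5]
  have h6 : 2 / Real.pi * (Real.pi * nn x) = 2 * nn x := by
    field_simp
  have := le_abs_self (Real.sin (Real.pi * nn x))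
  linarith

theorem sum_range_ex_mul_nn_le (N : ℕ) (x : ℝ) :
    ‖∑ n ∈ range N, ex (n * x)‖ * (2 * nn x) ≤ 1 := by
  have h1 : (∑ n ∈ range N, ex (n * x)) * (ex x - 1) = ex x ^ N - 1 := by
    simp only [ex_nat_mul]
    exact geom_sum_mul _ _
  have h2 : ‖∑ n ∈ range N, ex (n * x)‖ * ‖ex x - 1‖ ≤ 2 := by
    rw [← norm_mul, h1]
    refine (norm_sub_le _ _).trans ?_
    simp
    norm_num
  have h3 := four_mul_nn_le x
  have h4 := norm_nonneg (∑ n ∈ range N, ex (n * x))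
  nlinarith

theorem sum_Ioc_ex_eq (a b : ℕ) (x : ℝ) :
    ∑ n ∈ Ioc a b, ex (n * x) = ex ((a + 1) * x) * ∑ n ∈ range (b - a), ex (n * x) := by
  have h : Ioc a b = (range (b - a)).map (addLeftEmbedding (a + 1)) := by
    ext n
    simp only [mem_Ioc, Finset.mem_map, mem_range, addLeftEmbedding_apply]
    constructor
    · rintro ⟨h1, h2⟩; exact ⟨n - (a + 1), by omega, by omega⟩
    · rintro ⟨k, h1, h2⟩; omega
  rw [h, sum_map, mul_sum]
  refine sum_congr rfl fun n _ => ?_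
  rw [← ex_add, addLeftEmbedding_apply]
  congr 1
  push_cast
  ring

theorem sum_Ioc_ex_mul_nn_le (a b : ℕ) (x : ℝ) :
    ‖∑ n ∈ Ioc a b, ex (n * x)‖ * (2 * nn x) ≤ 1 := by
  rw [sum_Ioc_ex_eq, norm_mul, norm_ex, one_mul]
  exact sum_range_ex_mul_nn_le _ _

theorem norm_sum_Ioc_ex_le (a b : ℕ) (x : ℝ) : ‖∑ n ∈ Ioc a b, ex (n * x)‖ ≤ (b - a : ℕ) := by
  refine (norm_sum_le _ _).trans ?_
  simp

/-- `min A (1 / (2 ‖x‖))` bounds geometric sums with at most `A` terms. -/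
noncomputable def geoBound (A x : ℝ) : ℝ := if nn x = 0 then A else min A (1 / (2 * nn x))

theorem le_geoBound {s A x : ℝ} (h1 : s ≤ A) (h2 : s * (2 * nn x) ≤ 1) : s ≤ geoBound A x := by
  rw [geoBound]
  split_ifs with h
  · exact h1
  · have : 0 < nn x := lt_of_le_of_ne (nn_nonneg x) (Ne.symm h)
    exact le_min h1 (by rw [le_div_iff₀ (by positivity)]; exact h2)

theorem geoBound_le_left (A x : ℝ) : geoBound A x ≤ A := by
  rw [geoBound]
  split_ifs with h
  · exact le_rfl
  · exact min_le_left _ _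

theorem geoBound_le_right {A x : ℝ} (h : 0 < nn x) : geoBound A x ≤ 1 / (2 * nn x) := by
  rw [geoBound, if_neg h.ne']
  exact min_le_right _ _

theorem geoBound_nonneg {A : ℝ} (hA : 0 ≤ A) (x : ℝ) : 0 ≤ geoBound A x := by
  rw [geoBound]
  have := nn_nonneg x
  split_ifs
  · exact hA
  · exact le_min hA (by positivity)

theorem geoBound_mono {A B : ℝ} (h : A ≤ B) (x : ℝ) : geoBound A x ≤ geoBound B x := by
  rw [geoBound, geoBound]
  split_ifs
  · exact h
  · exact min_le_min_right _ h

theorem norm_sum_Ioc_ex_le_geoBound {a b : ℕ} {A : ℝ} (hA : ((b - a : ℕ) : ℝ) ≤ A) (x : ℝ) :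
    ‖∑ n ∈ Ioc a b, ex (n * x)‖ ≤ geoBound A x :=
  le_geoBound ((norm_sum_Ioc_ex_le a b x).trans hA) (sum_Ioc_ex_mul_nn_le a b x)

/-! ### Ramanujan sums -/

/-- Reduced residues modulo `r`. -/
def cop (r : ℕ) : Finset ℕ := {b ∈ range r | b.Coprime r}

theorem card_cop (r : ℕ) : (cop r).card = r.totient := by
  rw [Nat.totient, cop]
  congr 1
  ext b
  simp [Nat.coprime_comm]

theorem sum_range_eq_sum_divisors {r : ℕ} (hr : 0 < r) (f : ℝ → ℂ) :
    ∑ b ∈ range r, f ((b : ℝ) / r) = ∑ d ∈ r.divisors, ∑ b ∈ cop d, f ((b : ℝ) / d) := by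
  have hmap : ∀ b ∈ range r, r / Nat.gcd b r ∈ r.divisors := fun b _ =>
    Nat.mem_divisors.2 ⟨Nat.div_dvd_of_dvd (Nat.gcd_dvd_right _ _), hr.ne'⟩
  rw [← sum_fiberwise_of_maps_to hmap]
  refine sum_congr rfl fun d hd => ?_
  have hd' := Nat.dvd_of_mem_divisors hd
  obtain ⟨k, rfl⟩ := hd'
  have hd0 : 0 < d := Nat.pos_of_mul_pos_right hr
  have hk0 : 0 < k := Nat.pos_of_mul_pos_left hr
  symm
  refine sum_bij (fun b _ => b * k) ?_ ?_ ?_ ?_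
  · intro b hb
    simp only [cop, mem_filter, mem_range] at hb ⊢
    refine ⟨Nat.mul_lt_mul_of_pos_right hb.1 hk0, ?_⟩
    rw [Nat.gcd_mul_right, hb.2, one_mul, Nat.mul_div_cancel _ hk0]
  · intro a _ b _ h
    exact Nat.eq_of_mul_eq_mul_right hk0 h
  · intro b hb
    simp only [mem_filter, mem_range] at hb
    obtain ⟨hb1, hb2⟩ := hb
    have hg : Nat.gcd b (d * k) = k := by
      have h1 : Nat.gcd b (d * k) * (d * k / Nat.gcd b (d * k)) = d * k :=
        Nat.mul_div_cancel' (Nat.gcd_dvd_right _ _)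
      rw [hb2] at h1
      rw [mul_comm] at h1
      exact Nat.eq_of_mul_eq_mul_left hd0 h1
    obtain ⟨c, hc⟩ : k ∣ b := hg ▸ Nat.gcd_dvd_left _ _
    refine ⟨c, ?_, by rw [hc, mul_comm]⟩
    subst hc
    simp only [cop, mem_filter, mem_range]
    refine ⟨?_, ?_⟩
    · rw [mul_comm] at hb1
      exact Nat.lt_of_mul_lt_mul_right hb1
    · rw [mul_comm k c, Nat.gcd_mul_right] at hg
      exact Nat.eq_of_mul_eq_mul_right hk0 (by rw [hg, one_mul])
  · intro b _
    congr 1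
    have : (k : ℝ) ≠ 0 := by exact_mod_cast hk0.ne'
    push_cast
    rw [mul_div_mul_right _ _ this]

/-- Ramanujan's sum `c_r(n)`. -/
noncomputable def ram (r n : ℕ) : ℂ := ∑ b ∈ cop r, ex (n * ((b : ℝ) / r))

theorem sum_range_ex_div {r n : ℕ} (hr : 0 < r) :
    ∑ b ∈ range r, ex (n * ((b : ℝ) / r)) = if r ∣ n then (r : ℂ) else 0 := by
  have hr' : (r : ℝ) ≠ 0 := by exact_mod_cast hr.ne'
  have h1 : ∀ b : ℕ, ex (n * ((b : ℝ) / r)) = ex ((n : ℝ) / r) ^ b := by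
    intro b
    rw [← ex_nat_mul]
    congr 1
    ring
  simp only [h1]
  have hiff : ex ((n : ℝ) / r) = 1 ↔ r ∣ n := by
    rw [ex_eq_one_iff]
    constructor
    · rintro ⟨m, hm⟩
      rw [div_eq_iff hr'] at hm
      have : (n : ℤ) = m * r := by exact_mod_cast hm
      exact Int.natCast_dvd_natCast.1 ⟨m, by rw [this, mul_comm]⟩
    · rintro ⟨m, rfl⟩
      exact ⟨m, by push_cast; field_simp⟩
  split_ifs with h
  · rw [hiff.2 h]
    simp
  · have hne : ex ((n : ℝ) / r) ≠ 1 := fun h' => h (hiff.1 h')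
    have h2 := geom_sum_mul (ex ((n : ℝ) / r)) r
    have h3 : ex ((n : ℝ) / r) ^ r = 1 := by
      rw [← ex_nat_mul, mul_div_cancel₀ _ hr', ex_nat]
    rw [h3, sub_self] at h2
    exact (mul_eq_zero.1 h2).resolve_right (sub_ne_zero.2 hne)

theorem ram_of_coprime {r n : ℕ} (hr : 0 < r) (h : n.Coprime r) :
    ram r n = (ArithmeticFunction.moebius r : ℂ) := by
  have key := (ArithmeticFunction.sum_eq_iff_sum_mul_moebius_eq_on (R := ℂ)
    (f := fun d => ram d n) (g := fun d => if d = 1 then 1 else 0)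
    {r : ℕ | n.Coprime r} (fun m k hmk hk => Nat.Coprime.coprime_dvd_right hmk hk)).1 ?_ r hr h
  · rw [← key]
    rw [sum_eq_single (r, 1)]
    · simp
    · rintro ⟨a, b⟩ _ hne
      simp only
      rw [if_neg, mul_zero]
      rintro rfl
      rename_i hmem
      simp only [Nat.mem_divisorsAntidiagonal, mul_one] at hmem
      exact hne (by rw [hmem.1])
    · intro hnot
      exact absurd (Nat.mem_divisorsAntidiagonal.2 ⟨mul_one r, hr.ne'⟩) hnot
  · intro d hd hdc
    have h1 := sum_range_eq_sum_divisors hd (fun x => ex (n * x))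
    simp only [ram]
    rw [← h1, sum_range_ex_div hd]
    by_cases hd1 : d = 1
    · simp [hd1]
    · rw [if_neg hd1, if_neg]
      intro hdvd
      exact hd1 (Nat.dvd_one.1 ((Nat.Coprime.dvd_of_dvd_mul_left (Nat.Coprime.symm hdc)
        (by simpa using hdvd))))

theorem norm_ram_le_one {r n : ℕ} (hr : 0 < r) (h : n.Coprime r) : ‖ram r n‖ ≤ 1 := by
  rw [ram_of_coprime hr h, Complex.norm_intCast]
  exact_mod_cast ArithmeticFunction.abs_moebius_le_one

theorem norm_ram_le (r n : ℕ) : ‖ram r n‖ ≤ r.totient := by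
  rw [ram, ← card_cop]
  refine (norm_sum_le _ _).trans ?_
  simp

/-! ### Exponential sums -/

/-- The exponential sum `∑_{n ∈ s} f n e(nα)`. -/
noncomputable def esum (s : Finset ℕ) (f : ℕ → ℝ) (α : ℝ) : ℂ := ∑ n ∈ s, (f n : ℂ) * ex (n * α)

theorem esum_add_int (s : Finset ℕ) (f : ℕ → ℝ) (α : ℝ) (m : ℤ) :
    esum s f (α + m) = esum s f α := by
  refine sum_congr rfl fun n _ => ?_
  have : (n : ℝ) * (α + m) = n * α + ((n * m : ℤ) : ℝ) := by push_cast; ring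
  rw [this, ex_add_int]

theorem norm_esum_le (s : Finset ℕ) (f : ℕ → ℝ) (α : ℝ) : ‖esum s f α‖ ≤ ∑ n ∈ s, |f n| := by
  refine (norm_sum_le _ _).trans (le_of_eq ?_)
  refine sum_congr rfl fun n _ => ?_
  rw [norm_mul, norm_ex, mul_one, Complex.norm_real, Real.norm_eq_abs]

/-- The analytic core of the large sieve, for a function supported on integers coprime to `r`. -/
theorem norm_esum_sq_le {s : Finset ℕ} {f : ℕ → ℝ} {r : ℕ} (hr : Squarefree r)
    (hf : ∀ n ∈ s, f n ≠ 0 → n.Coprime r) (α : ℝ) :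
    ‖esum s f α‖ ^ 2 ≤ r.totient * ∑ b ∈ cop r, ‖esum s f (α + (b : ℝ) / r)‖ ^ 2 := by
  have hr0 : 0 < r := Nat.pos_of_ne_zero hr.ne_zero
  have h1 : ∑ b ∈ cop r, esum s f (α + (b : ℝ) / r)
      = (ArithmeticFunction.moebius r : ℂ) * esum s f α := by
    simp only [esum]
    rw [sum_comm, mul_sum]
    refine sum_congr rfl fun n hn => ?_
    by_cases h0 : f n = 0
    · simp [h0]
    · rw [← ram_of_coprime hr0 (hf n hn h0), ram, sum_mul]
      refine sum_congr rfl fun b _ => ?_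
      rw [mul_add, ex_add]
      ring
  have h2 : ‖esum s f α‖ = ‖∑ b ∈ cop r, esum s f (α + (b : ℝ) / r)‖ := by
    rw [h1, norm_mul, Complex.norm_intCast]
    have : |(ArithmeticFunction.moebius r : ℤ)| = 1 :=
      ArithmeticFunction.abs_moebius_eq_one_of_squarefree hr
    rw [← Int.cast_abs, this]
    simp
  rw [h2, ← card_cop]
  calc ‖∑ b ∈ cop r, esum s f (α + (b : ℝ) / r)‖ ^ 2
      ≤ (∑ b ∈ cop r, ‖esum s f (α + (b : ℝ) / r)‖) ^ 2 := by
        gcongr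
        exact norm_sum_le _ _
    _ ≤ _ := sq_sum_le_card_mul_sum_sq

/-! ### The Euler product `∏_{p ≤ Q} (1 - 1/p)⁻¹` -/

/-- The Euler product `∏_{p ≤ Q} (1 - 1/p)⁻¹`. -/
noncomputable def eul (Q : ℕ) : ℝ := ∏ p ∈ (Q + 1).primesBelow, (1 - (p : ℝ)⁻¹)⁻¹

theorem one_sub_inv_pos {p : ℕ} (hp : p.Prime) : 0 < 1 - (p : ℝ)⁻¹ := by
  have : (1 : ℝ) < p := by exact_mod_cast hp.one_lt
  have := inv_lt_one_of_one_lt₀ this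
  linarith

theorem one_le_one_sub_inv_inv {p : ℕ} (hp : p.Prime) : 1 ≤ (1 - (p : ℝ)⁻¹)⁻¹ := by
  rw [one_le_inv₀ (one_sub_inv_pos hp)]
  have : (0 : ℝ) ≤ (p : ℝ)⁻¹ := by positivity
  linarith

theorem eul_mono {Q Q' : ℕ} (h : Q ≤ Q') : eul Q ≤ eul Q' := by
  apply prod_le_prod_of_subset_of_one_le
  · intro p hp
    rw [Nat.mem_primesBelow] at hp ⊢
    exact ⟨by omega, hp.2⟩
  · intro p hp
    exact (inv_pos.2 (one_sub_inv_pos (Nat.prime_of_mem_primesBelow hp))).le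
  · intro p hp _
    exact one_le_one_sub_inv_inv (Nat.prime_of_mem_primesBelow hp)

theorem one_le_eul (Q : ℕ) : 1 ≤ eul Q :=
  Finset.one_le_prod fun _ hp => one_le_one_sub_inv_inv (Nat.prime_of_mem_primesBelow hp)

theorem eul_pos (Q : ℕ) : 0 < eul Q := lt_of_lt_of_le one_pos (one_le_eul Q)

theorem card_primes_dyadic (k : ℕ) :
    (#{p ∈ Ioc (2 ^ k) (2 ^ (k + 1)) | p.Prime} : ℝ) * k ≤ 4 * 2 ^ k := by
  have h1 := Chebyshev.theta_le_log4_mul_x (x := 2 ^ (k + 1)) (by positivity)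
  have h2 : (#{p ∈ Ioc (2 ^ k) (2 ^ (k + 1)) | p.Prime} : ℝ) * (k * Real.log 2)
      ≤ Chebyshev.theta (2 ^ (k + 1)) := by
    have hfl : ⌊((2 : ℝ) ^ (k + 1))⌋₊ = 2 ^ (k + 1) := by
      have : ((2 : ℝ) ^ (k + 1)) = ((2 ^ (k + 1) : ℕ) : ℝ) := by push_cast; rfl
      rw [this, Nat.floor_natCast]
    rw [Chebyshev.theta, hfl, ← nsmul_eq_mul]
    refine (card_nsmul_le_sum _ (fun p : ℕ => Real.log p) _ ?_).trans ?_
    · intro p hp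
      simp only [mem_filter, mem_Ioc] at hp
      rw [← Real.log_pow]
      apply Real.log_le_log (by positivity)
      exact_mod_cast hp.1.1.le
    · apply sum_le_sum_of_subset_of_nonneg
      · intro p hp
        simp only [mem_filter, mem_Ioc] at hp ⊢
        exact ⟨⟨hp.2.pos, hp.1.2⟩, hp.2⟩
      · intro p hp _
        exact Real.log_natCast_nonneg p
  have h3 : Real.log 4 = 2 * Real.log 2 := by
    rw [show (4 : ℝ) = 2 ^ 2 by norm_num, Real.log_pow]; norm_num
  have h4 : 0 < Real.log 2 := Real.log_pos (by norm_num)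
  have h5 := h2.trans h1
  rw [h3, pow_succ (2 : ℝ)] at h5
  have h6 : ((#{p ∈ Ioc (2 ^ k) (2 ^ (k + 1)) | p.Prime} : ℝ) * k) * Real.log 2
      ≤ (4 * 2 ^ k) * Real.log 2 := by linarith
  exact le_of_mul_le_mul_right h6 h4

theorem eul_two_pow_succ_le {k : ℕ} (hk : 2 ≤ k) :
    eul (2 ^ (k + 1)) ≤ eul (2 ^ k) * ((k : ℝ) / (k - 1)) ^ 4 := by
  have hk' : (2 : ℝ) ≤ k := by exact_mod_cast hk
  have hsplit : eul (2 ^ (k + 1)) = eul (2 ^ k) *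
      ∏ p ∈ (Ioc (2 ^ k) (2 ^ (k + 1)) : Finset ℕ) with p.Prime, (1 - (p : ℝ)⁻¹)⁻¹ := by
    rw [eul, eul, ← prod_union]
    · congr 1
      ext p
      have : 2 ^ k ≤ 2 ^ (k + 1) := Nat.pow_le_pow_right (by norm_num) (by omega)
      simp only [mem_union, Nat.mem_primesBelow, mem_filter, mem_Ioc]
      constructor
      · rintro ⟨h1, h2⟩
        by_cases h : p < 2 ^ k + 1
        · exact Or.inl ⟨h, h2⟩
        · exact Or.inr ⟨⟨by omega, by omega⟩, h2⟩
      · rintro (⟨h1, h2⟩ | ⟨⟨h1, h3⟩, h2⟩)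
        · exact ⟨by omega, h2⟩
        · exact ⟨by omega, h2⟩
    · rw [disjoint_left]
      intro p hp hp'
      rw [Nat.mem_primesBelow] at hp
      simp only [mem_filter, mem_Ioc] at hp'
      omega
  rw [hsplit]
  apply mul_le_mul_of_nonneg_left _ (eul_pos _).le
  have h1 : ∏ p ∈ (Ioc (2 ^ k) (2 ^ (k + 1)) : Finset ℕ) with p.Prime, (1 - (p : ℝ)⁻¹)⁻¹
      ≤ ∏ p ∈ (Ioc (2 ^ k) (2 ^ (k + 1)) : Finset ℕ) with p.Prime, Real.exp (1 / 2 ^ k) := by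
    apply Finset.prod_le_prod
    · intro p hp
      exact (inv_pos.2 (one_sub_inv_pos (mem_filter.1 hp).2)).le
    · intro p hp
      simp only [mem_filter, mem_Ioc] at hp
      have hp1 : (2 : ℝ) ^ k + 1 ≤ p := by exact_mod_cast hp.1.1
      have h2k : (0 : ℝ) < 2 ^ k := by positivity
      have hp0 : (0 : ℝ) < p := by linarith
      have : (1 - (p : ℝ)⁻¹)⁻¹ = 1 / (p - 1) + 1 := by
        have : (p : ℝ) - 1 ≠ 0 := by linarith
        field_simp
        ring
      rw [this]
      have h3 : 1 / ((p : ℝ) - 1) ≤ 1 / 2 ^ k := one_div_le_one_div_of_le h2k (by linarith)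
      have := Real.add_one_le_exp (1 / (2 : ℝ) ^ k)
      linarith
  refine h1.trans ?_
  rw [prod_const, ← Real.exp_nat_mul]
  have hc := card_primes_dyadic k
  have h2 : (#{p ∈ Ioc (2 ^ k) (2 ^ (k + 1)) | p.Prime} : ℝ) * (1 / 2 ^ k) ≤ 4 * (1 / k) := by
    rw [mul_one_div, mul_one_div, div_le_div_iff₀ (by positivity) (by positivity)]
    exact hc
  refine (Real.exp_le_exp.2 h2).trans ?_
  have h3 : Real.exp (4 * (1 / (k : ℝ))) = Real.exp (1 / k) ^ 4 := by
    rw [← Real.exp_nat_mul]; norm_num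
  rw [h3]
  apply pow_le_pow_left₀ (Real.exp_pos _).le
  have h4 := Real.one_sub_le_exp_neg (1 / (k : ℝ))
  have h5 : 1 - 1 / (k : ℝ) = ((k : ℝ) / (k - 1))⁻¹ := by
    rw [inv_div]
    field_simp
  rw [h5, Real.exp_neg] at h4
  exact (inv_le_inv₀ (div_pos (by linarith) (by linarith)) (Real.exp_pos _)).1 h4

theorem eul_two_pow_le {k : ℕ} (hk : 2 ≤ k) : eul (2 ^ k) ≤ 3 * ((k : ℝ) - 1) ^ 4 := by
  induction k, hk using Nat.le_induction with
  | base =>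
    have : (2 ^ 2 + 1).primesBelow = {2, 3} := by decide
    rw [eul, this]
    norm_num
  | succ k hk ih =>
    have hk' : (2 : ℝ) ≤ k := by exact_mod_cast hk
    refine (eul_two_pow_succ_le hk).trans ?_
    have h0 : (k : ℝ) - 1 ≠ 0 := by linarith
    calc eul (2 ^ k) * ((k : ℝ) / (k - 1)) ^ 4
        ≤ (3 * ((k : ℝ) - 1) ^ 4) * ((k : ℝ) / (k - 1)) ^ 4 := by gcongr
      _ = 3 * (k : ℝ) ^ 4 := by field_simp
      _ = _ := by push_cast; ring

theorem eul_le (Q : ℕ) : eul Q ≤ 3 * ((Nat.log 2 Q : ℝ) + 1) ^ 4 := by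
  have h1 : Q ≤ 2 ^ (Nat.log 2 Q + 2) :=
    (Nat.lt_pow_succ_log_self (by norm_num) Q).le.trans
      (Nat.pow_le_pow_right (by norm_num) (by omega))
  refine (eul_mono h1).trans ((eul_two_pow_le (by omega)).trans (le_of_eq ?_))
  push_cast
  ring

theorem eul_le_log {Q : ℕ} (hQ : 1 ≤ Q) : eul Q ≤ 48 * (1 + Real.log Q) ^ 4 := by
  refine (eul_le Q).trans ?_
  have h1 : (Nat.log 2 Q : ℝ) * Real.log 2 ≤ Real.log Q := by
    rw [← Real.log_pow]
    apply Real.log_le_log (by positivity)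
    exact_mod_cast Nat.pow_log_le_self 2 (by omega)
  have h2 : (1 / 2 : ℝ) ≤ Real.log 2 := by have := Real.log_two_gt_d9; linarith
  have h3 : (0 : ℝ) ≤ Nat.log 2 Q := by positivity
  have h4 : (Nat.log 2 Q : ℝ) + 1 ≤ 2 * (1 + Real.log Q) := by nlinarith
  calc 3 * ((Nat.log 2 Q : ℝ) + 1) ^ 4 ≤ 3 * (2 * (1 + Real.log Q)) ^ 4 := by gcongr
    _ = _ := by ring

theorem le_totient_mul_eul_of_forall_le {q Q : ℕ} (hQ : ∀ p ∈ q.primeFactors, p ≤ Q) :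
    (q : ℝ) ≤ q.totient * eul Q := by
  have h1 : (q.totient : ℝ) = q * ∏ p ∈ q.primeFactors, (1 - (p : ℝ)⁻¹) := by
    have := Nat.totient_eq_mul_prod_factors q
    have h := congrArg (fun x : ℚ => (x : ℝ)) this
    push_cast at h
    exact h
  have h2 : ∏ p ∈ q.primeFactors, (1 - (p : ℝ)⁻¹)⁻¹ ≤ eul Q := by
    apply prod_le_prod_of_subset_of_one_le
    · intro p hp
      rw [Nat.mem_primesBelow]
      exact ⟨Nat.lt_succ_of_le (hQ p hp), Nat.prime_of_mem_primeFactors hp⟩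
    · intro p hp
      exact (inv_pos.2 (one_sub_inv_pos (Nat.prime_of_mem_primeFactors hp))).le
    · intro p hp _
      exact one_le_one_sub_inv_inv (Nat.prime_of_mem_primesBelow hp)
  rw [prod_inv_distrib] at h2
  have h3 : 0 < ∏ p ∈ q.primeFactors, (1 - (p : ℝ)⁻¹) :=
    prod_pos fun p hp => one_sub_inv_pos (Nat.prime_of_mem_primeFactors hp)
  rw [h1]
  have h3' := h3.ne'
  calc (q : ℝ) = q * (∏ p ∈ q.primeFactors, (1 - (p : ℝ)⁻¹))
        * (∏ p ∈ q.primeFactors, (1 - (p : ℝ)⁻¹))⁻¹ := by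
          rw [mul_assoc, mul_inv_cancel₀ h3', mul_one]
    _ ≤ _ := by gcongr

theorem le_totient_mul_eul (q : ℕ) : (q : ℝ) ≤ q.totient * eul q :=
  le_totient_mul_eul_of_forall_le fun _ hp => Nat.le_of_mem_primeFactors hp

/-! ### Squarefree moduli without small prime factors -/

/-- Squarefree `r ≤ R` all of whose prime factors exceed `Q`. -/
def rough (R Q : ℕ) : Finset ℕ :=
  (range (R + 1)).filter fun r => Squarefree r ∧ ∀ p ∈ r.primeFactors, Q < p

theorem exists_smooth_mul_rough (Q n : ℕ) (hn : n ≠ 0) :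
    ∃ s t, n = s * t ∧ s ∈ (Q + 1).smoothNumbers ∧ t ≠ 0 ∧ ∀ p, p.Prime → p ∣ t → Q < p := by
  induction n using Nat.recOnMul with
  | zero => exact absurd rfl hn
  | one => exact ⟨1, 1, rfl, Nat.mem_smoothNumbers'.2
      fun p hp h => absurd (Nat.dvd_one.1 h) hp.ne_one, one_ne_zero,
      fun p hp h => absurd (Nat.dvd_one.1 h) hp.ne_one⟩
  | prime p hp =>
    by_cases h : p ≤ Q
    · refine ⟨p, 1, (mul_one p).symm, ?_, one_ne_zero,
        fun p hp h => absurd (Nat.dvd_one.1 h) hp.ne_one⟩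
      rw [Nat.mem_smoothNumbers']
      intro p' hp' hdvd
      rw [(Nat.prime_dvd_prime_iff_eq hp' hp).1 hdvd]
      omega
    · refine ⟨1, p, (one_mul p).symm, ?_, hp.ne_zero, ?_⟩
      · rw [Nat.mem_smoothNumbers']
        intro p' hp' hdvd
        exact absurd (Nat.dvd_one.1 hdvd) hp'.ne_one
      · intro p' hp' hdvd
        rw [(Nat.prime_dvd_prime_iff_eq hp' hp).1 hdvd]
        omega
  | mul a b iha ihb =>
    obtain ⟨s, t, h1, h2, h3, h4⟩ := iha (left_ne_zero_of_mul hn)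
    obtain ⟨s', t', h1', h2', h3', h4'⟩ := ihb (right_ne_zero_of_mul hn)
    refine ⟨s * s', t * t', by rw [h1, h1']; ring, Nat.mul_mem_smoothNumbers h2 h2',
      mul_ne_zero h3 h3', ?_⟩
    intro p hp hdvd
    rcases (Nat.Prime.dvd_mul hp).1 hdvd with h | h
    · exact h4 p hp h
    · exact h4' p hp h

theorem sum_smooth_le_eul (Q : ℕ) (t : Finset ℕ) (ht : ∀ s ∈ t, s ∈ (Q + 1).smoothNumbers) :
    ∑ s ∈ t, (s : ℝ)⁻¹ ≤ eul Q := by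
  let f : ℕ →* ℝ :=
    { toFun := fun n => (n : ℝ)⁻¹
      map_one' := by simp
      map_mul' := fun a b => by push_cast; rw [mul_inv] }
  have h := (EulerProduct.summable_and_hasSum_smoothNumbers_prod_primesBelow_geometric (f := f)
    (fun {p} hp => by
      change ‖(p : ℝ)⁻¹‖ < 1
      rw [Real.norm_of_nonneg (by positivity)]
      exact inv_lt_one_of_one_lt₀ (by exact_mod_cast hp.one_lt)) (Q + 1)).2
  have h2 := sum_le_hasSum (t.attach.map ⟨fun s => (⟨s.1, ht s.1 s.2⟩ : (Q + 1).smoothNumbers),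
    fun a b hab => by
      have := congrArg (fun x : (Q + 1).smoothNumbers => (x : ℕ)) hab
      exact Subtype.ext this⟩) (fun i _ => by
      change (0 : ℝ) ≤ ((i : ℕ) : ℝ)⁻¹
      positivity) h
  rw [sum_map] at h2
  rw [← sum_attach]
  exact h2

theorem sum_inv_sq_le (R : ℕ) : ∑ m ∈ Icc 1 R, ((m : ℝ) ^ 2)⁻¹ ≤ 2 := by
  have h : ∀ R : ℕ, ∑ m ∈ Icc 1 (R + 1), ((m : ℝ) ^ 2)⁻¹ ≤ 2 - 1 / (R + 1) := by
    intro R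
    induction R with
    | zero => norm_num
    | succ R ih =>
      rw [sum_Icc_succ_top (by omega)]
      have : (((R + 1 + 1 : ℕ) : ℝ) ^ 2)⁻¹ ≤ 1 / (R + 1) - 1 / (((R + 1 : ℕ) : ℝ) + 1) := by
        push_cast
        rw [div_sub_div _ _ (by positivity) (by positivity), inv_eq_one_div,
          div_le_div_iff₀ (by positivity) (by positivity)]
        nlinarith
      linarith
  cases R with
  | zero => simp
  | succ R =>
    have := h R
    have h2 : (0 : ℝ) ≤ 1 / (R + 1) := by positivity
    linarith

theorem log_le_eul_mul_sum_rough (R Q : ℕ) :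
    Real.log R ≤ 2 * eul Q * ∑ r ∈ rough R Q, (r.totient : ℝ)⁻¹ := by
  set sm : Finset ℕ := {s ∈ Icc 1 R | s ∈ (Q + 1).smoothNumbers} with hsm
  have hch : ∀ n ∈ Icc 1 R, ∃ x ∈ sm ×ˢ (Icc 1 R ×ˢ rough R Q), n = x.1 * (x.2.1 ^ 2 * x.2.2) := by
    intro n hn
    rw [mem_Icc] at hn
    obtain ⟨s, t, h1, h2, h3, h4⟩ := exists_smooth_mul_rough Q n (by omega)
    obtain ⟨r, m, hrm, hr⟩ := Nat.sq_mul_squarefree t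
    have hs0 : 0 < s := Nat.pos_of_ne_zero (by rintro rfl; simp at h1; omega)
    have hm0 : 0 < m := Nat.pos_of_ne_zero (by rintro rfl; simp at hrm; exact h3 hrm.symm)
    have hr0 : 0 < r := Nat.pos_of_ne_zero (by rintro rfl; simp at hrm; exact h3 hrm.symm)
    have hn' : n = s * (m ^ 2 * r) := by rw [h1, ← hrm]
    have hle : ∀ k, k ∣ n → k ≤ R := fun k hk => (Nat.le_of_dvd (by omega) hk).trans hn.2
    refine ⟨(s, m, r), ?_, hn'⟩
    simp only [mem_product, hsm, mem_filter, mem_Icc, rough, mem_range, Nat.mem_primeFactors]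
    refine ⟨⟨⟨hs0, hle s ⟨_, hn'⟩⟩, h2⟩, ⟨hm0, hle m ⟨s * m * r, by rw [hn']; ring⟩⟩,
      Nat.lt_succ_of_le (hle r ⟨s * m ^ 2, by rw [hn']; ring⟩), hr, ?_⟩
    rintro p ⟨hp, hpr, _⟩
    exact h4 p hp (hrm ▸ hpr.mul_left _)
  choose! g hg hg' using hch
  have hinj : Set.InjOn g (Icc 1 R : Finset ℕ) := by
    intro a ha b hb hab
    rw [hg' a ha, hg' b hb, hab]
  have h1 : ∑ n ∈ Icc 1 R, (n : ℝ)⁻¹ ≤ ∑ x ∈ sm ×ˢ (Icc 1 R ×ˢ rough R Q),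
      ((x.1 : ℝ)⁻¹ * (((x.2.1 : ℝ) ^ 2)⁻¹ * (x.2.2 : ℝ)⁻¹)) := by
    calc ∑ n ∈ Icc 1 R, (n : ℝ)⁻¹ = ∑ x ∈ (Icc 1 R).image g,
          ((x.1 : ℝ)⁻¹ * (((x.2.1 : ℝ) ^ 2)⁻¹ * (x.2.2 : ℝ)⁻¹)) := by
          rw [sum_image hinj]
          refine sum_congr rfl fun n hn => ?_
          conv_lhs => rw [hg' n hn]
          push_cast
          rw [mul_inv, mul_inv]
      _ ≤ _ := by
          apply sum_le_sum_of_subset_of_nonneg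
          · intro x hx
            obtain ⟨n, hn, rfl⟩ := mem_image.1 hx
            exact hg n hn
          · intro x _ _
            positivity
  rw [sum_product, ] at h1
  simp only [sum_product, ← mul_sum, ← sum_mul] at h1
  have h2 : Real.log R ≤ ∑ n ∈ Icc 1 R, (n : ℝ)⁻¹ := by
    rcases Nat.eq_zero_or_pos R with rfl | hR
    · simp
    have := log_add_one_le_harmonic R
    rw [harmonic_eq_sum_Icc] at this
    push_cast at this
    refine le_trans (Real.log_le_log (by exact_mod_cast hR) (by linarith)) this
  have h3 : ∑ r ∈ rough R Q, (r : ℝ)⁻¹ ≤ ∑ r ∈ rough R Q, (r.totient : ℝ)⁻¹ := by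
    apply sum_le_sum
    intro r hr
    have : r ≠ 0 := by
      simp only [rough, mem_filter] at hr
      exact hr.2.1.ne_zero
    apply inv_anti₀
    · exact_mod_cast Nat.totient_pos.2 (by omega)
    · exact_mod_cast Nat.totient_le r
  have h4 := sum_smooth_le_eul Q sm (fun s hs => (mem_filter.1 hs).2)
  have h5 := sum_inv_sq_le R
  have h6 : (0 : ℝ) ≤ ∑ r ∈ rough R Q, (r : ℝ)⁻¹ := sum_nonneg fun _ _ => by positivity
  have h7 : (0 : ℝ) ≤ ∑ m ∈ Icc 1 R, ((m : ℝ) ^ 2)⁻¹ := sum_nonneg fun _ _ => by positivity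
  have h8 := (eul_pos Q).le
  calc Real.log R ≤ _ := h2
    _ ≤ _ := h1
    _ ≤ eul Q * (2 * ∑ r ∈ rough R Q, (r.totient : ℝ)⁻¹) := by gcongr
    _ = _ := by ring

/-! ### Parseval on the discrete circle -/

theorem sum_range_ex_sub {M : ℕ} (hM : 0 < M) (m n : ℕ) :
    ∑ k ∈ range M, ex (n * ((k : ℝ) / M)) * ex (-(m * ((k : ℝ) / M)))
      = if n ≡ m [MOD M] then (M : ℂ) else 0 := by
  have hM' : (M : ℝ) ≠ 0 := by exact_mod_cast hM.ne'
  have h1 : ∀ k ∈ range M, ex (n * ((k : ℝ) / M)) * ex (-(m * ((k : ℝ) / M)))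
      = ex ((n + (M - 1) * m : ℕ) * ((k : ℝ) / M)) := by
    intro k _
    rw [← ex_add, ← ex_add_int _ ((m * k : ℕ) : ℤ)]
    congr 1
    push_cast [Nat.cast_sub hM]
    field_simp
    ring
  rw [sum_congr rfl h1, sum_range_ex_div hM]
  have h2 : M ∣ n + (M - 1) * m ↔ n ≡ m [MOD M] := by
    rw [← Nat.modEq_zero_iff_dvd]
    have h3 : m + (M - 1) * m ≡ 0 [MOD M] := by
      rw [Nat.modEq_zero_iff_dvd]
      refine ⟨m, ?_⟩
      obtain ⟨M', rfl⟩ := Nat.exists_eq_succ_of_ne_zero hM.ne'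
      simp
      ring
    constructor
    · intro h
      exact Nat.ModEq.add_right_cancel' _ (h.trans h3.symm)
    · intro h
      exact (Nat.ModEq.add_right _ h).trans h3
  simp only [h2]

theorem parseval {M : ℕ} (hM : 0 < M) {s : Finset ℕ} (f : ℕ → ℝ)
    (hs : ∀ m ∈ s, ∀ n ∈ s, m ≡ n [MOD M] → m = n) :
    ∑ k ∈ range M, ‖esum s f ((k : ℝ) / M)‖ ^ 2 = M * ∑ n ∈ s, f n ^ 2 := by
  have key : ((∑ k ∈ range M, ‖esum s f ((k : ℝ) / M)‖ ^ 2 : ℝ) : ℂ)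
      = ((M * ∑ n ∈ s, f n ^ 2 : ℝ) : ℂ) := by
    push_cast
    have h1 : ∀ k ∈ range M, ((‖esum s f ((k : ℝ) / M)‖ : ℂ)) ^ 2
        = ∑ n ∈ s, ∑ m ∈ s, (f n * f m : ℂ) *
          (ex (n * ((k : ℝ) / M)) * ex (-(m * ((k : ℝ) / M)))) := by
      intro k _
      rw [← Complex.mul_conj', esum, map_sum, sum_mul_sum]
      refine sum_congr rfl fun n _ => sum_congr rfl fun m _ => ?_
      rw [map_mul, Complex.conj_ofReal, ← ex_neg]
      ring
    rw [sum_congr rfl h1, sum_comm, mul_sum]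
    refine sum_congr rfl fun n hn => ?_
    rw [sum_comm]
    simp only [← mul_sum, sum_range_ex_sub hM]
    rw [sum_eq_single n]
    · rw [if_pos (Nat.ModEq.refl n)]
      ring
    · intro m hm hmn
      rw [if_neg (fun h => hmn (hs n hn m hm h).symm), mul_zero]
    · intro h
      exact absurd hn h
  exact Complex.ofReal_injective key

theorem esum_mod {M : ℕ} (hM : 0 < M) (s : Finset ℕ) (f : ℕ → ℝ) (k : ℕ) :
    esum s f (((k % M : ℕ) : ℝ) / M) = esum s f ((k : ℝ) / M) := by
  rw [← esum_add_int s f _ ((k / M : ℕ) : ℤ)]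
  congr 1
  have hM' : (M : ℝ) ≠ 0 := by exact_mod_cast hM.ne'
  have : (k : ℝ) = ((k % M : ℕ) : ℝ) + M * ((k / M : ℕ) : ℝ) := by
    exact_mod_cast (Nat.mod_add_div k M).symm
  rw [this, add_div, mul_div_cancel_left₀ _ hM']
  push_cast
  rfl

/-! ### The `L²` bound on neighbourhoods of rationals with small denominators -/

theorem coprime_of_mem_rough {R Q r q : ℕ} (hr : r ∈ rough R Q) (hq0 : 0 < q) (hq : q ≤ Q) :
    Nat.Coprime r q := by
  simp only [rough, mem_filter, mem_range] at hr
  rw [Nat.coprime_iff_gcd_eq_one]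
  by_contra h
  obtain ⟨p, hp, hpd⟩ := Nat.exists_prime_and_dvd h
  have h1 := hr.2.2 p (Nat.mem_primeFactors.2 ⟨hp, hpd.trans (Nat.gcd_dvd_left _ _),
    hr.2.1.ne_zero⟩)
  have h2 := Nat.le_of_dvd hq0 (hpd.trans (Nat.gcd_dvd_right r q))
  omega

theorem eq_of_shifts {R Q r r' q q' b b' : ℕ} {a a' m : ℤ} {δ β β' : ℝ}
    (hr : r ∈ rough R Q) (hr' : r' ∈ rough R Q) (hb : b ∈ cop r) (hb' : b' ∈ cop r')
    (hq0 : 0 < q) (hq0' : 0 < q') (hq : q ≤ Q) (hq' : q' ≤ Q)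
    (hβ : |β| ≤ δ) (hβ' : |β'| ≤ δ) (hδ : 2 * δ * ((R : ℝ) * Q) ^ 2 < 1)
    (h : ((a : ℝ) / q + β + (b : ℝ) / r) - ((a' : ℝ) / q' + β' + (b' : ℝ) / r') = m) :
    r = r' ∧ b = b' := by
  have hr0 : 0 < r := Nat.pos_of_ne_zero (by
    simp only [rough, mem_filter] at hr; exact hr.2.1.ne_zero)
  have hr0' : 0 < r' := Nat.pos_of_ne_zero (by
    simp only [rough, mem_filter] at hr'; exact hr'.2.1.ne_zero)
  have hrR : r ≤ R := by simp only [rough, mem_filter, mem_range] at hr; omega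
  have hrR' : r' ≤ R := by simp only [rough, mem_filter, mem_range] at hr'; omega
  have hrp : (0 : ℝ) < r := by exact_mod_cast hr0
  have hrp' : (0 : ℝ) < r' := by exact_mod_cast hr0'
  have hqp : (0 : ℝ) < q := by exact_mod_cast hq0
  have hqp' : (0 : ℝ) < q' := by exact_mod_cast hq0'
  set z : ℤ := r * r' * (a * q' - a' * q) + q * q' * (b * r' - b' * r) - m * (q * q' * r * r')
    with hz
  have hz1 : (z : ℝ) = (β' - β) * (q * q' * r * r') := by
    have h2 : β' - β = (a : ℝ) / q + (b : ℝ) / r - (a' : ℝ) / q' - (b' : ℝ) / r' - m := by linarith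
    rw [h2, hz]
    push_cast
    field_simp
    ring
  have hz2 : |(z : ℝ)| < 1 := by
    rw [hz1, abs_mul]
    have h3 : |β' - β| ≤ 2 * δ := (abs_sub _ _).trans (by linarith)
    have h4 : ((q : ℝ) * q' * r * r') ≤ ((R : ℝ) * Q) ^ 2 := by
      have : q * q' * r * r' ≤ (R * Q) ^ 2 := by
        calc q * q' * r * r' ≤ Q * Q * R * R := by gcongr
          _ = _ := by ring
      exact_mod_cast this
    rw [abs_of_pos (by positivity : (0 : ℝ) < (q : ℝ) * q' * r * r')]
    calc |β' - β| * ((q : ℝ) * q' * r * r') ≤ 2 * δ * ((R : ℝ) * Q) ^ 2 := by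
          have : 0 ≤ 2 * δ := (abs_nonneg _).trans h3
          gcongr
      _ < 1 := hδ
  have hz3 : z = 0 := by
    rw [← Int.cast_abs] at hz2
    have : |z| < 1 := by exact_mod_cast hz2
    exact Int.abs_lt_one_iff.1 this
  have hcop : IsCoprime ((r : ℤ) * r') ((q : ℤ) * q') := by
    have h1 := coprime_of_mem_rough hr hq0 hq
    have h2 := coprime_of_mem_rough hr hq0' hq'
    have h3 := coprime_of_mem_rough hr' hq0 hq
    have h4 := coprime_of_mem_rough hr' hq0' hq'
    have := Nat.Coprime.mul_left (Nat.Coprime.mul_right h1 h2) (Nat.Coprime.mul_right h3 h4)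
    have h := Nat.isCoprime_iff_coprime.2 this
    push_cast at h
    exact h
  have hdvd : (r : ℤ) * r' ∣ b * r' - b' * r := by
    apply hcop.dvd_of_dvd_mul_left
    refine ⟨m * (q * q') - (a * q' - a' * q), ?_⟩
    linear_combination hz3 - hz
  have hb2 : b.Coprime r := by simp only [cop, mem_filter] at hb; exact hb.2
  have hb2' : b'.Coprime r' := by simp only [cop, mem_filter] at hb'; exact hb'.2
  have hd1 : r ∣ r' := by
    have h1 : (r : ℤ) ∣ b * r' := by
      have := (Dvd.intro _ rfl : (r : ℤ) ∣ r * r').trans hdvd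
      exact (dvd_sub_left (Dvd.intro_left _ rfl)).1 this
    have h2 : r ∣ b * r' := by exact_mod_cast h1
    exact hb2.symm.dvd_of_dvd_mul_left h2
  have hd2 : r' ∣ r := by
    have h1 : (r' : ℤ) ∣ b' * r := by
      have := (Dvd.intro_left _ rfl : (r' : ℤ) ∣ r * r').trans hdvd
      exact (dvd_sub_right (Dvd.intro_left _ rfl)).1 this
    have h2 : r' ∣ b' * r := by exact_mod_cast h1
    exact hb2'.symm.dvd_of_dvd_mul_left h2
  have hrr : r = r' := Nat.dvd_antisymm hd1 hd2
  refine ⟨hrr, ?_⟩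
  subst hrr
  have h5 : (r : ℤ) ∣ b - b' := by
    rw [← sub_mul] at hdvd
    exact Int.dvd_of_mul_dvd_mul_right (by exact_mod_cast hr0.ne') hdvd
  simp only [cop, mem_filter, mem_range] at hb hb'
  have h6 : b ≡ b' [MOD r] := (Nat.modEq_iff_dvd.2 (by rw [← dvd_neg, neg_sub]; exact h5))
  exact Nat.ModEq.eq_of_lt_of_lt h6 hb.1 hb'.1

theorem sum_arcs_sq_le {M R Q : ℕ} {δ : ℝ} (hM : 0 < M) (hMR : ∀ r, 1 ≤ r → r ≤ R → r ∣ M)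
    (hδ : 2 * δ * ((R : ℝ) * Q) ^ 2 < 1) {A : Finset ℕ} (hAM : A ⊆ range M)
    (hA : ∀ k ∈ A, ∃ q : ℕ, ∃ a : ℤ, 0 < q ∧ q ≤ Q ∧ |(k : ℝ) / M - a / q| ≤ δ)
    {s : Finset ℕ} {f : ℕ → ℝ} (hs : ∀ m ∈ s, ∀ n ∈ s, m ≡ n [MOD M] → m = n)
    (hf : ∀ n ∈ s, f n ≠ 0 → ∀ r ∈ rough R Q, n.Coprime r) :
    (∑ k ∈ A, ‖esum s f ((k : ℝ) / M)‖ ^ 2) * Real.log R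
      ≤ 2 * eul Q * (M * ∑ n ∈ s, f n ^ 2) := by
  have hMp : (0 : ℝ) < M := by exact_mod_cast hM
  set Z := ∑ k ∈ A, ‖esum s f ((k : ℝ) / M)‖ ^ 2 with hZ
  have hZ0 : 0 ≤ Z := sum_nonneg fun _ _ => by positivity
  have hrough : ∀ r ∈ rough R Q, Squarefree r ∧ 0 < r ∧ r ≤ R := by
    intro r hr
    simp only [rough, mem_filter, mem_range] at hr
    exact ⟨hr.2.1, Nat.pos_of_ne_zero hr.2.1.ne_zero, by omega⟩
  have hshift : ∀ r ∈ rough R Q, ∀ b k : ℕ,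
      ((k + b * (M / r) : ℕ) : ℝ) / M = (k : ℝ) / M + (b : ℝ) / r := by
    intro r hr b k
    obtain ⟨_, h0, h1⟩ := hrough r hr
    obtain ⟨c, hc⟩ := hMR r h0 h1
    have hr' : (r : ℝ) ≠ 0 := by exact_mod_cast h0.ne'
    have hc' : (c : ℝ) ≠ 0 := by
      rintro h
      rw [hc] at hMp
      push_cast at hMp
      rw [h] at hMp
      simp at hMp
    rw [hc, Nat.mul_div_cancel_left _ h0]
    push_cast
    field_simp
  let T : Finset ((Σ _ : ℕ, ℕ) × ℕ) := ((rough R Q).sigma fun r => cop r) ×ˢ A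
  let g : (Σ _ : ℕ, ℕ) × ℕ → ℕ := fun x => (x.2 + x.1.2 * (M / x.1.1)) % M
  have hg : ∀ x ∈ T, g x ∈ range M := fun x _ => mem_range.2 (Nat.mod_lt _ hM)
  have hinj : Set.InjOn g T := by
    rintro ⟨⟨r, b⟩, k⟩ hx ⟨⟨r', b'⟩, k'⟩ hx' hxx
    simp only [T, coe_product, Set.mem_prod, mem_coe, mem_sigma] at hx hx'
    obtain ⟨⟨hr, hb⟩, hk⟩ := hx
    obtain ⟨⟨hr', hb'⟩, hk'⟩ := hx'
    obtain ⟨q, a, hq0, hq, hβ⟩ := hA k hk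
    obtain ⟨q', a', hq0', hq', hβ'⟩ := hA k' hk'
    have h1 : (k + b * (M / r)) ≡ (k' + b' * (M / r')) [MOD M] := hxx
    obtain ⟨m, hm⟩ := (Nat.modEq_iff_dvd.1 h1.symm)
    have h2 : (k : ℝ) / M + (b : ℝ) / r - ((k' : ℝ) / M + (b' : ℝ) / r') = m := by
      rw [← hshift r hr b k, ← hshift r' hr' b' k', ← sub_div, div_eq_iff hMp.ne']
      have := congrArg (fun z : ℤ => (z : ℝ)) hm
      simp only [Int.cast_sub, Int.cast_natCast, Int.cast_mul] at this
      linarith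
    obtain ⟨hrr, hbb⟩ := eq_of_shifts (a := a) (a' := a') (m := m)
      (β := (k : ℝ) / M - a / q) (β' := (k' : ℝ) / M - a' / q') hr hr' hb hb' hq0 hq0' hq hq'
      hβ hβ' hδ (by linarith)
    subst hrr hbb
    have h3 : k ≡ k' [MOD M] := Nat.ModEq.add_right_cancel' _ h1
    have h4 := mem_range.1 (hAM hk)
    have h5 := mem_range.1 (hAM hk')
    rw [Nat.ModEq.eq_of_lt_of_lt h3 h4 h5]
  have h1 : Z * ∑ r ∈ rough R Q, (r.totient : ℝ)⁻¹ ≤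
      ∑ x ∈ T, ‖esum s f ((x.2 : ℝ) / M + (x.1.2 : ℝ) / x.1.1)‖ ^ 2 := by
    simp only [T]
    rw [sum_product, sum_sigma, mul_sum]
    apply sum_le_sum
    intro r hr
    obtain ⟨hsq, h0, _⟩ := hrough r hr
    have hφ : (0 : ℝ) < r.totient := by exact_mod_cast Nat.totient_pos.2 h0
    rw [mul_inv_le_iff₀ hφ, sum_comm, hZ, sum_mul]
    apply sum_le_sum
    intro k _
    rw [mul_comm]
    exact norm_esum_sq_le hsq (fun n hn hfn => hf n hn hfn r hr) _
  have h2 : ∑ x ∈ T, ‖esum s f ((x.2 : ℝ) / M + (x.1.2 : ℝ) / x.1.1)‖ ^ 2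
      ≤ ∑ k ∈ range M, ‖esum s f ((k : ℝ) / M)‖ ^ 2 := by
    calc _ = ∑ x ∈ T, ‖esum s f ((g x : ℝ) / M)‖ ^ 2 := by
          refine sum_congr rfl fun x hx => ?_
          simp only [T, mem_product, mem_sigma] at hx
          simp only [g]
          rw [esum_mod hM, hshift _ hx.1.1]
      _ = ∑ k ∈ T.image g, ‖esum s f ((k : ℝ) / M)‖ ^ 2 :=
          (sum_image (f := fun k : ℕ => ‖esum s f ((k : ℝ) / M)‖ ^ 2) hinj).symm
      _ ≤ _ := by
          apply sum_le_sum_of_subset_of_nonneg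
          · intro k hk
            obtain ⟨x, hx, rfl⟩ := mem_image.1 hk
            exact hg x hx
          · intro _ _ _
            positivity
  rw [parseval hM f hs] at h2
  calc Z * Real.log R ≤ Z * (2 * eul Q * ∑ r ∈ rough R Q, (r.totient : ℝ)⁻¹) := by
        gcongr
        exact log_le_eul_mul_sum_rough R Q
    _ = 2 * eul Q * (Z * ∑ r ∈ rough R Q, (r.totient : ℝ)⁻¹) := by ring
    _ ≤ _ := by
        have := (eul_pos Q).le
        have := h1.trans h2
        gcongr

/-! ### The Brun–Titchmarsh inequality -/

theorem ex_mul_div_congr {q n b : ℕ} (hq : 0 < q) (h : n ≡ b [MOD q]) (a : ℕ) :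
    ex (n * ((a : ℝ) / q)) = ex (b * ((a : ℝ) / q)) := by
  obtain ⟨m, hm⟩ := Nat.modEq_iff_dvd.1 h.symm
  have hq' : (q : ℝ) ≠ 0 := by exact_mod_cast hq.ne'
  rw [← ex_add_int (b * ((a : ℝ) / q)) (m * a)]
  congr 1
  have := congrArg (fun z : ℤ => (z : ℝ)) hm
  simp only [Int.cast_sub, Int.cast_natCast, Int.cast_mul] at this
  have h2 : (n : ℝ) = b + q * m := by linarith
  rw [h2]
  push_cast
  field_simp

theorem card_div_two_le_norm_esum {s : Finset ℕ} {x h q b a : ℕ} (hq : 0 < q) (hh : 0 < h)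
    (hs : ∀ n ∈ s, x ≤ n ∧ n ≤ x + h ∧ n ≡ b [MOD q]) {β : ℝ} (hβ : |β| ≤ 1 / (16 * h)) :
    (#s : ℝ) / 2 ≤ ‖esum s (fun _ => 1) ((a : ℝ) / q + β)‖ := by
  have hhp : (0 : ℝ) < h := by exact_mod_cast hh
  have h1 : esum s (fun _ => 1) ((a : ℝ) / q + β)
      = ex (b * ((a : ℝ) / q) + x * β) * ∑ n ∈ s, ex (((n : ℝ) - x) * β) := by
    rw [esum, mul_sum]
    refine sum_congr rfl fun n hn => ?_
    have h3 : ex (n * ((a : ℝ) / q + β)) = ex (b * ((a : ℝ) / q)) * ex (n * β) := by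
      rw [mul_add, ex_add, ex_mul_div_congr hq (hs n hn).2.2]
    rw [h3, Complex.ofReal_one, one_mul, ← ex_add, ← ex_add]
    congr 1
    ring
  rw [h1, norm_mul, norm_ex, one_mul]
  have h2 : ‖∑ n ∈ s, (ex (((n : ℝ) - x) * β) - 1)‖ ≤ #s * (1 / 2) := by
    rw [← nsmul_eq_mul]
    apply norm_sum_le_of_le _ _ |>.trans (le_of_eq (sum_const _))
    intro n hn
    refine (norm_ex_sub_one_le _).trans ?_
    have h3 : |((n : ℝ) - x) * β| ≤ h * (1 / (16 * h)) := by
      rw [abs_mul]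
      gcongr
      have h4 : (x : ℝ) ≤ n := by exact_mod_cast (hs n hn).1
      have h5 : (n : ℝ) ≤ x + h := by exact_mod_cast (hs n hn).2.1
      rw [abs_le]
      constructor <;> linarith
    have h6 : (h : ℝ) * (1 / (16 * h)) = 1 / 16 := by field_simp
    rw [h6] at h3
    have := Real.pi_lt_four
    have := Real.pi_pos
    nlinarith
  rw [sum_sub_distrib] at h2
  have h3 : ‖∑ n ∈ s, (1 : ℂ)‖ = #s := by simp
  have h4 := norm_sub_norm_le (∑ n ∈ s, (1 : ℂ)) (∑ n ∈ s, ex (((n : ℝ) - x) * β))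
  rw [norm_sub_rev, h3] at h4
  linarith

theorem coprime_rough_of_prime {p R Q r : ℕ} (hp : p.Prime) (hpR : R < p) (hr : r ∈ rough R Q) :
    p.Coprime r := by
  simp only [rough, mem_filter, mem_range] at hr
  rw [hp.coprime_iff_not_dvd]
  intro h
  have := Nat.le_of_dvd (Nat.pos_of_ne_zero hr.2.1.ne_zero) h
  omega

theorem card_mul_log_le {x h q b R : ℕ} (hq : 0 < q) (hh : q ≤ h) (hR : R ≤ h)
    (hRq : (R * q) ^ 2 ≤ h) {s : Finset ℕ}
    (hs : ∀ n ∈ s, x < n ∧ n ≤ x + h ∧ n ≡ b [MOD q] ∧ n.Prime ∧ R < n) :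
    (#s : ℝ) * (q * Real.log R) ≤ 128 * eul q * h := by
  have hh0 : 0 < h := lt_of_lt_of_le hq hh
  have hhp : (0 : ℝ) < h := by exact_mod_cast hh0
  have hqp : (0 : ℝ) < q := by exact_mod_cast hq
  set M := (16 * h).factorial with hMdef
  have hM : 0 < M := Nat.factorial_pos _
  have hMp : (0 : ℝ) < M := by exact_mod_cast hM
  have hdvd : ∀ r, 1 ≤ r → r ≤ 16 * h → r ∣ M := fun r h1 h2 => Nat.dvd_factorial h1 h2
  obtain ⟨J, hJ⟩ := hdvd (16 * h) (by omega) le_rfl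
  obtain ⟨c, hc⟩ := hdvd q hq (by omega)
  have hJp : (M : ℝ) = 16 * h * J := by rw [hJ]; push_cast; ring
  have hJ0 : 0 < J := Nat.pos_of_ne_zero (by rintro rfl; simp at hJ; omega)
  have hJc : J ≤ c := by
    have h1 : q * J ≤ q * c := by
      rw [← hc, hJ]
      apply Nat.mul_le_mul_right
      omega
    exact Nat.le_of_mul_le_mul_left h1 hq
  set A : Finset ℕ := (range q ×ˢ range J).image fun y => y.1 * c + y.2 with hA
  have hinj : Set.InjOn (fun y : ℕ × ℕ => y.1 * c + y.2) (range q ×ˢ range J : Finset (ℕ × ℕ)) := by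
    rintro ⟨a, j⟩ h1 ⟨a', j'⟩ h2 h3
    simp only [coe_product, Set.mem_prod, mem_coe, mem_range] at h1 h2 h3
    have hj : j < c := by omega
    have hj' : j' < c := by omega
    have h4 : a = a' := by
      have h5 := congrArg (· / c) h3
      simp only [mul_comm _ c] at h5
      rwa [Nat.mul_add_div (by omega), Nat.mul_add_div (by omega), Nat.div_eq_of_lt hj,
        Nat.div_eq_of_lt hj', add_zero, add_zero] at h5
    subst h4
    simp only [add_right_inj] at h3
    rw [h3]
  have hcard : #A = q * J := by
    rw [hA, card_image_of_injOn hinj, card_product, card_range, card_range]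
  have hcp : (0 : ℝ) < c := by exact_mod_cast lt_of_lt_of_le hJ0 hJc
  have hform : ∀ a j : ℕ, ((a * c + j : ℕ) : ℝ) / M = (a : ℝ) / q + (j : ℝ) / M := by
    intro a j
    rw [hc]
    push_cast
    field_simp
  have hβ : ∀ j : ℕ, j < J → |(j : ℝ) / M| ≤ 1 / (16 * h) := by
    intro j hj
    rw [abs_of_nonneg (by positivity), div_le_div_iff₀ hMp (by positivity), hJp]
    have : (j : ℝ) ≤ J := by exact_mod_cast hj.le
    nlinarith
  have hmain := sum_arcs_sq_le (M := M) (R := R) (Q := q) (δ := 1 / (16 * h)) hM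
    (fun r h1 h2 => hdvd r h1 (by omega))
    (by
      have : ((R : ℝ) * q) ^ 2 ≤ h := by exact_mod_cast hRq
      calc 2 * (1 / (16 * (h : ℝ))) * ((R : ℝ) * q) ^ 2 ≤ 2 * (1 / (16 * (h : ℝ))) * h := by gcongr
        _ = 1 / 8 := by field_simp; norm_num
        _ < 1 := by norm_num)
    (A := A)
    (by
      intro k hk
      obtain ⟨⟨a, j⟩, h1, rfl⟩ := mem_image.1 hk
      simp only [mem_product, mem_range] at h1 ⊢
      rw [hc]
      calc a * c + j < a * c + c := by omega
        _ = (a + 1) * c := by ring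
        _ ≤ q * c := Nat.mul_le_mul_right _ h1.1)
    (by
      intro k hk
      obtain ⟨⟨a, j⟩, h1, rfl⟩ := mem_image.1 hk
      simp only [mem_product, mem_range] at h1 ⊢
      refine ⟨q, a, hq, le_rfl, ?_⟩
      rw [hform]
      push_cast
      rw [add_sub_cancel_left]
      exact hβ j h1.2)
    (s := s) (f := fun _ => 1)
    (by
      intro m hm n hn hmn
      have h1 := hs m hm
      have h2 := hs n hn
      have hMh : h < M := by
        have := Nat.self_le_factorial (16 * h)
        omega
      rcases le_total m n with h3 | h3
      · have := (Nat.modEq_iff_dvd' h3).1 hmn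
        by_contra hne
        have := Nat.le_of_dvd (by omega) this
        omega
      · have := (Nat.modEq_iff_dvd' h3).1 hmn.symm
        by_contra hne
        have := Nat.le_of_dvd (by omega) this
        omega)
    (fun n hn _ r hr => coprime_rough_of_prime (hs n hn).2.2.2.1 (hs n hn).2.2.2.2 hr)
  have hlow : (q * J : ℝ) * ((#s : ℝ) / 2) ^ 2 ≤
      ∑ k ∈ A, ‖esum s (fun _ => 1) ((k : ℝ) / M)‖ ^ 2 := by
    have h1 : ((#A : ℕ) : ℝ) = q * J := by rw [hcard]; push_cast; rfl
    rw [← h1, ← nsmul_eq_mul]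
    apply card_nsmul_le_sum
    intro k hk
    obtain ⟨⟨a, j⟩, h1, rfl⟩ := mem_image.1 hk
    simp only [mem_product, mem_range] at h1
    rw [hform]
    gcongr
    exact card_div_two_le_norm_esum hq hh0
      (fun n hn => ⟨(hs n hn).1.le, (hs n hn).2.1, (hs n hn).2.2.1⟩) (hβ j h1.2)
  rcases Nat.eq_zero_or_pos #s with h0 | h0
  · rw [h0]
    have := (eul_pos q).le
    simp only [Nat.cast_zero, zero_mul]
    positivity
  have hs0 : (0 : ℝ) < #s := by exact_mod_cast h0
  have hlogR : 0 ≤ Real.log R := Real.log_natCast_nonneg R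
  have h2 : (q * J : ℝ) * ((#s : ℝ) / 2) ^ 2 * Real.log R ≤ 2 * eul q * (M * #s) := by
    refine (mul_le_mul_of_nonneg_right hlow hlogR).trans (hmain.trans (le_of_eq ?_))
    simp
  rw [hJp] at h2
  have hJ0' : (0 : ℝ) < J := by exact_mod_cast hJ0
  have h3 : ((#s : ℝ) * (q * Real.log R)) * (J * #s / 4) ≤ (128 * eul q * h) * (J * #s / 4) := by
    nlinarith
  exact le_of_mul_le_mul_right h3 (by positivity)

theorem brun_titchmarsh {x h q : ℕ} (b : ℕ) (hq : 0 < q) (hqh : q ^ 4 ≤ h) (hx : x + h ≤ h ^ 2) :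
    ∑ p ∈ Ioc x (x + h) with p.Prime ∧ p ≡ b [MOD q], Real.log p ≤ 3000 * eul q * h / q := by
  have hqp : (0 : ℝ) < q := by exact_mod_cast hq
  have hq1 : (1 : ℝ) ≤ q := by exact_mod_cast hq
  have hE := one_le_eul q
  have hh0 : 0 < h := lt_of_lt_of_le (by positivity) hqh
  have hh1 : (1 : ℝ) ≤ h := by exact_mod_cast hh0
  have hqh' : (q : ℝ) ^ 4 ≤ h := by exact_mod_cast hqh
  have hlogh : 0 ≤ Real.log h := Real.log_nonneg hh1
  have hlog : ∀ p ∈ ({p ∈ Ioc x (x + h) | p.Prime ∧ p ≡ b [MOD q]} : Finset ℕ),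
      Real.log p ≤ 2 * Real.log h := by
    intro p hp
    simp only [mem_filter, mem_Ioc] at hp
    have : 2 * Real.log h = Real.log ((h : ℝ) ^ 2) := by rw [Real.log_pow]; norm_num
    rw [this]
    apply Real.log_le_log (by exact_mod_cast hp.2.1.pos)
    exact_mod_cast hp.1.2.trans hx
  rcases lt_or_ge h 256 with hsmall | hlarge
  · refine (sum_le_card_nsmul _ _ _ hlog).trans ?_
    rw [nsmul_eq_mul]
    have h1 : (#{p ∈ Ioc x (x + h) | p.Prime ∧ p ≡ b [MOD q]} : ℝ) ≤ h := by
      have : #{p ∈ Ioc x (x + h) | p.Prime ∧ p ≡ b [MOD q]} ≤ h := by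
        refine (card_filter_le _ _).trans ?_
        simp
      exact_mod_cast this
    have h2 : Real.log h ≤ 256 := by
      have := Real.log_le_sub_one_of_pos (by linarith : (0 : ℝ) < h)
      have : (h : ℝ) < 256 := by exact_mod_cast hsmall
      linarith
    have h3 : (q : ℝ) ≤ 4 := by
      by_contra h4
      push Not at h4
      have h5 : 5 ≤ q := by
        have : 4 < q := by exact_mod_cast h4
        omega
      have := Nat.pow_le_pow_left h5 4
      omega
    rw [le_div_iff₀ hqp]
    calc (#{p ∈ Ioc x (x + h) | p.Prime ∧ p ≡ b [MOD q]} : ℝ) * (2 * Real.log h) * q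
        ≤ h * (2 * 256) * 4 := by gcongr
      _ ≤ 3000 * 1 * h := by linarith
      _ ≤ 3000 * eul q * h := by gcongr
  set R := ⌊√(h : ℝ) / q⌋₊ with hRdef
  have hsq : 0 < √(h : ℝ) := Real.sqrt_pos.2 (by linarith)
  have hsqsq : √(h : ℝ) ^ 2 = h := Real.sq_sqrt (by linarith)
  have hRle : (R : ℝ) ≤ √h / q := Nat.floor_le (by positivity)
  have hq2 : (q : ℝ) ^ 2 ≤ √h := by
    apply Real.le_sqrt_of_sq_le
    rw [← pow_mul]
    exact hqh'
  have hRge : √h / (2 * q) ≤ R := by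
    have h1 := Nat.lt_floor_add_one (√(h : ℝ) / q)
    rw [← hRdef] at h1
    have h2 : 1 ≤ √(h : ℝ) / q := by
      rw [one_le_div hqp]
      nlinarith
    have h3 : (1 : ℝ) ≤ R := by
      exact_mod_cast Nat.one_le_iff_ne_zero.2 (by
        rw [hRdef]
        exact (Nat.floor_pos.2 h2).ne')
    have h4 : √(h : ℝ) / (2 * q) = √h / q / 2 := by field_simp
    rw [h4]
    linarith
  have hRq : (R * q) ^ 2 ≤ h := by
    have : ((R : ℝ) * q) ^ 2 ≤ h := by
      rw [← hsqsq]
      gcongr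
      rwa [le_div_iff₀ hqp] at hRle
    exact_mod_cast this
  have hRh : R ≤ h := by
    calc R ≤ R * q := Nat.le_mul_of_pos_right _ hq
      _ ≤ (R * q) ^ 2 := Nat.le_self_pow (by norm_num) _
      _ ≤ h := hRq
  have hlogR : Real.log h / 8 ≤ Real.log R := by
    have h256 : (256 : ℝ) ≤ h := by exact_mod_cast hlarge
    have h2 : √(h : ℝ) ≤ R * (2 * q) := by rwa [div_le_iff₀ (by positivity)] at hRge
    have h3 : (h : ℝ) ≤ (2 * R) ^ 4 := by
      have h4 : √(h : ℝ) ^ 2 ≤ (R * (2 * q)) ^ 2 := by gcongr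
      have h5 : (R * (2 * (q : ℝ))) ^ 2 ≤ (2 * R) ^ 2 * √h := by
        calc (R * (2 * (q : ℝ))) ^ 2 = (2 * R) ^ 2 * (q : ℝ) ^ 2 := by ring
          _ ≤ _ := by gcongr
      have h6 : √(h : ℝ) ≤ (2 * R) ^ 2 := by
        have : √(h : ℝ) * √h ≤ (2 * R) ^ 2 * √h := by nlinarith
        exact le_of_mul_le_mul_right this hsq
      calc (h : ℝ) = √h ^ 2 := hsqsq.symm
        _ ≤ ((2 * R) ^ 2) ^ 2 := by gcongr
        _ = _ := by ring
    have hR0 : (0 : ℝ) < R := lt_of_lt_of_le (by positivity) hRge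
    have h7 : (h : ℝ) ≤ (R : ℝ) ^ 8 := by
      have h8 : (4 : ℝ) ^ 4 ≤ (2 * R) ^ 4 := by norm_num at h3 ⊢; linarith
      have h9 : (2 : ℝ) ≤ R := by
        by_contra h10
        push Not at h10
        have : (2 * (R : ℝ)) ^ 4 < 4 ^ 4 := by
          apply pow_lt_pow_left₀ (by linarith) (by positivity) (by norm_num)
        linarith
      calc (h : ℝ) ≤ (2 * R) ^ 4 := h3
        _ ≤ (R * R) ^ 4 := by gcongr
        _ = _ := by ring
    have := Real.log_le_log (by linarith) h7
    rw [Real.log_pow] at this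
    push_cast at this
    linarith
  set s := ({p ∈ Ioc x (x + h) | p.Prime ∧ p ≡ b [MOD q]} : Finset ℕ) with hs
  have hbig := card_mul_log_le (x := x) (h := h) (q := q) (b := b) (R := R) hq
    ((Nat.le_self_pow (by norm_num) q).trans hqh) hRh hRq (s := s.filter fun p => R < p)
    (by
      intro n hn
      simp only [hs, mem_filter, mem_Ioc] at hn
      exact ⟨hn.1.1.1, hn.1.1.2, hn.1.2.2, hn.1.2.1, hn.2⟩)
  have hsplit := sum_filter_add_sum_filter_not s (fun p => R < p) (fun p : ℕ => Real.log p)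
  rw [← hsplit]
  have h1 : ∑ p ∈ s with R < p, Real.log p ≤ 2048 * eul q * h / q := by
    refine (sum_le_card_nsmul _ _ _ (fun p hp => hlog p (mem_filter.1 hp).1)).trans ?_
    rw [nsmul_eq_mul, le_div_iff₀ hqp]
    have : (#{p ∈ s | R < p} : ℝ) * (q * (Real.log h / 8)) ≤ 128 * eul q * h :=
      le_trans (by gcongr) hbig
    linarith
  have h2 : ∑ p ∈ s with ¬ R < p, Real.log p ≤ 4 * eul q * h / q := by
    refine (sum_le_card_nsmul _ _ _ (fun p hp => hlog p (mem_filter.1 hp).1)).trans ?_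
    rw [nsmul_eq_mul]
    have h3 : (#{p ∈ s | ¬ R < p} : ℝ) ≤ R := by
      have : #{p ∈ s | ¬ R < p} ≤ #(Ioc 0 R) := by
        apply card_le_card
        intro p hp
        simp only [hs, mem_filter, mem_Ioc, not_lt] at hp ⊢
        exact ⟨hp.1.2.1.pos, hp.2⟩
      rw [Nat.card_Ioc] at this
      exact_mod_cast this
    have h4 : Real.log h ≤ 2 * √h := by
      have h5 := Real.log_le_sub_one_of_pos hsq
      rw [Real.log_sqrt (by linarith)] at h5
      linarith
    calc (#{p ∈ s | ¬ R < p} : ℝ) * (2 * Real.log h) ≤ (√h / q) * (2 * (2 * √h)) := by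
          gcongr
          exact h3.trans hRle
      _ = 4 * 1 * (√h ^ 2) / q := by ring
      _ = 4 * 1 * h / q := by rw [hsqsq]
      _ ≤ _ := by gcongr
  have h5 : 3000 * eul q * h / q = 2048 * eul q * h / q + 4 * eul q * h / q
      + 948 * eul q * h / q := by ring
  have h6 : 0 ≤ 948 * eul q * h / q := by have := eul_pos q; positivity
  linarith

open scoped ArithmeticFunction.vonMangoldt

/-! ### Chebyshev and Mertens type estimates -/

/-- The logarithm of `n` if `n` is prime, and zero otherwise. -/
noncomputable def lp (n : ℕ) : ℝ := if n.Prime then Real.log n else 0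

/-- The von Mangoldt function, restricted to the integers which are not prime. -/
noncomputable def npm (n : ℕ) : ℝ := if n.Prime then 0 else Λ n

theorem lp_nonneg (n : ℕ) : 0 ≤ lp n := by
  unfold lp; split_ifs
  · exact Real.log_natCast_nonneg n
  · exact le_rfl

theorem npm_nonneg (n : ℕ) : 0 ≤ npm n := by
  unfold npm; split_ifs
  · exact le_rfl
  · exact ArithmeticFunction.vonMangoldt_nonneg

theorem lp_add_npm (n : ℕ) : lp n + npm n = Λ n := by
  unfold lp npm; split_ifs with h
  · rw [ArithmeticFunction.vonMangoldt_apply_prime h, add_zero]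
  · rw [zero_add]

theorem lp_le (n : ℕ) : lp n ≤ Λ n := by linarith [lp_add_npm n, npm_nonneg n]

theorem sum_lp_eq_theta (y : ℕ) : ∑ n ∈ Ioc 0 y, lp n = Chebyshev.theta y := by
  unfold lp Chebyshev.theta
  rw [Nat.floor_natCast, sum_filter]

theorem sum_vonMangoldt_eq_psi (y : ℕ) : ∑ n ∈ Ioc 0 y, Λ n = Chebyshev.psi y := by
  unfold Chebyshev.psi
  rw [Nat.floor_natCast]

theorem log_four_lt : Real.log 4 < 1.4 := by
  have : Real.log 4 = 2 * Real.log 2 := by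
    rw [show (4 : ℝ) = 2 ^ 2 by norm_num, Real.log_pow]; norm_num
  have := Real.log_two_lt_d9
  linarith

theorem sum_lp_le (y : ℕ) : ∑ n ∈ Ioc 0 y, lp n ≤ 2 * y := by
  rw [sum_lp_eq_theta]
  have := Chebyshev.theta_le_log4_mul_x (x := y) (by positivity)
  have h2 := log_four_lt
  have : (0 : ℝ) ≤ y := by positivity
  nlinarith

theorem sum_vonMangoldt_le (y : ℕ) : ∑ n ∈ Ioc 0 y, Λ n ≤ 6 * y := by
  rw [sum_vonMangoldt_eq_psi]
  have := Chebyshev.psi_le_const_mul_self (x := y) (by positivity)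
  have h2 := log_four_lt
  have : (0 : ℝ) ≤ y := by positivity
  nlinarith

theorem sum_npm_le (y : ℕ) (hy : 1 ≤ y) : ∑ n ∈ Ioc 0 y, npm n ≤ 2 * √y * Real.log y := by
  have h := Chebyshev.psi_sub_theta_le (x := y) (by exact_mod_cast hy)
  rw [← sum_vonMangoldt_eq_psi, ← sum_lp_eq_theta, ← sum_sub_distrib] at h
  refine le_trans (le_of_eq (sum_congr rfl fun n _ => ?_)) h
  linarith [lp_add_npm n]

theorem exists_sum_npm_div_le : ∃ C : ℝ, 0 < C ∧ ∀ s : Finset ℕ, ∑ n ∈ s, npm n / n ≤ C := by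
  have h := ArithmeticFunction.vonMangoldt.summable_residueClass_non_primes_div (q := 1) 0
  have h0 : ∀ n : ℕ, (if n.Prime then 0 else ArithmeticFunction.vonMangoldt.residueClass
      (0 : ZMod 1) n) / n = npm n / n := by
    intro n
    unfold npm
    split_ifs
    · rfl
    · congr 1
      simp only [ArithmeticFunction.vonMangoldt.residueClass]
      rw [Set.indicator_of_mem]
      exact Subsingleton.elim _ _
  simp_rw [h0] at h
  have hpos : ∀ n : ℕ, 0 ≤ npm n / n := fun n => div_nonneg (npm_nonneg n) (by positivity)
  refine ⟨∑' n, npm n / n + 1, by have := tsum_nonneg (L := .unconditional ℕ) hpos; linarith, fun s => ?_⟩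
  linarith [h.sum_le_tsum s fun n _ => hpos n]

/-- Summation over the hyperbolic region `ab ≤ x`. -/
theorem sum_antidiagonal_eq_sum_sum {E : Type*} [AddCommMonoid E] (F : ℕ → ℕ → E) (x : ℕ) :
    ∑ n ∈ Ioc 0 x, ∑ d ∈ n.divisorsAntidiagonal, F d.1 d.2 =
      ∑ a ∈ Ioc 0 x, ∑ b ∈ Ioc 0 (x / a), F a b := by
  rw [sum_sigma', sum_sigma']
  refine sum_nbij' (fun z => ⟨z.2.1, z.2.2⟩) (fun z => ⟨z.1 * z.2, (z.1, z.2)⟩) ?_ ?_ ?_ ?_ ?_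
  · rintro ⟨n, a, b⟩ h
    simp only [mem_sigma, mem_Ioc, Nat.mem_divisorsAntidiagonal] at h ⊢
    obtain ⟨⟨h1, h2⟩, h3, h4⟩ := h
    have ha : 0 < a := Nat.pos_of_ne_zero (by rintro rfl; simp at h3; omega)
    have hb : 0 < b := Nat.pos_of_ne_zero (by rintro rfl; simp at h3; omega)
    refine ⟨⟨ha, ?_⟩, hb, ?_⟩
    · nlinarith
    · rw [Nat.le_div_iff_mul_le ha, mul_comm]; omega
  · rintro ⟨a, b⟩ h
    simp only [mem_sigma, mem_Ioc, Nat.mem_divisorsAntidiagonal] at h ⊢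
    obtain ⟨⟨h1, h2⟩, h3, h4⟩ := h
    rw [Nat.le_div_iff_mul_le h1] at h4
    exact ⟨⟨by positivity, by rwa [mul_comm]⟩, trivial, by positivity⟩
  · rintro ⟨n, a, b⟩ h
    simp only [mem_sigma, mem_Ioc, Nat.mem_divisorsAntidiagonal] at h ⊢
    obtain ⟨⟨h1, h2⟩, h3, h4⟩ := h
    subst h3; rfl
  · rintro ⟨a, b⟩ h
    rfl
  · rintro ⟨n, a, b⟩ h
    rfl

theorem sum_sum_comm_hyperbola {E : Type*} [AddCommMonoid E] (F : ℕ → ℕ → E) (x : ℕ) :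
    ∑ a ∈ Ioc 0 x, ∑ b ∈ Ioc 0 (x / a), F a b = ∑ a ∈ Ioc 0 x, ∑ b ∈ Ioc 0 (x / a), F b a := by
  rw [← sum_antidiagonal_eq_sum_sum, ← sum_antidiagonal_eq_sum_sum (fun a b => F b a)]
  refine sum_congr rfl fun n _ => ?_
  conv_lhs => rw [← Nat.map_swap_divisorsAntidiagonal, sum_map]
  rfl

theorem sum_vonMangoldt_div_le (z : ℕ) (hz : 1 ≤ z) :
    ∑ d ∈ Ioc 0 z, Λ d / d ≤ Real.log z + 6 := by
  have hz0 : (0 : ℝ) < z := by exact_mod_cast hz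
  have h1 : ∑ n ∈ Ioc 0 z, Real.log n = ∑ d ∈ Ioc 0 z, Λ d * (z / d : ℕ) := by
    rw [← ArithmeticFunction.sum_Ioc_mul_zeta_eq_sum, ArithmeticFunction.vonMangoldt_mul_zeta]
    rfl
  have h2 : ∑ n ∈ Ioc 0 z, Real.log n ≤ z * Real.log z := by
    have : ∑ n ∈ Ioc 0 z, Real.log n ≤ ∑ n ∈ Ioc 0 z, Real.log z := by
      refine sum_le_sum fun n hn => ?_
      rw [mem_Ioc] at hn
      exact Real.log_le_log (by exact_mod_cast hn.1) (by exact_mod_cast hn.2)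
    simpa using this
  have h3 : z * ∑ d ∈ Ioc 0 z, Λ d / d ≤ ∑ d ∈ Ioc 0 z, Λ d * (z / d : ℕ) + ∑ d ∈ Ioc 0 z, Λ d := by
    rw [mul_sum, ← sum_add_distrib]
    refine sum_le_sum fun d hd => ?_
    have hL : 0 ≤ Λ d := ArithmeticFunction.vonMangoldt_nonneg
    have : (z : ℝ) / d ≤ (z / d : ℕ) + 1 := by
      rw [← Nat.floor_div_eq_div (K := ℝ)]
      exact (Nat.lt_floor_add_one _).le
    calc z * (Λ d / d) = Λ d * (z / d) := by ring
      _ ≤ Λ d * ((z / d : ℕ) + 1) := by gcongr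
      _ = _ := by ring
  have h4 := sum_vonMangoldt_le z
  rw [← h1] at h3
  have : z * ∑ d ∈ Ioc 0 z, Λ d / d ≤ z * (Real.log z + 6) := by linarith
  exact le_of_mul_le_mul_left this hz0

theorem log_div_le_sum {n x : ℕ} (hn : 1 ≤ n) (hx : n ≤ x) :
    Real.log ((x : ℝ) / n) ≤ ∑ k ∈ Ico n x, (1 : ℝ) / k := by
  induction x, hx using Nat.le_induction with
  | base => simp [div_self (show (n : ℝ) ≠ 0 by positivity)]
  | succ x hx ih =>
    have hn0 : (0 : ℝ) < n := by exact_mod_cast hn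
    have hx0 : (0 : ℝ) < x := by exact_mod_cast lt_of_lt_of_le hn hx
    rw [sum_Ico_succ_top hx]
    have : Real.log (((x + 1 : ℕ) : ℝ) / n) = Real.log (x / n) + Real.log (1 + 1 / x) := by
      rw [← Real.log_mul (by positivity) (by positivity)]
      congr 1; push_cast; field_simp
    rw [this]
    have := Real.log_le_sub_one_of_pos (show (0 : ℝ) < 1 + 1 / x by positivity)
    linarith

theorem sum_vonMangoldt_mul_log_div_le (x : ℕ) :
    ∑ n ∈ Ioc 0 x, Λ n * Real.log ((x : ℝ) / n) ≤ 6 * x := by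
  calc ∑ n ∈ Ioc 0 x, Λ n * Real.log ((x : ℝ) / n)
      ≤ ∑ n ∈ Ioc 0 x, Λ n * ∑ k ∈ Ico n x, (1 : ℝ) / k := by
        refine sum_le_sum fun n hn => ?_
        rw [mem_Ioc] at hn
        exact mul_le_mul_of_nonneg_left (log_div_le_sum hn.1 hn.2)
          ArithmeticFunction.vonMangoldt_nonneg
    _ = ∑ k ∈ Ico 1 x, ∑ n ∈ Ioc 0 k, Λ n * ((1 : ℝ) / k) := by
        simp_rw [mul_sum]
        refine sum_comm' fun n k => ?_
        simp only [mem_Ioc, mem_Ico]; omega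
    _ ≤ ∑ k ∈ Ico 1 x, (6 : ℝ) := by
        refine sum_le_sum fun k hk => ?_
        rw [mem_Ico] at hk
        have hk0 : (0 : ℝ) < k := by exact_mod_cast hk.1
        rw [← sum_mul, mul_one_div, div_le_iff₀ hk0]
        exact sum_vonMangoldt_le k
    _ ≤ 6 * x := by
        rw [sum_const, Nat.card_Ico, nsmul_eq_mul, mul_comm]
        have : ((x - 1 : ℕ) : ℝ) ≤ x := by exact_mod_cast Nat.sub_le x 1
        linarith

/-! ### Selberg's identity -/

open ArithmeticFunction (moebius zeta vonMangoldt_mul_zeta vonMangoldt_sum natCoe_apply intCoe_apply mul_apply zeta_apply coe_moebius_mul_coe_zeta) in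
/-- Selberg's weights. -/
noncomputable def selW (x n : ℕ) : ℝ :=
  ∑ d ∈ n.divisorsAntidiagonal, (moebius d.1 : ℝ) * Real.log ((x : ℝ) / d.1) ^ 2

open ArithmeticFunction (moebius zeta vonMangoldt_mul_zeta vonMangoldt_sum natCoe_apply intCoe_apply mul_apply zeta_apply coe_moebius_mul_coe_zeta) in
theorem vonMangoldt_mul_log_add (n : ℕ) :
    Λ n * Real.log n + (Λ * Λ : ArithmeticFunction ℝ) n =
      ∑ d ∈ n.divisorsAntidiagonal, (moebius d.1 : ℝ) * Real.log d.2 ^ 2 := by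
  set F : ArithmeticFunction ℝ := ⟨fun n => Λ n * Real.log n, by simp⟩ with hF
  set L2 : ArithmeticFunction ℝ := ⟨fun n => Real.log n ^ 2, by simp⟩ with hL2
  have h1 : F * (zeta : ArithmeticFunction ℝ) + Λ * ArithmeticFunction.log = L2 := by
    ext n
    rw [ArithmeticFunction.add_apply, mul_apply, mul_apply, ← sum_add_distrib]
    have h2 : L2 n = ∑ d ∈ n.divisorsAntidiagonal, Λ d.1 * Real.log n := by
      rw [← sum_mul, Nat.sum_divisorsAntidiagonal (fun d _ => Λ d), vonMangoldt_sum]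
      simp [hL2, sq]
    rw [h2]
    refine sum_congr rfl fun d hd => ?_
    rw [Nat.mem_divisorsAntidiagonal] at hd
    obtain ⟨h3, h4⟩ := hd
    have ha : d.1 ≠ 0 := by rintro h; simp [h] at h3; omega
    have hb : d.2 ≠ 0 := by rintro h; simp [h] at h3; omega
    rw [← h3]
    push_cast
    rw [Real.log_mul (by exact_mod_cast ha) (by exact_mod_cast hb)]
    simp [hF, hb, natCoe_apply, ArithmeticFunction.log_apply, zeta_apply]
    ring
  have h5 : F + Λ * Λ = (moebius : ArithmeticFunction ℝ) * L2 := by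
    rw [← h1, ← vonMangoldt_mul_zeta, mul_add, ← mul_assoc Λ, mul_comm F, mul_comm (Λ * Λ),
      ← mul_assoc, ← mul_assoc, coe_moebius_mul_coe_zeta, one_mul, one_mul]
  have := congrArg (fun f : ArithmeticFunction ℝ => f n) h5
  simp only [ArithmeticFunction.add_apply, mul_apply (f := (moebius : ArithmeticFunction ℝ)), intCoe_apply] at this
  exact this

open scoped ArithmeticFunction.vonMangoldt

theorem selW_eq {x n : ℕ} (hx : 1 ≤ x) (hn : 1 ≤ n) :
    selW x n = (if n = 1 then Real.log x ^ 2 else 0) + Λ n * Real.log x +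
      Λ n * Real.log ((x : ℝ) / n) + (Λ * Λ : ArithmeticFunction ℝ) n := by
  have hx0 : (x : ℝ) ≠ 0 := by positivity
  have hn0 : (n : ℝ) ≠ 0 := by positivity
  set u := Real.log ((x : ℝ) / n) with hu
  have hu' : u = Real.log x - Real.log n := Real.log_div hx0 hn0
  have h1 : ∑ d ∈ n.divisorsAntidiagonal, (ArithmeticFunction.moebius d.1 : ℝ) =
      if n = 1 then 1 else 0 := by
    have := congrArg (fun f : ArithmeticFunction ℤ => f n)
      ArithmeticFunction.moebius_mul_coe_zeta
    simp only [ArithmeticFunction.mul_apply, ArithmeticFunction.one_apply] at this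
    have h2 : ∑ d ∈ n.divisorsAntidiagonal, ArithmeticFunction.moebius d.1 =
        if n = 1 then (1 : ℤ) else 0 := by
      rw [← this]
      refine sum_congr rfl fun d hd => ?_
      rw [Nat.mem_divisorsAntidiagonal] at hd
      have hb : d.2 ≠ 0 := by rintro h; simp [h] at hd; omega
      simp [ArithmeticFunction.natCoe_apply, ArithmeticFunction.zeta_apply, hb]
    exact_mod_cast h2
  have h2 : ∑ d ∈ n.divisorsAntidiagonal, (ArithmeticFunction.moebius d.1 : ℝ) * Real.log d.2 =
      Λ n := by
    have := congrArg (fun f : ArithmeticFunction ℝ => f n)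
      ArithmeticFunction.moebius_mul_log_eq_vonMangoldt
    simp only [ArithmeticFunction.mul_apply] at this
    exact this
  have h3 := vonMangoldt_mul_log_add n
  have h4 : selW x n = ∑ d ∈ n.divisorsAntidiagonal, (u ^ 2 * (ArithmeticFunction.moebius d.1 : ℝ) +
      2 * u * ((ArithmeticFunction.moebius d.1 : ℝ) * Real.log d.2) +
      (ArithmeticFunction.moebius d.1 : ℝ) * Real.log d.2 ^ 2) := by
    unfold selW
    refine sum_congr rfl fun d hd => ?_
    rw [Nat.mem_divisorsAntidiagonal] at hd
    have ha : d.1 ≠ 0 := by rintro h; simp [h] at hd; omega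
    have hb : d.2 ≠ 0 := by rintro h; simp [h] at hd; omega
    have : Real.log ((x : ℝ) / d.1) = u + Real.log d.2 := by
      rw [hu', ← hd.1, Real.log_div hx0 (by exact_mod_cast ha)]
      push_cast
      rw [Real.log_mul (by exact_mod_cast ha) (by exact_mod_cast hb)]
      ring
    rw [this]; ring
  rw [h4, sum_add_distrib, sum_add_distrib, ← mul_sum, ← mul_sum, h1, h2, ← h3, hu']
  by_cases h : n = 1
  · simp [h]
  · simp [h]; ring

theorem mul_vonMangoldt_nonneg (n : ℕ) : 0 ≤ (Λ * Λ : ArithmeticFunction ℝ) n := by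
  rw [ArithmeticFunction.mul_apply]
  exact sum_nonneg fun _ _ => mul_nonneg ArithmeticFunction.vonMangoldt_nonneg
    ArithmeticFunction.vonMangoldt_nonneg

theorem log_div_nonneg {x n : ℕ} (hn : 1 ≤ n) (hx : n ≤ x) : 0 ≤ Real.log ((x : ℝ) / n) := by
  apply Real.log_nonneg
  rw [le_div_iff₀ (by exact_mod_cast hn), one_mul]
  exact_mod_cast hx

theorem selW_nonneg {x n : ℕ} (hn : 1 ≤ n) (hx : n ≤ x) : 0 ≤ selW x n := by
  rw [selW_eq (hn.trans hx) hn]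
  have h1 : 0 ≤ Λ n := ArithmeticFunction.vonMangoldt_nonneg
  have h2 := log_div_nonneg hn hx
  have h3 := mul_vonMangoldt_nonneg n
  have h4 := Real.log_natCast_nonneg x
  have : 0 ≤ (if n = 1 then Real.log x ^ 2 else 0) := by split_ifs <;> positivity
  positivity

theorem sq_log_le {t : ℝ} (ht : 1 ≤ t) : Real.log t ^ 2 ≤ 16 * √t := by
  have h0 : 0 ≤ Real.log t := Real.log_nonneg ht
  have h1 : Real.log √√t = Real.log t / 4 := by
    rw [Real.log_sqrt (by positivity), Real.log_sqrt (by positivity)]; ring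
  have hpos : 0 < √√t := Real.sqrt_pos.2 (Real.sqrt_pos.2 (by positivity))
  have h2 := Real.log_le_sub_one_of_pos hpos
  have h3 : Real.log t ≤ 4 * √√t := by linarith
  calc Real.log t ^ 2 ≤ (4 * √√t) ^ 2 := by gcongr
    _ = 16 * √t := by rw [mul_pow, Real.sq_sqrt (by positivity)]; norm_num

theorem sum_sum_le_of_le {f g : ℕ → ℝ} {c : ℝ} (hf : ∀ n, 0 ≤ f n)
    (hg : ∀ y : ℕ, ∑ n ∈ Ioc 0 y, g n ≤ c * y) (hc : 0 ≤ c) (s : Finset ℕ) (x : ℕ) :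
    ∑ a ∈ s, ∑ b ∈ Ioc 0 (x / a), f a * g b ≤ c * x * ∑ a ∈ s, f a / a := by
  rw [mul_sum]
  refine sum_le_sum fun a _ => ?_
  rw [← mul_sum]
  calc f a * ∑ b ∈ Ioc 0 (x / a), g b ≤ f a * (c * (x / a : ℕ)) := by
        gcongr; exacts [hf a, hg _]
    _ ≤ f a * (c * ((x : ℝ) / a)) := by gcongr; exacts [hf a, Nat.cast_div_le]
    _ = _ := by ring

theorem sum_selW_le {x : ℕ} (hx : 1 ≤ x) :
    ∑ n ∈ Ioc 0 x, selW x n ≤ Real.log x ^ 2 + 12 * x * Real.log x + 42 * x := by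
  have h0 : ∀ n ∈ Ioc 0 x, selW x n = (if n = 1 then Real.log x ^ 2 else 0) + Λ n * Real.log x +
      Λ n * Real.log ((x : ℝ) / n) + (Λ * Λ : ArithmeticFunction ℝ) n := fun n hn =>
    selW_eq hx (mem_Ioc.1 hn).1
  rw [sum_congr rfl h0, sum_add_distrib, sum_add_distrib, sum_add_distrib]
  have h1 : ∑ n ∈ Ioc 0 x, (if n = 1 then Real.log x ^ 2 else 0) ≤ Real.log x ^ 2 := by
    rw [sum_ite_eq']; split_ifs; exacts [le_rfl, by positivity]
  have hL := Real.log_natCast_nonneg x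
  have h2 : ∑ n ∈ Ioc 0 x, Λ n * Real.log x ≤ 6 * x * Real.log x := by
    rw [← sum_mul]; gcongr; exact sum_vonMangoldt_le x
  have h3 := sum_vonMangoldt_mul_log_div_le x
  have h4 : ∑ n ∈ Ioc 0 x, (Λ * Λ : ArithmeticFunction ℝ) n ≤ 6 * x * (Real.log x + 6) := by
    simp_rw [ArithmeticFunction.mul_apply]
    rw [sum_antidiagonal_eq_sum_sum (fun a b => Λ a * Λ b)]
    refine (sum_sum_le_of_le (fun _ => ArithmeticFunction.vonMangoldt_nonneg) sum_vonMangoldt_le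
      (by norm_num) _ x).trans ?_
    gcongr
    exact sum_vonMangoldt_div_le x hx
  linarith

/-- The exponential sum over primes up to `x`. -/
noncomputable def pS (x : ℕ) (α : ℝ) : ℂ := esum (Ioc 0 x) lp α

theorem norm_pS_le (x : ℕ) (α : ℝ) : ‖pS x α‖ ≤ 2 * x := by
  refine (norm_esum_le _ _ _).trans (le_trans (le_of_eq ?_) (sum_lp_le x))
  exact sum_congr rfl fun n _ => abs_of_nonneg (lp_nonneg n)

theorem esum_mul_eq (f g : ArithmeticFunction ℝ) (x : ℕ) (α : ℝ) :
    esum (Ioc 0 x) (f * g : ArithmeticFunction ℝ) α =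
      ∑ a ∈ Ioc 0 x, ∑ b ∈ Ioc 0 (x / a), ((f a * g b : ℝ) : ℂ) * ex (a * b * α) := by
  rw [← sum_antidiagonal_eq_sum_sum (fun a b => ((f a * g b : ℝ) : ℂ) * ex (a * b * α))]
  refine sum_congr rfl fun n _ => ?_
  rw [ArithmeticFunction.mul_apply]
  push_cast
  rw [sum_mul]
  refine sum_congr rfl fun d hd => ?_
  rw [Nat.mem_divisorsAntidiagonal] at hd
  rw [← hd.1]; push_cast; rfl

/-- The bilinear sum over products of two primes. -/
noncomputable def bil (x : ℕ) (α : ℝ) : ℂ := ∑ p ∈ Ioc 0 x, (lp p : ℂ) * pS (x / p) (p * α)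

theorem exists_log_mul_norm_pS_le : ∃ C : ℝ, 0 < C ∧ ∀ (x : ℕ) (α : ℝ), 1 ≤ x →
    Real.log x * ‖pS x α‖ ≤ ‖esum (Ioc 0 x) (selW x) α‖ + ‖bil x α‖ + C * x := by
  obtain ⟨C, hC, hnpm⟩ := exists_sum_npm_div_le
  refine ⟨54 + 12 * C, by positivity, fun x α hx => ?_⟩
  set L := Real.log x with hL
  have hL0 : 0 ≤ L := Real.log_natCast_nonneg x
  have hx1 : (1 : ℝ) ≤ x := by exact_mod_cast hx
  set E : ℂ := ∑ a ∈ Ioc 0 x, ∑ b ∈ Ioc 0 (x / a),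
    ((Λ a * Λ b - lp a * lp b : ℝ) : ℂ) * ex (a * b * α) with hE
  have hEle : ‖E‖ ≤ 12 * C * x := by
    have h1 : ‖E‖ ≤ ∑ a ∈ Ioc 0 x, ∑ b ∈ Ioc 0 (x / a), (Λ a * npm b + npm a * Λ b) := by
      refine (norm_sum_le _ _).trans (sum_le_sum fun a _ => (norm_sum_le _ _).trans
        (sum_le_sum fun b _ => ?_))
      rw [norm_mul, norm_ex, mul_one, Complex.norm_real, Real.norm_eq_abs]
      have e1 := lp_add_npm a
      have e2 := lp_add_npm b
      have := npm_nonneg a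
      have := npm_nonneg b
      have := lp_nonneg a
      have := lp_nonneg b
      rw [← e1, ← e2, abs_of_nonneg]
      · nlinarith [mul_nonneg (npm_nonneg a) (npm_nonneg b)]
      · have := mul_nonneg (npm_nonneg a) (npm_nonneg b)
        have := mul_nonneg (lp_nonneg a) (npm_nonneg b)
        have := mul_nonneg (npm_nonneg a) (lp_nonneg b)
        nlinarith
    have h2 : ∑ a ∈ Ioc 0 x, ∑ b ∈ Ioc 0 (x / a), npm a * Λ b ≤ 6 * x * C :=
      (sum_sum_le_of_le npm_nonneg sum_vonMangoldt_le (by norm_num) _ x).trans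
        (by gcongr; exact hnpm _)
    have h3 : ∑ a ∈ Ioc 0 x, ∑ b ∈ Ioc 0 (x / a), Λ a * npm b =
        ∑ a ∈ Ioc 0 x, ∑ b ∈ Ioc 0 (x / a), npm a * Λ b := by
      rw [sum_sum_comm_hyperbola]
      exact sum_congr rfl fun a _ => sum_congr rfl fun b _ => mul_comm _ _
    simp_rw [sum_add_distrib] at h1
    linarith
  set F : ℂ := esum (Ioc 0 x) (fun n => Λ n * Real.log ((x : ℝ) / n)) α with hF
  have hFle : ‖F‖ ≤ 6 * x := by
    refine (norm_esum_le _ _ _).trans (le_trans (le_of_eq ?_) (sum_vonMangoldt_mul_log_div_le x))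
    refine sum_congr rfl fun n hn => abs_of_nonneg ?_
    rw [mem_Ioc] at hn
    exact mul_nonneg ArithmeticFunction.vonMangoldt_nonneg (log_div_nonneg hn.1 hn.2)
  set P : ℂ := esum (Ioc 0 x) npm α with hP
  have hPle : ‖P‖ ≤ 2 * √x * L := by
    refine (norm_esum_le _ _ _).trans (le_trans (le_of_eq ?_) (sum_npm_le x hx))
    exact sum_congr rfl fun n hn => abs_of_nonneg (npm_nonneg n)
  have hB : esum (Ioc 0 x) (Λ * Λ : ArithmeticFunction ℝ) α = bil x α + E := by
    rw [esum_mul_eq]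
    simp only [bil, pS, esum, hE, mul_sum]
    rw [← sum_add_distrib]
    refine sum_congr rfl fun a _ => ?_
    rw [← sum_add_distrib]
    refine sum_congr rfl fun b _ => ?_
    rw [show (b : ℝ) * (a * α) = a * b * α by ring]
    push_cast; ring
  have hT : esum (Ioc 0 x) (selW x) α = (L : ℂ) ^ 2 * ex α + (L * (pS x α + P) + F + (bil x α + E)) := by
    rw [← hB]
    have h1 : (L : ℂ) ^ 2 * ex α = ∑ n ∈ Ioc 0 x, if n = 1 then (L : ℂ) ^ 2 * ex (n * α) else 0 := by
      rw [sum_ite_eq', if_pos (by simp; omega)]; simp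
    rw [h1]
    simp only [pS, hP, hF, esum]
    rw [← sum_add_distrib, mul_sum, ← sum_add_distrib, ← sum_add_distrib, ← sum_add_distrib]
    refine sum_congr rfl fun n hn => ?_
    rw [selW_eq hx (mem_Ioc.1 hn).1, ← lp_add_npm n, ← hL]
    split_ifs <;> push_cast <;> ring
  have hS : (L : ℂ) * pS x α = esum (Ioc 0 x) (selW x) α - bil x α - E - F - L * P - L ^ 2 * ex α := by
    rw [hT]; ring
  have hn : L * ‖pS x α‖ = ‖(L : ℂ) * pS x α‖ := by
    rw [norm_mul, Complex.norm_real, Real.norm_of_nonneg hL0]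
  rw [hn, hS]
  have n1 : ‖(L : ℂ) * P‖ ≤ L * (2 * √x * L) := by
    rw [norm_mul, Complex.norm_real, Real.norm_of_nonneg hL0]; gcongr
  have n2 : ‖(L : ℂ) ^ 2 * ex α‖ = L ^ 2 := by
    rw [norm_mul, norm_ex, norm_pow, Complex.norm_real, Real.norm_of_nonneg hL0, mul_one]
  have n3 := sq_log_le hx1
  have hs1 : 1 ≤ √(x : ℝ) := Real.one_le_sqrt.2 hx1
  have hs2 : √(x : ℝ) * √x = x := Real.mul_self_sqrt (by positivity)
  have n4 : L * (2 * √x * L) ≤ 32 * x := by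
    calc L * (2 * √x * L) = 2 * √x * L ^ 2 := by ring
      _ ≤ 2 * √x * (16 * √x) := by gcongr
      _ = 32 * x := by linear_combination 32 * hs2
  have n5 : L ^ 2 ≤ 16 * x := by nlinarith
  have m1 := norm_sub_le (esum (Ioc 0 x) (selW x) α - bil x α - E - F - L * P) (L ^ 2 * ex α)
  have m2 := norm_sub_le (esum (Ioc 0 x) (selW x) α - bil x α - E - F) (L * P)
  have m3 := norm_sub_le (esum (Ioc 0 x) (selW x) α - bil x α - E) F
  have m4 := norm_sub_le (esum (Ioc 0 x) (selW x) α - bil x α) E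
  have m5 := norm_sub_le (esum (Ioc 0 x) (selW x) α) (bil x α)
  have : (54 + 12 * C) * x = 54 * x + 12 * C * x := by ring
  linarith

open scoped ArithmeticFunction.vonMangoldt

/-! ### Selberg's weights on the major arcs -/

theorem sum_Ioc_inv_le_log {X x : ℕ} (hX : 1 ≤ X) (hx : X ≤ x) :
    ∑ d ∈ Ioc X x, (1 : ℝ) / d ≤ Real.log ((x : ℝ) / X) := by
  induction x, hx using Nat.le_induction with
  | base => simp [div_self (show (X : ℝ) ≠ 0 by positivity)]
  | succ x hx ih =>
    have hn0 : (0 : ℝ) < X := by exact_mod_cast hX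
    have hx0 : (0 : ℝ) < x := by exact_mod_cast lt_of_lt_of_le hX hx
    rw [sum_Ioc_succ_top (by omega)]
    have : Real.log ((x : ℝ) / X) = Real.log (((x + 1 : ℕ) : ℝ) / X) + Real.log (1 - 1 / (x + 1)) := by
      have h1 : (1 : ℝ) - 1 / (x + 1) = x / (x + 1) := by field_simp; ring
      rw [h1, ← Real.log_mul (by positivity) (by positivity)]
      congr 1; push_cast; field_simp
    have h1 : (0 : ℝ) < 1 - 1 / (x + 1) := by
      rw [sub_pos, div_lt_one (by positivity)]; linarith
    have := Real.log_le_sub_one_of_pos h1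
    push_cast at *
    linarith

theorem sum_Ioc_inv_sqrt_le (X : ℕ) : ∑ d ∈ Ioc 0 X, 1 / √(d : ℝ) ≤ 2 * √(X : ℝ) := by
  induction X with
  | zero => simp
  | succ X ih =>
    rw [sum_Ioc_succ_top (by omega)]
    have h0 : (0 : ℝ) < √((X + 1 : ℕ) : ℝ) := Real.sqrt_pos.2 (by positivity)
    have h1 : √(X : ℝ) ^ 2 = X := Real.sq_sqrt (by positivity)
    have h2 : √((X + 1 : ℕ) : ℝ) ^ 2 = X + 1 := by rw [Real.sq_sqrt (by positivity)]; push_cast; ring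
    have h3 : √(X : ℝ) ≤ √((X + 1 : ℕ) : ℝ) := Real.sqrt_le_sqrt (by push_cast; linarith)
    have : 1 / √((X + 1 : ℕ) : ℝ) ≤ 2 * √((X + 1 : ℕ) : ℝ) - 2 * √(X : ℝ) := by
      rw [div_le_iff₀ h0]
      nlinarith [sq_nonneg (√((X + 1 : ℕ) : ℝ) - √(X : ℝ))]
    linarith

theorem sum_sq_log_div_le {x Z : ℕ} (hZ : 1 ≤ Z) :
    ∑ d ∈ (Ioc 0 (x / (4 * Z ^ 4)) : Finset ℕ), Real.log ((x : ℝ) / d) ^ 2 ≤ 16 * x / Z ^ 2 := by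
  set X := x / (4 * Z ^ 4) with hX
  have hZ0 : (0 : ℝ) < Z := by exact_mod_cast hZ
  have hXx : X ≤ x := Nat.div_le_self _ _
  have h1 : ∀ d ∈ Ioc 0 X, Real.log ((x : ℝ) / d) ^ 2 ≤ 16 * √(x : ℝ) * (1 / √(d : ℝ)) := by
    intro d hd
    rw [mem_Ioc] at hd
    have : (1 : ℝ) ≤ (x : ℝ) / d := by
      rw [le_div_iff₀ (by exact_mod_cast hd.1), one_mul]; exact_mod_cast hd.2.trans hXx
    refine (sq_log_le this).trans (le_of_eq ?_)
    rw [Real.sqrt_div (by positivity)]; ring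
  have h2 : √(X : ℝ) ≤ √(x : ℝ) / (2 * Z ^ 2) := by
    rw [le_div_iff₀ (by positivity)]
    rw [← Real.sqrt_sq (show (0 : ℝ) ≤ 2 * Z ^ 2 by positivity), ← Real.sqrt_mul (by positivity)]
    apply Real.sqrt_le_sqrt
    have : X * (4 * Z ^ 4) ≤ x := Nat.div_mul_le_self _ _
    have h : (X : ℝ) * (4 * Z ^ 4) ≤ x := by exact_mod_cast this
    nlinarith
  calc _ ≤ ∑ d ∈ Ioc 0 X, 16 * √(x : ℝ) * (1 / √(d : ℝ)) := sum_le_sum h1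
    _ = 16 * √(x : ℝ) * ∑ d ∈ Ioc 0 X, (1 / √(d : ℝ)) := by rw [mul_sum]
    _ ≤ 16 * √(x : ℝ) * (2 * (√(x : ℝ) / (2 * Z ^ 2))) := by
        gcongr
        exact (sum_Ioc_inv_sqrt_le X).trans (by gcongr)
    _ = 16 * (√(x : ℝ) * √x) / Z ^ 2 := by field_simp
    _ = _ := by rw [Real.mul_self_sqrt (by positivity)]

theorem sum_sq_log_div_mul_le {x Z : ℕ} (hZ : 1 ≤ Z) (hx : 4 * Z ^ 4 ≤ x) :
    ∑ d ∈ Ioc (x / (4 * Z ^ 4)) x, Real.log ((x : ℝ) / d) ^ 2 * ((x / d : ℕ) : ℝ) ≤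
      64 * (1 + Real.log Z) ^ 3 * x := by
  set X := x / (4 * Z ^ 4) with hX
  have hZ0 : (0 : ℝ) < Z := by exact_mod_cast hZ
  have hX1 : 1 ≤ X := (Nat.one_le_div_iff (by positivity)).2 hx
  have hX0 : (0 : ℝ) < X := by exact_mod_cast hX1
  have hXx : X ≤ x := Nat.div_le_self _ _
  have hlog : Real.log ((x : ℝ) / X) ≤ 4 * (1 + Real.log Z) := by
    have h1 : (x : ℝ) / X ≤ 8 * Z ^ 4 := by
      rw [div_le_iff₀ hX0]
      have : x < (X + 1) * (4 * Z ^ 4) := by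
        have := Nat.lt_mul_div_succ x (show 0 < 4 * Z ^ 4 by positivity)
        rw [← hX] at this; linarith
      have h : (x : ℝ) < (X + 1) * (4 * Z ^ 4) := by exact_mod_cast this
      have : (1 : ℝ) ≤ X := by exact_mod_cast hX1
      nlinarith [show (0 : ℝ) < Z ^ 4 by positivity]
    have hx0 : (0 : ℝ) < x := by exact_mod_cast lt_of_lt_of_le hX1 hXx
    refine (Real.log_le_log (by positivity) h1).trans ?_
    rw [Real.log_mul (by norm_num) (by positivity), Real.log_pow,
      show (8 : ℝ) = 2 ^ 3 by norm_num, Real.log_pow]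
    push_cast
    linarith [Real.log_two_lt_d9]
  have hl0 : 0 ≤ Real.log ((x : ℝ) / X) := log_div_nonneg hX1 hXx
  have hl4 : 0 ≤ 4 * (1 + Real.log Z) := hl0.trans hlog
  calc _ ≤ ∑ d ∈ Ioc X x, (4 * (1 + Real.log Z)) ^ 2 * x * (1 / d) := by
        refine sum_le_sum fun d hd => ?_
        rw [mem_Ioc] at hd
        have hd0 : (0 : ℝ) < d := by exact_mod_cast lt_of_le_of_lt (Nat.zero_le _) hd.1
        have h1 : Real.log ((x : ℝ) / d) ≤ 4 * (1 + Real.log Z) := by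
          refine le_trans ?_ hlog
          have : (0 : ℝ) < x := by exact_mod_cast lt_of_lt_of_le hX1 hXx
          apply Real.log_le_log (by positivity)
          gcongr
          exact_mod_cast hd.1.le
        have h0 : 0 ≤ Real.log ((x : ℝ) / d) := log_div_nonneg (by omega) hd.2
        calc _ ≤ (4 * (1 + Real.log Z)) ^ 2 * ((x : ℝ) / d) := by
              gcongr; exact Nat.cast_div_le
          _ = _ := by ring
    _ = (4 * (1 + Real.log Z)) ^ 2 * x * ∑ d ∈ Ioc X x, (1 : ℝ) / d := by rw [mul_sum]
    _ ≤ (4 * (1 + Real.log Z)) ^ 2 * x * (4 * (1 + Real.log Z)) := by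
        gcongr
        exact (sum_Ioc_inv_le_log hX1 hXx).trans hlog
    _ = _ := by ring

/-- The part of the Selberg sum coming from the small multiples of `q`. -/
noncomputable def selMain (x q X : ℕ) (β : ℝ) : ℂ :=
  ∑ d ∈ Ioc 0 X with q ∣ d, ((ArithmeticFunction.moebius d * Real.log ((x : ℝ) / d) ^ 2 : ℝ) : ℂ) *
    ∑ m ∈ Ioc 0 (x / d), ex (m * (d * β))

theorem esum_selW_eq (x : ℕ) (α : ℝ) : esum (Ioc 0 x) (selW x) α =
    ∑ d ∈ Ioc 0 x, ((ArithmeticFunction.moebius d * Real.log ((x : ℝ) / d) ^ 2 : ℝ) : ℂ) *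
      ∑ m ∈ Ioc 0 (x / d), ex (m * (d * α)) := by
  simp_rw [mul_sum]
  rw [← sum_antidiagonal_eq_sum_sum (fun d m =>
    ((ArithmeticFunction.moebius d * Real.log ((x : ℝ) / d) ^ 2 : ℝ) : ℂ) * ex (m * (d * α)))]
  refine sum_congr rfl fun n _ => ?_
  rw [selW]
  push_cast
  rw [sum_mul]
  refine sum_congr rfl fun d hd => ?_
  rw [Nat.mem_divisorsAntidiagonal] at hd
  rw [← hd.1, show ((d.1 * d.2 : ℕ) : ℝ) * α = d.2 * (d.1 * α) by push_cast; ring]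

theorem abs_moebius_mul_sq_le (d : ℕ) (t : ℝ) :
    ‖((ArithmeticFunction.moebius d * t ^ 2 : ℝ) : ℂ)‖ ≤ t ^ 2 := by
  rw [Complex.norm_real, norm_mul, Real.norm_eq_abs, Real.norm_eq_abs, abs_of_nonneg (sq_nonneg t)]
  have : |(ArithmeticFunction.moebius d : ℝ)| ≤ 1 := by
    exact_mod_cast ArithmeticFunction.abs_moebius_le_one
  nlinarith [sq_nonneg t]

theorem norm_esum_selW_sub_selMain_le {x q Z : ℕ} {a : ℤ} {β : ℝ} (hq : 0 < q) (hqZ : q ≤ Z)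
    (hx : 4 * Z ^ 4 ≤ x) (hβ : x * |β| ≤ Z) (ha : IsCoprime a (q : ℤ)) :
    ‖esum (Ioc 0 x) (selW x) (a / q + β) - selMain x q (x / (4 * Z ^ 4)) β‖ ≤
      80 * (1 + Real.log Z) ^ 3 * x := by
  have hZ : 1 ≤ Z := by omega
  have hZ1 : (1 : ℝ) ≤ Z := by exact_mod_cast hZ
  have hq0 : (0 : ℝ) < q := by exact_mod_cast hq
  have hqZ' : (q : ℝ) ≤ Z := by exact_mod_cast hqZ
  set X := x / (4 * Z ^ 4) with hX
  have hXx : X ≤ x := Nat.div_le_self _ _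
  set c : ℕ → ℂ := fun d => ((ArithmeticFunction.moebius d * Real.log ((x : ℝ) / d) ^ 2 : ℝ) : ℂ)
    with hc
  have hcle : ∀ d, ‖c d‖ ≤ Real.log ((x : ℝ) / d) ^ 2 := fun d => abs_moebius_mul_sq_le d _
  set I : ℕ → ℂ := fun d => ∑ m ∈ Ioc 0 (x / d), ex (m * (d * (a / q + β))) with hI
  have hsplit : esum (Ioc 0 x) (selW x) (a / q + β) =
      ∑ d ∈ Ioc 0 X with q ∣ d, c d * I d + ∑ d ∈ Ioc 0 X with ¬ q ∣ d, c d * I d +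
        ∑ d ∈ Ioc X x, c d * I d := by
    rw [sum_filter_add_sum_filter_not, esum_selW_eq, sum_Ioc_consecutive _ (Nat.zero_le _) hXx]
  have hmain : ∑ d ∈ Ioc 0 X with q ∣ d, c d * I d = selMain x q X β := by
    refine sum_congr rfl fun d hd => ?_
    simp only [mem_filter] at hd
    obtain ⟨e, rfl⟩ := hd.2
    simp only [hc, hI]
    congr 1
    refine sum_congr rfl fun m _ => ?_
    have : (m : ℝ) * (((q * e : ℕ) : ℝ) * (a / q + β)) =
        m * (((q * e : ℕ) : ℝ) * β) + ((m * e * a : ℤ) : ℝ) := by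
      push_cast; field_simp; ring
    rw [this, ex_add_int]
  have h1 : ‖∑ d ∈ Ioc X x, c d * I d‖ ≤ 64 * (1 + Real.log Z) ^ 3 * x := by
    refine le_trans ?_ (sum_sq_log_div_mul_le hZ hx)
    refine (norm_sum_le _ _).trans (sum_le_sum fun d _ => ?_)
    rw [norm_mul]
    gcongr
    · exact hcle d
    · simpa using norm_sum_Ioc_ex_le 0 (x / d) (d * (a / q + β))
  have h2 : ‖∑ d ∈ Ioc 0 X with ¬ q ∣ d, c d * I d‖ ≤ 16 * x := by
    have hI' : ∀ d ∈ Ioc 0 X, ¬ q ∣ d → ‖I d‖ ≤ q := by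
      intro d hd hqd
      rw [mem_Ioc] at hd
      have hXZ : (d : ℝ) * |β| ≤ 1 / (2 * q) := by
        have h3 : (X : ℝ) * (4 * Z ^ 4) ≤ x := by exact_mod_cast Nat.div_mul_le_self _ _
        have h4 : (d : ℝ) ≤ X := by exact_mod_cast hd.2
        have h5 : (d : ℝ) * (4 * Z ^ 4) * |β| ≤ Z := by
          refine le_trans ?_ hβ; gcongr; nlinarith [show (0 : ℝ) < 4 * Z ^ 4 by positivity]
        rw [le_div_iff₀ (by positivity)]
        have h6 : (d : ℝ) * |β| * (4 * Z ^ 3) ≤ 1 := by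
          have : ((d : ℝ) * |β| * (4 * Z ^ 3)) * Z ≤ 1 * Z := by linarith
          exact le_of_mul_le_mul_right this (by linarith)
        have h7 : (2 : ℝ) * q ≤ 4 * Z ^ 3 := by
          have : (Z : ℝ) ≤ Z ^ 3 := by nlinarith [sq_nonneg ((Z : ℝ) - 1)]
          linarith
        refine le_trans ?_ h6
        gcongr
      have hnd : ¬ (q : ℤ) ∣ (d : ℤ) * a := by
        intro h
        have := ha.symm.dvd_of_dvd_mul_right h
        exact hqd (by exact_mod_cast this)
      have h3 := nn_int_div_ge hq hnd
      have h4 : nn (((d * a : ℤ) : ℝ) / q) ≤ nn (d * (a / q + β)) + |d * β| := by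
        have := nn_add_le (d * (a / q + β)) (-(d * β))
        rw [abs_neg] at this
        convert this using 2
        push_cast; ring
      rw [abs_mul, Nat.abs_cast] at h4
      have h5 : 1 / (2 * q) ≤ nn (d * (a / q + β)) := by
        have : (1 : ℝ) / q = 1 / (2 * q) + 1 / (2 * q) := by field_simp; norm_num
        linarith
      have h6 := sum_Ioc_ex_mul_nn_le 0 (x / d) (d * (a / q + β))
      have h7 : ‖I d‖ * (2 * (1 / (2 * q))) ≤ 1 := by
        refine le_trans ?_ h6
        gcongr
      have h8 : 2 * (1 / (2 * (q : ℝ))) = 1 / q := by field_simp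
      rw [h8, mul_one_div, div_le_one hq0] at h7
      exact h7
    calc _ ≤ ∑ d ∈ Ioc 0 X with ¬ q ∣ d, Real.log ((x : ℝ) / d) ^ 2 * q := by
          refine (norm_sum_le _ _).trans (sum_le_sum fun d hd => ?_)
          rw [mem_filter] at hd
          rw [norm_mul]
          gcongr
          · exact hcle d
          · exact hI' d hd.1 hd.2
      _ ≤ ∑ d ∈ Ioc 0 X, Real.log ((x : ℝ) / d) ^ 2 * q :=
          sum_le_sum_of_subset_of_nonneg (filter_subset _ _) fun _ _ _ => by positivity
      _ = (∑ d ∈ Ioc 0 X, Real.log ((x : ℝ) / d) ^ 2) * q := by rw [sum_mul]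
      _ ≤ 16 * x / Z ^ 2 * Z := by gcongr; exact sum_sq_log_div_le hZ
      _ = 16 * x / Z := by field_simp
      _ ≤ 16 * x := div_le_self (by positivity) hZ1
  rw [hsplit, hmain, add_assoc, add_sub_cancel_left]
  refine (norm_add_le _ _).trans ?_
  have h3 : (1 : ℝ) ≤ (1 + Real.log Z) ^ 3 := one_le_pow₀ (by linarith [Real.log_natCast_nonneg Z])
  nlinarith [show (0 : ℝ) ≤ x by positivity]

theorem norm_mul_sum_ex_sub_le {x d : ℕ} (hd : 1 ≤ d) (β : ℝ) :
    ‖(d : ℂ) * ∑ m ∈ Ioc 0 (x / d), ex (m * (d * β)) - ∑ n ∈ Ioc 0 x, ex (n * β)‖ ≤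
      d * (1 + 7 * (x * |β|)) := by
  have hx : x / d * d ≤ x := Nat.div_mul_le_self _ _
  have hblock : ∀ y : ℕ, ∑ n ∈ Ioc 0 (y * d), ex (n * β) =
      ∑ m ∈ Ioc 0 y, ∑ n ∈ Ioc ((m - 1) * d) (m * d), ex (n * β) := by
    intro y
    induction y with
    | zero => simp
    | succ y ih =>
      rw [sum_Ioc_succ_top (by omega), ← ih, Nat.add_sub_cancel,
        sum_Ioc_consecutive _ (by omega) (by gcongr; omega)]
  rw [← sum_Ioc_consecutive _ (Nat.zero_le _) hx, hblock, ← sub_sub, mul_sum, ← sum_sub_distrib]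
  have h1 : ‖∑ n ∈ Ioc (x / d * d) x, ex (n * β)‖ ≤ d := by
    refine (norm_sum_Ioc_ex_le _ _ _).trans ?_
    have := Nat.div_add_mod x d
    have h2 := Nat.mod_lt x (show d > 0 by omega)
    have : x - x / d * d ≤ d := by rw [mul_comm]; omega
    exact_mod_cast this
  have h2 : ‖∑ m ∈ Ioc 0 (x / d), ((d : ℂ) * ex (m * (d * β)) -
      ∑ n ∈ Ioc ((m - 1) * d) (m * d), ex (n * β))‖ ≤ d * (7 * (x * |β|)) := by
    have h3 : ∀ m ∈ Ioc 0 (x / d), ‖(d : ℂ) * ex (m * (d * β)) -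
        ∑ n ∈ Ioc ((m - 1) * d) (m * d), ex (n * β)‖ ≤ d * (7 * (d * |β|)) := by
      intro m hm
      rw [mem_Ioc] at hm
      have hcard : (Ioc ((m - 1) * d) (m * d)).card = d := by
        rw [Nat.card_Ioc, ← Nat.sub_mul]
        have : m - (m - 1) = 1 := by omega
        rw [this, one_mul]
      have : (d : ℂ) * ex (m * (d * β)) = ∑ n ∈ Ioc ((m - 1) * d) (m * d), ex (m * (d * β)) := by
        rw [sum_const, hcard, nsmul_eq_mul]
      rw [this, ← sum_sub_distrib]
      calc _ ≤ ∑ n ∈ Ioc ((m - 1) * d) (m * d), 7 * (d * |β|) := by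
            refine (norm_sum_le _ _).trans (sum_le_sum fun n hn => ?_)
            rw [mem_Ioc] at hn
            refine (norm_ex_sub_ex_le _ _).trans ?_
            rw [show (m : ℝ) * (d * β) - n * β = (((m * d : ℕ) : ℝ) - n) * β by push_cast; ring, abs_mul]
            have h5 : |((m * d : ℕ) : ℝ) - n| ≤ d := by
              rw [← Nat.cast_sub hn.2, Nat.abs_cast]
              have h7 : (m - 1) * d + d = m * d := by
                rw [← Nat.succ_mul]; congr 1; omega
              have : m * d - n ≤ d := by omega
              exact_mod_cast this
            have h6 := Real.pi_lt_d2
            have : (2 * Real.pi) ≤ 7 := by linarith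
            gcongr
        _ = _ := by rw [sum_const, hcard, nsmul_eq_mul]
    calc _ ≤ ∑ m ∈ Ioc 0 (x / d), (d : ℝ) * (7 * (d * |β|)) :=
          (norm_sum_le _ _).trans (sum_le_sum h3)
      _ = d * (7 * (((x / d * d : ℕ) : ℝ) * |β|)) := by
          rw [sum_const, Nat.card_Ioc, nsmul_eq_mul]; push_cast; simp; ring
      _ ≤ _ := by gcongr
  calc _ ≤ d * (7 * (x * |β|)) + d := (norm_sub_le _ _).trans (add_le_add h2 h1)
    _ = _ := by ring

/-- The singular coefficient attached to the Selberg weights. -/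
noncomputable def selCo (x q X : ℕ) : ℝ :=
  ∑ d ∈ Ioc 0 X with q ∣ d, ArithmeticFunction.moebius d * Real.log ((x : ℝ) / d) ^ 2 / d

theorem norm_selMain_sub_le {x q Z : ℕ} {β : ℝ} (hZ : 1 ≤ Z) (hβ : x * |β| ≤ Z) :
    ‖selMain x q (x / (4 * Z ^ 4)) β - (∑ n ∈ Ioc 0 x, ex (n * β)) * selCo x q (x / (4 * Z ^ 4))‖ ≤
      128 * x := by
  set X := x / (4 * Z ^ 4) with hX
  have hZ1 : (1 : ℝ) ≤ Z := by exact_mod_cast hZ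
  unfold selMain selCo
  push_cast
  rw [mul_sum, ← sum_sub_distrib]
  calc _ ≤ ∑ d ∈ Ioc 0 X with q ∣ d, Real.log ((x : ℝ) / d) ^ 2 * (8 * Z) := by
        refine (norm_sum_le _ _).trans (sum_le_sum fun d hd => ?_)
        simp only [mem_filter, mem_Ioc] at hd
        have hd0 : (d : ℂ) ≠ 0 := by exact_mod_cast hd.1.1.ne'
        have hd0' : (0 : ℝ) < d := by exact_mod_cast hd.1.1
        have h1 := norm_mul_sum_ex_sub_le (x := x) hd.1.1 β
        have h2 := abs_moebius_mul_sq_le d (Real.log ((x : ℝ) / d))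
        push_cast at h2
        have h3 : (ArithmeticFunction.moebius d : ℂ) * (Real.log ((x : ℝ) / d) : ℂ) ^ 2 *
            ∑ m ∈ Ioc 0 (x / d), ex (m * (d * β)) - (∑ n ∈ Ioc 0 x, ex (n * β)) *
            ((ArithmeticFunction.moebius d : ℂ) * (Real.log ((x : ℝ) / d) : ℂ) ^ 2 / d) =
            (ArithmeticFunction.moebius d : ℂ) * (Real.log ((x : ℝ) / d) : ℂ) ^ 2 *
            (((d : ℂ) * ∑ m ∈ Ioc 0 (x / d), ex (m * (d * β)) - ∑ n ∈ Ioc 0 x, ex (n * β)) / d) := by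
          generalize ∑ m ∈ Ioc 0 (x / d), ex (m * (d * β)) = A
          generalize ∑ n ∈ Ioc 0 x, ex (n * β) = B
          field_simp
        rw [h3, norm_mul, norm_div, Complex.norm_natCast]
        gcongr
        rw [div_le_iff₀ hd0', mul_comm (8 * (Z : ℝ))]
        refine h1.trans ?_
        gcongr
        linarith
    _ ≤ ∑ d ∈ Ioc 0 X, Real.log ((x : ℝ) / d) ^ 2 * (8 * Z) :=
        sum_le_sum_of_subset_of_nonneg (filter_subset _ _) fun _ _ _ => by positivity
    _ = (∑ d ∈ Ioc 0 X, Real.log ((x : ℝ) / d) ^ 2) * (8 * Z) := by rw [sum_mul]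
    _ ≤ 16 * x / Z ^ 2 * (8 * Z) := by gcongr; exact sum_sq_log_div_le hZ
    _ = 128 * x / Z := by field_simp; ring
    _ ≤ 128 * x := div_le_self (by positivity) hZ1

open scoped ArithmeticFunction.vonMangoldt

theorem sum_lp_dvd_le {q : ℕ} (hq : 0 < q) (x : ℕ) :
    ∑ n ∈ Ioc 0 x, (if n ∣ q then lp n else 0) ≤ Real.log q := by
  rw [← ArithmeticFunction.vonMangoldt_sum, ← sum_filter]
  refine (sum_le_sum_of_subset_of_nonneg (t := q.divisors) ?_ fun n _ _ => lp_nonneg n).trans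
    (sum_le_sum fun n _ => lp_le n)
  intro n hn
  rw [mem_filter] at hn
  exact Nat.mem_divisors.2 ⟨hn.2, hq.ne'⟩

theorem ite_coprime_le (n q : ℕ) : (if n.Coprime q then 0 else Λ n) ≤
    npm n + if n ∣ q then lp n else 0 := by
  have h1 := npm_nonneg n
  have h2 := lp_nonneg n
  have h3 := lp_add_npm n
  by_cases hc : n.Coprime q
  · rw [if_pos hc]; split_ifs <;> linarith
  · rw [if_neg hc]
    by_cases hp : n.Prime
    · have : n ∣ q := by
        by_contra h
        exact hc ((Nat.Prime.coprime_iff_not_dvd hp).2 h)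
      rw [if_pos this]; linarith
    · have : lp n = 0 := by unfold lp; rw [if_neg hp]
      split_ifs <;> linarith

theorem exists_sum_selW_not_coprime_le : ∃ C : ℝ, 0 < C ∧ ∀ x q : ℕ, 1 ≤ q → q ≤ x →
    ∑ n ∈ Ioc 0 x with ¬ n.Coprime q, selW x n ≤ C * x * (1 + Real.log q) := by
  obtain ⟨C, hC, hnpm⟩ := exists_sum_npm_div_le
  refine ⟨96 + 12 * C, by positivity, fun x q hq hqx => ?_⟩
  have hx : 1 ≤ x := hq.trans hqx
  have hx1 : (1 : ℝ) ≤ x := by exact_mod_cast hx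
  set L := Real.log x with hL
  have hL0 : 0 ≤ L := Real.log_natCast_nonneg x
  have hlq0 : 0 ≤ Real.log q := Real.log_natCast_nonneg q
  have hlqL : Real.log q ≤ L := Real.log_le_log (by exact_mod_cast hq) (by exact_mod_cast hqx)
  set f : ℕ → ℝ := fun n => if n.Coprime q then 0 else Λ n with hf
  have hf0 : ∀ n, 0 ≤ f n := fun n => by
    simp only [hf]; split_ifs; exacts [le_rfl, ArithmeticFunction.vonMangoldt_nonneg]
  have h1 : ∑ n ∈ Ioc 0 x, f n ≤ 2 * √x * L + Real.log q := by
    refine (sum_le_sum fun n _ => ite_coprime_le n q).trans ?_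
    rw [sum_add_distrib]
    exact add_le_add (sum_npm_le x hx) (sum_lp_dvd_le hq x)
  have h2 : ∑ n ∈ Ioc 0 x, f n / n ≤ C + Real.log q := by
    have : ∑ n ∈ Ioc 0 x, f n / n ≤ ∑ n ∈ Ioc 0 x, (npm n / n + if n ∣ q then lp n else 0) := by
      refine sum_le_sum fun n hn => ?_
      rw [mem_Ioc] at hn
      have hn1 : (1 : ℝ) ≤ n := by exact_mod_cast hn.1
      refine (div_le_div_of_nonneg_right (ite_coprime_le n q) (by positivity)).trans ?_
      rw [add_div]
      gcongr
      exact div_le_self (by split_ifs; exacts [lp_nonneg n, le_rfl]) hn1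
    rw [sum_add_distrib] at this
    exact this.trans (add_le_add (hnpm _) (sum_lp_dvd_le hq x))
  have h3 : ∑ a ∈ Ioc 0 x, ∑ b ∈ Ioc 0 (x / a), f a * Λ b ≤ 6 * x * (C + Real.log q) :=
    (sum_sum_le_of_le hf0 sum_vonMangoldt_le (by norm_num) _ x).trans (by gcongr)
  have h4 : ∑ n ∈ Ioc 0 x with ¬ n.Coprime q, selW x n ≤ ∑ n ∈ Ioc 0 x, (2 * L * f n +
      ∑ d ∈ n.divisorsAntidiagonal, (f d.1 * Λ d.2 + f d.2 * Λ d.1)) := by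
    rw [sum_filter]
    refine sum_le_sum fun n hn => ?_
    rw [mem_Ioc] at hn
    have hnn : 0 ≤ ∑ d ∈ n.divisorsAntidiagonal, (f d.1 * Λ d.2 + f d.2 * Λ d.1) :=
      sum_nonneg fun d _ => add_nonneg
        (mul_nonneg (hf0 _) ArithmeticFunction.vonMangoldt_nonneg)
        (mul_nonneg (hf0 _) ArithmeticFunction.vonMangoldt_nonneg)
    by_cases hc : n.Coprime q
    · rw [if_neg (not_not.2 hc)]
      have := hf0 n
      positivity
    · have hn1 : n ≠ 1 := by rintro rfl; exact hc (Nat.coprime_one_left q)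
      rw [if_pos hc]
      rw [selW_eq hx hn.1, if_neg hn1]
      have hfn : f n = Λ n := by simp [hf, hc]
      have h5 : Real.log ((x : ℝ) / n) ≤ L := by
        have hn0 : (1 : ℝ) ≤ n := by exact_mod_cast hn.1
        exact Real.log_le_log (by positivity) (div_le_self (by positivity) hn0)
      have h6 : (Λ * Λ : ArithmeticFunction ℝ) n ≤
          ∑ d ∈ n.divisorsAntidiagonal, (f d.1 * Λ d.2 + f d.2 * Λ d.1) := by
        rw [ArithmeticFunction.mul_apply]
        refine sum_le_sum fun d hd => ?_
        rw [Nat.mem_divisorsAntidiagonal] at hd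
        have v1 : 0 ≤ Λ d.1 := ArithmeticFunction.vonMangoldt_nonneg
        have v2 : 0 ≤ Λ d.2 := ArithmeticFunction.vonMangoldt_nonneg
        by_cases c1 : d.1.Coprime q
        · have c2 : ¬ d.2.Coprime q := fun c2 => hc (by rw [← hd.1]; exact c1.mul_left c2)
          have : f d.2 = Λ d.2 := by simp [hf, c2]
          rw [this]
          have := mul_nonneg (hf0 d.1) v2
          linarith [mul_comm (Λ d.1) (Λ d.2)]
        · have : f d.1 = Λ d.1 := by simp [hf, c1]
          rw [this]
          have := mul_nonneg (hf0 d.2) v1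
          linarith
      rw [hfn]
      have v : 0 ≤ Λ n := ArithmeticFunction.vonMangoldt_nonneg
      nlinarith
  rw [sum_add_distrib, ← mul_sum, sum_antidiagonal_eq_sum_sum (fun a b => f a * Λ b + f b * Λ a)]
    at h4
  simp_rw [sum_add_distrib] at h4
  have h5 : ∑ a ∈ Ioc 0 x, ∑ b ∈ Ioc 0 (x / a), f b * Λ a =
      ∑ a ∈ Ioc 0 x, ∑ b ∈ Ioc 0 (x / a), f a * Λ b := sum_sum_comm_hyperbola _ x
  rw [h5] at h4
  have n3 := sq_log_le hx1
  have hs1 : 1 ≤ √(x : ℝ) := Real.one_le_sqrt.2 hx1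
  have hs2 : √(x : ℝ) * √x = x := Real.mul_self_sqrt (by positivity)
  have h6 : 2 * L * ∑ n ∈ Ioc 0 x, f n ≤ 96 * x := by
    calc 2 * L * ∑ n ∈ Ioc 0 x, f n ≤ 2 * L * (2 * √x * L + √x * L) := by
          gcongr
          refine h1.trans ?_
          gcongr
          nlinarith
      _ = 6 * √x * L ^ 2 := by ring
      _ ≤ 6 * √x * (16 * √x) := by gcongr
      _ = 96 * x := by linear_combination 96 * hs2
  have h7 : (0 : ℝ) ≤ x * Real.log q := by positivity
  have h8 : 0 ≤ C * (x * Real.log q) := by positivity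
  nlinarith

theorem exists_norm_esum_selW_le : ∃ C : ℝ, 0 < C ∧ ∀ (x q Z : ℕ) (a : ℤ) (β : ℝ), 0 < q → q ≤ Z →
    4 * Z ^ 4 ≤ x → x * |β| ≤ Z → IsCoprime a (q : ℤ) →
    ‖esum (Ioc 0 x) (selW x) (a / q + β)‖ ≤
      C * (Real.log x * (eul q / q) * ‖∑ n ∈ Ioc 0 x, ex (n * β)‖ + x * (1 + Real.log Z) ^ 3) := by
  obtain ⟨C, hC, hnc⟩ := exists_sum_selW_not_coprime_le
  refine ⟨474 + C, by positivity, fun x q Z a β hq hqZ hx hβ ha => ?_⟩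
  have hZ : 1 ≤ Z := by omega
  have hZx : Z ≤ x := by
    have : Z ^ 1 ≤ Z ^ 4 := Nat.pow_le_pow_right hZ (by norm_num)
    rw [pow_one] at this
    omega
  have hx1 : 1 ≤ x := hZ.trans hZx
  have hx1' : (1 : ℝ) ≤ x := by exact_mod_cast hx1
  have hq0 : (0 : ℝ) < q := by exact_mod_cast hq
  set E := (1 + Real.log Z) ^ 3 with hE
  set L := Real.log x with hL
  have hL0 : 0 ≤ L := Real.log_natCast_nonneg x
  have hlZ : 0 ≤ Real.log Z := Real.log_natCast_nonneg Z
  have hE1 : 1 ≤ E := one_le_pow₀ (by linarith)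
  have hEl : 1 + Real.log q ≤ E := by
    have h1 : Real.log q ≤ Real.log Z := Real.log_le_log hq0 (by exact_mod_cast hqZ)
    have : 1 + Real.log Z ≤ E := le_self_pow₀ (by linarith) (by norm_num)
    linarith
  set X := x / (4 * Z ^ 4) with hX
  have hT := norm_esum_selW_sub_selMain_le hq hqZ hx hβ ha
  have hM := norm_selMain_sub_le (q := q) hZ hβ
  have hβ0 : (x : ℝ) * |(0 : ℝ)| ≤ Z := by simp
  have hM0 := norm_selMain_sub_le (q := q) hZ hβ0
  rw [← hX] at hT hM hM0
  set Co := selCo x q X with hCo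
  set G : ℂ := ∑ n ∈ Ioc 0 x, ex (n * β) with hG
  have hφ : 0 < (q.totient : ℝ) := by exact_mod_cast Nat.totient_pos.2 hq
  have havg : (q.totient : ℝ) * ‖selMain x q X 0‖ ≤
      q.totient * (80 * E * x) + ((12 * L + 58) * x + q.totient * (C * x * E)) := by
    have h1 : (q.totient : ℂ) * selMain x q X 0 =
        ∑ b ∈ cop q, (selMain x q X 0 - esum (Ioc 0 x) (selW x) ((b : ℤ) / q + 0)) +
          ∑ b ∈ cop q, esum (Ioc 0 x) (selW x) ((b : ℤ) / q + 0) := by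
      rw [← sum_add_distrib]
      simp [card_cop]
    have h2 : ‖∑ b ∈ cop q, (selMain x q X 0 - esum (Ioc 0 x) (selW x) ((b : ℤ) / q + 0))‖ ≤
        q.totient * (80 * E * x) := by
      rw [← card_cop, ← nsmul_eq_mul, ← sum_const]
      refine (norm_sum_le _ _).trans (sum_le_sum fun b hb => ?_)
      rw [norm_sub_rev]
      refine norm_esum_selW_sub_selMain_le hq hqZ hx hβ0 ?_
      simp only [cop, mem_filter] at hb
      exact Nat.isCoprime_iff_coprime.2 hb.2
    have h3 : ∑ b ∈ cop q, esum (Ioc 0 x) (selW x) ((b : ℤ) / q + 0) =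
        ∑ n ∈ Ioc 0 x, (selW x n : ℂ) * ram q n := by
      simp only [esum, ram, mul_sum]
      rw [sum_comm]
      simp
    have h4 : ‖∑ n ∈ Ioc 0 x, (selW x n : ℂ) * ram q n‖ ≤
        (12 * L + 58) * x + q.totient * (C * x * E) := by
      have h5 : ∀ n ∈ Ioc 0 x, ‖(selW x n : ℂ) * ram q n‖ ≤
          selW x n + q.totient * (if ¬ n.Coprime q then selW x n else 0) := by
        intro n hn
        rw [mem_Ioc] at hn
        have h6 := selW_nonneg hn.1 hn.2
        rw [norm_mul, Complex.norm_real, Real.norm_of_nonneg h6]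
        by_cases hc : n.Coprime q
        · have := norm_ram_le_one hq hc
          rw [if_neg (not_not.2 hc), mul_zero, add_zero]
          nlinarith
        · have := norm_ram_le q n
          rw [if_pos hc]
          nlinarith
      refine (norm_sum_le _ _).trans ((sum_le_sum h5).trans ?_)
      rw [sum_add_distrib, ← mul_sum, ← sum_filter]
      have h7 := sum_selW_le hx1
      have h8 := hnc x q hq (hqZ.trans hZx)
      have h9 : L ^ 2 ≤ 16 * x := by
        have n3 := sq_log_le hx1'
        have hs1 : 1 ≤ √(x : ℝ) := Real.one_le_sqrt.2 hx1'
        have hs2 : √(x : ℝ) * √x = x := Real.mul_self_sqrt (by positivity)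
        nlinarith
      have h10 : C * x * (1 + Real.log q) ≤ C * x * E := by gcongr
      gcongr
      · linarith
      · exact h8.trans h10
    have h5 : (q.totient : ℝ) * ‖selMain x q X 0‖ = ‖(q.totient : ℂ) * selMain x q X 0‖ := by
      rw [norm_mul, Complex.norm_natCast]
    rw [h5, h1]
    exact (norm_add_le _ _).trans (add_le_add h2 (by rw [h3]; exact h4))
  have hE2 := le_totient_mul_eul q
  have hφ1 : 1 ≤ (q.totient : ℝ) := by exact_mod_cast Nat.totient_pos.2 hq
  have heul : 1 / (q.totient : ℝ) ≤ eul q / q := by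
    rw [div_le_div_iff₀ hφ hq0]; linarith [mul_comm (q.totient : ℝ) (eul q)]
  have hmain0 : ‖selMain x q X 0‖ ≤ ((138 + C) * E + 12 * L * (eul q / q)) * x := by
    have h1 : ‖selMain x q X 0‖ ≤ 80 * E * x + (12 * L * (1 / q.totient) * x + 58 * x) + C * x * E := by
      rw [← mul_le_mul_iff_right₀ hφ]
      refine havg.trans ?_
      have : (q.totient : ℝ) * (1 / q.totient) = 1 := by field_simp
      have h2 : (q.totient : ℝ) * (80 * E * x + (12 * L * (1 / q.totient) * x + 58 * x) + C * x * E) =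
        q.totient * (80 * E * x) + (12 * L * x + q.totient * (58 * x) + q.totient * (C * x * E)) := by
        linear_combination 12 * L * x * this
      rw [h2]
      nlinarith
    refine h1.trans ?_
    have h3 : 12 * L * (1 / q.totient) * x ≤ 12 * L * (eul q / q) * x := by gcongr
    nlinarith
  have hx0 : (0 : ℝ) < x := by linarith
  have hCole : |Co| ≤ (266 + C) * E + 12 * L * (eul q / q) := by
    have h1 : (∑ n ∈ Ioc 0 x, ex (n * 0)) * (Co : ℂ) = ((x * Co : ℝ) : ℂ) := by simp
    rw [h1] at hM0
    have h2 : ‖((x * Co : ℝ) : ℂ)‖ ≤ ‖selMain x q X 0‖ + 128 * x := by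
      have := norm_le_norm_add_norm_sub' ((x * Co : ℝ) : ℂ) (selMain x q X 0)
      rw [norm_sub_rev] at this
      linarith
    rw [Complex.norm_real, Real.norm_eq_abs, abs_mul, Nat.abs_cast] at h2
    rw [← mul_le_mul_iff_right₀ hx0]
    nlinarith
  have hGx : ‖G‖ ≤ x := by simpa using norm_sum_Ioc_ex_le 0 x β
  have h1 : ‖esum (Ioc 0 x) (selW x) (a / q + β)‖ ≤ 80 * E * x + 128 * x + ‖G‖ * |Co| := by
    have e1 := norm_le_norm_add_norm_sub' (esum (Ioc 0 x) (selW x) (a / q + β)) (selMain x q X β)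
    have e2 := norm_le_norm_add_norm_sub' (selMain x q X β) (G * Co)
    rw [norm_mul, Complex.norm_real, Real.norm_eq_abs] at e2
    linarith
  have h2 : ‖G‖ * |Co| ≤ x * ((266 + C) * E) + 12 * (L * (eul q / q) * ‖G‖) := by
    calc ‖G‖ * |Co| ≤ ‖G‖ * ((266 + C) * E + 12 * L * (eul q / q)) := by gcongr
      _ = ‖G‖ * ((266 + C) * E) + 12 * (L * (eul q / q) * ‖G‖) := by ring
      _ ≤ _ := by gcongr
  have h3 : 0 ≤ L * (eul q / q) * ‖G‖ := by
    have := eul_pos q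
    positivity
  have h4 : (474 + C) * (L * (eul q / q) * ‖G‖ + x * E) = 12 * (L * (eul q / q) * ‖G‖) +
      (462 + C) * (L * (eul q / q) * ‖G‖) + (474 + C) * (x * E) := by ring
  have h5 : 0 ≤ (462 + C) * (L * (eul q / q) * ‖G‖) := by positivity
  rw [h4]
  have h6 : (x : ℝ) ≤ x * E := le_mul_of_one_le_right hx0.le hE1
  linarith

theorem sum_norm_pS_sq_eq {q a : ℕ} (hq : 0 < q) (hc : a.Coprime q) (y : ℕ) (θ : ℝ) :
    ((∑ b ∈ range q, ‖pS y (b * (a / q) + θ)‖ ^ 2 : ℝ) : ℂ) =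
      q * ∑ m ∈ Ioc 0 y, ∑ m' ∈ Ioc 0 y with m' ≡ m [MOD q],
        (lp m * lp m' : ℝ) * ex (((m : ℝ) - m') * θ) := by
  have key : ∀ b : ℕ, ((‖pS y (b * (a / q) + θ)‖ ^ 2 : ℝ) : ℂ) =
      ∑ m ∈ Ioc 0 y, ∑ m' ∈ Ioc 0 y, (lp m * lp m' : ℝ) * ex (((m : ℝ) - m') * θ) *
        (ex ((m * a : ℕ) * ((b : ℝ) / q)) * ex (-((m' * a : ℕ) * ((b : ℝ) / q)))) := by
    intro b
    rw [Complex.ofReal_pow, ← Complex.mul_conj', pS, esum, map_sum, sum_mul_sum]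
    refine sum_congr rfl fun m _ => sum_congr rfl fun m' _ => ?_
    rw [map_mul, Complex.conj_ofReal, ← ex_neg]
    have : ex (((m : ℝ) - m') * θ) * (ex ((m * a : ℕ) * ((b : ℝ) / q)) *
        ex (-((m' * a : ℕ) * ((b : ℝ) / q)))) =
        ex (m * (b * (a / q) + θ)) * ex (-(m' * (b * (a / q) + θ))) := by
      rw [← ex_add, ← ex_add, ← ex_add]
      congr 1
      push_cast
      ring
    rw [mul_assoc ((lp m * lp m' : ℝ) : ℂ), this]
    push_cast
    ring
  rw [Complex.ofReal_sum, sum_congr rfl fun b _ => key b, sum_comm, mul_sum]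
  refine sum_congr rfl fun m _ => ?_
  rw [sum_comm, sum_filter, mul_sum]
  refine sum_congr rfl fun m' _ => ?_
  rw [← mul_sum, sum_range_ex_sub hq]
  have hiff : (m * a ≡ m' * a [MOD q]) ↔ (m' ≡ m [MOD q]) := by
    constructor
    · intro h
      exact (Nat.ModEq.cancel_right_of_coprime (by rwa [Nat.coprime_comm] at hc) h).symm
    · intro h
      exact (h.symm).mul_right a
  by_cases h : m' ≡ m [MOD q]
  · rw [if_pos h, if_pos (hiff.2 h)]
    ring
  · rw [if_neg h, if_neg (fun h' => h (hiff.1 h'))]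
    ring

theorem sum_sum_norm_pS_sq_le {q a : ℕ} (hq : 0 < q) (hc : a.Coprime q) (y J : ℕ) (θ : ℕ → ℝ) :
    ∑ j ∈ range J, ∑ b ∈ range q, ‖pS y (b * (a / q) + θ j)‖ ^ 2 ≤
      q * ∑ m ∈ Ioc 0 y, ∑ m' ∈ Ioc 0 y with m' ≡ m [MOD q],
        lp m * lp m' * ‖∑ j ∈ range J, ex (((m : ℝ) - m') * θ j)‖ := by
  have h1 : ((∑ j ∈ range J, ∑ b ∈ range q, ‖pS y (b * (a / q) + θ j)‖ ^ 2 : ℝ) : ℂ) =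
      q * ∑ m ∈ Ioc 0 y, ∑ m' ∈ Ioc 0 y with m' ≡ m [MOD q],
        (lp m * lp m' : ℝ) * ∑ j ∈ range J, ex (((m : ℝ) - m') * θ j) := by
    rw [Complex.ofReal_sum, sum_congr rfl fun j _ => sum_norm_pS_sq_eq hq hc y (θ j), ← mul_sum,
      sum_comm]
    congr 1
    refine sum_congr rfl fun m _ => ?_
    rw [sum_comm]
    exact sum_congr rfl fun m' _ => (mul_sum _ _ _).symm
  have h0 : 0 ≤ ∑ j ∈ range J, ∑ b ∈ range q, ‖pS y (b * (a / q) + θ j)‖ ^ 2 :=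
    sum_nonneg fun j _ => sum_nonneg fun b _ => by positivity
  rw [← abs_of_nonneg h0, ← Real.norm_eq_abs, ← Complex.norm_real, h1, norm_mul, Complex.norm_natCast]
  gcongr
  refine (norm_sum_le _ _).trans (sum_le_sum fun m _ => (norm_sum_le _ _).trans
    (sum_le_sum fun m' _ => ?_))
  rw [norm_mul, Complex.norm_real, Real.norm_of_nonneg (mul_nonneg (lp_nonneg _) (lp_nonneg _))]

theorem sum_lp_modEq_le {x h q : ℕ} (b : ℕ) (hq : 0 < q) (hqh : q ^ 4 ≤ h) (hxh : x + h ≤ h ^ 2) :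
    ∑ p ∈ Ioc x (x + h) with p ≡ b [MOD q], lp p ≤ 3000 * eul q * h / q := by
  refine le_trans (le_of_eq ?_) (brun_titchmarsh b hq hqh hxh)
  rw [sum_filter, sum_filter]
  refine sum_congr rfl fun p _ => ?_
  by_cases hp : p.Prime <;> by_cases hb : p ≡ b [MOD q] <;> simp [hp, hb, lp]

theorem sum_lp_modEq_Ioc_zero_le {y q : ℕ} (b : ℕ) (hq : 0 < q) (hqy : q ^ 4 ≤ y) :
    ∑ p ∈ Ioc 0 y with p ≡ b [MOD q], lp p ≤ 3000 * eul q * y / q := by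
  have h := sum_lp_modEq_le (x := 0) b hq hqy (by rw [zero_add]; exact Nat.le_self_pow two_ne_zero y)
  rwa [zero_add] at h

theorem sum_sum_norm_pS_sq_le_trivial {q a y : ℕ} (hq : 0 < q) (hc : a.Coprime q) (hqy : q ^ 4 ≤ y)
    (J : ℕ) (θ : ℕ → ℝ) :
    ∑ j ∈ range J, ∑ b ∈ range q, ‖pS y (b * (a / q) + θ j)‖ ^ 2 ≤ 6000 * eul q * J * y ^ 2 := by
  have hq' : (0 : ℝ) < q := by exact_mod_cast hq
  refine (sum_sum_norm_pS_sq_le hq hc y J θ).trans ?_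
  have hE := (eul_pos q).le
  have h1 : ∀ m ∈ Ioc 0 y, ∑ m' ∈ Ioc 0 y with m' ≡ m [MOD q],
      lp m * lp m' * ‖∑ j ∈ range J, ex (((m : ℝ) - m') * θ j)‖ ≤
      lp m * (J * (3000 * eul q * y / q)) := by
    intro m _
    refine le_trans (sum_le_sum fun m' _ => mul_le_mul_of_nonneg_left (b := ‖_‖) (c := (J : ℝ)) ?_
      (mul_nonneg (lp_nonneg m) (lp_nonneg m'))) ?_
    · refine (norm_sum_le _ _).trans ?_
      simp [norm_ex]
    · rw [← sum_mul, ← mul_sum]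
      have := mul_le_mul_of_nonneg_left (sum_lp_modEq_Ioc_zero_le m hq hqy)
        (mul_nonneg (lp_nonneg m) (Nat.cast_nonneg (α := ℝ) J))
      linarith
  have h2 := mul_le_mul_of_nonneg_right (sum_lp_le y)
    (show (0 : ℝ) ≤ J * (3000 * eul q * y / q) by positivity)
  calc _ ≤ (q : ℝ) * ∑ m ∈ Ioc 0 y, lp m * (J * (3000 * eul q * y / q)) :=
        mul_le_mul_of_nonneg_left (sum_le_sum h1) hq'.le
    _ ≤ q * (2 * y * (J * (3000 * eul q * y / q))) := by
        rw [← sum_mul]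
        exact mul_le_mul_of_nonneg_left h2 hq'.le
    _ = _ := by field_simp; ring

theorem sum_sum_norm_pS_sq_le_of_spaced {q a y K J : ℕ} {t β s : ℝ} (hq : 0 < q)
    (hc : a.Coprime q) (hK : 0 < K) (hKy : K ^ 2 ≤ y) (hqK : q ^ 4 * K ≤ y) (hs : y * |s| ≤ 1 / 2)
    (hJ : (K : ℝ) ^ 2 ≤ 4 * J * (y * |s|)) :
    ∑ j ∈ range J, ∑ b ∈ range q, ‖pS y (b * (a / q) + (t * β + j * s))‖ ^ 2 ≤
      36000 * eul q * J * y ^ 2 / K := by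
  have hq' : (0 : ℝ) < q := by exact_mod_cast hq
  have hK' : (0 : ℝ) < K := by exact_mod_cast hK
  have hy0 : 0 < y := lt_of_lt_of_le (pow_pos hK 2) hKy
  have hy' : (0 : ℝ) < y := by exact_mod_cast hy0
  have hE := (eul_pos q).le
  have hqy : q ^ 4 ≤ y := le_trans (Nat.le_mul_of_pos_right _ hK) hqK
  have hs0 : 0 < |s| := by
    rcases (abs_nonneg s).lt_or_eq with h | h
    · exact h
    · rw [← h] at hJ
      have : (0 : ℝ) < (K : ℝ) ^ 2 := by positivity
      simp at hJ
      linarith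
  refine (sum_sum_norm_pS_sq_le hq hc y J _).trans ?_
  set g := y / K with hg
  have hgK : g * K ≤ y := Nat.div_mul_le_self y K
  have hgK2 : y < (g + 1) * K := by
    rw [hg, mul_comm]; exact Nat.lt_mul_div_succ y hK
  have hg1 : 1 ≤ g := (Nat.one_le_div_iff hK).2 ((Nat.le_self_pow two_ne_zero K).trans hKy)
  have hgR : (g : ℝ) ≤ y / K := by
    rw [le_div_iff₀ hK']; exact_mod_cast hgK
  have hgR2 : (y : ℝ) / K ≤ g + 1 := by
    rw [div_le_iff₀ hK']; exact_mod_cast hgK2.le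
  have hg1R : (1 : ℝ) ≤ g := by exact_mod_cast hg1
  have hyg : y < (g + 1) ^ 2 := by
    have h1 : y * y < (g + 1) ^ 2 * y := by
      calc y * y < ((g + 1) * K) * ((g + 1) * K) := Nat.mul_lt_mul'' hgK2 hgK2
        _ = (g + 1) ^ 2 * K ^ 2 := by ring
        _ ≤ _ := Nat.mul_le_mul_left _ hKy
    exact Nat.lt_of_mul_lt_mul_right h1
  have hq4 : q ^ 4 ≤ g := (Nat.le_div_iff_mul_le hK).2 hqK
  have hgeo : ∀ m ∈ Ioc 0 y, ∀ m' ∈ Ioc 0 y, ¬ (m ≤ m' + g ∧ m' ≤ m + g) →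
      ‖∑ j ∈ range J, ex (((m : ℝ) - m') * (t * β + j * s))‖ ≤ 2 * J / K := by
    intro m hm m' hm' hmm
    have hm1 : (m : ℝ) ≤ y := by exact_mod_cast (mem_Ioc.1 hm).2
    have hm2 : (m' : ℝ) ≤ y := by exact_mod_cast (mem_Ioc.1 hm').2
    have hm3 : (0 : ℝ) ≤ m := Nat.cast_nonneg m
    have hm4 : (0 : ℝ) ≤ m' := Nat.cast_nonneg m'
    have hlo : (y : ℝ) / K ≤ |(m : ℝ) - m'| := by
      refine hgR2.trans ?_
      rw [not_and_or] at hmm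
      rw [le_abs]
      rcases hmm with h | h
      · left
        have : m' + g + 1 ≤ m := by omega
        have : (m' : ℝ) + g + 1 ≤ m := by exact_mod_cast this
        linarith
      · right
        have : m + g + 1 ≤ m' := by omega
        have : (m : ℝ) + g + 1 ≤ m' := by exact_mod_cast this
        linarith
    have hhi : |(m : ℝ) - m'| ≤ y := abs_le.2 ⟨by linarith, by linarith⟩
    have hsplit : ∑ j ∈ range J, ex (((m : ℝ) - m') * (t * β + j * s)) =
        ex (((m : ℝ) - m') * (t * β)) * ∑ j ∈ range J, ex (j * (((m : ℝ) - m') * s)) := by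
      rw [mul_sum]
      refine sum_congr rfl fun j _ => ?_
      rw [← ex_add]
      congr 1
      ring
    rw [hsplit, norm_mul, norm_ex, one_mul]
    have habs : |((m : ℝ) - m') * s| = |(m : ℝ) - m'| * |s| := abs_mul _ _
    have hnn : nn (((m : ℝ) - m') * s) = |(m : ℝ) - m'| * |s| := by
      rw [nn_of_abs_le_half, habs]
      rw [habs]
      exact (mul_le_mul_of_nonneg_right hhi hs0.le).trans hs
    have h1 := sum_range_ex_mul_nn_le J (((m : ℝ) - m') * s)
    rw [hnn] at h1
    set A := ‖∑ j ∈ range J, ex (j * (((m : ℝ) - m') * s))‖ with hA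
    have hA0 : 0 ≤ A := norm_nonneg _
    have h2 : A * (2 * (y / K * |s|)) ≤ 1 :=
      le_trans (by gcongr) h1
    rw [le_div_iff₀ hK']
    have h3 : A * (2 * (y * |s|)) ≤ K := by
      have h4 : A * (2 * (y * |s|)) = A * (2 * (y / K * |s|)) * K := by field_simp
      rw [h4]
      nlinarith
    have hys : 0 < y * |s| := by positivity
    have h5 : A * K * K ≤ 2 * J * K := by nlinarith
    exact le_of_mul_le_mul_right h5 hK'
  have hnear : ∀ m ∈ Ioc 0 y, ∑ m' ∈ Ioc 0 y with m' ≡ m [MOD q] ∧ (m ≤ m' + g ∧ m' ≤ m + g),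
      lp m' ≤ 12000 * eul q * y / (K * q) := by
    intro m hm
    have hmy := (mem_Ioc.1 hm).2
    have h1 := sum_lp_modEq_le (x := m - g - 1) (h := 2 * g + 2) m hq (by omega) (by
      have : (2 * g + 2) ^ 2 = 4 * (g + 1) ^ 2 := by ring
      rw [this]
      have : (g + 1) ≤ (g + 1) ^ 2 := Nat.le_self_pow two_ne_zero _
      omega)
    refine le_trans (sum_le_sum_of_subset_of_nonneg ?_ fun _ _ _ => lp_nonneg _) (h1.trans ?_)
    · intro m' hm'
      simp only [mem_filter, mem_Ioc] at hm' ⊢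
      refine ⟨by omega, hm'.2.1⟩
    · rw [div_le_div_iff₀ hq' (by positivity)]
      push_cast
      have h3 : (2 * (g : ℝ) + 2) * K ≤ 4 * y := by
        have : (g : ℝ) * K ≤ y := by exact_mod_cast hgK
        nlinarith
      calc 3000 * eul q * (2 * (g : ℝ) + 2) * (K * q) = 3000 * eul q * q * ((2 * (g : ℝ) + 2) * K) := by
            ring
        _ ≤ 3000 * eul q * q * (4 * y) := by gcongr
        _ = _ := by ring
  have hall : ∀ m ∈ Ioc 0 y, ∑ m' ∈ Ioc 0 y with m' ≡ m [MOD q],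
      lp m * lp m' * ‖∑ j ∈ range J, ex (((m : ℝ) - m') * (t * β + j * s))‖ ≤
      lp m * (J * (18000 * eul q * y / (K * q))) := by
    intro m hm
    have h1 : ∀ m' ∈ ({m' ∈ Ioc 0 y | m' ≡ m [MOD q]} : Finset ℕ),
        lp m * lp m' * ‖∑ j ∈ range J, ex (((m : ℝ) - m') * (t * β + j * s))‖ ≤
        lp m * (J * (if m ≤ m' + g ∧ m' ≤ m + g then lp m' else 0) + 2 * J / K * lp m') := by
      intro m' hm'
      rw [mul_assoc]
      refine mul_le_mul_of_nonneg_left ?_ (lp_nonneg m)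
      have hl := lp_nonneg m'
      have hJK : (0 : ℝ) ≤ 2 * J / K := by positivity
      by_cases hmm : m ≤ m' + g ∧ m' ≤ m + g
      · rw [if_pos hmm]
        have : ‖∑ j ∈ range J, ex (((m : ℝ) - m') * (t * β + j * s))‖ ≤ J := by
          refine (norm_sum_le _ _).trans ?_
          simp [norm_ex]
        nlinarith
      · rw [if_neg hmm]
        have := hgeo m hm m' (mem_filter.1 hm').1 hmm
        nlinarith
    refine (sum_le_sum h1).trans ?_
    rw [← mul_sum]
    refine mul_le_mul_of_nonneg_left ?_ (lp_nonneg m)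
    rw [sum_add_distrib, ← mul_sum, ← mul_sum, ← sum_filter, filter_filter]
    have h2 := hnear m hm
    have h3 := sum_lp_modEq_Ioc_zero_le m hq hqy
    calc _ ≤ (J : ℝ) * (12000 * eul q * y / (K * q)) + 2 * J / K * (3000 * eul q * y / q) := by
          gcongr
      _ = _ := by field_simp; ring
  have h2 := mul_le_mul_of_nonneg_right (sum_lp_le y)
    (show (0 : ℝ) ≤ J * (18000 * eul q * y / (K * q)) by positivity)
  calc _ ≤ (q : ℝ) * ∑ m ∈ Ioc 0 y, lp m * (J * (18000 * eul q * y / (K * q))) :=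
        mul_le_mul_of_nonneg_left (sum_le_sum hall) hq'.le
    _ ≤ q * (2 * y * (J * (18000 * eul q * y / (K * q)))) := by
        rw [← sum_mul]
        exact mul_le_mul_of_nonneg_left h2 hq'.le
    _ = _ := by field_simp; ring

theorem sum_Ioc_windows (f : ℕ → ℝ) (D h J : ℕ) :
    ∑ d ∈ Ioc D (D + J * h), f d =
      ∑ j ∈ range J, ∑ d ∈ Ioc (D + j * h) (D + j * h + h), f d := by
  induction J with
  | zero => simp
  | succ J ih =>
    rw [sum_range_succ, ← ih, sum_Ioc_consecutive _ (by omega) (by omega)]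
    congr 2
    ring

theorem sum_eq_sum_classes {q : ℕ} (hq : 0 < q) (s : Finset ℕ) (f : ℕ → ℝ) :
    ∑ d ∈ s, f d = ∑ b ∈ range q, ∑ d ∈ s with d ≡ b [MOD q], f d := by
  rw [← sum_fiberwise_of_maps_to (g := fun d => d % q) (t := range q)
    (fun d _ => mem_range.2 (Nat.mod_lt d hq))]
  refine sum_congr rfl fun b hb => sum_congr ?_ fun _ _ => rfl
  ext d
  simp only [mem_filter, Nat.ModEq, Nat.mod_eq_of_lt (mem_range.1 hb)]

theorem norm_pS_sub_le {q d b y a : ℕ} {β t w : ℝ} (hq : 0 < q) (hd : d ≡ b [MOD q])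
    (hw : |(d : ℝ) * β - t| ≤ w) :
    ‖pS y (d * (a / q + β))‖ ≤ ‖pS y (b * (a / q) + t)‖ + 13 * y * (w * y) := by
  have hw0 : 0 ≤ w := (abs_nonneg _).trans hw
  have h1 : ‖pS y (d * (a / q + β)) - pS y (b * (a / q) + t)‖ ≤ 13 * y * (w * y) := by
    unfold pS esum
    rw [← sum_sub_distrib]
    have h2 : ∀ n ∈ Ioc 0 y, ‖(lp n : ℂ) * ex (n * (d * (a / q + β))) -
        (lp n : ℂ) * ex (n * (b * (a / q) + t))‖ ≤ lp n * (6.5 * (w * y)) := by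
      intro n hn
      have hn' : (n : ℝ) ≤ y := by exact_mod_cast (mem_Ioc.1 hn).2
      have e1 : ex (n * (d * ((a : ℝ) / q + β))) = ex ((n * d : ℕ) * ((a : ℝ) / q)) * ex (n * (d * β)) := by
        rw [← ex_add]; congr 1; push_cast; ring
      have e2 : ex (n * (b * ((a : ℝ) / q) + t)) = ex ((n * b : ℕ) * ((a : ℝ) / q)) * ex (n * t) := by
        rw [← ex_add]; congr 1; push_cast; ring
      rw [e1, e2, ex_mul_div_congr hq (hd.mul_left n) a, ← mul_sub, ← mul_sub, norm_mul, norm_mul,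
        norm_ex, one_mul, Complex.norm_real, Real.norm_of_nonneg (lp_nonneg n)]
      refine mul_le_mul_of_nonneg_left ((norm_ex_sub_ex_le _ _).trans ?_) (lp_nonneg n)
      rw [← mul_sub, abs_mul, Nat.abs_cast]
      have hpi := Real.pi_lt_d2
      have hpi0 := Real.pi_pos
      calc 2 * Real.pi * (n * |(d : ℝ) * β - t|) ≤ 2 * 3.15 * (y * w) := by gcongr
        _ ≤ _ := by nlinarith [mul_nonneg hw0 (Nat.cast_nonneg (α := ℝ) y)]
    refine (norm_sum_le _ _).trans ((sum_le_sum h2).trans ?_)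
    rw [← sum_mul]
    calc _ ≤ 2 * (y : ℝ) * (6.5 * (w * y)) := by
          exact mul_le_mul_of_nonneg_right (sum_lp_le y) (by positivity)
      _ = _ := by ring
  have := norm_le_norm_add_norm_sub' (pS y (d * (a / q + β))) (pS y (b * (a / q) + t))
  linarith

theorem sum_lp_mul_norm_pS_le {q a D h J y : ℕ} {β ω κ : ℝ} (hq : 0 < q)
    (hqh : q ^ 4 ≤ h) (hDh : D + J * h ≤ h ^ 2) (hω : 0 ≤ ω)
    (hB : ∑ j ∈ range J, ∑ b ∈ range q, ‖pS y (b * (a / q) + (D * β + j * (h * β)))‖ ^ 2 ≤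
      36000 * eul q * J * y ^ 2 * κ)
    (hκ : eul q ^ 3 * κ ≤ ω ^ 2 * q) :
    ∑ d ∈ Ioc D (D + J * h), lp d * ‖pS y (d * (a / q + β))‖ ≤
      J * h * y * (570000 * ω + 39000 * (h * |β| * y)) := by
  have hq' : (0 : ℝ) < q := by exact_mod_cast hq
  have hE := (eul_pos q).le
  have h1 : ∀ j ∈ range J, ∑ d ∈ Ioc (D + j * h) (D + j * h + h), lp d * ‖pS y (d * (a / q + β))‖ ≤
      (3000 * eul q * h / q) * ∑ b ∈ range q, ‖pS y (b * (a / q) + (D * β + j * (h * β)))‖ +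
      3000 * h * (13 * y * (h * |β| * y)) := by
    intro j hj
    have hj' : (j + 1) * h ≤ J * h := Nat.mul_le_mul_right _ (mem_range.1 hj)
    have hle : D + j * h + h ≤ h ^ 2 := by nlinarith
    have hpt : ∀ b ∈ range q, ∀ d ∈ ({d ∈ Ioc (D + j * h) (D + j * h + h) | d ≡ b [MOD q]} : Finset ℕ),
        lp d * ‖pS y (d * (a / q + β))‖ ≤
        lp d * ‖pS y (b * (a / q) + (D * β + j * (h * β)))‖ + lp d * (13 * y * (h * |β| * y)) := by
      intro b _ d hd
      obtain ⟨hd1, hd2⟩ := mem_filter.1 hd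
      obtain ⟨hd3, hd4⟩ := mem_Ioc.1 hd1
      rw [← mul_add]
      refine mul_le_mul_of_nonneg_left (norm_pS_sub_le hq hd2 ?_) (lp_nonneg d)
      have e : (d : ℝ) * β - (D * β + j * (h * β)) = (d - (D + j * h)) * β := by ring
      rw [e, abs_mul]
      refine mul_le_mul_of_nonneg_right ?_ (abs_nonneg β)
      have h3 : ((D : ℝ) + j * h) ≤ d := by exact_mod_cast hd3.le
      have h4 : (d : ℝ) ≤ D + j * h + h := by exact_mod_cast hd4
      rw [abs_of_nonneg (by linarith)]
      linarith
    rw [sum_eq_sum_classes hq]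
    refine (sum_le_sum fun b hb => sum_le_sum (hpt b hb)).trans ?_
    simp only [sum_add_distrib]
    refine add_le_add ?_ ?_
    · rw [mul_sum]
      refine sum_le_sum fun b _ => ?_
      rw [← sum_mul]
      exact mul_le_mul_of_nonneg_right (sum_lp_modEq_le b hq hqh hle) (norm_nonneg _)
    · rw [← sum_eq_sum_classes hq, ← sum_mul]
      have h5 := sum_lp_modEq_le (x := D + j * h) (h := h) (q := 1) 0 one_pos (by
        rw [one_pow]; exact le_trans (Nat.one_le_pow _ _ hq) hqh) hle
      have h6 : eul 1 = 1 := le_antisymm (by simp [eul]) (one_le_eul 1)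
      rw [h6] at h5
      have h7 : ∑ p ∈ Ioc (D + j * h) (D + j * h + h), lp p ≤ 3000 * h := by
        have : ∀ p, p ≡ 0 [MOD 1] := fun p => Nat.modEq_one
        simpa [this] using h5
      exact mul_le_mul_of_nonneg_right h7 (by positivity)
  rw [sum_Ioc_windows]
  refine (sum_le_sum h1).trans ?_
  rw [sum_add_distrib, ← mul_sum, sum_const, card_range, nsmul_eq_mul]
  set Y := ∑ j ∈ range J, ∑ b ∈ range q, ‖pS y (b * (a / q) + (D * β + j * (h * β)))‖ with hY
  have hY0 : 0 ≤ Y := sum_nonneg fun _ _ => sum_nonneg fun _ _ => norm_nonneg _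
  have hcs : Y ^ 2 ≤ (J * q) * (36000 * eul q * J * y ^ 2 * κ) := by
    rw [hY, ← sum_product' (range J) (range q)
      (fun j b => ‖pS y (b * (a / q) + (D * β + j * (h * β)))‖)]
    refine (sq_sum_le_card_mul_sum_sq).trans ?_
    rw [sum_product, card_product, card_range, card_range]
    push_cast
    exact mul_le_mul_of_nonneg_left hB (by positivity)
  have hfin : 3000 * eul q * h / q * Y ≤ J * h * y * (570000 * ω) := by
    refine le_of_sq_le_sq ?_ (by positivity)
    calc (3000 * eul q * h / q * Y) ^ 2 = (3000 * eul q * h / q) ^ 2 * Y ^ 2 := by ring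
      _ ≤ (3000 * eul q * h / q) ^ 2 * ((J * q) * (36000 * eul q * J * y ^ 2 * κ)) := by gcongr
      _ = (3000 ^ 2 * 36000) * (h * J * y) ^ 2 * (eul q ^ 3 * κ) / q := by field_simp
      _ ≤ (3000 ^ 2 * 36000) * (h * J * y) ^ 2 * (ω ^ 2 * q) / q := by gcongr
      _ = (3000 ^ 2 * 36000) * (h * J * y * ω) ^ 2 := by field_simp
      _ ≤ 570000 ^ 2 * (h * J * y * ω) ^ 2 := by
        refine mul_le_mul_of_nonneg_right ?_ (by positivity)
        norm_num
      _ = _ := by ring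
  calc _ ≤ J * h * y * (570000 * ω) + J * (3000 * h * (13 * y * (h * |β| * y))) := by linarith
    _ = _ := by ring

theorem lt_div_add_one_sq {y K : ℕ} (hK : 0 < K) (hKy : K ^ 2 ≤ y) : y < (y / K + 1) ^ 2 := by
  have hgK2 : y < (y / K + 1) * K := by
    rw [mul_comm]; exact Nat.lt_mul_div_succ y hK
  have h1 : y * y < (y / K + 1) ^ 2 * y := by
    calc y * y < ((y / K + 1) * K) * ((y / K + 1) * K) := Nat.mul_lt_mul'' hgK2 hgK2
      _ = (y / K + 1) ^ 2 * K ^ 2 := by ring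
      _ ≤ _ := Nat.mul_le_mul_left _ hKy
  exact Nat.lt_of_mul_lt_mul_right h1

theorem norm_pS_le_add {y y' w : ℕ} (h1 : y ≤ y') (h2 : y' ≤ y + w) (hw : 1 ≤ w)
    (h3 : y + w ≤ w ^ 2) (α : ℝ) : ‖pS y α‖ ≤ ‖pS y' α‖ + 3000 * w := by
  have h4 : pS y' α - pS y α = esum (Ioc y y') lp α := by
    unfold pS esum
    rw [← sum_Ioc_consecutive _ (Nat.zero_le y) h1]
    ring
  have h5 : ‖esum (Ioc y y') lp α‖ ≤ 3000 * w := by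
    refine (norm_esum_le _ _ _).trans ?_
    have h6 : eul 1 = 1 := le_antisymm (by simp [eul]) (one_le_eul 1)
    have h7 := sum_lp_modEq_le (x := y) (h := w) (q := 1) 0 one_pos (by simpa using hw) h3
    have h8 : ∀ p, p ≡ 0 [MOD 1] := fun p => Nat.modEq_one
    simp only [h8, filter_true, h6] at h7
    refine le_trans (sum_le_sum_of_subset_of_nonneg (Ioc_subset_Ioc_right h2)
      fun _ _ _ => abs_nonneg _) ?_
    rw [sum_congr rfl fun n _ => abs_of_nonneg (lp_nonneg n)]
    simpa using h7
  have h6 := norm_sub_norm_le (pS y α) (pS y' α)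
  rw [norm_sub_rev, h4] at h6
  linarith

theorem sum_norm_pS_sq_unified {q a y K J : ℕ} {t β s κ : ℝ} (hq : 0 < q)
    (hc : a.Coprime q) (hK : 0 < K) (hqK : q ^ 4 * K ^ 2 ≤ y) (hs : y * |s| ≤ 1 / 2)
    (hκ : κ = 1 ∨ κ = 1 / K ∧ (K : ℝ) ^ 2 ≤ 4 * J * (y * |s|)) :
    ∑ j ∈ range J, ∑ b ∈ range q, ‖pS y (b * (a / q) + (t * β + j * s))‖ ^ 2 ≤
      36000 * eul q * J * y ^ 2 * κ := by
  have hE := (eul_pos q).le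
  have hq4 : 1 ≤ q ^ 4 := Nat.one_le_pow _ _ hq
  have hKK : K ≤ K ^ 2 := Nat.le_self_pow two_ne_zero K
  have hqq : q ^ 4 * K ≤ y := le_trans (Nat.mul_le_mul_left _ hKK) hqK
  rcases hκ with rfl | ⟨rfl, h⟩
  · refine (sum_sum_norm_pS_sq_le_trivial hq hc (le_trans (Nat.le_mul_of_pos_right _ hK) hqq) J
      fun j => t * β + j * s).trans ?_
    have : 0 ≤ eul q * J * y ^ 2 := by positivity
    nlinarith
  · refine (sum_sum_norm_pS_sq_le_of_spaced hq hc hK (by nlinarith) hqq hs h).trans (le_of_eq ?_)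
    ring

theorem sum_block_le {x q a K J h D : ℕ} {β ω κ : ℝ} (hq : 0 < q) (hc : a.Coprime q)
    (hK : 0 < K) (hJ : 0 < J) (hqh : q ^ 4 ≤ h) (hD : D = K * (J * h)) (hKJ : 2 * (K * J) ≤ h)
    (hx : 2 * D * (q ^ 4 * K ^ 2 + 1) ≤ x) (hβ : 2 * (x * |β|) ≤ J) (hω : 0 ≤ ω)
    (hκ : eul q ^ 3 * κ ≤ ω ^ 2 * q) (hκ2 : κ = 1 ∨ κ = 1 / K ∧ (K : ℝ) ^ 3 ≤ x * |β|) :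
    ∑ d ∈ Ioc D (2 * D), lp d * ‖pS (x / d) (d * (a / q + β))‖ ≤
      x * (570000 * ω + 60000 / K) := by
  have hq1 : 1 ≤ q ^ 4 := Nat.one_le_pow _ _ hq
  have hh : 0 < h := lt_of_lt_of_le (Nat.pos_of_ne_zero (by positivity)) hqh
  have hD0 : 0 < D := by rw [hD]; positivity
  have hDR : (0 : ℝ) < D := by exact_mod_cast hD0
  have hKR : (0 : ℝ) < K := by exact_mod_cast hK
  have hJR : (0 : ℝ) < J := by exact_mod_cast hJ
  have hhR : (0 : ℝ) < h := by exact_mod_cast hh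
  have hDeq : (D : ℝ) = K * (J * h) := by rw [hD]; push_cast; ring
  have hx0 : (0 : ℝ) ≤ x := Nat.cast_nonneg x
  have hE := (eul_pos q).le
  set w := x / D / K + 2 with hw
  have hxD : q ^ 4 * K ^ 2 + 1 ≤ x / (2 * D) := by
    rw [Nat.le_div_iff_mul_le (by omega)]; linarith
  have hKxD : K ^ 2 ≤ x / D := by
    have h1 : x / (2 * D) ≤ x / D := Nat.div_le_div_left (by omega) hD0
    nlinarith
  have hwR : (w : ℝ) ≤ 3 * (x / D / K) := by
    have h1 : 1 ≤ x / D / K := (Nat.one_le_div_iff hK).2 ((Nat.le_self_pow two_ne_zero K).trans hKxD)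
    have h2 : w ≤ 3 * (x / D / K) := by omega
    have h3 : ((x / D / K : ℕ) : ℝ) ≤ x / D / K := by
      refine Nat.cast_div_le.trans ?_
      gcongr
      exact Nat.cast_div_le
    calc (w : ℝ) ≤ ((3 * (x / D / K) : ℕ) : ℝ) := by exact_mod_cast h2
      _ ≤ _ := by push_cast; linarith
  have hk : ∀ k ∈ range K,
      ∑ d ∈ Ioc (D + k * (J * h)) (D + k * (J * h) + J * h), lp d * ‖pS (x / d) (d * (a / q + β))‖ ≤
      J * h * (x / D) * (570000 * ω + 19500 / K) +
      9000 * (x / D / K) * ∑ d ∈ Ioc (D + k * (J * h)) (D + k * (J * h) + J * h), lp d := by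
    intro k hk
    set D' := D + k * (J * h) with hD'
    have hD'2 : D' + J * h ≤ 2 * D := by
      have : (k + 1) * (J * h) ≤ K * (J * h) := Nat.mul_le_mul_right _ (mem_range.1 hk)
      rw [← hD] at this
      rw [hD']
      linarith
    have hD'1 : D ≤ D' := Nat.le_add_right _ _
    set y := x / D' with hy
    have hyR : (y : ℝ) ≤ x / D := by
      refine Nat.cast_div_le.trans ?_
      gcongr
    have hylow : q ^ 4 * K ^ 2 + 1 ≤ y := hxD.trans (Nat.div_le_div_left (by omega) (by omega))
    have hylowR : (x : ℝ) / (4 * D) ≤ y := by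
      have h1 : x < (y + 1) * D' := by
        rw [hy, mul_comm]; exact Nat.lt_mul_div_succ x (by omega)
      have h2 : x < (y + 1) * (2 * D) := lt_of_lt_of_le h1 (Nat.mul_le_mul_left _ (by omega))
      have h3 : (y + 1) ≤ 2 * y := by nlinarith
      rw [div_le_iff₀ (by positivity)]
      have h4 : x ≤ y * (4 * D) := by
        calc x ≤ (y + 1) * (2 * D) := h2.le
          _ ≤ 2 * y * (2 * D) := Nat.mul_le_mul_right _ h3
          _ = _ := by ring
      exact_mod_cast h4
    have hβ0 : (x : ℝ) / D * (h * |β|) = x * |β| / (K * J) := by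
      rw [hDeq]; field_simp
    have hhy : h * |β| * y ≤ 1 / (2 * K) := by
      calc h * |β| * y ≤ h * |β| * (x / D) := by gcongr
        _ = x * |β| / (K * J) := by rw [← hβ0]; ring
        _ ≤ _ := by
          rw [div_le_div_iff₀ (by positivity) (by positivity)]
          nlinarith
    have hB : ∑ j ∈ range J, ∑ b ∈ range q, ‖pS y (b * (a / q) + (D' * β + j * (h * β)))‖ ^ 2 ≤
        36000 * eul q * J * y ^ 2 * κ := by
      refine sum_norm_pS_sq_unified hq hc hK (by omega) ?_ ?_
      · rw [abs_mul, Nat.abs_cast, mul_comm]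
        refine hhy.trans ?_
        rw [div_le_div_iff₀ (by positivity) (by positivity)]
        have : (1 : ℝ) ≤ K := by exact_mod_cast hK
        linarith
      · refine hκ2.imp id fun hV => ⟨hV.1, ?_⟩
        rw [abs_mul, Nat.abs_cast]
        have h1 : (K : ℝ) ^ 2 ≤ x * |β| / K := by
          rw [le_div_iff₀ hKR]
          calc (K : ℝ) ^ 2 * K = K ^ 3 := by ring
            _ ≤ _ := hV.2
        calc (K : ℝ) ^ 2 ≤ x * |β| / K := h1
          _ = 4 * J * (x / (4 * D) * (h * |β|)) := by rw [hDeq]; field_simp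
          _ ≤ _ := by gcongr
    have hA := sum_lp_mul_norm_pS_le (D := D') (h := h) (J := J) hq hqh (by
      have : 2 * D = 2 * (K * J) * h := by rw [hD]; ring
      have h1 : 2 * (K * J) * h ≤ h * h := Nat.mul_le_mul_right _ hKJ
      rw [sq]
      omega) hω hB hκ
    have hpt : ∀ d ∈ Ioc D' (D' + J * h), lp d * ‖pS (x / d) (d * (a / q + β))‖ ≤
        lp d * ‖pS y (d * (a / q + β))‖ + 9000 * (x / D / K) * lp d := by
      intro d hd
      obtain ⟨hd1, hd2⟩ := mem_Ioc.1 hd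
      have hd0 : 0 < d := by omega
      have hyd : y ≤ x / d + w := by
        have hD'R : (0 : ℝ) < D' := by exact_mod_cast (by omega : 0 < D')
        have hdR : (0 : ℝ) < d := by exact_mod_cast hd0
        have a1 : (y : ℝ) ≤ x / D' := Nat.cast_div_le
        have a2 : (x : ℝ) / d < (x / d : ℕ) + 1 := by
          rw [div_lt_iff₀ hdR]
          have := Nat.lt_mul_div_succ x hd0
          rw [mul_comm] at this
          exact_mod_cast this
        have a3 : (x : ℝ) / (D * K) < (x / D / K : ℕ) + 1 := by
          rw [Nat.div_div_eq_div_mul, div_lt_iff₀ (by positivity)]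
          have := Nat.lt_mul_div_succ x (Nat.mul_pos hD0 hK)
          rw [mul_comm] at this
          exact_mod_cast this
        have a4 : (x : ℝ) / D' ≤ x / d + x / (D * K) := by
          have b1 : (d : ℝ) - D' ≤ J * h := by
            have : (d : ℝ) ≤ D' + J * h := by exact_mod_cast hd2
            linarith
          have b2 : (x : ℝ) / D' - x / d = x * (d - D') / (D' * d) := by field_simp
          have b3 : (D : ℝ) ≤ D' := by exact_mod_cast hD'1
          have b4 : (D : ℝ) ≤ d := b3.trans (by exact_mod_cast hd1.le)
          have b5 : (x : ℝ) * (d - D') / (D' * d) ≤ x * (J * h) / (D * D) := by gcongr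
          have b6 : (x : ℝ) * (J * h) / (D * D) = x / (D * K) := by
            rw [div_eq_div_iff (by positivity) (by positivity)]
            nth_rewrite 2 [hDeq]
            ring
          linarith
        have a5 : (y : ℝ) < ((x / d + w : ℕ) : ℝ) := by
          rw [hw]
          push_cast at *
          linarith
        exact le_of_lt (by exact_mod_cast a5)
      have h1 := norm_pS_le_add (y := x / d) (y' := y) (w := w)
        (Nat.div_le_div_left hd1.le (by omega)) hyd (by rw [hw]; exact Nat.succ_le_succ (Nat.zero_le _)) (by
          have b1 : x / d ≤ x / D := Nat.div_le_div_left (by omega) hD0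
          have b2 := lt_div_add_one_sq hK hKxD
          have b3 : w ^ 2 = (x / D / K + 1) ^ 2 + 2 * (x / D / K) + 3 := by rw [hw]; ring
          rw [b3]
          omega) (d * (a / q + β))
      have h2 := lp_nonneg d
      nlinarith
    refine (sum_le_sum hpt).trans ?_
    rw [sum_add_distrib, ← mul_sum]
    refine add_le_add (hA.trans ?_) le_rfl
    have h3 : 39000 * (h * |β| * y) ≤ 19500 / K := by
      calc 39000 * (h * |β| * y) ≤ 39000 * (1 / (2 * K)) := by gcongr
        _ = _ := by field_simp; norm_num
    gcongr
  have e : Ioc D (2 * D) = Ioc D (D + K * (J * h)) := by rw [← hD, two_mul]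
  have htot : ∑ d ∈ Ioc D (2 * D), lp d ≤ 4 * D := by
    refine (sum_le_sum_of_subset_of_nonneg (Ioc_subset_Ioc_left (Nat.zero_le D))
      fun _ _ _ => lp_nonneg _).trans ((sum_lp_le _).trans (le_of_eq ?_))
    push_cast; ring
  rw [e] at htot ⊢
  rw [sum_Ioc_windows] at htot ⊢
  refine (sum_le_sum hk).trans ?_
  rw [sum_add_distrib, sum_const, card_range, nsmul_eq_mul, ← mul_sum]
  calc _ ≤ (K : ℝ) * (J * h * (x / D) * (570000 * ω + 19500 / K)) + 9000 * (x / D / K) * (4 * D) :=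
        add_le_add le_rfl (mul_le_mul_of_nonneg_left htot (by positivity))
    _ = x * (570000 * ω + 55500 / K) := by rw [hDeq]; field_simp; ring
    _ ≤ _ := by gcongr; norm_num

theorem sum_Ioc_one_two_pow (f : ℕ → ℝ) (I : ℕ) :
    ∑ d ∈ Ioc 1 (2 ^ I), f d = ∑ i ∈ range I, ∑ d ∈ Ioc (2 ^ i) (2 * 2 ^ i), f d := by
  induction I with
  | zero => simp
  | succ I ih =>
    rw [sum_range_succ, ← ih, ← pow_succ', sum_Ioc_consecutive _ Nat.one_le_two_pow
      (Nat.pow_le_pow_right two_pos (Nat.le_succ I))]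

theorem sum_block_le_trivial (x : ℕ) {D : ℕ} (hD : 0 < D) (α : ℝ) :
    ∑ d ∈ Ioc D (2 * D), lp d * ‖pS (x / d) (d * α)‖ ≤ 8 * x := by
  have hDR : (0 : ℝ) < D := by exact_mod_cast hD
  have h1 : ∀ d ∈ Ioc D (2 * D), lp d * ‖pS (x / d) (d * α)‖ ≤ lp d * (2 * (x / D)) := by
    intro d hd
    refine mul_le_mul_of_nonneg_left ((norm_pS_le _ _).trans ?_) (lp_nonneg d)
    have : (D : ℝ) ≤ d := by exact_mod_cast (mem_Ioc.1 hd).1.le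
    have h2 : ((x / d : ℕ) : ℝ) ≤ x / D := Nat.cast_div_le.trans (by gcongr)
    linarith
  refine (sum_le_sum h1).trans ?_
  rw [← sum_mul]
  have h2 : ∑ d ∈ Ioc D (2 * D), lp d ≤ 4 * D := by
    refine (sum_le_sum_of_subset_of_nonneg (Ioc_subset_Ioc_left (Nat.zero_le D))
      fun _ _ _ => lp_nonneg _).trans ((sum_lp_le _).trans (le_of_eq ?_))
    push_cast; ring
  calc _ ≤ 4 * (D : ℝ) * (2 * (x / D)) := mul_le_mul_of_nonneg_right h2 (by positivity)
    _ = _ := by field_simp; ring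

theorem norm_bil_le {x q a k z : ℕ} {β ω κ : ℝ} (hx1 : 1 ≤ x) (hq : 0 < q) (hc : a.Coprime q)
    (hqz : q ≤ 2 ^ z) (hβ : x * |β| ≤ 2 ^ z) (hkz : k ≤ z) (hω : 0 ≤ ω)
    (hκ : eul q ^ 3 * κ ≤ ω ^ 2 * q)
    (hκ2 : κ = 1 ∨ κ = 1 / (2 ^ k : ℝ) ∧ ((2 : ℝ) ^ k) ^ 3 ≤ x * |β|) :
    ‖bil x (a / q + β)‖ ≤ x * (192 * (z + 1)) +
      (Nat.log 2 x + 1) * (x * (570000 * ω + 60000 / 2 ^ k)) := by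
  set L := Nat.log 2 x with hL
  set i0 := 12 * z + 12 with hi0
  set α : ℝ := a / q + β with hα
  set f : ℕ → ℝ := fun d => lp d * ‖pS (x / d) (d * α)‖ with hf
  have hf0 : ∀ d, 0 ≤ f d := fun d => mul_nonneg (lp_nonneg d) (norm_nonneg _)
  have hx2 : x < 2 ^ (L + 1) := Nat.lt_pow_succ_log_self one_lt_two x
  have hx3 : 2 ^ L ≤ x := Nat.pow_log_le_self 2 (by omega)
  have h1 : ‖bil x α‖ ≤ ∑ d ∈ Ioc 1 (2 ^ (L + 1)), f d := by
    have h2 : ‖bil x α‖ ≤ ∑ d ∈ Ioc 0 x, f d := by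
      refine (norm_sum_le _ _).trans (le_of_eq (sum_congr rfl fun d _ => ?_))
      rw [norm_mul, Complex.norm_real, Real.norm_of_nonneg (lp_nonneg d)]
    refine h2.trans ?_
    have h3 : Ioc 0 x ⊆ insert 1 (Ioc 1 (2 ^ (L + 1))) := by
      intro d hd
      simp only [mem_insert, mem_Ioc] at hd ⊢
      omega
    refine (sum_le_sum_of_subset_of_nonneg h3 fun _ _ _ => hf0 _).trans ?_
    rw [sum_insert (by simp)]
    have : f 1 = 0 := by simp [hf, lp, Nat.not_prime_one]
    rw [this, zero_add]
  refine h1.trans ?_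
  rw [sum_Ioc_one_two_pow]
  set T : ℝ := x * (570000 * ω + 60000 / 2 ^ k) with hT
  have hT0 : 0 ≤ T := by positivity
  have hi : ∀ i ∈ range (L + 1), ∑ d ∈ Ioc (2 ^ i) (2 * 2 ^ i), f d ≤
      T + ((if i < i0 then 8 * (x : ℝ) else 0) + (if L < i + i0 then 8 * (x : ℝ) else 0)) := by
    intro i _
    have hx0 : (0 : ℝ) ≤ x := Nat.cast_nonneg x
    by_cases c1 : i < i0
    · have := sum_block_le_trivial x (pow_pos two_pos i) α
      rw [if_pos c1]
      have : (0 : ℝ) ≤ if L < i + i0 then 8 * (x : ℝ) else 0 := by split_ifs <;> positivity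
      linarith
    by_cases c2 : L < i + i0
    · have := sum_block_le_trivial x (pow_pos two_pos i) α
      rw [if_pos c2, if_neg c1]
      linarith
    rw [if_neg c1, if_neg c2, add_zero, add_zero]
    have hq4 : q ^ 4 ≤ 2 ^ (4 * z) := by
      calc q ^ 4 ≤ (2 ^ z) ^ 4 := Nat.pow_le_pow_left hqz 4
        _ = _ := by rw [← pow_mul, mul_comm]
    have e1 : (2 : ℕ) ^ i = 2 ^ k * (2 ^ (z + 1) * 2 ^ (i - k - z - 1)) := by
      rw [← pow_add, ← pow_add]
      congr 1
      omega
    have := sum_block_le (x := x) (K := 2 ^ k) (J := 2 ^ (z + 1)) (h := 2 ^ (i - k - z - 1))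
      (D := 2 ^ i) (β := β) (κ := κ) (ω := ω) hq hc (by positivity) (by positivity)
      (hq4.trans (Nat.pow_le_pow_right two_pos (by omega))) e1
      (by
        rw [← pow_add, ← pow_succ']
        exact Nat.pow_le_pow_right two_pos (by omega))
      (by
        calc 2 * 2 ^ i * (q ^ 4 * (2 ^ k) ^ 2 + 1) ≤
            2 * 2 ^ i * (2 ^ (4 * z) * (2 ^ k) ^ 2 + 2 ^ (4 * z) * (2 ^ k) ^ 2) := by
              gcongr
              exact Nat.one_le_iff_ne_zero.2 (by positivity)
          _ = 2 ^ (1 + i + (4 * z + k * 2 + 1)) := by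
              rw [pow_add, pow_add, pow_add, pow_add, pow_mul 2 k 2]; ring
          _ ≤ 2 ^ L := Nat.pow_le_pow_right two_pos (by omega)
          _ ≤ x := hx3)
      (by push_cast; rw [pow_succ]; linarith) hω hκ (by push_cast; exact hκ2)
    push_cast at this
    exact this
  refine (sum_le_sum hi).trans ?_
  rw [sum_add_distrib, sum_add_distrib, sum_const, card_range, ← sum_filter, ← sum_filter,
    sum_const, sum_const]
  have c1 : ((range (L + 1)).filter fun i => i < i0).card ≤ i0 := by
    refine (card_le_card (t := range i0) fun i hi => ?_).trans (card_range i0).le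
    exact mem_range.2 (mem_filter.1 hi).2
  have c2 : ((range (L + 1)).filter fun i => L < i + i0).card ≤ i0 := by
    refine (card_le_card (t := Ico (L + 1 - i0) (L + 1)) fun i hi => ?_).trans ?_
    · have h1 := mem_range.1 (mem_filter.1 hi).1
      have h2 := (mem_filter.1 hi).2
      rw [mem_Ico]
      omega
    · rw [Nat.card_Ico]
      omega
  have c1' : (((range (L + 1)).filter fun i => i < i0).card : ℝ) ≤ i0 := by exact_mod_cast c1
  have c2' : (((range (L + 1)).filter fun i => L < i + i0).card : ℝ) ≤ i0 := by exact_mod_cast c2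
  rw [nsmul_eq_mul, nsmul_eq_mul, nsmul_eq_mul]
  have hi0R : (i0 : ℝ) = 12 * z + 12 := by rw [hi0]; push_cast; ring
  have hx0 : (0 : ℝ) ≤ x := Nat.cast_nonneg x
  push_cast
  calc _ ≤ ((L : ℝ) + 1) * T + (i0 * (8 * x) + i0 * (8 * x)) := by gcongr
    _ = _ := by rw [hi0R]; ring

theorem exists_eul_pow_le : ∃ C : ℝ, 1 ≤ C ∧ ∀ q : ℕ, 0 < q → eul q ^ 3 ≤ C * q ∧
    ∀ K : ℝ, 0 < K → K ^ 4 ≤ q → eul q ^ 3 * K ≤ C * q := by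
  refine ⟨48 ^ 3 * 17 ^ 12, by norm_num, fun q hq => ?_⟩
  have hq1 : (1 : ℝ) ≤ q := by exact_mod_cast hq
  set s : ℝ := (q : ℝ) ^ (1 / 16 : ℝ) with hs
  have hs1 : 1 ≤ s := Real.one_le_rpow hq1 (by norm_num)
  have hs16 : s ^ 16 = q := by
    rw [hs, ← Real.rpow_natCast, ← Real.rpow_mul (by linarith)]
    norm_num
  have hlog : Real.log q = 16 * Real.log s := by
    rw [← hs16, Real.log_pow]; norm_num
  have hl : Real.log s ≤ s := Real.log_le_self (by linarith)
  have hl0 : 0 ≤ Real.log s := Real.log_nonneg hs1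
  have h1 : eul q ≤ 48 * (17 * s) ^ 4 := by
    refine (eul_le_log hq).trans ?_
    rw [hlog]
    gcongr
    linarith
  have h2 : eul q ^ 3 ≤ 48 ^ 3 * 17 ^ 12 * s ^ 12 := by
    calc eul q ^ 3 ≤ (48 * (17 * s) ^ 4) ^ 3 := by
          have := (eul_pos q).le
          gcongr
      _ = _ := by ring
  refine ⟨h2.trans ?_, fun K hK hKq => ?_⟩
  · rw [← hs16]
    gcongr
    norm_num
  · have h3 : K ≤ s ^ 4 := by
      refine le_of_pow_le_pow_left₀ (n := 4) (by norm_num) (by positivity) ?_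
      calc K ^ 4 ≤ q := hKq
        _ = _ := by rw [← hs16]; ring
    calc eul q ^ 3 * K ≤ 48 ^ 3 * 17 ^ 12 * s ^ 12 * s ^ 4 := by gcongr
      _ = _ := by rw [← hs16]; ring

set_option maxHeartbeats 1000000 in
theorem exists_norm_pS_le_major : ∃ C : ℝ, 0 < C ∧ ∃ x₀ : ℕ, ∀ (x z k q a : ℕ) (β : ℝ), x₀ ≤ x →
    (1 + (z : ℝ)) ^ 6 ≤ Real.log x → 0 < q → a.Coprime q → q ≤ 2 ^ z → x * |β| ≤ 2 ^ z →
    (((2 : ℝ) ^ k) ^ 4 ≤ q ∨ ((2 : ℝ) ^ k) ^ 4 ≤ x * |β|) →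
    ‖pS x (a / q + β)‖ ≤ C * x * ((√(2 ^ k))⁻¹ + (√(Real.log x))⁻¹) := by
  obtain ⟨C1, hC1, H1⟩ := exists_log_mul_norm_pS_le
  obtain ⟨C2, hC2, H2⟩ := exists_norm_esum_selW_le
  obtain ⟨C3, hC3, H3⟩ := exists_eul_pow_le
  refine ⟨C2 * C3 + C2 + C1 + 192 + 3 * (570000 * C3 + 60000), by positivity,
    ⌈Real.exp 4⌉₊, fun x z k q a β hx hz hq hc hqz hβ hcase => ?_⟩
  have hxe : Real.exp 4 ≤ x := Nat.ceil_le.1 hx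
  have hx0 : (0 : ℝ) < x := (Real.exp_pos 4).trans_le hxe
  have hx1 : 1 ≤ x := by exact_mod_cast hx0
  set ℓ := Real.log x with hℓ
  have hℓ4 : 4 ≤ ℓ := (Real.le_log_iff_exp_le hx0).2 hxe
  have hz0 : (0 : ℝ) ≤ z := Nat.cast_nonneg z
  have hq' : (0 : ℝ) < q := by exact_mod_cast hq
  have hq1 : (1 : ℝ) ≤ q := by exact_mod_cast hq
  have hqzR : (q : ℝ) ≤ 2 ^ z := by exact_mod_cast hqz
  set K : ℝ := 2 ^ k with hK
  have hK1 : 1 ≤ K := one_le_pow₀ (by norm_num)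
  have hE1 := one_le_eul q
  -- size of `z`
  have hzℓ : (4 * (z : ℝ) + 2) * 0.7 ≤ ℓ := by
    rcases Nat.eq_zero_or_pos z with h | h
    · rw [h]; push_cast; linarith
    · have h1 : (1 : ℝ) ≤ z := by exact_mod_cast h
      have h2 : (2 : ℝ) ^ 5 ≤ (1 + (z : ℝ)) ^ 5 := by gcongr; linarith
      have h3 : (1 + (z : ℝ)) ^ 6 = (1 + z) ^ 5 * (1 + z) := by ring
      nlinarith
  have hZx : 4 * (2 ^ z) ^ 4 ≤ x := by
    have h1 : ((4 * (2 ^ z) ^ 4 : ℕ) : ℝ) = Real.exp ((4 * z + 2) * Real.log 2) := by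
      rw [mul_comm (4 * (z : ℝ) + 2) (Real.log 2), Real.exp_mul, Real.exp_log two_pos]
      have : (4 * (z : ℝ) + 2) = ((4 * z + 2 : ℕ) : ℝ) := by push_cast; ring
      rw [this, Real.rpow_natCast]
      push_cast
      rw [← pow_mul, pow_add, mul_comm z 4]
      ring
    have h2 : ((4 * (2 ^ z) ^ 4 : ℕ) : ℝ) ≤ x := by
      rw [h1, ← Real.le_log_iff_exp_le hx0]
      refine le_trans ?_ hzℓ
      have := Real.log_two_lt_d9
      gcongr
      linarith
    exact_mod_cast h2
  have hkz : k ≤ z := by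
    have h1 : K ^ 4 ≤ 2 ^ z := hcase.elim (fun h => h.trans hqzR) (fun h => h.trans hβ)
    have h2 : K ≤ 2 ^ z := le_trans (le_self_pow₀ hK1 (by norm_num)) h1
    exact (pow_le_pow_iff_right₀ (by norm_num : (1 : ℝ) < 2)).1 h2
  have hsK : 1 ≤ √K := Real.one_le_sqrt.2 hK1
  have hsℓ : 1 ≤ √ℓ := Real.one_le_sqrt.2 (by linarith)
  have hKK : K⁻¹ ≤ (√K)⁻¹ := by
    gcongr
    calc √K ≤ √K * √K := le_mul_of_one_le_left (by linarith) hsK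
      _ = K := Real.mul_self_sqrt (by linarith)
  -- main term
  have hG : eul q / q * ‖∑ n ∈ Ioc 0 x, ex (n * β)‖ ≤ C3 * x * K⁻¹ := by
    have hE3 : eul q ≤ eul q ^ 3 := le_self_pow₀ hE1 (by norm_num)
    rcases hcase with h | h
    · have h1 := (H3 q hq).2 K (by linarith) h
      have h2 : ‖∑ n ∈ Ioc 0 x, ex (n * β)‖ ≤ x := by simpa using norm_sum_Ioc_ex_le 0 x β
      have h3 : eul q / q ≤ C3 * K⁻¹ := by
        rw [div_le_iff₀ hq', ← div_eq_mul_inv, div_mul_eq_mul_div, le_div_iff₀ (by linarith)]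
        exact le_trans (by gcongr) h1
      calc _ ≤ C3 * K⁻¹ * x := by gcongr
        _ = _ := by ring
    · have h1 := (H3 q hq).1
      have h3 : eul q / q ≤ C3 := by
        rw [div_le_iff₀ hq']
        exact hE3.trans h1
      have hβ0 : 0 < |β| := by
        rcases (abs_nonneg β).lt_or_eq with h' | h'
        · exact h'
        · rw [← h', mul_zero] at h
          have : 0 < K ^ 4 := by positivity
          linarith
      have hβh : |β| ≤ 1 / 2 := by
        have h4 : (2 : ℝ) * 2 ^ z ≤ x := by
          have : 2 * 2 ^ z ≤ x := by
            refine le_trans ?_ hZx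
            have : (2 : ℕ) ^ z ≤ (2 ^ z) ^ 4 := Nat.le_self_pow (by norm_num) _
            omega
          exact_mod_cast this
        rw [le_div_iff₀ two_pos]
        refine le_of_mul_le_mul_left ?_ hx0
        linarith
      have h5 := sum_Ioc_ex_mul_nn_le 0 x β
      rw [nn_of_abs_le_half hβh] at h5
      have hKK4 : K ≤ K ^ 4 := le_self_pow₀ hK1 (by norm_num)
      have h6 : ‖∑ n ∈ Ioc 0 x, ex (n * β)‖ ≤ x * K⁻¹ := by
        rw [← div_eq_mul_inv, le_div_iff₀ (by linarith)]
        set A := ‖∑ n ∈ Ioc 0 x, ex (n * β)‖ with hA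
        have hA0 : 0 ≤ A := norm_nonneg _
        calc A * K ≤ A * (x * |β|) := by gcongr; linarith
          _ = x / 2 * (A * (2 * |β|)) := by ring
          _ ≤ x / 2 * 1 := by gcongr
          _ ≤ x := by linarith
      calc _ ≤ C3 * (x * K⁻¹) := by gcongr
        _ = _ := by ring
  -- the bilinear term
  have hω : (√(C3 / K)) ≤ C3 * (√K)⁻¹ := by
    rw [Real.sqrt_div (by linarith), div_eq_mul_inv]
    gcongr
    exact Real.sqrt_le_iff.2 ⟨by linarith, by nlinarith⟩
  have hbil : ‖bil x (a / q + β)‖ ≤ x * (192 * (z + 1)) +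
      (Nat.log 2 x + 1) * (x * (570000 * √(C3 / K) + 60000 / K)) := by
    have hsq : √(C3 / K) ^ 2 = C3 / K := Real.sq_sqrt (by positivity)
    by_cases h : K ^ 4 ≤ q
    · refine norm_bil_le (κ := 1) hx1 hq hc hqz hβ hkz (Real.sqrt_nonneg _) ?_ (Or.inl rfl)
      have h1 := (H3 q hq).2 K (by linarith) h
      rw [hsq, mul_one, div_mul_eq_mul_div, le_div_iff₀ (by linarith)]
      exact h1
    · refine norm_bil_le (κ := 1 / K) hx1 hq hc hqz hβ hkz (Real.sqrt_nonneg _) ?_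
        (Or.inr ⟨rfl, le_trans (pow_le_pow_right₀ hK1 (by norm_num)) (hcase.resolve_left h)⟩)
      have h1 := (H3 q hq).1
      rw [hsq, mul_one_div, div_mul_eq_mul_div]
      gcongr
  have hlog2 : (Nat.log 2 x : ℝ) + 1 ≤ 3 * ℓ := by
    have h1 : (Nat.log 2 x : ℝ) * Real.log 2 ≤ ℓ := by
      rw [← Real.log_pow]
      refine Real.log_le_log (by positivity) ?_
      exact_mod_cast Nat.pow_log_le_self 2 (by omega)
    have h2 := Real.log_two_gt_d9
    have h3 : (0 : ℝ) ≤ Nat.log 2 x := Nat.cast_nonneg _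
    nlinarith
  have hz3 : (1 + (z : ℝ)) ^ 3 ≤ √ℓ := by
    refine Real.le_sqrt_of_sq_le ?_
    calc ((1 + (z : ℝ)) ^ 3) ^ 2 = (1 + z) ^ 6 := by ring
      _ ≤ ℓ := hz
  have hz1 : (z : ℝ) + 1 ≤ √ℓ := by
    refine le_trans ?_ hz3
    rw [add_comm]
    exact le_self_pow₀ (by linarith) (by norm_num)
  have hlogZ : (1 + Real.log ((2 ^ z : ℕ) : ℝ)) ^ 3 ≤ √ℓ := by
    refine le_trans ?_ hz3
    push_cast
    rw [Real.log_pow]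
    have h1 := Real.log_two_lt_d9
    have h2 := Real.log_two_gt_d9
    gcongr
    nlinarith
  have hT := H2 x q (2 ^ z) a β hq hqz hZx (by push_cast; exact hβ) (Nat.isCoprime_iff_coprime.2 hc)
  rw [Int.cast_natCast] at hT
  have hS := H1 x (a / q + β) hx1
  have hfin : ℓ * ‖pS x (a / q + β)‖ ≤
      C2 * (ℓ * (C3 * x * (√K)⁻¹) + x * √ℓ) + (x * (192 * √ℓ) +
      3 * ℓ * (x * (570000 * (C3 * (√K)⁻¹) + 60000 * (√K)⁻¹))) + C1 * x := by
    refine hS.trans (add_le_add (add_le_add (hT.trans ?_) (hbil.trans ?_)) le_rfl)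
    · rw [mul_assoc (Real.log (x : ℝ))]
      have h5 : C3 * x * K⁻¹ ≤ C3 * x * (√K)⁻¹ := by gcongr
      have h6 := hG.trans h5
      gcongr
    · have h7 : 60000 / K ≤ 60000 * (√K)⁻¹ := by
        rw [div_eq_mul_inv]; gcongr
      gcongr
  have hℓs : ℓ * (√ℓ)⁻¹ = √ℓ := by
    rw [← div_eq_mul_inv, Real.div_sqrt]
  rw [← mul_le_mul_iff_right₀ (show 0 < ℓ by linarith)]
  refine hfin.trans ?_
  have i1 : 0 ≤ ℓ * (√K)⁻¹ * x := by positivity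
  have i2 : (x : ℝ) ≤ x * √ℓ := le_mul_of_one_le_right hx0.le hsℓ
  have e : ℓ * ((C2 * C3 + C2 + C1 + 192 + 3 * (570000 * C3 + 60000)) * x * ((√K)⁻¹ + (√ℓ)⁻¹)) =
      (C2 * C3 + C2 + C1 + 192 + 3 * (570000 * C3 + 60000)) * (ℓ * (√K)⁻¹ * x) +
      (C2 * C3 + C2 + C1 + 192 + 3 * (570000 * C3 + 60000)) * (x * √ℓ) := by
    calc _ = (C2 * C3 + C2 + C1 + 192 + 3 * (570000 * C3 + 60000)) * (ℓ * (√K)⁻¹ * x) +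
        (C2 * C3 + C2 + C1 + 192 + 3 * (570000 * C3 + 60000)) * (x * (ℓ * (√ℓ)⁻¹)) := by ring
      _ = _ := by rw [hℓs]
  rw [e]
  have i3 : C1 * x ≤ C1 * (x * √ℓ) := by gcongr
  have i4 : 0 ≤ x * √ℓ := by positivity
  have i5 : 0 ≤ C1 * (ℓ * (√K)⁻¹ * x) := by positivity
  have i6 : 0 ≤ C2 * (ℓ * (√K)⁻¹ * x) := by positivity
  have i7 : 0 ≤ C2 * C3 * (x * √ℓ) := by positivity
  have i8 : 0 ≤ C3 * (x * √ℓ) := by positivity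
  linarith

theorem sum_residue_le {q : ℕ} {a : ℤ} (hq : 0 < q) (hc : IsCoprime a (q : ℤ)) (c : ℤ) {s : Finset ℕ}
    (hs : ∀ m ∈ s, ∀ n ∈ s, m ≡ n [MOD q] → m = n) {f : ℕ → ℝ} (hf : ∀ j, 0 ≤ f j) :
    ∑ d ∈ s, f ((((d : ℤ) * a + c) % q).toNat) ≤ ∑ j ∈ range q, f j := by
  have hq0 : (q : ℤ) ≠ 0 := by exact_mod_cast hq.ne'
  have hinj : Set.InjOn (fun d : ℕ => (((d : ℤ) * a + c) % q).toNat) s := by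
    intro m hm n hn h
    have h1 : ((m : ℤ) * a + c) % q = ((n : ℤ) * a + c) % q := by
      have := Int.emod_nonneg ((m : ℤ) * a + c) hq0
      have := Int.emod_nonneg ((n : ℤ) * a + c) hq0
      simp only at h
      omega
    have h2 : (q : ℤ) ∣ ((n : ℤ) - m) * a := by
      have := Int.ModEq.dvd (show ((m : ℤ) * a + c) ≡ ((n : ℤ) * a + c) [ZMOD q] from h1)
      have e : ((n : ℤ) * a + c) - ((m : ℤ) * a + c) = ((n : ℤ) - m) * a := by ring
      rwa [e] at this
    have h3 : (q : ℤ) ∣ ((n : ℤ) - m) := hc.symm.dvd_of_dvd_mul_right h2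
    exact hs m hm n hn ((Nat.modEq_iff_dvd).2 h3)
  rw [← sum_image (f := f) hinj]
  refine sum_le_sum_of_subset_of_nonneg (fun j hj => ?_) fun _ _ _ => hf _
  obtain ⟨d, _, rfl⟩ := mem_image.1 hj
  have := Int.emod_lt_of_pos ((d : ℤ) * a + c) (show (0 : ℤ) < q by exact_mod_cast hq)
  have := Int.emod_nonneg ((d : ℤ) * a + c) hq0
  rw [mem_range]
  omega

theorem min_div_le_nn {q j : ℕ} (hq : 0 < q) (hj : j < q) :
    min (j : ℝ) (q - j) / q ≤ nn ((j : ℝ) / q) := by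
  have hq' : (0 : ℝ) < q := by exact_mod_cast hq
  have hjq : (j : ℝ) ≤ q := by exact_mod_cast hj.le
  rw [div_le_iff₀ hq', nn]
  set n := round ((j : ℝ) / q) with hn
  have e : |(j : ℝ) / q - n| * q = |(j : ℝ) - n * q| := by
    rw [← abs_of_pos hq', ← abs_mul, abs_of_pos hq']
    congr 1
    field_simp
  rw [e]
  rcases le_or_gt n 0 with h | h
  · have h1 : (n : ℝ) ≤ 0 := by exact_mod_cast h
    refine (min_le_left _ _).trans (le_trans ?_ (le_abs_self _))
    nlinarith
  · have h1 : (1 : ℝ) ≤ n := by exact_mod_cast h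
    refine (min_le_right _ _).trans (le_trans ?_ (neg_le_abs _))
    nlinarith

/-- The reciprocal weight attached to a residue `j` modulo `q`. -/
noncomputable def recw (q j : ℕ) : ℝ := 1 / j + 1 / (q - j : ℕ)

theorem recw_nonneg (q j : ℕ) : 0 ≤ recw q j := by unfold recw; positivity

theorem inv_min_le_recw {q j : ℕ} (hj0 : 0 < j) (hj : j < q) :
    1 / min (j : ℝ) (q - j) ≤ recw q j := by
  have h1 : (0 : ℝ) < j := by exact_mod_cast hj0
  have h2 : ((q - j : ℕ) : ℝ) = q - j := Nat.cast_sub hj.le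
  have h3 : (0 : ℝ) < (q : ℝ) - j := by rw [← h2]; exact_mod_cast Nat.sub_pos_of_lt hj
  rw [recw, h2]
  have h4 : 0 < 1 / (j : ℝ) := by positivity
  have h5 : 0 < 1 / ((q : ℝ) - j) := by positivity
  rcases min_cases (j : ℝ) (q - j) with ⟨h, _⟩ | ⟨h, _⟩ <;> rw [h] <;> linarith

theorem sum_recw_le {q : ℕ} (hq : 0 < q) : ∑ j ∈ range q, recw q j ≤ 2 * (1 + Real.log q) + 1 / q := by
  have h1 : ∑ j ∈ range q, (1 : ℝ) / j ≤ 1 + Real.log q := by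
    rcases q with _ | q
    · omega
    rw [sum_range_succ']
    simp only [Nat.cast_zero, div_zero, add_zero]
    have := harmonic_le_one_add_log q
    rw [harmonic] at this
    push_cast at this ⊢
    simp only [one_div]
    refine this.trans ?_
    rcases Nat.eq_zero_or_pos q with h | h
    · simp [h]
    · gcongr
      linarith
  have h2 : ∑ j ∈ range q, (1 : ℝ) / (q - j : ℕ) ≤ 1 + Real.log q := by
    have := harmonic_le_one_add_log q
    rw [harmonic, ← sum_range_reflect] at this
    push_cast at this
    refine le_trans (le_of_eq (sum_congr rfl fun j hj => ?_)) this
    have hj := mem_range.1 hj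
    rw [one_div]
    congr 1
    have : (q - j : ℕ) = (q - 1 - j) + 1 := by omega
    rw [this]
    push_cast
    ring
  unfold recw
  rw [sum_add_distrib]
  have : (0 : ℝ) ≤ 1 / q := by positivity
  linarith

theorem intCast_div_eq_emod_add {q : ℕ} (hq : 0 < q) {k : ℤ} {j : ℕ} (hj : k % q = j) :
    (k : ℝ) / q = (j : ℝ) / q + (k / (q : ℤ) : ℤ) := by
  have hq' : (0 : ℝ) < q := by exact_mod_cast hq
  have h1 := Int.emod_add_mul_ediv k q
  rw [hj] at h1
  have h2 : (j : ℝ) + q * (k / (q : ℤ) : ℤ) = k := by exact_mod_cast h1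
  rw [div_eq_iff hq'.ne', add_mul, div_mul_cancel₀ _ hq'.ne']
  linarith

theorem geoBound_le_of_near {q : ℕ} (hq : 0 < q) {A x : ℝ} (hA : 0 ≤ A) (k : ℤ)
    (hx : |x - k / q| ≤ 3 / (2 * q)) :
    geoBound A x ≤ (if (k % q).toNat ≤ 1 then A else 0) + (if q ≤ (k % q).toNat + 1 then A else 0) +
      2 * q * recw q (k % q).toNat := by
  have hq' : (0 : ℝ) < q := by exact_mod_cast hq
  have hq0 : (0 : ℤ) < q := by exact_mod_cast hq
  have hj1 := Int.emod_nonneg k hq0.ne'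
  have hj2 := Int.emod_lt_of_pos k hq0
  obtain ⟨j, hj⟩ := Int.eq_ofNat_of_zero_le hj1
  rw [hj, Int.toNat_natCast]
  have hr := recw_nonneg q j
  have hle := geoBound_le_left A x
  have hr2 : 0 ≤ 2 * q * recw q j := by positivity
  by_cases c1 : j ≤ 1
  · rw [if_pos c1]
    have : (0 : ℝ) ≤ if q ≤ j + 1 then A else 0 := by split_ifs <;> linarith
    linarith
  by_cases c2 : q ≤ j + 1
  · rw [if_pos c2, if_neg c1]
    linarith
  rw [if_neg c1, if_neg c2, zero_add, zero_add]
  have hjq : j < q := by omega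
  set m := min (j : ℝ) (q - j) with hm
  have hm2 : 2 ≤ m := by
    refine le_min (by exact_mod_cast (by omega : 2 ≤ j)) ?_
    have : (j : ℝ) + 2 ≤ q := by exact_mod_cast (by omega : j + 2 ≤ q)
    linarith
  have hk := intCast_div_eq_emod_add hq hj
  have h1 : m / q ≤ nn ((k : ℝ) / q) := by
    rw [hk, nn_add_int]
    exact min_div_le_nn hq hjq
  have h2 : nn ((k : ℝ) / q) ≤ nn x + 3 / (2 * q) := by
    have := nn_add_le x (k / q - x)
    rw [add_sub_cancel, abs_sub_comm] at this
    linarith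
  have h3 : m / (4 * q) ≤ nn x := by
    have e1 : m / q - 3 / (2 * q) = (4 * m - 6) / (4 * q) := by field_simp; ring
    have e2 : m / (4 * q) ≤ (4 * m - 6) / (4 * q) := by gcongr; linarith
    linarith
  have h4 : 0 < nn x := lt_of_lt_of_le (by positivity) h3
  refine (geoBound_le_right h4).trans ?_
  calc 1 / (2 * nn x) ≤ 1 / (2 * (m / (4 * q))) := by gcongr
    _ = 2 * q * (1 / m) := by field_simp; norm_num
    _ ≤ _ := by
      gcongr
      exact inv_min_le_recw (by omega) hjq

theorem geoBound_le_of_small {q : ℕ} (hq : 0 < q) {A x : ℝ} (k : ℤ) (hk : ¬ (q : ℤ) ∣ k)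
    (hx : |x - k / q| ≤ 1 / (2 * q)) : geoBound A x ≤ q * recw q (k % q).toNat := by
  have hq' : (0 : ℝ) < q := by exact_mod_cast hq
  have hq0 : (0 : ℤ) < q := by exact_mod_cast hq
  have hj1 := Int.emod_nonneg k hq0.ne'
  have hj2 := Int.emod_lt_of_pos k hq0
  have hj0 : k % q ≠ 0 := fun h => hk (Int.dvd_of_emod_eq_zero h)
  obtain ⟨j, hj⟩ := Int.eq_ofNat_of_zero_le hj1
  rw [hj, Int.toNat_natCast]
  have hjq : j < q := by omega
  have hj0' : 0 < j := by omega
  set m := min (j : ℝ) (q - j) with hm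
  have hm1 : 1 ≤ m := by
    refine le_min (by exact_mod_cast hj0') ?_
    have : (j : ℝ) + 1 ≤ q := by exact_mod_cast hjq
    linarith
  have hk := intCast_div_eq_emod_add hq hj
  have h1 : m / q ≤ nn ((k : ℝ) / q) := by
    rw [hk, nn_add_int]
    exact min_div_le_nn hq hjq
  have h2 : nn ((k : ℝ) / q) ≤ nn x + 1 / (2 * q) := by
    have := nn_add_le x (k / q - x)
    rw [add_sub_cancel, abs_sub_comm] at this
    linarith
  have h3 : m / (2 * q) ≤ nn x := by
    have e1 : m / q - 1 / (2 * q) = (2 * m - 1) / (2 * q) := by field_simp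
    have e2 : m / (2 * q) ≤ (2 * m - 1) / (2 * q) := by gcongr; linarith
    linarith
  have h4 : 0 < nn x := lt_of_lt_of_le (by positivity) h3
  refine (geoBound_le_right h4).trans ?_
  calc 1 / (2 * nn x) ≤ 1 / (2 * (m / (2 * q))) := by gcongr
    _ = q * (1 / m) := by field_simp
    _ ≤ _ := by
      gcongr
      exact inv_min_le_recw hj0' hjq

theorem eq_of_modEq_of_mem_Ioc {q D m n : ℕ} (hm : m ∈ Ioc D (D + q)) (hn : n ∈ Ioc D (D + q))
    (h : m ≡ n [MOD q]) : m = n := by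
  rw [Finset.mem_Ioc] at hm hn
  rcases le_total m n with hle | hle
  · have h1 := (Nat.modEq_iff_dvd' hle).1 h
    have := Nat.eq_zero_of_dvd_of_lt h1 (by omega)
    omega
  · have h1 := (Nat.modEq_iff_dvd' hle).1 h.symm
    have := Nat.eq_zero_of_dvd_of_lt h1 (by omega)
    omega

theorem sum_ite_le_one_le {q : ℕ} {A : ℝ} (hA : 0 ≤ A) :
    ∑ j ∈ range q, (if j ≤ 1 then A else 0) ≤ 2 * A := by
  rw [← sum_filter, sum_const, nsmul_eq_mul]
  gcongr
  have : (range q).filter (fun j => j ≤ 1) ⊆ range 2 := fun j hj => by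
    rw [mem_filter] at hj
    exact mem_range.2 (by omega)
  have := card_le_card this
  rw [card_range] at this
  exact_mod_cast this

theorem sum_ite_ge_le {q : ℕ} {A : ℝ} (hA : 0 ≤ A) :
    ∑ j ∈ range q, (if q ≤ j + 1 then A else 0) ≤ A := by
  rw [← sum_filter, sum_const, nsmul_eq_mul]
  have : (range q).filter (fun j => q ≤ j + 1) ⊆ {q - 1} := fun j hj => by
    rw [mem_filter, mem_range] at hj
    exact mem_singleton.2 (by omega)
  have := card_le_card this
  rw [card_singleton] at this
  have : (((range q).filter (fun j => q ≤ j + 1)).card : ℝ) ≤ 1 := by exact_mod_cast this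
  nlinarith

theorem sum_window_geoBound_le {q : ℕ} (hq : 0 < q) {a : ℤ} (hc : IsCoprime a (q : ℤ)) {α : ℝ}
    (hα : |α - a / q| ≤ 1 / (q : ℝ) ^ 2) {A : ℝ} (hA : 0 ≤ A) (D : ℕ) (t : ℝ) :
    ∑ d ∈ Ioc D (D + q), geoBound A (t + d * α) ≤ 3 * A + 6 * q * (1 + Real.log q) := by
  have hq' : (1 : ℝ) ≤ q := by exact_mod_cast hq
  have hq0 : (0 : ℝ) < q := by linarith
  have hlq := Real.log_nonneg hq'
  set c : ℤ := round (q * (t + D * α)) with hcdef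
  have hcr : |(t + D * α) - c / q| ≤ 1 / (2 * q) := by
    have := abs_sub_round ((q : ℝ) * (t + D * α))
    rw [← hcdef] at this
    have e : (t + D * α) - c / q = (q * (t + D * α) - c) / q := by field_simp
    rw [e, abs_div, abs_of_pos hq0, div_le_div_iff₀ hq0 (by positivity)]
    nlinarith
  set f : ℕ → ℝ := fun j => (if j ≤ 1 then A else 0) + (if q ≤ j + 1 then A else 0) + 2 * q * recw q j
    with hf
  have hf0 : ∀ j, 0 ≤ f j := fun j => by
    have := recw_nonneg q j
    simp only [hf]
    positivity
  have h1 : ∀ d ∈ Ioc D (D + q), geoBound A (t + d * α) ≤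
      f ((((d : ℤ) * a + (c - D * a)) % q).toNat) := by
    intro d hd
    rw [Finset.mem_Ioc] at hd
    refine geoBound_le_of_near hq hA _ ?_
    have hd1 : (D : ℝ) ≤ d := by exact_mod_cast hd.1.le
    have hd2 : (d : ℝ) ≤ D + q := by exact_mod_cast hd.2
    have e : t + d * α - (((d : ℤ) * a + (c - D * a) : ℤ) : ℝ) / q =
        ((t + D * α) - c / q) + (d - D) * (α - a / q) := by
      push_cast
      field_simp
      ring
    rw [e]
    refine (abs_add_le _ _).trans ?_
    rw [abs_mul, abs_of_nonneg (by linarith : (0 : ℝ) ≤ d - D)]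
    have h2 : ((d : ℝ) - D) * |α - a / q| ≤ q * (1 / (q : ℝ) ^ 2) := by
      gcongr
      linarith
    have h3 : (q : ℝ) * (1 / (q : ℝ) ^ 2) = 1 / q := by field_simp
    have h4 : (3 : ℝ) / (2 * q) = 1 / (2 * q) + 1 / q := by field_simp; norm_num
    linarith
  refine (sum_le_sum h1).trans ((sum_residue_le hq hc _
    (fun m hm n hn h => eq_of_modEq_of_mem_Ioc hm hn h) hf0).trans ?_)
  simp only [hf]
  rw [sum_add_distrib, sum_add_distrib, ← mul_sum]
  have h5 := sum_ite_le_one_le (q := q) hA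
  have h6 := sum_ite_ge_le (q := q) hA
  have h7 : 2 * q * ∑ j ∈ range q, recw q j ≤ 2 * q * (2 * (1 + Real.log q) + 1 / q) := by
    gcongr
    exact sum_recw_le hq
  have h8 : 2 * q * (2 * (1 + Real.log q) + 1 / (q : ℝ)) = 4 * q * (1 + Real.log q) + 2 := by
    field_simp
    ring
  have h9 : 0 ≤ (q : ℝ) * Real.log q := by positivity
  nlinarith

theorem sum_windows_geoBound_le {q : ℕ} (hq : 0 < q) {a : ℤ} (hc : IsCoprime a (q : ℤ)) {α : ℝ}
    (hα : |α - a / q| ≤ 1 / (q : ℝ) ^ 2) {A : ℝ} (hA : 0 ≤ A) (N : ℕ) (t : ℝ) :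
    ∑ d ∈ Ioc 0 N, geoBound A (t + d * α) ≤
      ((N : ℝ) / q + 1) * (3 * A + 6 * q * (1 + Real.log q)) := by
  have hq' : (1 : ℝ) ≤ q := by exact_mod_cast hq
  have hlq := Real.log_nonneg hq'
  have h1 : ∑ d ∈ Ioc 0 N, geoBound A (t + d * α) ≤
      ∑ d ∈ Ioc 0 (0 + (N / q + 1) * q), geoBound A (t + d * α) := by
    refine sum_le_sum_of_subset_of_nonneg ?_ fun _ _ _ => geoBound_nonneg hA _
    refine Finset.Ioc_subset_Ioc le_rfl ?_
    have := Nat.div_add_mod N q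
    have := Nat.mod_lt N hq
    rw [zero_add, add_mul, mul_comm, one_mul]
    omega
  rw [sum_Ioc_windows] at h1
  refine h1.trans ((sum_le_sum fun j _ => sum_window_geoBound_le hq hc hα hA _ t).trans ?_)
  rw [sum_const, card_range, nsmul_eq_mul]
  gcongr
  push_cast
  have : ((N / q : ℕ) : ℝ) ≤ N / q := Nat.cast_div_le
  linarith

theorem sum_small_geoBound_le {q : ℕ} (hq : 0 < q) {a : ℤ} (hc : IsCoprime a (q : ℤ)) {α : ℝ}
    (hα : |α - a / q| ≤ 1 / (q : ℝ) ^ 2) (A : ℕ → ℝ) :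
    ∑ d ∈ Ioc 0 (q / 2), geoBound (A d) (d * α) ≤ 3 * q * (1 + Real.log q) := by
  have hq' : (1 : ℝ) ≤ q := by exact_mod_cast hq
  have hq0 : (0 : ℝ) < q := by linarith
  have hlq := Real.log_nonneg hq'
  have h1 : ∀ d ∈ Ioc 0 (q / 2), geoBound (A d) (d * α) ≤
      q * recw q ((((d : ℤ) * a + 0) % q).toNat) := by
    intro d hd
    rw [Finset.mem_Ioc] at hd
    refine geoBound_le_of_small hq _ (fun hdvd => ?_) ?_
    · rw [add_zero] at hdvd
      have h2 := hc.symm.dvd_of_dvd_mul_right hdvd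
      have := Nat.le_of_dvd hd.1 (Int.natCast_dvd_natCast.1 h2)
      omega
    · have hd2 : 2 * (d : ℝ) ≤ q := by exact_mod_cast (by omega : 2 * d ≤ q)
      have e : (d : ℝ) * α - (((d : ℤ) * a + 0 : ℤ) : ℝ) / q = d * (α - a / q) := by
        push_cast
        ring
      rw [e, abs_mul, Nat.abs_cast]
      calc (d : ℝ) * |α - a / q| ≤ (q / 2) * (1 / (q : ℝ) ^ 2) := by
            gcongr
            linarith
        _ = 1 / (2 * q) := by field_simp
  refine (sum_le_sum h1).trans ?_
  rw [← mul_sum]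
  have h3 := sum_residue_le hq hc 0 (s := Ioc 0 (q / 2)) (fun m hm n hn h => eq_of_modEq_of_mem_Ioc
    (Finset.Ioc_subset_Ioc le_rfl (by omega) hm) (Finset.Ioc_subset_Ioc le_rfl (by omega) hn) h)
    (recw_nonneg q)
  have h4 := mul_le_mul_of_nonneg_left (h3.trans (sum_recw_le hq)) hq0.le
  have h5 : (q : ℝ) * (2 * (1 + Real.log q) + 1 / (q : ℝ)) = 2 * q * (1 + Real.log q) + 1 := by
    field_simp
  have h9 : 0 ≤ (q : ℝ) * Real.log q := by positivity
  linarith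

/-- The type I estimate. -/
theorem sum_geoBound_typeI_le {q x D : ℕ} (hq : 0 < q) {a : ℤ} (hc : IsCoprime a (q : ℤ)) {α : ℝ}
    (hα : |α - a / q| ≤ 1 / (q : ℝ) ^ 2) (hD : D ≤ x) :
    ∑ d ∈ Ioc 0 D, geoBound ((x / d : ℕ) : ℝ) (d * α) ≤
      12 * (x / q) * (1 + Real.log x) + (6 * D + 9 * q) * (1 + Real.log q) := by
  have hq' : (1 : ℝ) ≤ q := by exact_mod_cast hq
  have hq0 : (0 : ℝ) < q := by linarith
  have hlq := Real.log_nonneg hq'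
  have hlx : 0 ≤ Real.log x := Real.log_natCast_nonneg x
  rcases Nat.eq_zero_or_pos D with hD0 | hD0
  · subst hD0
    simp only [Ioc_self, sum_empty]
    positivity
  set h0 := q / 2 with hh0
  set J := D / q + 1 with hJ
  have hJD : J * q ≤ D + q := by
    have := Nat.div_mul_le_self D q
    rw [hJ, add_mul, one_mul]
    omega
  have hnn : ∀ d : ℕ, 0 ≤ geoBound ((x / d : ℕ) : ℝ) (d * α) := fun d =>
    geoBound_nonneg (Nat.cast_nonneg _) _
  have h1 : ∑ d ∈ Ioc 0 D, geoBound ((x / d : ℕ) : ℝ) (d * α) ≤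
      ∑ d ∈ Ioc 0 h0, geoBound ((x / d : ℕ) : ℝ) (d * α) +
      ∑ d ∈ Ioc h0 (h0 + J * q), geoBound ((x / d : ℕ) : ℝ) (d * α) := by
    rw [sum_Ioc_consecutive _ (Nat.zero_le _) (Nat.le_add_right _ _)]
    refine sum_le_sum_of_subset_of_nonneg (Finset.Ioc_subset_Ioc le_rfl ?_) fun _ _ _ => hnn _
    have := Nat.div_add_mod D q
    have := Nat.mod_lt D hq
    have : J * q = q * (D / q) + q := by rw [hJ]; ring
    omega
  have h2 := sum_small_geoBound_le hq hc hα (fun d => ((x / d : ℕ) : ℝ))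
  rw [sum_Ioc_windows] at h1
  have h3 : ∀ j ∈ range J, ∑ d ∈ Ioc (h0 + j * q) (h0 + j * q + q), geoBound ((x / d : ℕ) : ℝ) (d * α) ≤
      6 * (x / q) * (1 / ((j + 1 : ℕ) : ℝ)) + 6 * q * (1 + Real.log q) := by
    intro j _
    have h4 : ∀ d ∈ Ioc (h0 + j * q) (h0 + j * q + q), geoBound ((x / d : ℕ) : ℝ) (d * α) ≤
        geoBound (2 * (x / q) * (1 / ((j + 1 : ℕ) : ℝ))) (0 + d * α) := by
      intro d hd
      rw [Finset.mem_Ioc] at hd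
      rw [zero_add]
      refine geoBound_mono (Nat.cast_div_le.trans ?_) _
      have h5 : (j + 1) * q ≤ 2 * d := by
        have : (j + 1) * q = j * q + q := by ring
        omega
      have h5' : (((j + 1 : ℕ) : ℝ)) * q ≤ 2 * d := by exact_mod_cast h5
      have h6 : (0 : ℝ) < (j + 1 : ℕ) := by positivity
      have e : 2 * ((x : ℝ) / q) * (1 / ((j + 1 : ℕ) : ℝ)) = (2 * x) / (((j + 1 : ℕ) : ℝ) * q) := by
        field_simp
      rw [e]
      have hd0 : (0 : ℝ) < d := by exact_mod_cast (by omega : 0 < d)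
      rw [div_le_div_iff₀ hd0 (by positivity)]
      nlinarith [mul_le_mul_of_nonneg_left h5' (Nat.cast_nonneg (α := ℝ) x)]
    refine (sum_le_sum h4).trans ((sum_window_geoBound_le hq hc hα (by positivity) _ _).trans ?_)
    linarith
  have h7 := sum_le_sum h3
  rw [sum_add_distrib, ← mul_sum, sum_const, card_range, nsmul_eq_mul] at h7
  have hx1 : (1 : ℝ) ≤ x := by exact_mod_cast (hD0.trans_le hD)
  have h8 : ∑ j ∈ range J, 1 / ((j + 1 : ℕ) : ℝ) ≤ 2 * (1 + Real.log x) := by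
    have := harmonic_le_one_add_log J
    rw [harmonic] at this
    push_cast at this ⊢
    simp only [one_div]
    refine this.trans ?_
    have hJx : (J : ℝ) ≤ 2 * x := by
      have h9 : J ≤ 2 * x := by
        have := Nat.div_le_self D q
        omega
      exact_mod_cast h9
    have h10 : Real.log J ≤ Real.log (2 * x) :=
      Real.log_le_log (by rw [hJ]; positivity) hJx
    rw [Real.log_mul (by norm_num) (by positivity)] at h10
    have := Real.log_two_lt_d9
    linarith
  have h11 : 6 * ((x : ℝ) / q) * ∑ j ∈ range J, 1 / ((j + 1 : ℕ) : ℝ) ≤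
      6 * ((x : ℝ) / q) * (2 * (1 + Real.log x)) := by gcongr
  have h12 : (J : ℝ) * (6 * q * (1 + Real.log q)) ≤ 6 * (D + q) * (1 + Real.log q) := by
    have : (J : ℝ) * q ≤ D + q := by exact_mod_cast hJD
    have h13 := mul_le_mul_of_nonneg_right this (by positivity : 0 ≤ 6 * (1 + Real.log q))
    linarith
  linarith

/-- The type II estimate for one dyadic block. -/
theorem sum_norm_sq_typeII_le {q x M : ℕ} (hq : 0 < q) {a : ℤ} (hc : IsCoprime a (q : ℤ)) {α : ℝ}
    (hα : |α - a / q| ≤ 1 / (q : ℝ) ^ 2) (hM : 0 < M) (b : ℕ → ℝ) :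
    ∑ m ∈ Ioc M (2 * M), ‖esum (Ioc 0 (x / m)) b (m * α)‖ ^ 2 ≤
      (∑ l ∈ Ioc 0 (x / M), b l ^ 2) *
        ((((x / M : ℕ) : ℝ) / q + 1) * (3 * M + 6 * q * (1 + Real.log q))) := by
  set L := x / M with hL
  set B := (((L : ℝ) / q + 1) * (3 * M + 6 * q * (1 + Real.log q))) with hB
  have h1 : ((∑ m ∈ Ioc M (2 * M), ‖esum (Ioc 0 (x / m)) b (m * α)‖ ^ 2 : ℝ) : ℂ) =
      ∑ l ∈ Ioc 0 L, ∑ l' ∈ Ioc 0 L, ((b l * b l' : ℝ) : ℂ) *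
        ∑ m ∈ Ioc M (min (2 * M) (min (x / l) (x / l'))), ex (m * (l * α + l' * (-α))) := by
    have e1 : ∀ m ∈ Ioc M (2 * M), ((‖esum (Ioc 0 (x / m)) b (m * α)‖ ^ 2 : ℝ) : ℂ) =
        ∑ l ∈ Ioc 0 L, ∑ l' ∈ Ioc 0 L, if l ≤ x / m ∧ l' ≤ x / m then
          ((b l * b l' : ℝ) : ℂ) * ex (m * (l * α + l' * (-α))) else 0 := by
      intro m hm
      rw [Finset.mem_Ioc] at hm
      have hs : Ioc 0 (x / m) = (Ioc 0 L).filter (fun l => l ≤ x / m) := by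
        have : x / m ≤ L := Nat.div_le_div_left hm.1.le hM
        ext l
        simp only [Finset.mem_Ioc, mem_filter]
        omega
      rw [Complex.ofReal_pow, ← Complex.mul_conj', esum, map_sum, sum_mul_sum, hs, sum_filter]
      refine sum_congr rfl fun l _ => ?_
      by_cases hl : l ≤ x / m
      · rw [if_pos hl, sum_filter]
        refine sum_congr rfl fun l' _ => ?_
        by_cases hl' : l' ≤ x / m
        · rw [if_pos hl', if_pos ⟨hl, hl'⟩, map_mul, Complex.conj_ofReal, ← ex_neg]
          rw [mul_mul_mul_comm, ← ex_add]
          push_cast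
          congr 2
          ring
        · rw [if_neg hl', if_neg (fun h => hl' h.2)]
      · rw [if_neg hl]
        refine (sum_eq_zero fun l' _ => ?_).symm
        rw [if_neg (fun h => hl h.1)]
    rw [Complex.ofReal_sum, sum_congr rfl e1, sum_comm]
    refine sum_congr rfl fun l hl => ?_
    rw [sum_comm]
    refine sum_congr rfl fun l' hl' => ?_
    rw [← sum_filter, ← mul_sum]
    congr 2
    ext m
    rw [Finset.mem_Ioc] at hl hl'
    simp only [mem_filter, Finset.mem_Ioc, le_min_iff]
    constructor
    · rintro ⟨⟨g1, g2⟩, g3, g4⟩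
      refine ⟨g1, g2, ?_, ?_⟩
      · rw [Nat.le_div_iff_mul_le (by omega)] at g3 ⊢; rwa [mul_comm]
      · rw [Nat.le_div_iff_mul_le (by omega)] at g4 ⊢; rwa [mul_comm]
    · rintro ⟨g1, g2, g3, g4⟩
      refine ⟨⟨g1, g2⟩, ?_, ?_⟩
      · rw [Nat.le_div_iff_mul_le (by omega)] at g3 ⊢; rwa [mul_comm]
      · rw [Nat.le_div_iff_mul_le (by omega)] at g4 ⊢; rwa [mul_comm]
  have h2 : ∑ m ∈ Ioc M (2 * M), ‖esum (Ioc 0 (x / m)) b (m * α)‖ ^ 2 ≤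
      ∑ l ∈ Ioc 0 L, ∑ l' ∈ Ioc 0 L, (b l ^ 2 / 2 + b l' ^ 2 / 2) * geoBound M (l * α + l' * (-α)) := by
    have h3 := congrArg (fun z : ℂ => ‖z‖) h1
    simp only [Complex.norm_real, Real.norm_eq_abs] at h3
    refine (le_abs_self _).trans (h3.le.trans ?_)
    refine (norm_sum_le _ _).trans (sum_le_sum fun l _ => (norm_sum_le _ _).trans
      (sum_le_sum fun l' _ => ?_))
    rw [norm_mul, Complex.norm_real, Real.norm_eq_abs]
    refine mul_le_mul ?_ (norm_sum_Ioc_ex_le_geoBound ?_ _) (norm_nonneg _) (by positivity)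
    · rw [abs_mul]
      nlinarith [sq_nonneg (|b l| - |b l'|), sq_abs (b l), sq_abs (b l')]
    · exact_mod_cast (by omega)
  have hc' : IsCoprime (-a) (q : ℤ) := hc.neg_left
  have hα' : |-α - (-a : ℤ) / q| ≤ 1 / (q : ℝ) ^ 2 := by
    have : -α - (-a : ℤ) / q = -(α - a / q) := by push_cast; ring
    rwa [this, abs_neg]
  have h4 : ∑ l ∈ Ioc 0 L, ∑ l' ∈ Ioc 0 L, b l ^ 2 * geoBound M (l * α + l' * (-α)) ≤
      (∑ l ∈ Ioc 0 L, b l ^ 2) * B := by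
    rw [sum_mul]
    refine sum_le_sum fun l _ => ?_
    rw [← mul_sum]
    gcongr
    exact sum_windows_geoBound_le hq hc' hα' (Nat.cast_nonneg M) L _
  have h5 : ∑ l ∈ Ioc 0 L, ∑ l' ∈ Ioc 0 L, b l' ^ 2 * geoBound M (l * α + l' * (-α)) ≤
      (∑ l ∈ Ioc 0 L, b l ^ 2) * B := by
    rw [sum_comm, sum_mul]
    refine sum_le_sum fun l' _ => ?_
    rw [← mul_sum]
    gcongr
    simp_rw [add_comm _ ((l' : ℝ) * (-α))]
    exact sum_windows_geoBound_le hq hc hα (Nat.cast_nonneg M) L _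
  refine h2.trans ?_
  have e : ∑ l ∈ Ioc 0 L, ∑ l' ∈ Ioc 0 L, (b l ^ 2 / 2 + b l' ^ 2 / 2) * geoBound M (l * α + l' * (-α)) =
      (∑ l ∈ Ioc 0 L, ∑ l' ∈ Ioc 0 L, b l ^ 2 * geoBound M (l * α + l' * (-α)) +
      ∑ l ∈ Ioc 0 L, ∑ l' ∈ Ioc 0 L, b l' ^ 2 * geoBound M (l * α + l' * (-α))) / 2 := by
    simp_rw [← sum_add_distrib, sum_div]
    refine sum_congr rfl fun l _ => sum_congr rfl fun l' _ => ?_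
    ring
  rw [e]
  linarith

theorem card_divisors_mul_le (m n : ℕ) :
    (m * n).divisors.card ≤ m.divisors.card * n.divisors.card := by
  rw [Nat.divisors_mul]
  exact Finset.card_mul_le

theorem sum_inv_Ioc_le (y : ℕ) : ∑ d ∈ Ioc 0 y, (1 : ℝ) / d ≤ 1 + Real.log y := by
  have := harmonic_le_one_add_log y
  rw [harmonic_eq_sum_Icc] at this
  push_cast at this
  simp only [one_div]
  exact this

theorem sum_mul_card_divisors_eq (g : ℕ → ℝ) (y : ℕ) :
    ∑ n ∈ Ioc 0 y, g n * n.divisors.card = ∑ d ∈ Ioc 0 y, ∑ m ∈ Ioc 0 (y / d), g (d * m) := by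
  rw [← sum_antidiagonal_eq_sum_sum (fun d m => g (d * m)) y]
  refine sum_congr rfl fun n _ => ?_
  rw [sum_congr rfl (g := fun _ => g n) fun d hd => by rw [(Nat.mem_divisorsAntidiagonal.1 hd).1],
    sum_const, nsmul_eq_mul, mul_comm]
  congr 2
  rw [← Nat.map_div_right_divisors, Finset.card_map]

theorem sum_sq_card_divisors_le (y : ℕ) :
    ∑ n ∈ Ioc 0 y, ((n.divisors.card : ℝ)) ^ 2 ≤ y * (1 + Real.log y) ^ 3 := by
  have hl : 0 ≤ Real.log y := Real.log_natCast_nonneg y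
  have hlm : ∀ d : ℕ, Real.log (y / d : ℕ) ≤ Real.log y := fun d => by
    rcases Nat.eq_zero_or_pos (y / d) with h | h
    · rw [h]; simpa using hl
    · exact Real.log_le_log (by exact_mod_cast h) (by exact_mod_cast Nat.div_le_self y d)
  have h1 : ∀ z : ℕ, ∑ n ∈ Ioc 0 z, (n.divisors.card : ℝ) ≤ z * (1 + Real.log z) := fun z => by
    have := sum_mul_card_divisors_eq (fun _ => 1) z
    simp only [one_mul, sum_const, Nat.card_Ioc, nsmul_eq_mul, mul_one, tsub_zero] at this
    rw [this]
    calc ∑ d ∈ Ioc 0 z, ((z / d : ℕ) : ℝ) ≤ ∑ d ∈ Ioc 0 z, (z : ℝ) * (1 / d) :=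
          sum_le_sum fun d _ => by rw [mul_one_div]; exact Nat.cast_div_le
      _ ≤ _ := by
        rw [← mul_sum]
        gcongr
        exact sum_inv_Ioc_le z
  have h2 : ∑ n ∈ Ioc 0 y, (n.divisors.card : ℝ) / n ≤ (1 + Real.log y) ^ 2 := by
    have := sum_mul_card_divisors_eq (fun n => 1 / (n : ℝ)) y
    have e : ∑ n ∈ Ioc 0 y, (n.divisors.card : ℝ) / n =
        ∑ n ∈ Ioc 0 y, 1 / (n : ℝ) * (n.divisors.card : ℝ) :=
      sum_congr rfl fun n _ => by ring
    rw [e, this, sq]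
    calc ∑ d ∈ Ioc 0 y, ∑ m ∈ Ioc 0 (y / d), 1 / ((d * m : ℕ) : ℝ) ≤
        ∑ d ∈ Ioc 0 y, 1 / (d : ℝ) * (1 + Real.log y) := by
          refine sum_le_sum fun d _ => ?_
          have : ∑ m ∈ Ioc 0 (y / d), 1 / ((d * m : ℕ) : ℝ) =
              1 / (d : ℝ) * ∑ m ∈ Ioc 0 (y / d), 1 / (m : ℝ) := by
            rw [mul_sum]
            refine sum_congr rfl fun m _ => ?_
            push_cast
            rw [one_div_mul_one_div]
          rw [this]
          gcongr
          exact (sum_inv_Ioc_le _).trans (by linarith [hlm d])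
      _ ≤ _ := by
        rw [← sum_mul]
        gcongr
        exact sum_inv_Ioc_le y
  simp_rw [sq]
  rw [sum_mul_card_divisors_eq (fun n => (n.divisors.card : ℝ)) y]
  calc ∑ d ∈ Ioc 0 y, ∑ m ∈ Ioc 0 (y / d), ((d * m).divisors.card : ℝ) ≤
      ∑ d ∈ Ioc 0 y, (d.divisors.card : ℝ) / d * (y * (1 + Real.log y)) := by
        refine sum_le_sum fun d hd => ?_
        calc ∑ m ∈ Ioc 0 (y / d), ((d * m).divisors.card : ℝ) ≤
            ∑ m ∈ Ioc 0 (y / d), (d.divisors.card : ℝ) * m.divisors.card :=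
              sum_le_sum fun m _ => by exact_mod_cast card_divisors_mul_le d m
          _ ≤ d.divisors.card * ((y / d : ℕ) * (1 + Real.log (y / d : ℕ))) := by
            rw [← mul_sum]
            gcongr
            exact h1 _
          _ ≤ d.divisors.card * ((y / d) * (1 + Real.log y)) := by
            have := Real.log_natCast_nonneg (y / d)
            exact mul_le_mul_of_nonneg_left (mul_le_mul Nat.cast_div_le (by linarith [hlm d])
              (by linarith) (by positivity)) (Nat.cast_nonneg _)
          _ = _ := by ring
    _ ≤ (1 + Real.log y) ^ 2 * (y * (1 + Real.log y)) := by
      rw [← sum_mul]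
      gcongr
    _ = _ := by ring

theorem arith_sub_apply (f g : ArithmeticFunction ℝ) (n : ℕ) : (f - g) n = f n - g n := by
  have h := ArithmeticFunction.add_apply (f := f - g) (g := g) (n := n)
  rw [sub_add_cancel] at h
  linarith

/-- The restriction of an arithmetic function to `n ≤ U`. -/
noncomputable def low (f : ArithmeticFunction ℝ) (U : ℕ) : ArithmeticFunction ℝ :=
  ⟨fun n => if n ≤ U then f n else 0, by simp⟩

theorem low_apply (f : ArithmeticFunction ℝ) (U n : ℕ) :
    low f U n = if n ≤ U then f n else 0 := rfl

/-- The complementary factor in the bilinear part of Vaughan's identity. -/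
noncomputable def vco (U : ℕ) : ArithmeticFunction ℝ :=
  (((ArithmeticFunction.moebius : ArithmeticFunction ℤ) : ArithmeticFunction ℝ) -
    low (ArithmeticFunction.moebius : ArithmeticFunction ℤ) U) *
    ((ArithmeticFunction.zeta : ArithmeticFunction ℕ) : ArithmeticFunction ℝ)

theorem vaughan_identity (U : ℕ) :
    (Λ : ArithmeticFunction ℝ) = low Λ U +
      low (ArithmeticFunction.moebius : ArithmeticFunction ℤ) U * ArithmeticFunction.log -
      (low (ArithmeticFunction.moebius : ArithmeticFunction ℤ) U * low Λ U) *
        ((ArithmeticFunction.zeta : ArithmeticFunction ℕ) : ArithmeticFunction ℝ) +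
      (Λ - low Λ U) * vco U := by
  have h1 : ((ArithmeticFunction.moebius : ArithmeticFunction ℤ) : ArithmeticFunction ℝ) *
      ((ArithmeticFunction.zeta : ArithmeticFunction ℕ) : ArithmeticFunction ℝ) = 1 := by
    have := ArithmeticFunction.coe_moebius_mul_coe_zeta (R := ℝ)
    exact this
  have h2 := ArithmeticFunction.vonMangoldt_mul_zeta
  rw [vco, ← h2]
  linear_combination (-(Λ - low Λ U)) * h1

theorem norm_sum_log_mul_ex_le (M : ℕ) (θ : ℝ) :
    ‖∑ m ∈ Ioc 0 M, (Real.log m : ℂ) * ex (m * θ)‖ ≤ Real.log M * geoBound M θ := by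
  have hlog : ∀ m ∈ Ioc 0 M, Real.log m = ∑ k ∈ Ioc 0 M, if k < m then
      Real.log (k + 1 : ℕ) - Real.log k else 0 := by
    intro m hm
    rw [Finset.mem_Ioc] at hm
    rw [← sum_filter]
    have : (Ioc 0 M).filter (fun k => k < m) = Ico 1 m := by
      ext k
      simp only [mem_filter, Finset.mem_Ioc, Finset.mem_Ico]
      omega
    rw [this, Finset.sum_Ico_sub (fun k : ℕ => Real.log k) hm.1]
    simp
  have h1 : ∑ m ∈ Ioc 0 M, (Real.log m : ℂ) * ex (m * θ) = ∑ k ∈ Ioc 0 M,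
      if k < M then ((Real.log (k + 1 : ℕ) - Real.log k : ℝ) : ℂ) * ∑ m ∈ Ioc k M, ex (m * θ)
      else 0 := by
    have e1 : ∑ m ∈ Ioc 0 M, (Real.log m : ℂ) * ex (m * θ) = ∑ m ∈ Ioc 0 M, ∑ k ∈ Ioc 0 M,
        if k < m then ((Real.log (k + 1 : ℕ) - Real.log k : ℝ) : ℂ) * ex (m * θ) else 0 := by
      refine sum_congr rfl fun m hm => ?_
      rw [hlog m hm, Complex.ofReal_sum, sum_mul]
      refine sum_congr rfl fun k _ => ?_
      split_ifs <;> simp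
    rw [e1, sum_comm]
    refine sum_congr rfl fun k hk => ?_
    rw [← sum_filter, ← mul_sum]
    have : (Ioc 0 M).filter (fun m => k < m) = Ioc k M := by
      ext m
      simp only [mem_filter, Finset.mem_Ioc]
      omega
    rw [this]
    split_ifs with h
    · rfl
    · rw [Finset.Ioc_eq_empty (by omega)]
      simp
  rw [h1]
  refine (norm_sum_le _ _).trans ?_
  rcases Nat.eq_zero_or_pos M with h0 | h0
  · simp [h0]
  calc _ ≤ ∑ k ∈ Ioc 0 M, if k < M then
        (Real.log (k + 1 : ℕ) - Real.log k) * geoBound M θ else 0 := by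
        refine sum_le_sum fun k hk => ?_
        rw [Finset.mem_Ioc] at hk
        split_ifs with h
        · have : 0 ≤ Real.log (k + 1 : ℕ) - Real.log k :=
            sub_nonneg.2 (Real.log_le_log (by exact_mod_cast hk.1) (by exact_mod_cast Nat.le_succ k))
          rw [norm_mul, Complex.norm_real, Real.norm_of_nonneg this]
          gcongr
          exact norm_sum_Ioc_ex_le_geoBound (by exact_mod_cast Nat.sub_le M k) θ
        · simp
    _ = _ := by
      rw [hlog M (Finset.mem_Ioc.2 ⟨h0, le_rfl⟩), sum_mul]
      refine sum_congr rfl fun k _ => ?_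
      split_ifs <;> simp

theorem sum_low_vonMangoldt_le (x U : ℕ) : ∑ n ∈ Ioc 0 x, low Λ U n ≤ 6 * U := by
  refine le_trans ?_ (sum_vonMangoldt_le U)
  simp only [low_apply]
  rw [← sum_filter]
  refine sum_le_sum_of_subset_of_nonneg (fun n hn => ?_) fun _ _ _ =>
    ArithmeticFunction.vonMangoldt_nonneg
  rw [mem_filter, Finset.mem_Ioc] at hn
  rw [Finset.mem_Ioc]
  omega

theorem low_vonMangoldt_nonneg (U n : ℕ) : 0 ≤ low Λ U n := by
  rw [low_apply]
  split_ifs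
  · exact ArithmeticFunction.vonMangoldt_nonneg
  · exact le_rfl

theorem abs_low_moebius_le (U n : ℕ) :
    |low (ArithmeticFunction.moebius : ArithmeticFunction ℤ) U n| ≤ if n ≤ U then 1 else 0 := by
  rw [low_apply]
  split_ifs
  · rw [ArithmeticFunction.intCoe_apply]
    exact_mod_cast ArithmeticFunction.abs_moebius_le_one
  · simp

theorem abs_low_mul_low_le (U n : ℕ) :
    |(low (ArithmeticFunction.moebius : ArithmeticFunction ℤ) U * low Λ U) n| ≤
      if n ≤ U ^ 2 then Real.log n else 0 := by
  rw [ArithmeticFunction.mul_apply]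
  refine (abs_sum_le_sum_abs _ _).trans ?_
  split_ifs with h
  · rw [← ArithmeticFunction.log_apply, ← ArithmeticFunction.vonMangoldt_mul_zeta, mul_comm,
      ArithmeticFunction.mul_apply]
    refine sum_le_sum fun d hd => ?_
    have hd1 : d.1 ≠ 0 := (Nat.ne_zero_of_mem_divisorsAntidiagonal hd).1
    rw [ArithmeticFunction.natCoe_apply, ArithmeticFunction.zeta_apply_ne hd1, abs_mul,
      abs_of_nonneg (low_vonMangoldt_nonneg _ _)]
    have h1 := abs_low_moebius_le U d.1
    have h2 : low Λ U d.2 ≤ Λ d.2 := by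
      rw [low_apply]
      split_ifs
      · exact le_rfl
      · exact ArithmeticFunction.vonMangoldt_nonneg
    have h3 : |low (ArithmeticFunction.moebius : ArithmeticFunction ℤ) U d.1| ≤ 1 :=
      h1.trans (by split_ifs <;> norm_num)
    push_cast
    exact mul_le_mul h3 h2 (low_vonMangoldt_nonneg _ _) zero_le_one
  · refine (sum_eq_zero fun d hd => ?_).le
    rw [low_apply, low_apply]
    have := (Nat.mem_divisorsAntidiagonal.1 hd).1
    by_cases h1 : d.1 ≤ U
    · by_cases h2 : d.2 ≤ U
      · exfalso
        apply h
        rw [← this, sq]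
        exact Nat.mul_le_mul h1 h2
      · simp [h2]
    · simp [h1]

theorem vco_eq_zero {U n : ℕ} (h : n ≤ U) : vco U n = 0 := by
  rw [vco, ArithmeticFunction.mul_apply]
  refine sum_eq_zero fun d hd => ?_
  have h1 := Nat.mem_divisorsAntidiagonal.1 hd
  have h2 : d.1 ≤ U := (Nat.le_of_dvd (Nat.pos_of_ne_zero h1.2) ⟨d.2, h1.1.symm⟩).trans h
  rw [arith_sub_apply, low_apply, if_pos h2, sub_self, zero_mul]

theorem abs_vco_le (U n : ℕ) : |vco U n| ≤ n.divisors.card := by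
  rw [vco, ArithmeticFunction.mul_apply]
  refine (abs_sum_le_sum_abs _ _).trans ?_
  have : n.divisors.card = n.divisorsAntidiagonal.card := by
    rw [← Nat.map_div_right_divisors, Finset.card_map]
  rw [this, ← nsmul_one, ← sum_const]
  refine sum_le_sum fun d hd => ?_
  have hd2 : d.2 ≠ 0 := (Nat.ne_zero_of_mem_divisorsAntidiagonal hd).2
  rw [ArithmeticFunction.natCoe_apply, ArithmeticFunction.zeta_apply_ne hd2,
    arith_sub_apply, low_apply]
  split_ifs
  · simp
  · simp only [sub_zero, Nat.cast_one, mul_one, ArithmeticFunction.intCoe_apply]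
    exact_mod_cast ArithmeticFunction.abs_moebius_le_one

theorem esum_vaughan (x U : ℕ) (α : ℝ) :
    esum (Ioc 0 x) Λ α = esum (Ioc 0 x) (low Λ U) α +
      esum (Ioc 0 x) (low (ArithmeticFunction.moebius : ArithmeticFunction ℤ) U *
        ArithmeticFunction.log : ArithmeticFunction ℝ) α -
      esum (Ioc 0 x) ((low (ArithmeticFunction.moebius : ArithmeticFunction ℤ) U * low Λ U) *
        ((ArithmeticFunction.zeta : ArithmeticFunction ℕ) : ArithmeticFunction ℝ) :
          ArithmeticFunction ℝ) α +
      esum (Ioc 0 x) ((Λ - low Λ U) * vco U : ArithmeticFunction ℝ) α := by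
  simp only [esum]
  rw [← sum_add_distrib, ← sum_sub_distrib, ← sum_add_distrib]
  refine sum_congr rfl fun n _ => ?_
  have h := congrArg (fun f : ArithmeticFunction ℝ => f n) (vaughan_identity U)
  simp only [ArithmeticFunction.add_apply, arith_sub_apply] at h
  rw [h]
  push_cast
  ring

theorem norm_esum_typeI_log_le {x U : ℕ} (hU : U ≤ x) (α : ℝ) :
    ‖esum (Ioc 0 x) (low (ArithmeticFunction.moebius : ArithmeticFunction ℤ) U *
        ArithmeticFunction.log : ArithmeticFunction ℝ) α‖ ≤
      Real.log x * ∑ d ∈ Ioc 0 U, geoBound ((x / d : ℕ) : ℝ) (d * α) := by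
  rw [esum_mul_eq, mul_sum]
  refine (norm_sum_le _ _).trans ?_
  have hsub : Ioc 0 U ⊆ Ioc 0 x := Finset.Ioc_subset_Ioc le_rfl hU
  rw [← sum_subset hsub (fun a ha ha' => ?_)]
  · refine sum_le_sum fun d hd => ?_
    have e : ∑ b ∈ Ioc 0 (x / d), ((low (ArithmeticFunction.moebius : ArithmeticFunction ℤ) U d *
        ArithmeticFunction.log b : ℝ) : ℂ) * ex (d * b * α) =
        (low (ArithmeticFunction.moebius : ArithmeticFunction ℤ) U d : ℂ) *
        ∑ b ∈ Ioc 0 (x / d), (Real.log b : ℂ) * ex (b * (d * α)) := by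
      rw [mul_sum]
      refine sum_congr rfl fun b _ => ?_
      rw [ArithmeticFunction.log_apply, show (d * b * α : ℝ) = b * (d * α) by ring]
      push_cast
      ring
    rw [e, norm_mul, Complex.norm_real, Real.norm_eq_abs]
    have h1 := abs_low_moebius_le U d
    have h2 := norm_sum_log_mul_ex_le (x / d) (d * α)
    have h3 : Real.log (x / d : ℕ) ≤ Real.log x := by
      rcases Nat.eq_zero_or_pos (x / d) with h | h
      · rw [h]; simpa using Real.log_natCast_nonneg x
      · exact Real.log_le_log (by exact_mod_cast h) (by exact_mod_cast Nat.div_le_self x d)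
    have h4 := geoBound_nonneg (Nat.cast_nonneg (α := ℝ) (x / d)) (d * α)
    have h5 : |low (ArithmeticFunction.moebius : ArithmeticFunction ℤ) U d| ≤ 1 :=
      h1.trans (by split_ifs <;> norm_num)
    calc _ ≤ 1 * (Real.log x * geoBound ((x / d : ℕ) : ℝ) (d * α)) :=
          mul_le_mul h5 (h2.trans (by gcongr)) (norm_nonneg _) zero_le_one
      _ = _ := one_mul _
  · rw [Finset.mem_Ioc] at ha ha'
    rw [norm_eq_zero]
    refine sum_eq_zero fun b _ => ?_
    rw [low_apply, if_neg (by omega)]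
    simp

theorem norm_esum_typeI_le {x U : ℕ} (hU : U ^ 2 ≤ x) (α : ℝ) :
    ‖esum (Ioc 0 x) ((low (ArithmeticFunction.moebius : ArithmeticFunction ℤ) U * low Λ U) *
        ((ArithmeticFunction.zeta : ArithmeticFunction ℕ) : ArithmeticFunction ℝ) :
          ArithmeticFunction ℝ) α‖ ≤
      Real.log x * ∑ d ∈ Ioc 0 (U ^ 2), geoBound ((x / d : ℕ) : ℝ) (d * α) := by
  rw [esum_mul_eq, mul_sum]
  refine (norm_sum_le _ _).trans ?_
  have hsub : Ioc 0 (U ^ 2) ⊆ Ioc 0 x := Finset.Ioc_subset_Ioc le_rfl hU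
  have hab := abs_low_mul_low_le U
  rw [← sum_subset hsub (fun a ha ha' => ?_)]
  · refine sum_le_sum fun d hd => ?_
    have hd' := Finset.mem_Ioc.1 hd
    have e : ∑ b ∈ Ioc 0 (x / d), (((low (ArithmeticFunction.moebius : ArithmeticFunction ℤ) U *
        low Λ U) d *
        ((ArithmeticFunction.zeta : ArithmeticFunction ℕ) : ArithmeticFunction ℝ) b : ℝ) : ℂ) *
          ex (d * b * α) =
        ((low (ArithmeticFunction.moebius : ArithmeticFunction ℤ) U * low Λ U) d : ℂ) *
        ∑ b ∈ Ioc 0 (x / d), ex (b * (d * α)) := by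
      rw [mul_sum]
      refine sum_congr rfl fun b hb => ?_
      rw [ArithmeticFunction.natCoe_apply, ArithmeticFunction.zeta_apply_ne
        (Finset.mem_Ioc.1 hb).1.ne']
      push_cast
      rw [mul_one]
      congr 2
      ring
    rw [e, norm_mul, Complex.norm_real, Real.norm_eq_abs]
    have h1 := hab d
    rw [if_pos hd'.2] at h1
    have h2 : ‖∑ b ∈ Ioc 0 (x / d), ex (b * (d * α))‖ ≤ geoBound ((x / d : ℕ) : ℝ) (d * α) :=
      norm_sum_Ioc_ex_le_geoBound (by simp) _
    have h3 : Real.log d ≤ Real.log x :=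
      Real.log_le_log (by exact_mod_cast hd'.1) (by exact_mod_cast hd'.2.trans hU)
    exact mul_le_mul (h1.trans h3) h2 (norm_nonneg _) (Real.log_natCast_nonneg x)
  · rw [Finset.mem_Ioc] at ha ha'
    have h1 := hab a
    rw [if_neg (by omega)] at h1
    have h2 := abs_nonpos_iff.1 h1
    rw [norm_eq_zero]
    refine sum_eq_zero fun b _ => ?_
    rw [h2]
    simp

/-- The part of the bilinear sum with `m` in a dyadic block. -/
theorem typeII_block_le {q x Q M : ℕ} (hQ : 0 < Q) (hQq : Q ≤ q) (hqx : q * Q ≤ x) {a : ℤ}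
    (hc : IsCoprime a (q : ℤ)) {α : ℝ} (hα : |α - a / q| ≤ 1 / (q : ℝ) ^ 2) (hM : 0 < M) :
    ∑ m ∈ Ioc M (2 * M), |(Λ - low Λ Q) m| * ‖esum (Ioc 0 (x / m)) (vco Q) (m * α)‖ ≤
      17 * x * (1 + Real.log x) ^ 3 / √Q := by
  have hq : 0 < q := hQ.trans_le hQq
  have hx : 0 < x := lt_of_lt_of_le (Nat.mul_pos hq hQ) hqx
  have hlx : 0 ≤ Real.log x := Real.log_natCast_nonneg x
  have hQ' : (0 : ℝ) < Q := by exact_mod_cast hQ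
  have hq' : (0 : ℝ) < q := by exact_mod_cast hq
  have hM' : (0 : ℝ) < M := by exact_mod_cast hM
  have hx' : (0 : ℝ) < x := by exact_mod_cast hx
  have hrhs : 0 ≤ 17 * x * (1 + Real.log x) ^ 3 / √Q := by positivity
  by_cases c1 : 2 * M ≤ Q
  · refine le_of_eq_of_le (sum_eq_zero fun m hm => ?_) hrhs
    rw [Finset.mem_Ioc] at hm
    rw [arith_sub_apply, low_apply, if_pos (by omega), sub_self, abs_zero, zero_mul]
  by_cases c2 : x / M ≤ Q
  · refine le_of_eq_of_le (sum_eq_zero fun m hm => ?_) hrhs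
    rw [Finset.mem_Ioc] at hm
    have : esum (Ioc 0 (x / m)) (vco Q) (m * α) = 0 := by
      rw [esum]
      refine sum_eq_zero fun l hl => ?_
      have h1 : x / m ≤ x / M := Nat.div_le_div_left hm.1.le hM
      rw [vco_eq_zero ((Finset.mem_Ioc.1 hl).2.trans (h1.trans c2))]
      simp
    rw [this, norm_zero, mul_zero]
  push Not at c1 c2
  set ℓ := 1 + Real.log x with hℓ
  have hℓ1 : 1 ≤ ℓ := by linarith
  have hMx : M * Q ≤ x := by
    have := Nat.div_mul_le_self x M
    nlinarith
  have hMQx : (M : ℝ) ≤ x / Q := by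
    rw [le_div_iff₀ hQ']
    exact_mod_cast hMx
  have hqQx : (q : ℝ) ≤ x / Q := by
    rw [le_div_iff₀ hQ']
    exact_mod_cast hqx
  have hxM : (x : ℝ) / M ≤ 2 * (x / Q) := by
    have : (Q : ℝ) ≤ 2 * M := by exact_mod_cast c1.le
    rw [mul_div_assoc', div_le_div_iff₀ hM' hQ']
    nlinarith
  have hxq : (x : ℝ) / q ≤ x / Q := by gcongr
  have hlogM : Real.log (2 * M) ≤ ℓ := by
    rw [Real.log_mul (by norm_num) hM'.ne']
    have h1 : Real.log M ≤ Real.log x := Real.log_le_log hM' (by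
      exact_mod_cast (Nat.le_mul_of_pos_right M hQ).trans hMx)
    have := Real.log_two_lt_d9
    linarith
  have hA : ∑ m ∈ Ioc M (2 * M), |(Λ - low Λ Q) m| ^ 2 ≤ 12 * M * ℓ := by
    have h1 : ∀ m ∈ Ioc M (2 * M), |(Λ - low Λ Q) m| ^ 2 ≤ Λ m * ℓ := by
      intro m hm
      rw [Finset.mem_Ioc] at hm
      have hm0 : (0 : ℝ) < m := by exact_mod_cast hM.trans hm.1
      have h2 : Λ m ≤ ℓ := ArithmeticFunction.vonMangoldt_le_log.trans
        ((Real.log_le_log hm0 (by exact_mod_cast hm.2)).trans hlogM)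
      have h3 : |(Λ - low Λ Q) m| ≤ Λ m := by
        have := ArithmeticFunction.vonMangoldt_nonneg (n := m)
        rw [arith_sub_apply, low_apply]
        split_ifs
        · simp [this]
        · rw [sub_zero, abs_of_nonneg this]
      rw [sq]
      exact mul_le_mul h3 (h3.trans h2) (abs_nonneg _) ArithmeticFunction.vonMangoldt_nonneg
    refine (sum_le_sum h1).trans ?_
    rw [← sum_mul]
    have h4 : ∑ m ∈ Ioc M (2 * M), Λ m ≤ 6 * ((2 * M : ℕ) : ℝ) :=
      (sum_le_sum_of_subset_of_nonneg (Finset.Ioc_subset_Ioc (Nat.zero_le _) le_rfl)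
        fun _ _ _ => ArithmeticFunction.vonMangoldt_nonneg).trans (sum_vonMangoldt_le (2 * M))
    push_cast at h4
    have := mul_le_mul_of_nonneg_right h4 (by linarith : 0 ≤ ℓ)
    linarith
  have hB := sum_norm_sq_typeII_le (x := x) hq hc hα hM (vco Q)
  set L := x / M with hL
  have hLx : (L : ℝ) ≤ x / M := Nat.cast_div_le
  have hLx' : Real.log L ≤ Real.log x := Real.log_le_log (by exact_mod_cast hQ.trans c2)
    (by exact_mod_cast Nat.div_le_self x M)
  have hlL : 0 ≤ Real.log L := Real.log_natCast_nonneg L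
  have hb : ∑ l ∈ Ioc 0 L, vco Q l ^ 2 ≤ (x / M) * ℓ ^ 3 := by
    calc ∑ l ∈ Ioc 0 L, vco Q l ^ 2 ≤ ∑ l ∈ Ioc 0 L, ((l.divisors.card : ℝ)) ^ 2 := by
          refine sum_le_sum fun l _ => ?_
          rw [← sq_abs]
          have := abs_vco_le Q l
          gcongr
      _ ≤ L * (1 + Real.log L) ^ 3 := sum_sq_card_divisors_le L
      _ ≤ _ := by
        refine mul_le_mul hLx ?_ (by positivity) (by positivity)
        exact pow_le_pow_left₀ (by linarith) (by linarith) 3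
  have hlogq : 1 + Real.log q ≤ ℓ := by
    have : Real.log q ≤ Real.log x := Real.log_le_log hq' (by
      exact_mod_cast (Nat.le_mul_of_pos_right q hQ).trans hqx)
    linarith
  have hlogq0 : 0 ≤ Real.log q := Real.log_natCast_nonneg q
  have hG : ((L : ℝ) / q + 1) * (3 * M + 6 * q * (1 + Real.log q)) ≤ 24 * ℓ * (x / Q) := by
    calc ((L : ℝ) / q + 1) * (3 * M + 6 * q * (1 + Real.log q)) ≤
        ((x / M : ℝ) / q + 1) * (3 * M + 6 * q * ℓ) := by gcongr
      _ = 3 * (x / q) + 6 * (x / M) * ℓ + 3 * M + 6 * q * ℓ := by field_simp; ring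
      _ ≤ 3 * (x / Q) + 6 * (2 * (x / Q)) * ℓ + 3 * (x / Q) + 6 * (x / Q) * ℓ := by gcongr
      _ ≤ _ := by
        have : 0 ≤ (x : ℝ) / Q := by positivity
        nlinarith
  have hB' : ∑ m ∈ Ioc M (2 * M), ‖esum (Ioc 0 (x / m)) (vco Q) (m * α)‖ ^ 2 ≤
      ((x / M) * ℓ ^ 3) * (24 * ℓ * (x / Q)) :=
    hB.trans (mul_le_mul hb hG (by positivity) (by positivity))
  have hCS := sum_mul_sq_le_sq_mul_sq (Ioc M (2 * M)) (fun m => |(Λ - low Λ Q) m|)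
    (fun m => ‖esum (Ioc 0 (x / m)) (vco Q) (m * α)‖)
  refine abs_le_of_sq_le_sq' ?_ hrhs |>.2
  refine hCS.trans ((mul_le_mul hA hB' (sum_nonneg fun _ _ => sq_nonneg _) (by positivity)).trans ?_)
  rw [div_pow, Real.sq_sqrt hQ'.le]
  have e : 12 * M * ℓ * (x / M * ℓ ^ 3 * (24 * ℓ * (x / Q))) = 288 * x ^ 2 * ℓ ^ 5 / Q := by
    field_simp
    norm_num
  rw [e, mul_pow, mul_pow, ← pow_mul]
  gcongr ?_ * _ ^ 2 * ?_ / _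
  · norm_num
  · exact pow_le_pow_right₀ hℓ1 (by norm_num)

theorem norm_esum_typeII_le {q x Q : ℕ} (hQ : 0 < Q) (hQq : Q ≤ q) (hqx : q * Q ≤ x) {a : ℤ}
    (hc : IsCoprime a (q : ℤ)) {α : ℝ} (hα : |α - a / q| ≤ 1 / (q : ℝ) ^ 2) :
    ‖esum (Ioc 0 x) ((Λ - low Λ Q) * vco Q : ArithmeticFunction ℝ) α‖ ≤
      34 * x * (1 + Real.log x) ^ 4 / √Q := by
  have hx : 0 < x := lt_of_lt_of_le (Nat.mul_pos (hQ.trans_le hQq) hQ) hqx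
  have hlx : 0 ≤ Real.log x := Real.log_natCast_nonneg x
  set I := Nat.log 2 x + 1 with hI
  have hxI : x ≤ 2 ^ I := (Nat.lt_pow_succ_log_self (by norm_num) x).le
  have hIl : (I : ℝ) ≤ 2 * (1 + Real.log x) := by
    have h1 : ((2 ^ Nat.log 2 x : ℕ) : ℝ) ≤ x := by exact_mod_cast Nat.pow_log_le_self 2 hx.ne'
    have h2 := Real.log_le_log (by positivity) h1
    push_cast at h2
    rw [Real.log_pow] at h2
    have h3 := Real.log_two_gt_d9
    have h4 : (0 : ℝ) ≤ Nat.log 2 x := Nat.cast_nonneg _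
    rw [hI]
    push_cast
    nlinarith
  set F : ℕ → ℝ := fun m => |(Λ - low Λ Q) m| * ‖esum (Ioc 0 (x / m)) (vco Q) (m * α)‖ with hF
  have hF0 : ∀ m, 0 ≤ F m := fun m => by simp only [hF]; positivity
  have h1 : ‖esum (Ioc 0 x) ((Λ - low Λ Q) * vco Q : ArithmeticFunction ℝ) α‖ ≤
      ∑ m ∈ Ioc 0 x, F m := by
    rw [esum_mul_eq]
    refine (norm_sum_le _ _).trans (sum_le_sum fun m _ => le_of_eq ?_)
    have e : ∑ b ∈ Ioc 0 (x / m), (((Λ - low Λ Q) m * vco Q b : ℝ) : ℂ) * ex (m * b * α) =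
        ((Λ - low Λ Q) m : ℂ) * esum (Ioc 0 (x / m)) (vco Q) (m * α) := by
      rw [esum, mul_sum]
      refine sum_congr rfl fun b _ => ?_
      rw [show (m * b * α : ℝ) = b * (m * α) by ring]
      push_cast
      ring
    rw [e, norm_mul, Complex.norm_real, Real.norm_eq_abs]
  have h2 : ∑ m ∈ Ioc 0 x, F m ≤ ∑ m ∈ Ioc 1 (2 ^ I), F m := by
    have h3 : ∑ m ∈ Ioc 0 x, F m = ∑ m ∈ Ioc 1 x, F m := by
      refine (sum_subset (Finset.Ioc_subset_Ioc (Nat.zero_le 1) le_rfl) fun m hm hm' => ?_).symm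
      rw [Finset.mem_Ioc] at hm hm'
      have : m = 1 := by omega
      simp only [hF]
      rw [this, arith_sub_apply, low_apply, if_pos (show 1 ≤ Q from hQ), sub_self, abs_zero, zero_mul]
    rw [h3]
    exact sum_le_sum_of_subset_of_nonneg (Finset.Ioc_subset_Ioc le_rfl hxI) fun _ _ _ => hF0 _
  rw [sum_Ioc_one_two_pow] at h2
  have h4 := sum_le_sum (s := range I) fun i _ => typeII_block_le hQ hQq hqx hc hα
    (M := 2 ^ i) (by positivity)
  rw [sum_const, card_range, nsmul_eq_mul] at h4
  have h5 : (I : ℝ) * (17 * x * (1 + Real.log x) ^ 3 / √Q) ≤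
      2 * (1 + Real.log x) * (17 * x * (1 + Real.log x) ^ 3 / √Q) := by gcongr
  have e : 2 * (1 + Real.log x) * (17 * x * (1 + Real.log x) ^ 3 / √Q) =
      34 * x * (1 + Real.log x) ^ 4 / √Q := by ring
  linarith

/-- Vinogradov's minor arc estimate. -/
theorem norm_pS_le_minor {q x Q : ℕ} (hQ : 0 < Q) (hQq : Q ≤ q) (hqx : q * Q ≤ x)
    (hQx : Q ^ 3 ≤ x) {a : ℤ} (hc : IsCoprime a (q : ℤ)) {α : ℝ}
    (hα : |α - a / q| ≤ 1 / (q : ℝ) ^ 2) :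
    ‖pS x α‖ ≤ 130 * x * (1 + Real.log x) ^ 4 / √Q := by
  have hq : 0 < q := hQ.trans_le hQq
  have hx : 0 < x := lt_of_lt_of_le (Nat.mul_pos hq hQ) hqx
  have hx1 : (1 : ℝ) ≤ x := by exact_mod_cast hx
  have hlx : 0 ≤ Real.log x := Real.log_natCast_nonneg x
  have hQ' : (0 : ℝ) < Q := by exact_mod_cast hQ
  have hQ1 : (1 : ℝ) ≤ Q := by exact_mod_cast hQ
  have hq' : (0 : ℝ) < q := by exact_mod_cast hq
  have hx' : (0 : ℝ) < x := by exact_mod_cast hx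
  set ℓ := 1 + Real.log x with hℓ
  have hℓ1 : 1 ≤ ℓ := by linarith
  have hQ2 : Q ^ 2 ≤ x := (Nat.pow_le_pow_right hQ (by norm_num)).trans hQx
  have hQ1x : Q ≤ x := (Nat.le_self_pow (by norm_num) Q).trans hQ2
  have hS : (x : ℝ) / Q ≤ x / √Q := by
    have : √(Q : ℝ) ≤ Q := Real.sqrt_le_iff.2 ⟨hQ'.le, by nlinarith⟩
    gcongr
  have hqQx : (q : ℝ) ≤ x / Q := by
    rw [le_div_iff₀ hQ']
    exact_mod_cast hqx
  have hQ2x : ((Q ^ 2 : ℕ) : ℝ) ≤ x / Q := by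
    rw [le_div_iff₀ hQ']
    exact_mod_cast (by rw [← pow_succ]; exact hQx : Q ^ 2 * Q ≤ x)
  have hQQx : (Q : ℝ) ≤ x / Q := by
    refine le_trans ?_ hQ2x
    exact_mod_cast Nat.le_self_pow (by norm_num) Q
  have hlogq : 1 + Real.log q ≤ ℓ := by
    have : Real.log q ≤ Real.log x := Real.log_le_log hq' (by
      exact_mod_cast (Nat.le_mul_of_pos_right q hQ).trans hqx)
    linarith
  have hlogq0 : 0 ≤ Real.log q := Real.log_natCast_nonneg q
  have hxq : (x : ℝ) / q ≤ x / Q := by gcongr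
  have hI : ∀ D : ℕ, D ≤ Q ^ 2 →
      ∑ d ∈ Ioc 0 D, geoBound ((x / d : ℕ) : ℝ) (d * α) ≤ 27 * (x / Q) * ℓ := by
    intro D hD
    have h1 := sum_geoBound_typeI_le hq hc hα (hD.trans hQ2)
    refine h1.trans ?_
    have hD' : (D : ℝ) ≤ x / Q := le_trans (by exact_mod_cast hD) hQ2x
    calc 12 * ((x : ℝ) / q) * (1 + Real.log x) + (6 * D + 9 * q) * (1 + Real.log q) ≤
        12 * ((x : ℝ) / Q) * ℓ + (6 * (x / Q) + 9 * (x / Q)) * ℓ := by gcongr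
      _ = _ := by ring
  have hu : 0 ≤ (x : ℝ) / Q := by positivity
  have hp2 : ℓ ^ 2 ≤ ℓ ^ 4 := pow_le_pow_right₀ hℓ1 (by norm_num)
  have hp1 : ℓ ≤ ℓ ^ 4 := le_self_pow₀ hℓ1 (by norm_num)
  have hp0 : 1 ≤ ℓ ^ 4 := one_le_pow₀ hℓ1
  have t1 : ‖esum (Ioc 0 x) (low Λ Q) α‖ ≤ 6 * (x / Q) * ℓ ^ 4 := by
    refine (norm_esum_le _ _ _).trans ?_
    have h1 : ∑ n ∈ Ioc 0 x, |low Λ Q n| ≤ 6 * Q := by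
      refine le_trans (le_of_eq (sum_congr rfl fun n _ => ?_)) (sum_low_vonMangoldt_le x Q)
      exact abs_of_nonneg (low_vonMangoldt_nonneg _ _)
    have h2 : 6 * (x / Q : ℝ) * 1 ≤ 6 * (x / Q) * ℓ ^ 4 := by gcongr
    linarith
  have t2 := norm_esum_typeI_log_le hQ1x α
  have t3 := norm_esum_typeI_le hQ2 α
  have t4 := norm_esum_typeII_le hQ hQq hqx hc hα
  have t2' : Real.log x * ∑ d ∈ Ioc 0 Q, geoBound ((x / d : ℕ) : ℝ) (d * α) ≤
      27 * (x / Q) * ℓ ^ 4 := by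
    have h1 := hI Q (Nat.le_self_pow (by norm_num) Q)
    calc _ ≤ ℓ * (27 * (x / Q) * ℓ) :=
          mul_le_mul (by linarith) h1 (sum_nonneg fun _ _ => geoBound_nonneg (Nat.cast_nonneg _) _)
            (by linarith)
      _ = 27 * (x / Q) * ℓ ^ 2 := by ring
      _ ≤ _ := by gcongr
  have t3' : Real.log x * ∑ d ∈ Ioc 0 (Q ^ 2), geoBound ((x / d : ℕ) : ℝ) (d * α) ≤
      27 * (x / Q) * ℓ ^ 4 := by
    have h1 := hI (Q ^ 2) le_rfl
    calc _ ≤ ℓ * (27 * (x / Q) * ℓ) :=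
          mul_le_mul (by linarith) h1 (sum_nonneg fun _ _ => geoBound_nonneg (Nat.cast_nonneg _) _)
            (by linarith)
      _ = 27 * (x / Q) * ℓ ^ 2 := by ring
      _ ≤ _ := by gcongr
  have t5 : ‖esum (Ioc 0 x) npm α‖ ≤ 2 * (x / Q) * ℓ ^ 4 := by
    refine (norm_esum_le _ _ _).trans ?_
    have h1 : ∑ n ∈ Ioc 0 x, |npm n| ≤ 2 * √x * Real.log x := by
      refine le_trans (le_of_eq (sum_congr rfl fun n _ => ?_)) (sum_npm_le x hx)
      exact abs_of_nonneg (npm_nonneg _)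
    refine h1.trans ?_
    have h2 : √(x : ℝ) ≤ x / Q := by
      rw [le_div_iff₀ hQ']
      have h3 : (Q : ℝ) ≤ √x := Real.le_sqrt_of_sq_le (by exact_mod_cast hQ2)
      calc √(x : ℝ) * Q ≤ √x * √x := by gcongr
        _ = x := Real.mul_self_sqrt hx'.le
    have h3 : Real.log x ≤ ℓ ^ 4 := by linarith
    gcongr
  have e : pS x α = esum (Ioc 0 x) Λ α - esum (Ioc 0 x) npm α := by
    rw [pS, esum, esum, esum, ← sum_sub_distrib]
    refine sum_congr rfl fun n _ => ?_
    rw [← lp_add_npm]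
    push_cast
    ring
  rw [e, esum_vaughan x Q]
  set A1 := esum (Ioc 0 x) (low Λ Q) α
  set A2 := esum (Ioc 0 x) (low (ArithmeticFunction.moebius : ArithmeticFunction ℤ) Q *
        ArithmeticFunction.log : ArithmeticFunction ℝ) α
  set A3 := esum (Ioc 0 x) ((low (ArithmeticFunction.moebius : ArithmeticFunction ℤ) Q * low Λ Q) *
        ((ArithmeticFunction.zeta : ArithmeticFunction ℕ) : ArithmeticFunction ℝ) :
          ArithmeticFunction ℝ) α
  set A4 := esum (Ioc 0 x) ((Λ - low Λ Q) * vco Q : ArithmeticFunction ℝ) α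
  set A5 := esum (Ioc 0 x) npm α
  have n1 : ‖A1 + A2 - A3 + A4 - A5‖ ≤ ‖A1‖ + ‖A2‖ + ‖A3‖ + ‖A4‖ + ‖A5‖ := by
    have := norm_sub_le (A1 + A2 - A3 + A4) A5
    have := norm_add_le (A1 + A2 - A3) A4
    have := norm_sub_le (A1 + A2) A3
    have := norm_add_le A1 A2
    linarith
  have hfin : (x / Q : ℝ) * ℓ ^ 4 ≤ x / √Q * ℓ ^ 4 := by gcongr
  have e2 : 130 * x * ℓ ^ 4 / √Q = 130 * (x / √Q * ℓ ^ 4) := by ring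
  have e3 : 34 * x * ℓ ^ 4 / √Q = 34 * (x / √Q * ℓ ^ 4) := by ring
  have hpos : 0 ≤ x / √Q * ℓ ^ 4 := by positivity
  rw [e2]
  rw [e3] at t4
  linarith

/-- The kernel `∫₀¹ t(1-t)e^{itu} dt`. -/
noncomputable def ker (u : ℝ) : ℂ :=
  ∫ t in (0 : ℝ)..1, ((t * (1 - t) : ℝ) : ℂ) * Complex.exp (Complex.I * ((t * u : ℝ) : ℂ))

lemma norm_exp_I_mul (x : ℝ) : ‖Complex.exp (Complex.I * (x : ℂ))‖ = 1 := by
  rw [mul_comm]; exact Complex.norm_exp_ofReal_mul_I x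

lemma continuous_ker : Continuous ker := by
  unfold ker
  apply intervalIntegral.continuous_parametric_intervalIntegral_of_continuous'
  simp only [Function.uncurry_def]
  fun_prop

lemma norm_ker_le_one (u : ℝ) : ‖ker u‖ ≤ 1 := by
  unfold ker
  have := intervalIntegral.norm_integral_le_of_norm_le_const (a := (0 : ℝ)) (b := 1) (C := 1)
    (f := fun t : ℝ => ((t * (1 - t) : ℝ) : ℂ) * Complex.exp (Complex.I * ((t * u : ℝ) : ℂ))) ?_
  · simpa using this
  · intro t ht
    rw [Set.uIoc_of_le zero_le_one] at ht
    rw [norm_mul, norm_exp_I_mul, mul_one, Complex.norm_real, Real.norm_eq_abs, abs_le]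
    constructor <;> nlinarith [ht.1, ht.2]

lemma ker_eq (u : ℝ) (hu : u ≠ 0) : ker u =
    (Complex.exp (Complex.I * u) * (1 / (Complex.I * u) ^ 2 - 2 / (Complex.I * u) ^ 3)) +
      (1 / (Complex.I * u) ^ 2 + 2 / (Complex.I * u) ^ 3) := by
  set c : ℂ := Complex.I * u with hc
  have hc0 : c ≠ 0 := by simp [hc, hu]
  have hd : ∀ t ∈ Set.uIcc (0 : ℝ) 1, HasDerivAt (fun t : ℝ => Complex.exp (c * t) *
      ((t : ℂ) * (1 - t) / c - (1 - 2 * t) / c ^ 2 - 2 / c ^ 3))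
      (((t * (1 - t) : ℝ) : ℂ) * Complex.exp (Complex.I * ((t * u : ℝ) : ℂ))) t := by
    intro t _
    have h1 : HasDerivAt (fun t : ℝ => (t : ℂ)) 1 t := Complex.ofRealCLM.hasDerivAt
    have h2 := (h1.const_mul c).cexp
    have h3 : HasDerivAt (fun t : ℝ => (t : ℂ) * (1 - t) / c - (1 - 2 * t) / c ^ 2 - 2 / c ^ 3)
        ((1 * (1 - (t : ℂ)) + t * (0 - 1)) / c - (0 - 2 * 1) / c ^ 2) t := by
      have ha := (h1.mul ((hasDerivAt_const t (1 : ℂ)).sub h1)).div_const c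
      have hb := ((hasDerivAt_const t (1 : ℂ)).sub (h1.const_mul 2)).div_const (c ^ 2)
      exact (ha.sub hb).sub_const _
    refine (h2.mul h3).congr_deriv ?_
    have : Complex.I * ((t * u : ℝ) : ℂ) = c * t := by rw [hc]; push_cast; ring
    rw [this]
    push_cast
    field_simp
    ring
  unfold ker
  rw [intervalIntegral.integral_eq_sub_of_hasDerivAt hd]
  · push_cast
    simp
    ring
  · apply Continuous.intervalIntegrable
    fun_prop

lemma norm_ker_le (u : ℝ) : ‖ker u‖ ≤ 12 / (1 + u ^ 2) := by
  rw [le_div_iff₀ (by positivity)]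
  rcases le_or_gt |u| 1 with h | h
  · have h1 := norm_ker_le_one u
    have h2 : u ^ 2 ≤ 1 := by rw [← sq_abs]; nlinarith [abs_nonneg u]
    nlinarith [norm_nonneg (ker u)]
  · have hu : u ≠ 0 := by rintro rfl; norm_num at h
    have h1 : ‖ker u‖ ≤ 2 / |u| ^ 2 + 4 / |u| ^ 3 := by
      rw [ker_eq u hu]
      have hn : ‖(Complex.I * u : ℂ)‖ = |u| := by simp
      have e1 : ‖(1 / (Complex.I * u) ^ 2 : ℂ)‖ = 1 / |u| ^ 2 := by
        rw [norm_div, norm_pow, hn, norm_one]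
      have e2 : ‖(2 / (Complex.I * u) ^ 3 : ℂ)‖ = 2 / |u| ^ 3 := by
        rw [norm_div, norm_pow, hn]; simp
      calc _ ≤ _ := norm_add_le _ _
        _ ≤ (1 / |u| ^ 2 + 2 / |u| ^ 3) + (1 / |u| ^ 2 + 2 / |u| ^ 3) := by
            rw [norm_mul, norm_exp_I_mul, one_mul, ← e1, ← e2]
            exact add_le_add (norm_sub_le _ _) (norm_add_le _ _)
        _ = _ := by ring
    have h2 : 4 / |u| ^ 3 ≤ 4 / |u| ^ 2 := by
      gcongr
      · exact h.le
      · norm_num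
    have h3 : ‖ker u‖ ≤ 6 / |u| ^ 2 := by
      calc _ ≤ _ := h1
        _ ≤ 2 / |u| ^ 2 + 4 / |u| ^ 2 := by linarith
        _ = _ := by ring
    rw [sq_abs] at h3
    have h4 : (1 : ℝ) < u ^ 2 := by rw [← sq_abs]; nlinarith
    rw [le_div_iff₀ (by linarith)] at h3
    nlinarith [norm_nonneg (ker u)]

lemma ker_ne_zero (u : ℝ) (hu : |u| ≤ 1) : ker u ≠ 0 := by
  have h0 : ∀ t : ℝ, (((t * (1 - t) : ℝ) : ℂ) * Complex.exp (Complex.I * ((t * u : ℝ) : ℂ))).re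
      = t * (1 - t) * Real.cos (t * u) := by
    intro t
    rw [Complex.re_ofReal_mul, mul_comm Complex.I, Complex.exp_ofReal_mul_I_re]
  have h1 : (ker u).re = ∫ t in (0 : ℝ)..1, t * (1 - t) * Real.cos (t * u) := by
    unfold ker
    have := (Complex.reCLM.intervalIntegral_comp_comm (μ := MeasureTheory.volume) (a := 0) (b := 1)
      (f := fun t : ℝ => ((t * (1 - t) : ℝ) : ℂ) * Complex.exp (Complex.I * ((t * u : ℝ) : ℂ)))
      (by apply Continuous.intervalIntegrable; fun_prop))
    simp only [Complex.reCLM_apply, h0] at this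
    exact this.symm
  have h2 : 0 < ∫ t in (0 : ℝ)..1, t * (1 - t) * Real.cos (t * u) := by
    apply intervalIntegral.intervalIntegral_pos_of_pos_on
    · apply Continuous.intervalIntegrable; fun_prop
    · intro t ht
      have hc : 0 < Real.cos (t * u) := by
        have h3 : |t * u| ≤ 1 := by
          rw [abs_mul, abs_of_pos ht.1]
          nlinarith [ht.1, ht.2, abs_nonneg u]
        apply Real.cos_pos_of_mem_Ioo
        constructor <;> linarith [(abs_le.1 h3).1, (abs_le.1 h3).2, Real.pi_gt_three]
      have := ht.1
      have := ht.2
      have : 0 < 1 - t := by linarith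
      positivity
    · norm_num
  intro h
  rw [h] at h1
  simp at h1
  linarith

lemma sum_amalgam {m : ℕ → ℝ} {B : ℝ} (hB : 0 ≤ B) (hm0 : ∀ n, 0 ≤ m n)
    (hm : ∀ X : ℕ, ∑ n ∈ Ioc 0 X, m n ≤ B * X) {b : ℤ → ℝ} (hb : ∀ k, 0 ≤ b k) (y : ℝ)
    (F : Finset ℕ) :
    ∑ n ∈ F, m n / n * b ⌊y - Real.log n⌋ ≤
      Real.exp 1 * B * ∑ k ∈ F.image (fun n : ℕ => ⌊y - Real.log n⌋), b k := by
  rw [← Finset.sum_fiberwise_of_maps_to (g := fun n : ℕ => ⌊y - Real.log n⌋)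
    (t := F.image (fun n : ℕ => ⌊y - Real.log n⌋)) (fun n hn => Finset.mem_image_of_mem _ hn),
    Finset.mul_sum]
  apply Finset.sum_le_sum
  intro k _
  have h1 : ∑ n ∈ F.filter (fun n : ℕ => ⌊y - Real.log n⌋ = k), m n / n * b ⌊y - Real.log n⌋ =
      (∑ n ∈ F.filter (fun n : ℕ => ⌊y - Real.log n⌋ = k), m n / n) * b k := by
    rw [Finset.sum_mul]
    apply Finset.sum_congr rfl
    intro n hn
    rw [(Finset.mem_filter.1 hn).2]
  rw [h1]
  apply mul_le_mul_of_nonneg_right _ (hb k)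
  set X : ℕ := ⌊Real.exp (y - k)⌋₊ with hX
  have h2 : ∑ n ∈ F.filter (fun n : ℕ => ⌊y - Real.log n⌋ = k), m n / n ≤
      ∑ n ∈ Ioc 0 X, m n * Real.exp (-(y - k - 1)) := by
    rw [← Finset.sum_filter_add_sum_filter_not (F.filter (fun n : ℕ => ⌊y - Real.log n⌋ = k))
      (fun n => n = 0)]
    have hz : ∑ n ∈ (F.filter (fun n : ℕ => ⌊y - Real.log n⌋ = k)).filter (fun n => n = 0),
        m n / n = 0 := by
      apply Finset.sum_eq_zero
      intro n hn
      rw [(Finset.mem_filter.1 hn).2]; simp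
    rw [hz, zero_add]
    have key : ∀ n ∈ (F.filter (fun n : ℕ => ⌊y - Real.log n⌋ = k)).filter (fun n => ¬ n = 0),
        n ∈ Ioc 0 X ∧ m n / n ≤ m n * Real.exp (-(y - k - 1)) := by
      intro n hn
      simp only [Finset.mem_filter] at hn
      obtain ⟨⟨_, hk⟩, hn0⟩ := hn
      have hnp : (0 : ℝ) < n := by exact_mod_cast Nat.pos_of_ne_zero hn0
      rw [Int.floor_eq_iff] at hk
      refine ⟨Finset.mem_Ioc.2 ⟨Nat.pos_of_ne_zero hn0, ?_⟩, ?_⟩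
      · apply Nat.le_floor
        rw [← Real.log_le_iff_le_exp hnp]
        linarith
      · rw [div_eq_mul_inv, Real.exp_neg]
        apply mul_le_mul_of_nonneg_left _ (hm0 n)
        apply inv_anti₀ (Real.exp_pos _)
        rw [← Real.le_log_iff_exp_le hnp]
        linarith
    calc _ ≤ ∑ n ∈ (F.filter (fun n : ℕ => ⌊y - Real.log n⌋ = k)).filter (fun n => ¬ n = 0),
          m n * Real.exp (-(y - k - 1)) := Finset.sum_le_sum fun n hn => (key n hn).2
      _ ≤ _ := Finset.sum_le_sum_of_subset_of_nonneg (fun n hn => (key n hn).1)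
          fun n _ _ => mul_nonneg (hm0 n) (Real.exp_pos _).le
  refine h2.trans ?_
  rw [← Finset.sum_mul]
  have h3 : (X : ℝ) ≤ Real.exp (y - k) := Nat.floor_le (Real.exp_pos _).le
  calc _ ≤ (B * Real.exp (y - k)) * Real.exp (-(y - k - 1)) := by
        apply mul_le_mul_of_nonneg_right _ (Real.exp_pos _).le
        exact (hm X).trans (mul_le_mul_of_nonneg_left h3 hB)
    _ = _ := by
        rw [mul_assoc, ← Real.exp_add, mul_comm]
        congr 2
        ring

/-- Summable weights dominating `1 / (1 + u²)` on unit intervals. -/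
noncomputable def wt (k : ℤ) : ℝ := 3 / (1 + (k : ℝ) ^ 2)

lemma wt_nonneg (k : ℤ) : 0 ≤ wt k := by unfold wt; positivity

lemma summable_wt : Summable wt := by
  have h : Summable (fun k : ℤ => 3 * ((1 : ℝ) / (k : ℝ) ^ 2) + (if k = 0 then 3 else 0)) := by
    apply Summable.add
    · exact (Real.summable_one_div_int_pow.2 (by norm_num)).mul_left 3
    · exact summable_of_ne_finset_zero (s := {0}) (by intro k hk; simp at hk; simp [hk])
  apply Summable.of_nonneg_of_le wt_nonneg _ h
  intro k
  unfold wt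
  by_cases hk : k = 0
  · simp [hk]
  · have : (0 : ℝ) < (k : ℝ) ^ 2 := by positivity
    simp only [hk, if_false, add_zero]
    rw [mul_one_div]
    apply div_le_div_of_nonneg_left (by norm_num) this (by linarith)

lemma inv_le_wt (u : ℝ) : 1 / (1 + u ^ 2) ≤ wt ⌊u⌋ := by
  unfold wt
  rw [div_le_div_iff₀ (by positivity) (by positivity)]
  have h1 := Int.floor_le u
  have h2 := Int.lt_floor_add_one u
  nlinarith [sq_nonneg (u - (⌊u⌋ - 1 : ℝ)), sq_nonneg (u + (⌊u⌋ : ℝ)), sq_nonneg u, sq_nonneg (u - 1), sq_nonneg (u + 1), sq_nonneg (2 * u - ⌊u⌋)]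

/-- The hypotheses of the Wiener–Ikehara theorem for the coefficients `E`: a Chebyshev bound and a
continuous extension `H` of the Dirichlet series to the closed half plane `1 ≤ re s`. -/
structure WienerData (E : ℕ → ℂ) (m : ℕ → ℝ) (B : ℝ) (H : ℂ → ℂ) : Prop where
  nonneg : 0 ≤ B
  norm_le : ∀ n, ‖E n‖ ≤ m n
  sum_le : ∀ X : ℕ, ∑ n ∈ Ioc 0 X, m n ≤ B * X
  cont : ContinuousOn H {s | 1 ≤ s.re}
  hasSum : ∀ s : ℂ, 1 < s.re → LSeriesHasSum E s (H s)

variable {E : ℕ → ℂ} {m : ℕ → ℝ} {B : ℝ} {H : ℂ → ℂ}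

lemma WienerData.m_nonneg (h : WienerData E m B H) (n : ℕ) : 0 ≤ m n :=
  (norm_nonneg _).trans (h.norm_le n)

/-- The smoothed average of `E n / n` against `φ` at logarithmic scale. -/
noncomputable def logAvg (E : ℕ → ℂ) (φ : ℝ → ℂ) (y : ℝ) : ℂ :=
  ∑' n : ℕ, E n / n * φ (y - Real.log n)

lemma WienerData.sum_wt_le (h : WienerData E m B H) {b : ℤ → ℝ} (hb : ∀ k, 0 ≤ b k)
    (hs : Summable b) (y : ℝ) (F : Finset ℕ) :
    ∑ n ∈ F, m n / n * b ⌊y - Real.log n⌋ ≤ Real.exp 1 * B * ∑' k, b k := by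
  refine (sum_amalgam h.nonneg h.m_nonneg h.sum_le hb y F).trans ?_
  exact mul_le_mul_of_nonneg_left (hs.sum_le_tsum _ fun k _ => hb k)
    (mul_nonneg (Real.exp_pos _).le h.nonneg)

lemma WienerData.summable_mul_wt (h : WienerData E m B H) {b : ℤ → ℝ} (hb : ∀ k, 0 ≤ b k)
    (hs : Summable b) (y : ℝ) :
    Summable (fun n : ℕ => m n / n * b ⌊y - Real.log n⌋) :=
  summable_of_sum_le (fun n => mul_nonneg (div_nonneg (h.m_nonneg n) n.cast_nonneg) (hb _))
    (h.sum_wt_le hb hs y)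

lemma WienerData.summable_logAvg (h : WienerData E m B H) {φ : ℝ → ℂ} {b : ℤ → ℝ}
    (hs : Summable b) (hφ : ∀ u, ‖φ u‖ ≤ b ⌊u⌋) (y : ℝ) :
    Summable (fun n : ℕ => E n / n * φ (y - Real.log n)) := by
  have hb : ∀ k, 0 ≤ b k := fun k => by
    have := hφ k
    rw [Int.floor_intCast] at this
    exact (norm_nonneg _).trans this
  apply Summable.of_norm_bounded (h.summable_mul_wt hb hs y)
  intro n
  rw [norm_mul, norm_div, Complex.norm_natCast]
  have := h.norm_le n
  have := h.m_nonneg n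
  have := hφ (y - Real.log n)
  gcongr

lemma WienerData.norm_logAvg_le (h : WienerData E m B H) {φ : ℝ → ℂ} {b : ℤ → ℝ}
    (hs : Summable b) (hφ : ∀ u, ‖φ u‖ ≤ b ⌊u⌋) (y : ℝ) :
    ‖logAvg E φ y‖ ≤ Real.exp 1 * B * ∑' k, b k := by
  have hb : ∀ k, 0 ≤ b k := fun k => by
    have := hφ k
    rw [Int.floor_intCast] at this
    exact (norm_nonneg _).trans this
  unfold logAvg
  refine (tsum_of_norm_bounded (h.summable_mul_wt hb hs y).hasSum ?_).trans
    ((h.summable_mul_wt hb hs y).tsum_le_of_sum_le (h.sum_wt_le hb hs y))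
  intro n
  rw [norm_mul, norm_div, Complex.norm_natCast]
  have := h.norm_le n
  have := h.m_nonneg n
  have := hφ (y - Real.log n)
  gcongr

/-- The kernel modulated by the frequency `ξ`. -/
noncomputable def mker (ξ u : ℝ) : ℂ := Complex.exp (Complex.I * ((ξ * u : ℝ) : ℂ)) * ker u

lemma norm_mker (ξ u : ℝ) : ‖mker ξ u‖ = ‖ker u‖ := by
  rw [mker, norm_mul, norm_exp_I_mul, one_mul]

lemma norm_mker_le (ξ u : ℝ) : ‖mker ξ u‖ ≤ 12 * wt ⌊u⌋ := by
  rw [norm_mker]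
  refine (norm_ker_le u).trans ?_
  have := inv_le_wt u
  calc 12 / (1 + u ^ 2) = 12 * (1 / (1 + u ^ 2)) := by ring
    _ ≤ _ := by linarith

/-- The continuous extension of the Dirichlet series, frozen to the left of the line `re s = 1`. -/
noncomputable def clamp (H : ℂ → ℂ) (σ t : ℝ) : ℂ := H ((max σ 1 : ℝ) + Complex.I * (t : ℂ))

lemma WienerData.continuous_clamp (h : WienerData E m B H) :
    Continuous (fun p : ℝ × ℝ => clamp H p.1 p.2) := by
  unfold clamp
  apply h.cont.comp_continuous (by fun_prop)
  intro p
  simp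

lemma WienerData.hasSum_mker (h : WienerData E m B H) (ξ y : ℝ) {σ : ℝ} (hσ : 1 < σ) :
    HasSum (fun n : ℕ => LSeries.term E σ n * mker ξ (y - Real.log n))
      (∫ t in (0 : ℝ)..1, ((t * (1 - t) : ℝ) : ℂ) *
        Complex.exp (Complex.I * (((t + ξ) * y : ℝ) : ℂ)) * clamp H σ (t + ξ)) := by
  have hsum : Summable (fun n => ‖LSeries.term E σ n‖) :=
    ((h.hasSum σ (by simpa using hσ)).summable).norm
  have hterm : ∀ (t : ℝ) (n : ℕ), LSeries.term E (σ + Complex.I * ((t + ξ : ℝ) : ℂ)) n =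
      LSeries.term E σ n * Complex.exp (-(Complex.I * (((t + ξ) * Real.log n : ℝ) : ℂ))) := by
    intro t n
    rcases eq_or_ne n 0 with rfl | hn
    · simp
    · rw [LSeries.term_of_ne_zero hn, LSeries.term_of_ne_zero hn,
        Complex.cpow_add _ _ (by exact_mod_cast hn), div_mul_eq_div_div, div_eq_mul_inv _ (_ ^ _)]
      rw [Complex.cpow_def_of_ne_zero (by exact_mod_cast hn) (Complex.I * _), ← Complex.exp_neg,
        ← Complex.ofReal_natCast, ← Complex.ofReal_log n.cast_nonneg]
      congr 2
      push_cast
      ring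
  have main := intervalIntegral.hasSum_integral_of_dominated_convergence (μ := MeasureTheory.volume)
    (a := 0) (b := 1)
    (F := fun (n : ℕ) (t : ℝ) => ((t * (1 - t) : ℝ) : ℂ) *
        Complex.exp (Complex.I * (((t + ξ) * y : ℝ) : ℂ)) *
        LSeries.term E (σ + Complex.I * ((t + ξ : ℝ) : ℂ)) n)
    (f := fun t => ((t * (1 - t) : ℝ) : ℂ) *
        Complex.exp (Complex.I * (((t + ξ) * y : ℝ) : ℂ)) * clamp H σ (t + ξ))
    (fun n _ => ‖LSeries.term E σ n‖) ?_ ?_ ?_ ?_ ?_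
  · convert! main using 2 with n
    simp only [hterm]
    unfold mker ker
    rw [← intervalIntegral.integral_const_mul, ← intervalIntegral.integral_const_mul]
    apply intervalIntegral.integral_congr
    intro t _
    simp only
    have e : Complex.exp (Complex.I * (((ξ * (y - Real.log n)) : ℝ) : ℂ)) *
        Complex.exp (Complex.I * ((t * (y - Real.log n) : ℝ) : ℂ)) =
        Complex.exp (Complex.I * (((t + ξ) * y : ℝ) : ℂ)) *
        Complex.exp (-(Complex.I * (((t + ξ) * Real.log n : ℝ) : ℂ))) := by
      rw [← Complex.exp_add, ← Complex.exp_add]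
      congr 1
      push_cast
      ring
    linear_combination (LSeries.term E σ n * ((t * (1 - t) : ℝ) : ℂ)) * e
  · intro n
    simp only [hterm]
    apply Continuous.aestronglyMeasurable
    fun_prop
  · intro n
    refine Eventually.of_forall fun t ht => ?_
    rw [Set.uIoc_of_le zero_le_one] at ht
    simp only [hterm]
    rw [norm_mul, norm_mul, norm_mul, norm_exp_I_mul, ← mul_neg, ← Complex.ofReal_neg,
      norm_exp_I_mul, mul_one, mul_one]
    refine mul_le_of_le_one_left (norm_nonneg _) ?_
    rw [Complex.norm_real, Real.norm_eq_abs, abs_le]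
    constructor <;> nlinarith [ht.1, ht.2]
  · exact Eventually.of_forall fun t _ => hsum
  · exact intervalIntegrable_const
  · refine Eventually.of_forall fun t _ => ?_
    have := h.hasSum (σ + Complex.I * ((t + ξ : ℝ) : ℂ)) (by simpa using hσ)
    have h2 : clamp H σ (t + ξ) = H (σ + Complex.I * ((t + ξ : ℝ) : ℂ)) := by
      rw [clamp, max_eq_left hσ.le]
    rw [h2]
    exact HasSum.mul_left _ this

lemma WienerData.logAvg_mker (h : WienerData E m B H) (ξ y : ℝ) :
    logAvg E (mker ξ) y = ∫ t in (0 : ℝ)..1, ((t * (1 - t) : ℝ) : ℂ) *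
        Complex.exp (Complex.I * (((t + ξ) * y : ℝ) : ℂ)) * clamp H 1 (t + ξ) := by
  have h1 : Tendsto (fun σ : ℝ => ∫ t in (0 : ℝ)..1, ((t * (1 - t) : ℝ) : ℂ) *
        Complex.exp (Complex.I * (((t + ξ) * y : ℝ) : ℂ)) * clamp H σ (t + ξ))
      (nhdsWithin 1 (Set.Ioi 1)) (nhds (∫ t in (0 : ℝ)..1, ((t * (1 - t) : ℝ) : ℂ) *
        Complex.exp (Complex.I * (((t + ξ) * y : ℝ) : ℂ)) * clamp H 1 (t + ξ))) := by
    apply Tendsto.mono_left _ nhdsWithin_le_nhds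
    apply Continuous.tendsto
    apply intervalIntegral.continuous_parametric_intervalIntegral_of_continuous'
    simp only [Function.uncurry_def]
    apply Continuous.mul (by fun_prop)
    exact h.continuous_clamp.comp (f := fun p : ℝ × ℝ => (p.1, p.2 + ξ)) (by fun_prop)
  have hw : ∀ k, 0 ≤ 12 * wt k := fun k => mul_nonneg (by norm_num) (wt_nonneg k)
  have h2 : Tendsto (fun σ : ℝ => ∑' n : ℕ, LSeries.term E σ n * mker ξ (y - Real.log n))
      (nhdsWithin 1 (Set.Ioi 1)) (nhds (logAvg E (mker ξ) y)) := by
    apply tendsto_tsum_of_dominated_convergence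
      (h.summable_mul_wt hw (summable_wt.mul_left 12) y)
    · intro n
      apply Tendsto.mul_const
      apply Tendsto.mono_left _ nhdsWithin_le_nhds
      rcases eq_or_ne n 0 with rfl | hn
      · simp
      · simp only [LSeries.term_of_ne_zero hn]
        have hc : Continuous (fun σ : ℝ => E n / (n : ℂ) ^ (σ : ℂ)) := by
          have hn' : (n : ℂ) ≠ 0 := by exact_mod_cast hn
          simp only [Complex.cpow_def_of_ne_zero hn']
          apply Continuous.div continuous_const (by fun_prop)
          intro x
          exact Complex.exp_ne_zero _
        have := hc.tendsto 1
        simpa using this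
    · filter_upwards [self_mem_nhdsWithin] with σ hσ n
      have hσ : 1 < σ := hσ
      rw [norm_mul]
      refine mul_le_mul ?_ (norm_mker_le _ _) (norm_nonneg _)
        (div_nonneg (h.m_nonneg n) n.cast_nonneg)
      rcases eq_or_ne n 0 with rfl | hn
      · simp
      · rw [LSeries.norm_term_eq, if_neg hn]
        have hn1 : (1 : ℝ) ≤ n := by exact_mod_cast Nat.one_le_iff_ne_zero.2 hn
        have : (n : ℝ) ≤ (n : ℝ) ^ (σ : ℂ).re := by
          simpa using Real.rpow_le_rpow_of_exponent_le hn1 hσ.le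
        exact div_le_div₀ (h.m_nonneg n) (h.norm_le n) (by linarith) this
  refine tendsto_nhds_unique h2 (h1.congr' ?_)
  filter_upwards [self_mem_nhdsWithin] with σ hσ
  exact (h.hasSum_mker ξ y hσ).tsum_eq.symm

lemma WienerData.tendsto_logAvg_mker (h : WienerData E m B H) (ξ : ℝ) :
    Tendsto (logAvg E (mker ξ)) atTop (nhds 0) := by
  set g : ℝ → ℂ := fun t => ((t * (1 - t) : ℝ) : ℂ) * clamp H 1 (t + ξ) with hg
  have hrl := Real.tendsto_integral_exp_smul_cocompact (Set.indicator (Set.Ioc 0 1) g)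
  have hcomp : Tendsto (fun y : ℝ => -y / (2 * Real.pi)) atTop (cocompact ℝ) := by
    apply Tendsto.mono_right _ atBot_le_cocompact
    apply Tendsto.atBot_div_const (by positivity)
    exact tendsto_neg_atTop_atBot
  have h1 := (hrl.comp hcomp).norm
  rw [norm_zero] at h1
  rw [tendsto_zero_iff_norm_tendsto_zero]
  refine h1.congr fun y => ?_
  rw [h.logAvg_mker]
  have e1 : (∫ t in (0 : ℝ)..1, ((t * (1 - t) : ℝ) : ℂ) *
        Complex.exp (Complex.I * (((t + ξ) * y : ℝ) : ℂ)) * clamp H 1 (t + ξ)) =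
      Complex.exp (Complex.I * ((ξ * y : ℝ) : ℂ)) *
        ∫ t in (0 : ℝ)..1, Complex.exp (Complex.I * ((t * y : ℝ) : ℂ)) * g t := by
    rw [← intervalIntegral.integral_const_mul]
    apply intervalIntegral.integral_congr
    intro t _
    simp only [hg]
    have : Complex.exp (Complex.I * (((t + ξ) * y : ℝ) : ℂ)) =
        Complex.exp (Complex.I * ((ξ * y : ℝ) : ℂ)) * Complex.exp (Complex.I * ((t * y : ℝ) : ℂ)) := by
      rw [← Complex.exp_add]
      congr 1
      push_cast
      ring
    rw [this]
    ring
  rw [e1, norm_mul, norm_exp_I_mul, one_mul, Function.comp_apply,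
    intervalIntegral.integral_of_le zero_le_one, ← MeasureTheory.integral_indicator
      measurableSet_Ioc]
  congr 1
  apply MeasureTheory.integral_congr_ae
  refine Eventually.of_forall fun t => ?_
  simp only
  by_cases ht : t ∈ Set.Ioc (0 : ℝ) 1
  · rw [Set.indicator_of_mem ht, Set.indicator_of_mem ht, Circle.smul_def, smul_eq_mul,
      Real.fourierChar_apply]
    congr 2
    have : (Real.pi : ℂ) ≠ 0 := by exact_mod_cast Real.pi_ne_zero
    push_cast
    field_simp
  · rw [Set.indicator_of_notMem ht, Set.indicator_of_notMem ht, smul_zero]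

variable {E : ℕ → ℂ} {m : ℕ → ℝ} {B : ℝ} {H : ℂ → ℂ}

set_option maxHeartbeats 1000000 in
lemma WienerData.tendsto_logAvg_span (h : WienerData E m B H) {T : ℝ} [hT : Fact (0 < T)]
    (p : C(AddCircle T, ℂ)) (hp : p ∈ Submodule.span ℂ (Set.range (@fourier T))) :
    Tendsto (logAvg E (fun u => ker u * p (u : AddCircle T))) atTop (nhds 0) := by
  have hbd : ∀ (p : C(AddCircle T, ℂ)) (u : ℝ),
      ‖ker u * p (u : AddCircle T)‖ ≤ (fun k => 12 * ‖p‖ * wt k) ⌊u⌋ := by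
    intro p u
    rw [norm_mul]
    have h1 := norm_ker_le u
    have h2 := inv_le_wt u
    have h3 := p.norm_coe_le_norm (u : AddCircle T)
    have h4 : ‖ker u‖ ≤ 12 * wt ⌊u⌋ := by
      calc _ ≤ _ := h1
        _ = 12 * (1 / (1 + u ^ 2)) := by ring
        _ ≤ _ := by linarith
    calc _ ≤ (12 * wt ⌊u⌋) * ‖p‖ := mul_le_mul h4 h3 (norm_nonneg _) (by linarith [norm_nonneg (ker u)])
      _ = _ := by simp only; ring
  have hsum : ∀ (p : C(AddCircle T, ℂ)) (y : ℝ),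
      Summable (fun n : ℕ => E n / n * (ker (y - Real.log n) * p ((y - Real.log n : ℝ) : AddCircle T))) :=
    fun p y => h.summable_logAvg (summable_wt.mul_left (12 * ‖p‖)) (hbd p) y
  induction hp using Submodule.span_induction with
  | mem p hp =>
    obtain ⟨k, rfl⟩ := hp
    have := h.tendsto_logAvg_mker (2 * Real.pi * k / T)
    refine this.congr fun y => ?_
    unfold logAvg
    congr 1
    ext n
    congr 1
    simp only [fourier_coe_apply, mker]
    rw [mul_comm]
    congr 2
    push_cast
    ring
  | zero =>
    have : logAvg E (fun u => ker u * (0 : C(AddCircle T, ℂ)) (u : AddCircle T)) = fun _ => 0 := by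
      ext y; simp [logAvg]
    rw [this]
    exact tendsto_const_nhds
  | add p q _ _ hp hq =>
    have := hp.add hq
    rw [add_zero] at this
    refine this.congr fun y => ?_
    unfold logAvg
    rw [← (hsum p y).tsum_add (hsum q y)]
    congr 1
    ext n
    simp only [ContinuousMap.add_apply]
    ring
  | smul c p _ hp =>
    have := hp.const_mul c
    rw [mul_zero] at this
    refine this.congr fun y => ?_
    unfold logAvg
    rw [← tsum_mul_left]
    congr 1
    ext n
    simp only [ContinuousMap.smul_apply, smul_eq_mul]
    ring

set_option maxHeartbeats 1000000 in
theorem WienerData.tendsto_logAvg (h : WienerData E m B H) {φ : ℝ → ℂ} (hφ : Continuous φ)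
    (hsupp : ∀ u, 1 ≤ |u| → φ u = 0) : Tendsto (logAvg E φ) atTop (nhds 0) := by
  set g : ℝ → ℂ := fun u => φ u / ker (max (-1) (min 1 u)) with hgdef
  have hg : Continuous g := by
    apply hφ.div (continuous_ker.comp (by fun_prop))
    intro u
    apply ker_ne_zero
    rw [abs_le]
    exact ⟨le_max_left _ _, max_le (by norm_num) (min_le_left _ _)⟩
  have hg0 : ∀ u, 1 ≤ |u| → g u = 0 := fun u hu => by simp [hgdef, hsupp u hu]
  have hkg : ∀ u, ker u * g u = φ u := by
    intro u
    rcases le_or_gt 1 |u| with hu | hu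
    · rw [hg0 u hu, hsupp u hu, mul_zero]
    · have hu' := abs_le.1 hu.le
      simp only [hgdef]
      rw [min_eq_right hu'.2, max_eq_right hu'.1, mul_div_cancel₀ _ (ker_ne_zero u hu.le)]
  obtain ⟨G, hG0, hG⟩ : ∃ G : ℝ, 0 ≤ G ∧ ∀ u, ‖g u‖ ≤ G := by
    obtain ⟨G, hG⟩ := (isCompact_Icc (a := (-1 : ℝ)) (b := 1)).exists_bound_of_continuousOn
      hg.continuousOn
    have h0 : 0 ≤ G := (norm_nonneg _).trans (hG 0 (by norm_num))
    refine ⟨G, h0, fun u => ?_⟩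
    rcases le_or_gt 1 |u| with hu | hu
    · rw [hg0 u hu, norm_zero]; exact h0
    · exact hG u (abs_le.1 hu.le)
  set W : ℝ := ∑' k, wt k with hW
  have hW0 : 0 ≤ W := tsum_nonneg wt_nonneg
  set C : ℝ := Real.exp 1 * B * (12 * (W + G + 1)) + 1 with hC
  have hB := h.nonneg
  have hCpos : 0 < C := by positivity
  rw [Metric.tendsto_atTop]
  intro ε hε
  set ε₁ : ℝ := min 1 (ε / (2 * C)) with hε₁
  have hε₁pos : 0 < ε₁ := lt_min one_pos (by positivity)
  have hε₁1 : ε₁ ≤ 1 := min_le_left _ _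
  have hε₁C : ε₁ * C ≤ ε / 2 := by
    calc _ ≤ ε / (2 * C) * C := mul_le_mul_of_nonneg_right (min_le_right _ _) hCpos.le
      _ = _ := by field_simp
  obtain ⟨s, hs⟩ := summable_iff_vanishing_norm.1 summable_wt ε₁ hε₁pos
  obtain ⟨N, hN⟩ : ∃ N : ℕ, ∀ k ∈ s, k.natAbs ≤ N :=
    ⟨s.sup Int.natAbs, fun k hk => Finset.le_sup (f := Int.natAbs) hk⟩
  set T : ℝ := 2 * (N + 3) with hTdef
  have hT : Fact (0 < T) := ⟨by positivity⟩
  have hends : g (-(N + 3)) = g (-(N + 3) + T) := by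
    have hN0 : (0 : ℝ) ≤ N := N.cast_nonneg
    rw [hg0, hg0]
    · rw [hTdef, abs_of_nonneg] <;> linarith
    · rw [abs_of_nonpos] <;> linarith
  let gl : C(AddCircle T, ℂ) := ⟨AddCircle.liftIco T (-(N + 3)) g,
    AddCircle.liftIco_continuous hends hg.continuousOn⟩
  have hgl : ∀ u ∈ Set.Ico (-(N + 3) : ℝ) (-(N + 3) + T), gl (u : AddCircle T) = g u :=
    fun u hu => AddCircle.liftIco_coe_apply (f := g) hu
  have hglb : ∀ z, ‖gl z‖ ≤ G := by
    intro z
    obtain ⟨u, hu, rfl⟩ : z ∈ (QuotientAddGroup.mk '' Set.Ico (-(N + 3) : ℝ) (-(N + 3) + T) :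
        Set (AddCircle T)) := by
      rw [AddCircle.coe_image_Ico_eq]; trivial
    have := hgl u hu
    exact (congrArg norm this).le.trans (hG u)
  obtain ⟨p, hp, hpg⟩ : ∃ p ∈ Submodule.span ℂ (Set.range (@fourier T)), dist gl p < ε₁ := by
    have : gl ∈ (Submodule.span ℂ (Set.range (@fourier T))).topologicalClosure := by
      rw [span_fourier_closure_eq_top]; trivial
    exact Metric.mem_closure_iff.1 this ε₁ hε₁pos
  have hpd : ∀ z, ‖gl z - p z‖ ≤ ε₁ := fun z => by
    rw [← dist_eq_norm]
    exact (ContinuousMap.dist_apply_le_dist z).trans hpg.le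
  have hpb : ∀ z, ‖p z‖ ≤ G + 1 := fun z => by
    have h1 : p z = gl z - (gl z - p z) := by ring
    rw [h1]
    exact (norm_sub_le _ _).trans (add_le_add (hglb z) ((hpd z).trans hε₁1))
  set b : ℤ → ℝ := fun k => 12 * ε₁ * wt k + 12 * (G + 1) * (if k ∈ s then 0 else wt k) with hb
  have htail0 : ∀ k, 0 ≤ (if k ∈ s then 0 else wt k) := fun k => by
    split_ifs
    · exact le_rfl
    · exact wt_nonneg k
  have htails : ∀ t : Finset ℤ, ∑ k ∈ t, (if k ∈ s then 0 else wt k) ≤ ε₁ := by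
    intro t
    have := hs (t \ s) Finset.sdiff_disjoint
    rw [Real.norm_eq_abs] at this
    have e : ∑ k ∈ t, (if k ∈ s then 0 else wt k) = ∑ k ∈ t \ s, wt k := by
      rw [← Finset.filter_notMem_eq_sdiff, Finset.sum_filter]
      apply Finset.sum_congr rfl
      intro k _
      by_cases hk : k ∈ s <;> simp [hk]
    rw [e]
    exact (le_abs_self _).trans this.le
  have htailsum : Summable (fun k => if k ∈ s then 0 else wt k) :=
    summable_of_sum_le htail0 htails
  have hbsum : Summable b := (summable_wt.mul_left _).add (htailsum.mul_left _)
  have hbt : ∑' k, b k ≤ 12 * (W + G + 1) * ε₁ := by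
    rw [hb, (summable_wt.mul_left _).tsum_add (htailsum.mul_left _), tsum_mul_left, tsum_mul_left,
      ← hW]
    have := htailsum.tsum_le_of_sum_le htails
    have h2 := mul_le_mul_of_nonneg_left this (show 0 ≤ 12 * (G + 1) by positivity)
    linarith
  have hψ : ∀ u, ‖φ u - ker u * p (u : AddCircle T)‖ ≤ b ⌊u⌋ := by
    intro u
    have hk : ‖ker u‖ ≤ 12 * wt ⌊u⌋ := by
      calc _ ≤ _ := norm_ker_le u
        _ = 12 * (1 / (1 + u ^ 2)) := by ring
        _ ≤ _ := by linarith [inv_le_wt u]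
    have hwn := wt_nonneg ⌊u⌋
    by_cases hu : u ∈ Set.Ico (-(N + 3) : ℝ) (-(N + 3) + T)
    · rw [← hkg, ← mul_sub, norm_mul, ← hgl u hu]
      calc _ ≤ (12 * wt ⌊u⌋) * ε₁ := mul_le_mul hk (hpd _) (norm_nonneg _) (by positivity)
        _ ≤ b ⌊u⌋ := by
          have := mul_nonneg (show 0 ≤ 12 * (G + 1) by positivity) (htail0 ⌊u⌋)
          simp only [hb]
          linarith
    · have hu2 : (N : ℝ) + 3 ≤ |u| := by
        by_contra hcon
        push Not at hcon
        have := abs_lt.1 hcon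
        exact hu ⟨by linarith, by rw [hTdef]; linarith⟩
      have hN0 : (0 : ℝ) ≤ N := N.cast_nonneg
      have hns : ⌊u⌋ ∉ s := by
        intro hmem
        have h1 := hN _ hmem
        have h2 : |(⌊u⌋ : ℝ)| ≤ N := by
          have : ((⌊u⌋.natAbs : ℤ) : ℝ) ≤ N := by exact_mod_cast h1
          rwa [Int.natCast_natAbs, Int.cast_abs] at this
        have h3 := Int.floor_le u
        have h4 := Int.lt_floor_add_one u
        have h5 := abs_le.1 h2
        have h6 : |u| ≤ N + 1 := abs_le.2 ⟨by linarith, by linarith⟩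
        linarith
      rw [hsupp u (by linarith), zero_sub, norm_neg, norm_mul]
      simp only [hb, hns, if_false]
      calc _ ≤ (12 * wt ⌊u⌋) * (G + 1) := mul_le_mul hk (hpb _) (norm_nonneg _) (by positivity)
        _ ≤ _ := by
          have : 0 ≤ 12 * ε₁ * wt ⌊u⌋ := by positivity
          linarith
  obtain ⟨y₀, hy₀⟩ := (Metric.tendsto_atTop.1 (h.tendsto_logAvg_span p hp)) (ε / 2) (by positivity)
  refine ⟨y₀, fun y hy => ?_⟩
  have h1 := hy₀ y hy
  rw [dist_zero_right] at h1 ⊢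
  have hkp : ∀ u, ‖ker u * p (u : AddCircle T)‖ ≤ (fun k => 12 * (G + 1) * wt k) ⌊u⌋ := by
    intro u
    have hk : ‖ker u‖ ≤ 12 * wt ⌊u⌋ := by
      calc _ ≤ _ := norm_ker_le u
        _ = 12 * (1 / (1 + u ^ 2)) := by ring
        _ ≤ _ := by linarith [inv_le_wt u]
    have hwn := wt_nonneg ⌊u⌋
    rw [norm_mul]
    calc _ ≤ (12 * wt ⌊u⌋) * (G + 1) := mul_le_mul hk (hpb _) (norm_nonneg _) (by positivity)
      _ = _ := by simp only; ring
  have hs1 := h.summable_logAvg (summable_wt.mul_left (12 * (G + 1))) hkp y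
  have hs2 := h.summable_logAvg hbsum hψ y
  have hdec : logAvg E φ y = logAvg E (fun u => ker u * p (u : AddCircle T)) y +
      logAvg E (fun u => φ u - ker u * p (u : AddCircle T)) y := by
    unfold logAvg
    rw [← hs1.tsum_add hs2]
    congr 1
    ext n
    ring
  have h2 := h.norm_logAvg_le hbsum hψ y
  have h3 : Real.exp 1 * B * ∑' k, b k ≤ ε / 2 := by
    calc _ ≤ Real.exp 1 * B * (12 * (W + G + 1) * ε₁) :=
          mul_le_mul_of_nonneg_left hbt (mul_nonneg (Real.exp_pos _).le hB)
      _ ≤ ε₁ * C := by rw [hC]; linarith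
      _ ≤ _ := hε₁C
  rw [hdec]
  calc _ ≤ _ := norm_add_le _ _
    _ < ε / 2 + ε / 2 := add_lt_add_of_lt_of_le h1 (h2.trans h3)
    _ = ε := by ring

variable {m : ℕ → ℝ} {B : ℝ} {H : ℂ → ℂ}

lemma card_filter_abs_sub_le (s : Finset ℕ) (c : ℝ) {r : ℝ} (hr : 0 ≤ r) :
    ((s.filter (fun n : ℕ => |(n : ℝ) - c| ≤ r)).card : ℝ) ≤ 2 * r + 1 := by
  have h1 : (s.filter (fun n : ℕ => |(n : ℝ) - c| ≤ r)).card ≤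
      (Finset.Icc ⌈c - r⌉ ⌊c + r⌋).card := by
    apply Finset.card_le_card_of_injOn (fun n : ℕ => (n : ℤ))
    · intro n hn
      have hn := abs_le.1 (Finset.mem_filter.1 hn).2
      rw [Finset.mem_coe, Finset.mem_Icc, Int.ceil_le, Int.le_floor]
      push_cast
      constructor <;> linarith [hn.1, hn.2]
    · intro a _ b _ hab
      exact Nat.cast_injective hab
  rw [Int.card_Icc] at h1
  have h2 : ((⌊c + r⌋ + 1 - ⌈c - r⌉).toNat : ℝ) ≤ 2 * r + 1 := by
    have h3 : (((⌊c + r⌋ + 1 - ⌈c - r⌉).toNat : ℤ) : ℝ) = ((max (⌊c + r⌋ + 1 - ⌈c - r⌉) 0 : ℤ) : ℝ) := by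
      rw [Int.toNat_eq_max]
    rw [Int.cast_natCast] at h3
    rw [h3]
    push_cast
    apply max_le
    · linarith [Int.floor_le (c + r), Int.le_ceil (c - r)]
    · linarith
  exact (by exact_mod_cast h1 : _ ≤ ((⌊c + r⌋ + 1 - ⌈c - r⌉).toNat : ℝ)).trans h2

lemma WienerData.tendsto_sum_smooth {f : ℕ → ℝ} {A : ℝ}
    (h : WienerData (fun n => ((f n - A : ℝ) : ℂ)) m B H) {τ : ℝ → ℝ} (hτ : Continuous τ)
    (h1 : ∀ v, v ≤ 2 / 5 → τ v = 0) (h2 : ∀ v, 5 / 2 ≤ v → τ v = 0) :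
    Tendsto (fun X : ℕ => (∑ n ∈ Ioc 0 (3 * X), (f n - A) * τ ((n : ℝ) / X)) / X) atTop
      (nhds 0) := by
  have he1 := Real.exp_one_gt_d9
  have he : Real.exp (-1) < 2 / 5 := by
    rw [Real.exp_neg, inv_lt_comm₀ (Real.exp_pos _) (by norm_num)]
    linarith
  have hlim := h.tendsto_logAvg (φ := fun u => ((Real.exp (-u) * τ (Real.exp (-u)) : ℝ) : ℂ))
    (by fun_prop) (by
      intro u hu
      rcases le_abs'.1 hu with hu | hu
      · have : Real.exp 1 ≤ Real.exp (-u) := Real.exp_le_exp.2 (by linarith)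
        simp [h2 (Real.exp (-u)) (by linarith)]
      · have : Real.exp (-u) ≤ Real.exp (-1) := Real.exp_le_exp.2 (by linarith)
        simp [h1 (Real.exp (-u)) (by linarith)])
  have hlim2 := (hlim.comp (Real.tendsto_log_atTop.comp tendsto_natCast_atTop_atTop)).norm
  rw [norm_zero] at hlim2
  rw [tendsto_zero_iff_norm_tendsto_zero]
  refine hlim2.congr' ?_
  filter_upwards [eventually_gt_atTop 0] with X hX
  have hX' : (0 : ℝ) < X := by exact_mod_cast hX
  have hφ : ∀ n : ℕ, 0 < n → Real.exp (-(Real.log X - Real.log n)) = n / X := by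
    intro n hn
    have hn' : (0 : ℝ) < n := by exact_mod_cast hn
    rw [neg_sub, Real.exp_sub, Real.exp_log hn', Real.exp_log hX']
  rw [Function.comp_apply, Function.comp_apply, logAvg, tsum_eq_sum (s := Ioc 0 (3 * X))]
  · rw [Finset.sum_div, ← Complex.norm_real]
    congr 1
    rw [Complex.ofReal_sum]
    apply Finset.sum_congr rfl
    intro n hn
    have hn0 := (Finset.mem_Ioc.1 hn).1
    have hn' : (n : ℂ) ≠ 0 := by exact_mod_cast hn0.ne'
    rw [hφ n hn0]
    push_cast
    field_simp
  · intro n hn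
    rcases Nat.eq_zero_or_pos n with rfl | hn0
    · simp
    · have hn3 : 3 * X < n := by
        by_contra hcon
        push Not at hcon
        exact hn (Finset.mem_Ioc.2 ⟨hn0, hcon⟩)
      have hn3' : 3 * (X : ℝ) < n := by exact_mod_cast hn3
      rw [hφ n hn0, h2]
      · simp
      · rw [le_div_iff₀ hX']; linarith

/-- The trapezoid that is `1` on `[a, b]` and vanishes outside `(a - η, b + η)`. -/
noncomputable def trap (a b η v : ℝ) : ℝ :=
  max 0 (min 1 (min ((v - (a - η)) / η) ((b + η - v) / η)))

lemma continuous_trap (a b η : ℝ) : Continuous (trap a b η) := by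
  unfold trap
  fun_prop

lemma trap_nonneg (a b η v : ℝ) : 0 ≤ trap a b η v := le_max_left _ _

lemma trap_le_one (a b η v : ℝ) : trap a b η v ≤ 1 := max_le zero_le_one (min_le_left _ _)

lemma trap_eq_one {a b η v : ℝ} (hη : 0 < η) (h1 : a ≤ v) (h2 : v ≤ b) : trap a b η v = 1 := by
  unfold trap
  rw [min_eq_left, max_eq_right zero_le_one]
  apply le_min
  · rw [le_div_iff₀ hη]; linarith
  · rw [le_div_iff₀ hη]; linarith

lemma trap_eq_zero_left {a b η v : ℝ} (hη : 0 < η) (h1 : v ≤ a - η) : trap a b η v = 0 := by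
  unfold trap
  apply max_eq_left
  apply (min_le_right _ _).trans ((min_le_left _ _).trans _)
  apply div_nonpos_of_nonpos_of_nonneg _ hη.le
  linarith

lemma trap_eq_zero_right {a b η v : ℝ} (hη : 0 < η) (h1 : b + η ≤ v) : trap a b η v = 0 := by
  unfold trap
  apply max_eq_left
  apply (min_le_right _ _).trans ((min_le_right _ _).trans _)
  apply div_nonpos_of_nonpos_of_nonneg _ hη.le
  linarith

lemma WienerData.abs_sum_half_le {f : ℕ → ℝ} {A : ℝ} (hf : ∀ n, 0 ≤ f n) (hA : 0 ≤ A)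
    (h : WienerData (fun n => ((f n - A : ℝ) : ℂ)) m B H) {ε : ℝ} (hε : 0 < ε) :
    ∃ X₀ : ℕ, ∀ X : ℕ, X₀ ≤ X → |∑ n ∈ Ioc (X / 2) X, (f n - A)| ≤ ε * X := by
  set η : ℝ := min (1 / 10) (ε / (16 * (A + 1))) with hηdef
  have hη : 0 < η := lt_min (by norm_num) (by positivity)
  have hη1 : η ≤ 1 / 10 := min_le_left _ _
  have hη2 : A * η ≤ ε / 16 := by
    have : η ≤ ε / (16 * (A + 1)) := min_le_right _ _
    rw [le_div_iff₀ (by positivity)] at this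
    linarith
  have hp := h.tendsto_sum_smooth (continuous_trap (1 / 2) 1 η)
    (fun v hv => trap_eq_zero_left hη (by linarith))
    (fun v hv => trap_eq_zero_right hη (by linarith))
  have hq := h.tendsto_sum_smooth (continuous_trap (1 / 2 + η) (1 - η) η)
    (fun v hv => trap_eq_zero_left hη (by linarith))
    (fun v hv => trap_eq_zero_right hη (by linarith))
  obtain ⟨X₁, hX₁⟩ := (Metric.tendsto_atTop.1 hp) (ε / 4) (by positivity)
  obtain ⟨X₂, hX₂⟩ := (Metric.tendsto_atTop.1 hq) (ε / 4) (by positivity)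
  obtain ⟨X₃, hX₃⟩ := exists_nat_ge (8 * A / ε)
  refine ⟨max (max X₁ X₂) (max X₃ 1), fun X hX => ?_⟩
  have hXpos : 0 < X := lt_of_lt_of_le zero_lt_one
    ((le_max_right _ _).trans ((le_max_right _ _).trans hX))
  have hX' : (0 : ℝ) < X := by exact_mod_cast hXpos
  have h1 := hX₁ X ((le_max_left _ _).trans ((le_max_left _ _).trans hX))
  have h2 := hX₂ X ((le_max_right _ _).trans ((le_max_left _ _).trans hX))
  rw [dist_zero_right, Real.norm_eq_abs, abs_div, abs_of_pos hX', div_lt_iff₀ hX'] at h1 h2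
  have hX3 : A * 2 ≤ ε / 4 * X := by
    have : (X₃ : ℝ) ≤ X := by
      exact_mod_cast (le_max_left _ _).trans ((le_max_right _ _).trans hX)
    have := hX₃.trans this
    rw [div_le_iff₀ hε] at this
    linarith
  set M := (Ioc 0 (3 * X) : Finset ℕ) with hM
  set ι : ℕ → ℝ := fun n => if n ∈ (Ioc (X / 2) X : Finset ℕ) then 1 else 0 with hι
  have hsub : (Ioc (X / 2) X : Finset ℕ) ⊆ M := by
    intro n hn
    rw [hM, Finset.mem_Ioc]
    rw [Finset.mem_Ioc] at hn
    omega
  have hS : ∑ n ∈ Ioc (X / 2) X, (f n - A) = ∑ n ∈ M, (f n - A) * ι n := by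
    simp only [hι, mul_ite, mul_one, mul_zero]
    rw [← Finset.sum_filter, Finset.filter_mem_eq_inter, Finset.inter_eq_right.2 hsub]
  set K : ℕ → ℝ := fun n => (if |(n : ℝ) - X / 2| ≤ η * X then 1 else 0) +
    (if |(n : ℝ) - X| ≤ η * X then 1 else 0) with hK
  have hK0 : ∀ n, 0 ≤ K n := fun n => by
    simp only [hK]; split_ifs <;> norm_num
  have hK1 : ∀ n, n ∈ M → (|(n : ℝ) - X / 2| ≤ η * X ∨ |(n : ℝ) - X| ≤ η * X) → 1 ≤ K n := by
    intro n _ hn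
    simp only [hK]
    rcases hn with hn | hn <;> rw [if_pos hn] <;> split_ifs <;> norm_num
  have hKs : A * ∑ n ∈ M, K n ≤ ε / 2 * X := by
    have hc1 := card_filter_abs_sub_le M (X / 2 : ℝ) (r := η * X) (by positivity)
    have hc2 := card_filter_abs_sub_le M (X : ℝ) (r := η * X) (by positivity)
    have : ∑ n ∈ M, K n ≤ 4 * (η * X) + 2 := by
      simp only [hK]
      rw [Finset.sum_add_distrib, ← Finset.sum_filter, ← Finset.sum_filter, Finset.sum_const,
        Finset.sum_const, nsmul_eq_mul, nsmul_eq_mul]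
      linarith
    calc A * ∑ n ∈ M, K n ≤ A * (4 * (η * X) + 2) := mul_le_mul_of_nonneg_left this hA
      _ = 4 * (A * η) * X + A * 2 := by ring
      _ ≤ 4 * (ε / 16) * X + ε / 4 * X := by
          have := mul_le_mul_of_nonneg_right hη2 hX'.le
          linarith
      _ = _ := by ring
  have hmem : ∀ n : ℕ, n ∈ (Ioc (X / 2) X : Finset ℕ) ↔ (X : ℝ) / 2 < n ∧ (n : ℝ) ≤ X := by
    intro n
    rw [Finset.mem_Ioc, Nat.div_lt_iff_lt_mul (by norm_num), Nat.cast_le, div_lt_iff₀ (by norm_num)]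
    norm_cast
  have up : ∀ n ∈ M, ι n ≤ trap (1 / 2) 1 η ((n : ℝ) / X) ∧
      trap (1 / 2) 1 η ((n : ℝ) / X) - ι n ≤ K n := by
    intro n hn
    by_cases hmn : n ∈ (Ioc (X / 2) X : Finset ℕ)
    · have hb := (hmem n).1 hmn
      have : trap (1 / 2) 1 η ((n : ℝ) / X) = 1 := by
        apply trap_eq_one hη
        · rw [le_div_iff₀ hX']; linarith
        · rw [div_le_iff₀ hX']; linarith
      rw [this]
      simp only [hι, if_pos hmn]
      exact ⟨le_rfl, by linarith [hK0 n]⟩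
    · simp only [hι, if_neg hmn, sub_zero]
      refine ⟨trap_nonneg _ _ _ _, ?_⟩
      by_cases hk : |(n : ℝ) - X / 2| ≤ η * X ∨ |(n : ℝ) - X| ≤ η * X
      · exact (trap_le_one _ _ _ _).trans (hK1 n hn hk)
      · push Not at hk
        have : trap (1 / 2) 1 η ((n : ℝ) / X) = 0 := by
          by_cases hb : (X : ℝ) / 2 < n
          · have hb2 : (X : ℝ) < n := by
              by_contra hcon
              exact hmn ((hmem n).2 ⟨hb, not_lt.1 hcon⟩)
            apply trap_eq_zero_right hη
            have := hk.2
            rw [abs_of_pos (by linarith)] at this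
            rw [le_div_iff₀ hX']
            linarith
          · apply trap_eq_zero_left hη
            have := hk.1
            rw [abs_of_nonpos (by linarith)] at this
            rw [div_le_iff₀ hX']
            linarith
        rw [this]
        exact hK0 n
  have lo : ∀ n ∈ M, trap (1 / 2 + η) (1 - η) η ((n : ℝ) / X) ≤ ι n ∧
      ι n - trap (1 / 2 + η) (1 - η) η ((n : ℝ) / X) ≤ K n := by
    intro n hn
    by_cases hmn : n ∈ (Ioc (X / 2) X : Finset ℕ)
    · have hb := (hmem n).1 hmn
      simp only [hι, if_pos hmn]
      refine ⟨trap_le_one _ _ _ _, ?_⟩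
      by_cases hk : |(n : ℝ) - X / 2| ≤ η * X ∨ |(n : ℝ) - X| ≤ η * X
      · linarith [trap_nonneg (1 / 2 + η) (1 - η) η ((n : ℝ) / X), hK1 n hn hk]
      · push Not at hk
        have e1 := hk.1
        have e2 := hk.2
        rw [abs_of_pos (by linarith)] at e1
        rw [abs_of_nonpos (by linarith)] at e2
        have : trap (1 / 2 + η) (1 - η) η ((n : ℝ) / X) = 1 := by
          apply trap_eq_one hη
          · rw [le_div_iff₀ hX']; linarith
          · rw [div_le_iff₀ hX']; linarith
        rw [this]
        linarith [hK0 n]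
    · simp only [hι, if_neg hmn]
      have : trap (1 / 2 + η) (1 - η) η ((n : ℝ) / X) = 0 := by
        by_cases hb : (X : ℝ) / 2 < n
        · have hb2 : (X : ℝ) < n := by
            by_contra hcon
            exact hmn ((hmem n).2 ⟨hb, not_lt.1 hcon⟩)
          apply trap_eq_zero_right hη
          rw [le_div_iff₀ hX']
          linarith
        · apply trap_eq_zero_left hη
          rw [div_le_iff₀ hX']
          linarith
      rw [this]
      exact ⟨le_rfl, by linarith [hK0 n]⟩
  rw [hS, abs_le]
  constructor
  · have : ∑ n ∈ M, (f n - A) * trap (1 / 2 + η) (1 - η) η ((n : ℝ) / X) - A * ∑ n ∈ M, K n ≤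
        ∑ n ∈ M, (f n - A) * ι n := by
      rw [Finset.mul_sum, ← Finset.sum_sub_distrib]
      apply Finset.sum_le_sum
      intro n hn
      have h3 := mul_le_mul_of_nonneg_left (lo n hn).1 (hf n)
      have h4 := mul_le_mul_of_nonneg_left (lo n hn).2 hA
      linarith
    have := (abs_lt.1 h2).1
    linarith
  · have : ∑ n ∈ M, (f n - A) * ι n ≤
        ∑ n ∈ M, (f n - A) * trap (1 / 2) 1 η ((n : ℝ) / X) + A * ∑ n ∈ M, K n := by
      rw [Finset.mul_sum, ← Finset.sum_add_distrib]
      apply Finset.sum_le_sum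
      intro n hn
      have h3 := mul_le_mul_of_nonneg_left (up n hn).1 (hf n)
      have h4 := mul_le_mul_of_nonneg_left (up n hn).2 hA
      linarith
    have := (abs_lt.1 h1).2
    linarith

theorem WienerData.tendsto_sum_div {f : ℕ → ℝ} {A : ℝ} (hf : ∀ n, 0 ≤ f n) (hA : 0 ≤ A)
    (h : WienerData (fun n => ((f n - A : ℝ) : ℂ)) m B H) :
    Tendsto (fun X : ℕ => (∑ n ∈ Ioc 0 X, f n) / X) atTop (nhds A) := by
  rw [Metric.tendsto_atTop]
  intro ε hε
  obtain ⟨X₀, hX₀⟩ := h.abs_sum_half_le hf hA (ε := ε / 4) (by positivity)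
  set C : ℝ := ∑ X ∈ range (X₀ + 1), |∑ n ∈ Ioc 0 X, (f n - A)| with hC
  have hC0 : 0 ≤ C := Finset.sum_nonneg fun _ _ => abs_nonneg _
  have key : ∀ X : ℕ, |∑ n ∈ Ioc 0 X, (f n - A)| ≤ 2 * (ε / 4) * X + C := by
    intro X
    induction X using Nat.strong_induction_on with
    | _ X ih =>
      rcases lt_or_ge X (X₀ + 1) with hX | hX
      · have := Finset.single_le_sum (f := fun X => |∑ n ∈ Ioc 0 X, (f n - A)|)
          (fun _ _ => abs_nonneg _) (Finset.mem_range.2 hX)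
        have h2 : 0 ≤ 2 * (ε / 4) * X := by positivity
        linarith
      · have h1 := hX₀ X (by omega)
        have h2 := ih (X / 2) (Nat.div_lt_self (by omega) (by norm_num))
        have h3 : ((X / 2 : ℕ) : ℝ) ≤ X / 2 := Nat.cast_div_le
        have h4 : ∑ n ∈ Ioc 0 X, (f n - A) =
            ∑ n ∈ Ioc 0 (X / 2), (f n - A) + ∑ n ∈ Ioc (X / 2) X, (f n - A) :=
          (Finset.sum_Ioc_consecutive _ (Nat.zero_le _) (Nat.div_le_self _ _)).symm
        rw [h4]
        have h5 := mul_le_mul_of_nonneg_left h3 (show 0 ≤ 2 * (ε / 4) by positivity)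
        refine (abs_add_le _ _).trans ?_
        linarith
  obtain ⟨X₁, hX₁⟩ := exists_nat_gt (2 * C / ε)
  refine ⟨max X₁ 1, fun X hX => ?_⟩
  have hXpos : (0 : ℝ) < X := by
    exact_mod_cast lt_of_lt_of_le zero_lt_one ((le_max_right _ _).trans hX)
  have hX1 : (X₁ : ℝ) ≤ X := by exact_mod_cast (le_max_left _ _).trans hX
  have h1 := key X
  have e : (∑ n ∈ Ioc 0 X, f n) / X - A = (∑ n ∈ Ioc 0 X, (f n - A)) / X := by
    rw [Finset.sum_sub_distrib, Finset.sum_const, Nat.card_Ioc, nsmul_eq_mul]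
    field_simp
    simp [mul_comm]
  rw [Real.dist_eq, e, abs_div, abs_of_pos hXpos, div_lt_iff₀ hXpos]
  rw [div_lt_iff₀ hε] at hX₁
  have := mul_le_mul_of_nonneg_left hX1 hε.le
  linarith

/-- `ζ(s) - 1/(s-1)`, extended by continuity. -/
noncomputable def zetaReg : ℂ → ℂ :=
  Function.update (fun s => riemannZeta s - 1 / (s - 1)) 1 Real.eulerMascheroniConstant

lemma continuous_zetaReg : Continuous zetaReg := by
  rw [continuous_iff_continuousAt]
  intro s
  rcases eq_or_ne s 1 with rfl | hs
  · exact continuousAt_update_same.2 tendsto_riemannZeta_sub_one_div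
  · unfold zetaReg
    rw [continuousAt_update_of_ne hs]
    apply (differentiableAt_riemannZeta hs).continuousAt.sub
    exact ContinuousAt.div₀ continuousAt_const (continuousAt_id.sub continuousAt_const)
      (sub_ne_zero.2 hs)

lemma wienerData_residueClass {q : ℕ} [NeZero q] {a : ZMod q} (ha : IsUnit a) :
    WienerData (fun n => ((ArithmeticFunction.vonMangoldt.residueClass a n -
        (q.totient : ℝ)⁻¹ : ℝ) : ℂ)) (fun n => Λ n + 1) 7
      (fun s => ArithmeticFunction.vonMangoldt.LFunctionResidueClassAux a s -
        (q.totient : ℂ)⁻¹ * zetaReg s) := by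
  have hA : (q.totient : ℝ)⁻¹ ≤ 1 := by
    apply inv_le_one_of_one_le₀
    exact_mod_cast Nat.totient_pos.2 (Nat.pos_of_ne_zero (NeZero.ne q))
  have hA0 : 0 ≤ (q.totient : ℝ)⁻¹ := by positivity
  refine ⟨by norm_num, fun n => ?_, fun X => ?_, ?_, fun s hs => ?_⟩
  · rw [Complex.norm_real, Real.norm_eq_abs]
    have h1 := ArithmeticFunction.vonMangoldt.residueClass_nonneg a n
    have h2 := ArithmeticFunction.vonMangoldt.residueClass_le a n
    exact abs_le.2 ⟨by linarith, by linarith⟩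
  · rw [Finset.sum_add_distrib, Finset.sum_const, Nat.card_Ioc]
    have := sum_vonMangoldt_le X
    simp only [nsmul_eq_mul, Nat.sub_zero, mul_one]
    linarith
  · exact (ArithmeticFunction.vonMangoldt.continuousOn_LFunctionResidueClassAux a).sub
      (continuous_const.mul continuous_zetaReg).continuousOn
  · have hs1 : s ≠ 1 := by rintro rfl; simp at hs
    have h1 : LSeriesHasSum (fun n => ((ArithmeticFunction.vonMangoldt.residueClass a n : ℝ) : ℂ)) s
        (LSeries (fun n => ((ArithmeticFunction.vonMangoldt.residueClass a n : ℝ) : ℂ)) s) := by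
      apply LSeriesSummable.LSeriesHasSum
      apply LSeriesSummable_of_abscissaOfAbsConv_lt_re
      exact (ArithmeticFunction.vonMangoldt.abscissaOfAbsConv_residueClass_le_one a).trans_lt
        (by exact_mod_cast hs)
    have h2 := (LSeriesHasSum_one hs).smul ((q.totient : ℂ)⁻¹)
    have h3 := h1.sub h2
    have e := ArithmeticFunction.vonMangoldt.eqOn_LFunctionResidueClassAux ha hs
    simp only at e
    rw [e]
    convert! h3 using 1
    · ext n
      simp
    · unfold zetaReg
      rw [Function.update_of_ne hs1]
      ring

/-- The prime number theorem in arithmetic progressions to a fixed modulus. -/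
theorem tendsto_sum_lp_modEq {q : ℕ} (hq : 0 < q) {a : ℕ} (ha : a.Coprime q) :
    Tendsto (fun X : ℕ => (∑ n ∈ (Ioc 0 X).filter (fun n => n ≡ a [MOD q]), lp n) / (X : ℝ)) atTop
      (nhds ((q.totient : ℝ)⁻¹)) := by
  have : NeZero q := ⟨hq.ne'⟩
  have hu : IsUnit (a : ZMod q) := (ZMod.isUnit_iff_coprime a q).2 ha
  have h1 := (wienerData_residueClass hu).tendsto_sum_div
    (ArithmeticFunction.vonMangoldt.residueClass_nonneg _) (by positivity)
  have h2 : Tendsto (fun X : ℕ => 2 * √(X : ℝ) * Real.log X / X) atTop (nhds 0) := by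
    have h3 : Tendsto (fun x : ℝ => 2 * (Real.log x / x ^ (1 / 2 : ℝ))) atTop (nhds (2 * 0)) :=
      ((isLittleO_log_rpow_atTop (by norm_num)).tendsto_div_nhds_zero).const_mul 2
    rw [mul_zero] at h3
    refine (h3.comp tendsto_natCast_atTop_atTop).congr' ?_
    filter_upwards [eventually_gt_atTop 0] with X hX
    have hX' : (0 : ℝ) < X := by exact_mod_cast hX
    rw [Function.comp_apply, ← Real.sqrt_eq_rpow]
    have hs := Real.sqrt_pos.2 hX'
    have hss := Real.mul_self_sqrt hX'.le
    rw [eq_div_iff hX'.ne', ← mul_div_assoc, div_mul_eq_mul_div, div_eq_iff hs.ne']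
    linear_combination (-2 * Real.log X) * hss
  have h4 : Tendsto (fun X : ℕ => (∑ n ∈ Ioc 0 X,
      ArithmeticFunction.vonMangoldt.residueClass (a : ZMod q) n) / (X : ℝ) -
      (∑ n ∈ (Ioc 0 X).filter (fun n => n ≡ a [MOD q]), lp n) / (X : ℝ)) atTop (nhds 0) := by
    have key : ∀ X : ℕ, ∑ n ∈ Ioc 0 X,
        ArithmeticFunction.vonMangoldt.residueClass (a : ZMod q) n -
        ∑ n ∈ (Ioc 0 X).filter (fun n => n ≡ a [MOD q]), lp n =
        ∑ n ∈ (Ioc 0 X).filter (fun n => n ≡ a [MOD q]), npm n := by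
      intro X
      have : ∑ n ∈ Ioc 0 X, ArithmeticFunction.vonMangoldt.residueClass (a : ZMod q) n =
          ∑ n ∈ (Ioc 0 X).filter (fun n => n ≡ a [MOD q]), Λ n := by
        rw [Finset.sum_filter]
        apply Finset.sum_congr rfl
        intro n _
        unfold ArithmeticFunction.vonMangoldt.residueClass
        rw [Set.indicator_apply]
        congr 1
        simp only [Set.mem_ofPred_eq, ZMod.natCast_eq_natCast_iff]
      rw [this, ← Finset.sum_sub_distrib]
      apply Finset.sum_congr rfl
      intro n _
      rw [← lp_add_npm]
      ring
    refine squeeze_zero' (Eventually.of_forall fun X => ?_) ?_ h2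
    · rw [← sub_div, key]
      exact div_nonneg (Finset.sum_nonneg fun n _ => npm_nonneg n) X.cast_nonneg
    · filter_upwards [eventually_ge_atTop 1] with X hX
      rw [← sub_div, key]
      apply div_le_div_of_nonneg_right _ X.cast_nonneg
      refine le_trans ?_ (sum_npm_le X hX)
      exact Finset.sum_le_sum_of_subset_of_nonneg (Finset.filter_subset _ _)
        fun n _ _ => npm_nonneg n
  have := h1.sub h4
  rw [sub_zero] at this
  refine this.congr fun X => ?_
  ring

/-- The density weight of the integers coprime to `W`. -/
noncomputable def cw (W n : ℕ) : ℝ := if n.Coprime W then (W : ℝ) / W.totient else 0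

lemma cw_nonneg (W n : ℕ) : 0 ≤ cw W n := by
  unfold cw; split_ifs <;> positivity

lemma cw_add (W n : ℕ) : cw W (n + W) = cw W n := by
  unfold cw
  simp

lemma sum_cw_window {W : ℕ} (hW : 0 < W) (v : ℕ) : ∑ n ∈ Ioc v (v + W), cw W n = W := by
  have h1 : (Ioc v (v + W) : Finset ℕ) = Ico (v + 1) (v + 1 + W) := by
    ext n; simp only [Finset.mem_Ioc, Finset.mem_Ico]; omega
  have hp : (0 : ℝ) < W.totient := by exact_mod_cast Nat.totient_pos.2 hW
  unfold cw
  rw [h1, ← Finset.sum_filter, Finset.sum_const, nsmul_eq_mul]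
  have h2 := Nat.filter_coprime_Ico_eq_totient W (v + 1)
  rw [Finset.filter_congr fun n _ => Nat.coprime_comm] at h2
  rw [h2]
  field_simp

lemma sum_cw_sq_le {W : ℕ} (hW : 0 < W) {u v : ℕ} (huv : u ≤ v) :
    ∑ n ∈ Ioc u v, cw W n ^ 2 ≤ W / W.totient * ((v - u : ℕ) + W) := by
  have h1 : (Ioc u v : Finset ℕ) = Ico (u + 1) (u + 1 + (v - u)) := by
    ext n; simp only [Finset.mem_Ioc, Finset.mem_Ico]; omega
  have hp : (0 : ℝ) < W.totient := by exact_mod_cast Nat.totient_pos.2 hW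
  have hW' : (0 : ℝ) < W := by exact_mod_cast hW
  have h2 := Nat.Ico_filter_coprime_le (a := W) (u + 1) (v - u) hW.ne'
  rw [Finset.filter_congr fun n _ => Nat.coprime_comm] at h2
  have h3 : ∑ n ∈ Ioc u v, cw W n ^ 2 =
      ((Ico (u + 1) (u + 1 + (v - u))).filter (fun n => n.Coprime W)).card *
        ((W : ℝ) / W.totient) ^ 2 := by
    rw [← nsmul_eq_mul, ← Finset.sum_const, Finset.sum_filter, h1]
    apply Finset.sum_congr rfl
    intro n _
    unfold cw
    split_ifs <;> simp
  have h4 : ((((Ico (u + 1) (u + 1 + (v - u))).filter (fun n => n.Coprime W)).card : ℕ) : ℝ) ≤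
      W.totient * (((v - u : ℕ) : ℝ) / W + 1) := by
    refine (show _ ≤ ((W.totient * ((v - u) / W + 1) : ℕ) : ℝ) from by exact_mod_cast h2).trans ?_
    push_cast
    have : (((v - u) / W : ℕ) : ℝ) ≤ ((v - u : ℕ) : ℝ) / W := Nat.cast_div_le
    gcongr
  rw [h3]
  calc _ ≤ (W.totient * (((v - u : ℕ) : ℝ) / W + 1)) * ((W : ℝ) / W.totient) ^ 2 := by
        gcongr
    _ = _ := by field_simp

lemma norm_esum_cw_le {W : ℕ} (hW : 0 < W) (u v : ℕ) (a : ℤ) {β : ℝ} (hβ0 : β ≠ 0)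
    (hβ : |β| ≤ 1 / (2 * W)) : ‖esum (Ioc u v) (cw W) (a / W + β)‖ ≤ 1 / (2 * |β|) := by
  have hW' : (0 : ℝ) < W := by exact_mod_cast hW
  have hb : 0 < |β| := abs_pos.2 hβ0
  rcases lt_or_ge v u with huv | huv
  · rw [Finset.Ioc_eq_empty (by omega)]
    simp only [esum, Finset.sum_empty, norm_zero]
    positivity
  set α : ℝ := a / W + β with hα
  set h : ℕ → ℂ := fun n => (cw W n : ℂ) * ex (n * α) with hh
  have hper : ∀ n, h (n + W) = ex (W * α) * h n := by
    intro n
    simp only [hh]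
    rw [cw_add]
    push_cast
    rw [add_mul, ex_add]
    ring
  have hshift : ∑ n ∈ Ioc (u + W) (v + W), h n = ex (W * α) * ∑ n ∈ Ioc u v, h n := by
    rw [Finset.mul_sum, ← Finset.map_add_right_Ioc, Finset.sum_map]
    exact Finset.sum_congr rfl fun n _ => hper n
  have hnorm : ∀ t : ℕ, ‖∑ n ∈ Ioc t (t + W), h n‖ ≤ W := by
    intro t
    refine (norm_sum_le _ _).trans ?_
    rw [← sum_cw_window hW t]
    apply Finset.sum_le_sum
    intro n _
    simp only [hh]
    rw [norm_mul, norm_ex, mul_one, Complex.norm_real, Real.norm_eq_abs, abs_of_nonneg (cw_nonneg W n)]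
  have hid : (ex (W * α) - 1) * ∑ n ∈ Ioc u v, h n =
      ∑ n ∈ Ioc v (v + W), h n - ∑ n ∈ Ioc u (u + W), h n := by
    have e1 := Finset.sum_Ioc_consecutive h huv (Nat.le_add_right v W)
    have e2 := Finset.sum_Ioc_consecutive h (Nat.le_add_right u W) (Nat.add_le_add_right huv W)
    rw [sub_mul, ← hshift, one_mul]
    linear_combination e2 - e1
  have h1 : ‖ex (W * α) - 1‖ * ‖∑ n ∈ Ioc u v, h n‖ ≤ 2 * W := by
    rw [← norm_mul, hid]
    refine (norm_sub_le _ _).trans ?_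
    linarith [hnorm v, hnorm u]
  have h2 : nn (W * α) = W * |β| := by
    have : (W : ℝ) * α = W * β + (a : ℤ) := by
      rw [hα]; field_simp; ring
    rw [this, nn_add_int, nn_of_abs_le_half]
    · rw [abs_mul, abs_of_pos hW']
    · rw [abs_mul, abs_of_pos hW']
      rw [le_div_iff₀ (by positivity)] at hβ
      linarith
  have h3 := four_mul_nn_le (W * α)
  rw [h2] at h3
  have h4 : 4 * (W * |β|) * ‖∑ n ∈ Ioc u v, h n‖ ≤ 2 * W :=
    (mul_le_mul_of_nonneg_right h3 (norm_nonneg _)).trans h1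
  have h5 : esum (Ioc u v) (cw W) α = ∑ n ∈ Ioc u v, h n := rfl
  rw [h5, le_div_iff₀ (by positivity)]
  have h6 : 2 * (W : ℝ) * (‖∑ n ∈ Ioc u v, h n‖ * (2 * |β|)) ≤ 2 * W * 1 := by linarith
  exact le_of_mul_le_mul_left h6 (by positivity)

/-- Summation by parts against a slowly varying unimodular weight. -/
lemma norm_sum_mul_ex_le {h : ℕ → ℝ} {D : ℝ} {y : ℕ} (hD : ∀ n ≤ y, |∑ i ∈ Ioc 0 n, h i| ≤ D)
    (β : ℝ) : ‖∑ n ∈ Ioc 0 y, (h n : ℂ) * ex (n * β)‖ ≤ D * (1 + 2 * Real.pi * |β| * y) := by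
  have hD0 : 0 ≤ D := (abs_nonneg _).trans (hD 0 (Nat.zero_le _))
  set S : ℕ → ℝ := fun n => ∑ i ∈ Ioc 0 n, h i with hS
  have hid : ∀ t : ℕ, ∑ n ∈ Ioc 0 t, (h n : ℂ) * ex (n * β) =
      S t * ex (t * β) - ∑ n ∈ range t, (S n : ℂ) * (ex ((n + 1 : ℕ) * β) - ex (n * β)) := by
    intro t
    induction t with
    | zero => simp [hS]
    | succ t ih =>
      rw [Finset.sum_Ioc_succ_top (Nat.zero_le _), ih, Finset.sum_range_succ]
      have : (S (t + 1) : ℂ) = S t + h (t + 1) := by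
        simp only [hS]
        rw [Finset.sum_Ioc_succ_top (Nat.zero_le _)]
        push_cast
        rfl
      rw [this]
      ring
  rw [hid]
  have h1 : ‖(S y : ℂ) * ex (y * β)‖ ≤ D := by
    rw [norm_mul, norm_ex, mul_one, Complex.norm_real]
    exact hD y le_rfl
  have h2 : ‖∑ n ∈ range y, (S n : ℂ) * (ex ((n + 1 : ℕ) * β) - ex (n * β))‖ ≤
      y * (D * (2 * Real.pi * |β|)) := by
    refine (norm_sum_le _ _).trans ?_
    rw [← nsmul_eq_mul, ← Finset.card_range y, ← Finset.sum_const, Finset.card_range]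
    apply Finset.sum_le_sum
    intro n hn
    rw [norm_mul, Complex.norm_real]
    refine mul_le_mul (hD n (Finset.mem_range.1 hn).le) ?_ (norm_nonneg _) hD0
    refine (norm_ex_sub_ex_le _ _).trans_eq ?_
    congr 2
    push_cast
    ring
  calc _ ≤ _ := norm_sub_le _ _
    _ ≤ D + y * (D * (2 * Real.pi * |β|)) := add_le_add h1 h2
    _ = _ := by ring

lemma abs_card_modEq_sub_le {W : ℕ} (hW : 0 < W) (b y : ℕ) :
    |(((Ioc 0 y).filter (fun n => n ≡ b [MOD W])).card : ℝ) - y / W| ≤ 1 := by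
  have hW' : (0 : ℚ) < W := by exact_mod_cast hW
  have h := Nat.Ioc_filter_modEq_card 0 y hW b
  have h0 : ((y : ℚ) - b) / W - (((0 : ℕ) : ℚ) - b) / W = y / W := by push_cast; ring
  have hmono : ⌊(((0 : ℕ) : ℚ) - b) / W⌋ ≤ ⌊((y : ℚ) - b) / W⌋ := by
    apply Int.floor_le_floor
    have : (0 : ℚ) ≤ y / W := by positivity
    linarith
  rw [max_eq_left (by linarith)] at h
  have h2 : |(((Ioc 0 y).filter (fun n => n ≡ b [MOD W])).card : ℚ) - y / W| ≤ 1 := by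
    have h3 : (((Ioc 0 y).filter (fun n => n ≡ b [MOD W])).card : ℚ) =
        (⌊((y : ℚ) - b) / W⌋ : ℚ) - (⌊(((0 : ℕ) : ℚ) - b) / W⌋ : ℚ) := by exact_mod_cast h
    rw [h3, abs_le]
    have e1 := Int.floor_le (((y : ℚ) - b) / W)
    have e2 := Int.lt_floor_add_one (((y : ℚ) - b) / W)
    have e3 := Int.floor_le ((((0 : ℕ) : ℚ) - b) / W)
    have e4 := Int.lt_floor_add_one ((((0 : ℕ) : ℚ) - b) / W)
    constructor <;> linarith
  have h3 : ((|(((Ioc 0 y).filter (fun n => n ≡ b [MOD W])).card : ℚ) - y / W| : ℚ) : ℝ) ≤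
      ((1 : ℚ) : ℝ) := Rat.cast_le.2 h2
  push_cast at h3
  exact h3

lemma tendsto_sum_lp_sub_cw {W : ℕ} (hW : 0 < W) (b : ℕ) :
    Tendsto (fun X : ℕ => (∑ n ∈ (Ioc 0 X).filter (fun n => n ≡ b [MOD W]), (lp n - cw W n)) / (X : ℝ))
      atTop (nhds 0) := by
  have hp : (0 : ℝ) < W.totient := by exact_mod_cast Nat.totient_pos.2 hW
  have hW' : (0 : ℝ) < W := by exact_mod_cast hW
  by_cases hb : b.Coprime W
  · have h1 := tendsto_sum_lp_modEq hW hb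
    have h2 : Tendsto (fun X : ℕ => (((Ioc 0 X).filter (fun n => n ≡ b [MOD W])).card : ℝ) / X)
        atTop (nhds ((W : ℝ)⁻¹)) := by
      rw [tendsto_iff_dist_tendsto_zero]
      refine squeeze_zero' (Eventually.of_forall fun _ => dist_nonneg) ?_
        tendsto_one_div_atTop_nhds_zero_nat
      filter_upwards [eventually_gt_atTop 0] with X hX
      have hX' : (0 : ℝ) < X := by exact_mod_cast hX
      have h8 : (((Ioc 0 X).filter (fun n => n ≡ b [MOD W])).card : ℝ) / X - (W : ℝ)⁻¹ =
          ((((Ioc 0 X).filter (fun n => n ≡ b [MOD W])).card : ℝ) - X / W) / X := by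
        field_simp
      rw [Real.dist_eq, h8, abs_div, abs_of_pos hX']
      gcongr
      exact abs_card_modEq_sub_le hW b X
    have h3 := h1.sub (h2.const_mul ((W : ℝ) / W.totient))
    have h4 : ((W.totient : ℝ)⁻¹) - (W : ℝ) / W.totient * (W : ℝ)⁻¹ = 0 := by field_simp; simp
    rw [h4] at h3
    refine h3.congr fun X => ?_
    have h5 : ∑ n ∈ (Ioc 0 X).filter (fun n => n ≡ b [MOD W]), cw W n =
        (((Ioc 0 X).filter (fun n => n ≡ b [MOD W])).card : ℝ) * ((W : ℝ) / W.totient) := by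
      rw [← nsmul_eq_mul, ← Finset.sum_const]
      refine Finset.sum_congr rfl fun n hn => ?_
      have hn' := (Finset.mem_filter.1 hn).2
      have : n.Coprime W := by
        unfold Nat.Coprime
        rw [hn'.gcd_eq]
        exact hb
      unfold cw
      rw [if_pos this]
    rw [Finset.sum_sub_distrib, h5]
    ring
  · refine squeeze_zero_norm (a := fun X : ℕ => (2 * W : ℝ) / X) (fun X => ?_)
      (tendsto_const_div_atTop_nhds_zero_nat _)
    rw [norm_div, Real.norm_natCast]
    gcongr
    have hnc : ∀ n ∈ (Ioc 0 X).filter (fun n => n ≡ b [MOD W]), ¬ n.Coprime W := by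
      intro n hn hc
      apply hb
      unfold Nat.Coprime
      rw [← (Finset.mem_filter.1 hn).2.gcd_eq]
      exact hc
    have h6 : ∑ n ∈ (Ioc 0 X).filter (fun n => n ≡ b [MOD W]), (lp n - cw W n) =
        ∑ n ∈ (Ioc 0 X).filter (fun n => n ≡ b [MOD W]), lp n := by
      refine Finset.sum_congr rfl fun n hn => ?_
      unfold cw
      rw [if_neg (hnc n hn), sub_zero]
    rw [h6, Real.norm_of_nonneg (Finset.sum_nonneg fun n _ => lp_nonneg n)]
    refine le_trans ?_ (sum_lp_le W)
    have hf : ∀ n ∈ (Ioc 0 X).filter (fun n => n ≡ b [MOD W]), n ∉ Ioc 0 W → lp n = 0 := by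
      intro n hn hnW
      by_contra h0
      have hnp : n.Prime := by
        by_contra h
        exact h0 (by unfold lp; simp [h])
      have hd : n ∣ W := by
        by_contra h
        exact hnc n hn ((hnp.coprime_iff_not_dvd).2 h)
      exact hnW (Finset.mem_Ioc.2 ⟨hnp.pos, Nat.le_of_dvd hW hd⟩)
    rw [← Finset.sum_filter_of_ne (p := fun n => n ∈ Ioc 0 W)
      (fun n hn h0 => by_contra fun h => h0 (hf n hn h))]
    exact Finset.sum_le_sum_of_subset_of_nonneg (fun n hn => (Finset.mem_filter.1 hn).2)
      fun n _ _ => lp_nonneg n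

lemma exists_forall_abs_le_mul {f : ℕ → ℝ}
    (hf : Tendsto (fun X : ℕ => f X / (X : ℝ)) atTop (nhds 0)) {ε : ℝ} (hε : 0 < ε) :
    ∀ᶠ N : ℕ in atTop, ∀ y ≤ N, |f y| ≤ ε * N := by
  have h1 : ∀ᶠ X : ℕ in atTop, |f X / (X : ℝ)| < ε := by
    have := (Metric.tendsto_nhds.1 hf) ε hε
    simpa only [Real.dist_eq, sub_zero] using this
  obtain ⟨Y, hY⟩ := eventually_atTop.1 h1
  set B : ℝ := ∑ y ∈ range (Y + 1), |f y| with hB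
  filter_upwards [(tendsto_natCast_atTop_atTop (R := ℝ)).eventually_ge_atTop (B / ε)] with N hN y hy
  rw [div_le_iff₀ hε] at hN
  rcases le_or_gt y Y with h | h
  · have : |f y| ≤ B := Finset.single_le_sum (f := fun y => |f y|) (fun _ _ => abs_nonneg _)
      (Finset.mem_range.2 (by omega))
    linarith
  · have hy0 : (0 : ℝ) < y := by exact_mod_cast (Nat.zero_le Y).trans_lt h
    have h2 := hY y h.le
    rw [abs_div, abs_of_pos hy0, div_lt_iff₀ hy0] at h2
    have h3 : (y : ℝ) ≤ N := by exact_mod_cast hy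
    exact h2.le.trans (by gcongr)

/-- Near a rational with denominator dividing `W`, the exponential sum over primes
agrees with its model. -/
theorem eventually_norm_pS_sub_esum_cw_le {W : ℕ} (hW : 0 < W) {ε : ℝ} (hε : 0 < ε) :
    ∀ᶠ N : ℕ in atTop, ∀ y ≤ N, ∀ (a : ℕ) (β : ℝ),
      ‖pS y (a / W + β) - esum (Ioc 0 y) (cw W) (a / W + β)‖ ≤
        ε * N * (1 + 2 * Real.pi * |β| * N) := by
  have hW' : (0 : ℝ) < W := by exact_mod_cast hW
  have h1 : ∀ᶠ N : ℕ in atTop, ∀ b ∈ range W, ∀ y ≤ N,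
      |∑ n ∈ (Ioc 0 y).filter (fun n => n ≡ b [MOD W]), (lp n - cw W n)| ≤ ε / W * N :=
    (Finset.eventually_all _).2 fun b _ =>
      exists_forall_abs_le_mul (tendsto_sum_lp_sub_cw hW b) (by positivity)
  filter_upwards [h1] with N hN y hy a β
  have hyN : (y : ℝ) ≤ N := by exact_mod_cast hy
  have e1 : pS y (a / W + β) - esum (Ioc 0 y) (cw W) (a / W + β) =
      ∑ b ∈ range W, ex (b * ((a : ℝ) / W)) * ∑ n ∈ Ioc 0 y,
        ((if n ≡ b [MOD W] then lp n - cw W n else 0 : ℝ) : ℂ) * ex (n * β) := by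
    simp only [Finset.mul_sum]
    rw [Finset.sum_comm]
    unfold pS esum
    rw [← Finset.sum_sub_distrib]
    refine Finset.sum_congr rfl fun n _ => ?_
    rw [Finset.sum_eq_single (n % W)]
    · rw [if_pos (Nat.mod_modEq n W).symm, ← ex_mul_div_congr hW (Nat.mod_modEq n W).symm a,
        mul_add, ex_add]
      push_cast
      ring
    · intro b hb hne
      rw [if_neg]
      · simp
      · intro h
        apply hne
        rw [h, Nat.mod_eq_of_lt (Finset.mem_range.1 hb)]
    · intro h
      exact absurd (Finset.mem_range.2 (Nat.mod_lt n hW)) h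
  rw [e1]
  calc _ ≤ ∑ b ∈ range W, ε / W * N * (1 + 2 * Real.pi * |β| * N) := by
        refine (norm_sum_le _ _).trans (Finset.sum_le_sum fun b hb => ?_)
        rw [norm_mul, norm_ex, one_mul]
        refine (norm_sum_mul_ex_le (D := ε / W * N) (fun n hn => ?_) β).trans ?_
        · rw [← Finset.sum_filter]
          exact hN b hb n (hn.trans hy)
        · have := Real.pi_pos
          gcongr
    _ = _ := by
        rw [Finset.sum_const, Finset.card_range, nsmul_eq_mul]
        field_simp

open scoped Classical in
/-- The indicator function of the units. -/
noncomputable def unitInd {R : Type} [CommRing R] (x : R) : ℝ := if IsUnit x then 1 else 0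

lemma unitInd_pos {R : Type} [CommRing R] {x : R} (h : IsUnit x) : unitInd x = 1 := if_pos h

lemma unitInd_neg {R : Type} [CommRing R] {x : R} (h : ¬ IsUnit x) : unitInd x = 0 := if_neg h

/-- The number of representations of `N` as a sum of three units. -/
noncomputable def unitRep {R : Type} [CommRing R] [Fintype R] (N : R) : ℝ :=
  ∑ x : R, ∑ y : R, unitInd x * unitInd y * unitInd (N - x - y)

lemma unitRep_equiv {R S : Type} [CommRing R] [Fintype R] [CommRing S] [Fintype S] (e : R ≃+* S)
    (N : R) : unitRep (e N) = unitRep N := by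
  unfold unitRep
  rw [← Equiv.sum_comp e.toEquiv]
  refine Finset.sum_congr rfl fun x _ => ?_
  rw [← Equiv.sum_comp e.toEquiv]
  refine Finset.sum_congr rfl fun y _ => ?_
  have h : ∀ z : R, unitInd (e z) = unitInd z := by
    intro z
    by_cases hz : IsUnit z
    · rw [unitInd_pos hz, unitInd_pos (hz.map e)]
    · rw [unitInd_neg hz, unitInd_neg (fun h => hz ((MulEquiv.isUnit_map e).1 h))]
  simp only [RingEquiv.toEquiv_eq_coe, EquivLike.coe_coe, ← map_sub, h]

lemma unitRep_prod {R S : Type} [CommRing R] [Fintype R] [CommRing S] [Fintype S] (a : R) (b : S) :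
    unitRep (a, b) = unitRep a * unitRep b := by
  have h : ∀ z : R × S, unitInd z = unitInd z.1 * unitInd z.2 := by
    intro z
    by_cases hz : IsUnit z
    · rw [unitInd_pos hz, unitInd_pos (Prod.isUnit_iff.1 hz).1, unitInd_pos (Prod.isUnit_iff.1 hz).2,
        one_mul]
    · rw [unitInd_neg hz]
      by_cases h1 : IsUnit z.1
      · rw [unitInd_neg fun h2 => hz (Prod.isUnit_iff.2 ⟨h1, h2⟩), mul_zero]
      · rw [unitInd_neg h1, zero_mul]
  unfold unitRep
  rw [Fintype.sum_prod_type, Finset.sum_mul_sum]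
  refine Finset.sum_congr rfl fun x _ => Finset.sum_congr rfl fun x' _ => ?_
  rw [Fintype.sum_prod_type, Finset.sum_mul_sum]
  refine Finset.sum_congr rfl fun y _ => Finset.sum_congr rfl fun y' _ => ?_
  simp only [h, Prod.fst_sub, Prod.snd_sub]
  ring

lemma unitRep_zmod_prime {p : ℕ} [Fact p.Prime] {N : ZMod p} (hN : N ≠ 0) :
    unitRep N = (p : ℝ) ^ 2 - 3 * p + 3 := by
  have hi : ∀ x : ZMod p, unitInd x = 1 - (if x = 0 then 1 else 0) := by
    intro x
    by_cases h : x = 0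
    · rw [unitInd_neg (by rw [isUnit_iff_ne_zero]; simpa using h), if_pos h, sub_self]
    · rw [unitInd_pos (isUnit_iff_ne_zero.2 h), if_neg h, sub_zero]
  have hin : ∀ c : ZMod p, ∑ y : ZMod p, unitInd y * unitInd (c - y) =
      (p : ℝ) - 2 + (if c = 0 then 1 else 0) := by
    intro c
    have : ∀ y : ZMod p, unitInd y * unitInd (c - y) = 1 - (if y = 0 then 1 else 0) -
        (if y = c then 1 else 0) + (if y = 0 then (if c = 0 then 1 else 0) else 0) := by
      intro y
      rw [hi, hi]
      have h1 : c - y = 0 ↔ y = c := by rw [sub_eq_zero, eq_comm]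
      simp only [h1]
      by_cases hy : y = 0
      · subst hy
        by_cases hc : c = 0 <;> simp [hc, eq_comm]
      · simp [hy]
    rw [Finset.sum_congr rfl fun y _ => this y, Finset.sum_add_distrib, Finset.sum_sub_distrib,
      Finset.sum_sub_distrib]
    simp only [Finset.sum_const, Finset.card_univ, ZMod.card, nsmul_eq_mul, mul_one,
      Finset.sum_ite_eq', Finset.mem_univ, if_true]
    ring
  unfold unitRep
  simp only [mul_assoc, ← Finset.mul_sum]
  have : ∀ x : ZMod p, unitInd x * ((p : ℝ) - 2 + (if N - x = 0 then 1 else 0)) =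
      ((p : ℝ) - 2) - (if x = 0 then (p : ℝ) - 2 else 0) + (if x = N then 1 else 0) := by
    intro x
    rw [hi]
    have h1 : N - x = 0 ↔ x = N := by rw [sub_eq_zero, eq_comm]
    simp only [h1]
    by_cases hx : x = 0
    · subst hx
      simp [hN.symm]
    · simp [hx]
  rw [Finset.sum_congr rfl fun x _ => by rw [hin, this x], Finset.sum_add_distrib,
    Finset.sum_sub_distrib]
  simp only [Finset.sum_const, Finset.card_univ, ZMod.card, nsmul_eq_mul,
      Finset.sum_ite_eq', Finset.mem_univ, if_true]
  ring

lemma totient_pow_three_le_unitRep (s : Finset ℕ) (hs : ∀ p ∈ s, p.Prime) (N : ℕ)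
    (hN : ∀ p ∈ s, N.Coprime p) (m : ℕ) [NeZero m] (hm : m = ∏ p ∈ s, p) :
    (m.totient : ℝ) ^ 3 ≤ m * unitRep (N : ZMod m) := by
  induction s using Finset.induction_on generalizing m with
  | empty =>
    simp only [Finset.prod_empty] at hm
    subst hm
    have : ∀ x : ZMod 1, unitInd x = 1 := by
      intro x
      rw [unitInd_pos (isUnit_of_subsingleton x)]
    unfold unitRep
    simp [this]
  | insert p s hps ih =>
    rw [Finset.prod_insert hps] at hm
    have hp := hs p (Finset.mem_insert_self p s)
    have : Fact p.Prime := ⟨hp⟩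
    set m' := ∏ p ∈ s, p with hm'
    have : NeZero m' := ⟨by
      intro h
      rw [h, mul_zero] at hm
      exact NeZero.ne m hm⟩
    have hc : p.Coprime m' := Nat.Coprime.prod_right fun q hq =>
      (Nat.coprime_primes hp (hs q (Finset.mem_insert_of_mem hq))).2 fun h => hps (h ▸ hq)
    have h1 := ih (fun q hq => hs q (Finset.mem_insert_of_mem hq))
      (fun q hq => hN q (Finset.mem_insert_of_mem hq)) m' rfl
    subst hm
    have h2 : unitRep (N : ZMod (p * m')) = unitRep (N : ZMod p) * unitRep (N : ZMod m') := by
      rw [← unitRep_equiv (ZMod.chineseRemainder hc), map_natCast, ← unitRep_prod]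
      rfl
    have hN0 : (N : ZMod p) ≠ 0 := by
      rw [Ne, ZMod.natCast_eq_zero_iff]
      exact (hp.coprime_iff_not_dvd).1 (hN p (Finset.mem_insert_self p s)).symm
    have hp1 : (1 : ℝ) ≤ p := by exact_mod_cast hp.one_le
    rw [h2, unitRep_zmod_prime hN0, Nat.totient_mul hc, Nat.totient_prime hp]
    push_cast [Nat.cast_sub hp.one_le]
    calc (((p : ℝ) - 1) * m'.totient) ^ 3 = ((p : ℝ) - 1) ^ 3 * (m'.totient : ℝ) ^ 3 := by ring
      _ ≤ (p * ((p : ℝ) ^ 2 - 3 * p + 3)) * (m' * unitRep (N : ZMod m')) := by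
        apply mul_le_mul _ h1 (by positivity)
        · nlinarith [sq_nonneg ((p : ℝ) - 2)]
        · nlinarith [sq_nonneg ((p : ℝ) - 2)]
      _ = _ := by ring

lemma sum_Ioc_zmod {P : ℕ} [NeZero P] (g : ZMod P → ℝ) (t h : ℕ) :
    ∑ n ∈ Ioc t (t + P * h), g n = h * ∑ x, g x := by
  induction h with
  | zero => simp
  | succ h ih =>
    rw [← Finset.sum_Ioc_consecutive _ (show t ≤ t + P * h by omega)
      (show t + P * h ≤ t + P * (h + 1) by rw [mul_add]; omega), ih]
    have h1 : ∑ n ∈ Ioc (t + P * h) (t + P * (h + 1)), g n = ∑ x, g x := by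
      refine Finset.sum_bij (fun n _ => (n : ZMod P)) (fun _ _ => Finset.mem_univ _) ?_ ?_
        (fun _ _ => rfl)
      · intro a ha b hb hab
        rw [Finset.mem_Ioc, mul_add, mul_one] at ha hb
        have h3 := (ZMod.natCast_eq_natCast_iff a b P).1 hab
        rcases le_total a b with hle | hle
        · have h4 := (Nat.modEq_iff_dvd' hle).1 h3
          have := Nat.eq_zero_of_dvd_of_lt h4 (by omega)
          omega
        · have h4 := (Nat.modEq_iff_dvd' hle).1 h3.symm
          have := Nat.eq_zero_of_dvd_of_lt h4 (by omega)
          omega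
      · intro x _
        set c := t + P * h + 1 with hc
        have hP : 0 < P := Nat.pos_of_ne_zero (NeZero.ne P)
        refine ⟨c + (x - (c : ZMod P)).val, ?_, ?_⟩
        · have := ZMod.val_lt (x - (c : ZMod P))
          rw [Finset.mem_Ioc, mul_add]
          omega
        · push_cast
          rw [ZMod.natCast_zmod_val]
          ring
    rw [h1]
    push_cast
    ring

lemma cw_eq_unitInd {P : ℕ} (n : ℕ) : cw P n = P / P.totient * unitInd (n : ZMod P) := by
  unfold cw
  by_cases h : n.Coprime P
  · rw [if_pos h, unitInd_pos ((ZMod.isUnit_iff_coprime n P).2 h), mul_one]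
  · rw [if_neg h, unitInd_neg fun h2 => h ((ZMod.isUnit_iff_coprime n P).1 h2), mul_zero]

lemma cw_prod_primeFactors {W : ℕ} (hW : 0 < W) : cw W = cw (∏ p ∈ W.primeFactors, p) := by
  set P := ∏ p ∈ W.primeFactors, p with hP
  have hpf : P.primeFactors = W.primeFactors :=
    Nat.primeFactors_prod fun p hp => Nat.prime_of_mem_primeFactors hp
  have hP0 : P ≠ 0 := Finset.prod_ne_zero_iff.2 fun p hp =>
    (Nat.prime_of_mem_primeFactors hp).ne_zero
  have key : ∀ m : ℕ, m ≠ 0 → (m : ℝ) / m.totient = (∏ p ∈ m.primeFactors, (1 - (p : ℝ)⁻¹))⁻¹ := by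
    intro m hm
    have h := congrArg (fun x : ℚ => (x : ℝ)) (Nat.totient_eq_mul_prod_factors m)
    push_cast at h
    rw [h]
    have : (m : ℝ) ≠ 0 := by exact_mod_cast hm
    rw [← div_div, div_self this, one_div]
  funext n
  unfold cw
  rw [key W hW.ne', key P hP0, hpf]
  have : n.Coprime W ↔ n.Coprime P := by
    rcases Nat.eq_zero_or_pos n with rfl | hn
    · have h1 := Nat.primeFactors_eq_empty (n := W)
      have h2 := Nat.primeFactors_eq_empty (n := P)
      rw [hpf] at h2
      rw [Nat.coprime_zero_left, Nat.coprime_zero_left]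
      have := h1.symm.trans h2
      omega
    · rw [← Nat.disjoint_primeFactors hn.ne' hW.ne', ← Nat.disjoint_primeFactors hn.ne' hP0, hpf]
  simp only [this]

/-- Lower bound for the weighted number of representations by integers coprime to `W`. -/
theorem sq_le_sum_cw {W N t h P : ℕ} (hW : 0 < W) (hP : P = ∏ p ∈ W.primeFactors, p)
    (hN : N.Coprime W) (hNt : 2 * (t + P * h) ≤ N) :
    ((h : ℝ) * P) ^ 2 ≤ ∑ a ∈ Ioc t (t + P * h), ∑ b ∈ Ioc t (t + P * h),
      cw W a * cw W b * cw W (N - a - b) := by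
  have hP0 : P ≠ 0 := by
    rw [hP]
    exact Finset.prod_ne_zero_iff.2 fun p hp => (Nat.prime_of_mem_primeFactors hp).ne_zero
  have : NeZero P := ⟨hP0⟩
  have hφ : (0 : ℝ) < P.totient := by exact_mod_cast Nat.totient_pos.2 (Nat.pos_of_ne_zero hP0)
  have hP1 : (0 : ℝ) < P := by exact_mod_cast Nat.pos_of_ne_zero hP0
  have h1 := totient_pow_three_le_unitRep W.primeFactors
    (fun p hp => Nat.prime_of_mem_primeFactors hp) N
    (fun p hp => Nat.Coprime.coprime_dvd_right (Nat.dvd_of_mem_primeFactors hp) hN) P hP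
  have h2 : ∑ a ∈ Ioc t (t + P * h), ∑ b ∈ Ioc t (t + P * h),
      cw W a * cw W b * cw W (N - a - b) =
      (P / P.totient : ℝ) ^ 3 * ((h : ℝ) ^ 2 * unitRep (N : ZMod P)) := by
    have e1 : ∀ a ∈ Ioc t (t + P * h), ∑ b ∈ Ioc t (t + P * h),
        cw W a * cw W b * cw W (N - a - b) = (P / P.totient : ℝ) ^ 3 * (h * ∑ y : ZMod P,
          unitInd (a : ZMod P) * unitInd y * unitInd ((N : ZMod P) - a - y)) := by
      intro a ha
      rw [← sum_Ioc_zmod _ t h, Finset.mul_sum]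
      refine Finset.sum_congr rfl fun b hb => ?_
      rw [Finset.mem_Ioc] at ha hb
      rw [cw_prod_primeFactors hW, ← hP, cw_eq_unitInd, cw_eq_unitInd, cw_eq_unitInd,
        Nat.cast_sub (by omega), Nat.cast_sub (by omega)]
      ring
    rw [Finset.sum_congr rfl e1, ← Finset.mul_sum, ← Finset.mul_sum,
      sum_Ioc_zmod (fun x : ZMod P => ∑ y : ZMod P,
          unitInd x * unitInd y * unitInd ((N : ZMod P) - x - y)) t h]
    unfold unitRep
    ring
  rw [h2]
  calc ((h : ℝ) * P) ^ 2 = (P / P.totient : ℝ) ^ 3 * ((h : ℝ) ^ 2 * ((P.totient : ℝ) ^ 3 / P)) := by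
        field_simp
    _ ≤ _ := by
        gcongr
        rw [div_le_iff₀ hP1]
        linarith

lemma two_pow_pow_le {N z : ℕ} (hz : 3 ≤ z) (hN : 0 < N) (hzN : (1 + (z : ℝ)) ^ 12 ≤ Real.log N) :
    ((2 : ℕ) ^ z) ^ 100 ≤ N := by
  have hN' : (0 : ℝ) < N := by exact_mod_cast hN
  have hz' : (3 : ℝ) ≤ z := by exact_mod_cast hz
  have h1 : (z : ℝ) * 100 ≤ Real.log N := by
    refine le_trans ?_ hzN
    have : (100 : ℝ) ≤ (1 + (z : ℝ)) ^ 11 := by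
      calc (100 : ℝ) ≤ (1 + 3) ^ 11 := by norm_num
        _ ≤ _ := by gcongr
    calc (z : ℝ) * 100 ≤ (1 + z) * (1 + (z : ℝ)) ^ 11 := by gcongr; linarith
      _ = _ := by ring
  have h2 : ((2 : ℝ) ^ z) ^ 100 ≤ N := by
    rw [← Real.log_le_log_iff (by positivity) hN', Real.log_pow, Real.log_pow]
    have := Real.log_two_lt_d9
    have h3 : (z : ℝ) * Real.log 2 ≤ z * 1 := by gcongr; linarith
    push_cast
    linarith
  exact_mod_cast h2

/-- Away from the major arcs, the exponential sum over the primes in `(u, v]` is small. -/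
theorem exists_norm_pS_sub_pS_le : ∃ C : ℝ, 0 < C ∧ ∃ x₀ : ℕ, ∀ (N z k₀ u v : ℕ), x₀ ≤ u → 0 < u →
    N ≤ 4 * u → u ≤ v → v ≤ N → 3 ≤ z → (1 + (z : ℝ)) ^ 12 ≤ Real.log N → 1 ≤ k₀ →
    ∀ α : ℝ, 0 ≤ α → (∀ a : ℕ, (16 : ℝ) ^ k₀ / N < |α - a / ((16 ^ k₀).factorial : ℕ)|) →
    ‖pS v α - pS u α‖ ≤ 260 * N * (1 + Real.log N) ^ 4 / √(2 ^ (z - 3)) ∨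
    ∃ j : ℕ, k₀ ≤ j ∧ 4 * j ≤ z ∧
      (∃ q : ℕ, ∃ a : ℤ, 0 < q ∧ q ≤ 16 ^ (j + 1) ∧ |α - a / q| ≤ 16 ^ (j + 1) / N) ∧
      ‖pS v α - pS u α‖ ≤ C * N * ((√(2 ^ j))⁻¹ + ((1 + (z : ℝ)) ^ 6)⁻¹) := by
  obtain ⟨C, hC, x₀, H⟩ := exists_norm_pS_le_major
  refine ⟨4 * C, by positivity, x₀, ?_⟩
  intro N z k₀ u v hu hu0 hNu huv hvN hz hzN hk α hα hmaj
  have hN : 0 < N := by omega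
  have hN' : (0 : ℝ) < N := by exact_mod_cast hN
  have hT := two_pow_pow_le hz hN hzN
  set T : ℕ := 2 ^ z with hTdef
  set Q : ℕ := 2 ^ (z - 3) with hQ
  have hQT : 8 * Q = T := by
    rw [hQ, hTdef, show (8 : ℕ) = 2 ^ 3 by norm_num, ← pow_add]; congr 1; omega
  have hQ0 : 0 < Q := by positivity
  have hT1 : 8 ≤ T := by omega
  have hT4 : T ^ 4 ≤ N := le_trans (Nat.pow_le_pow_right (by omega) (by norm_num)) hT
  have hTTT : 4 * T ^ 3 ≤ N := by
    calc 4 * T ^ 3 ≤ T * T ^ 3 := by gcongr; omega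
      _ = T ^ 4 := by ring
      _ ≤ N := hT4
  have hTN : T ≤ N := le_trans (Nat.le_self_pow (by norm_num) T) hT4
  have h6N : 6 * Q ≤ N := by omega
  set n₀ : ℕ := N / (6 * Q) with hn0
  have hn0p : 0 < n₀ := Nat.div_pos h6N (by omega)
  have hn0Q : n₀ * (6 * Q) ≤ N := Nat.div_mul_le_self N (6 * Q)
  have hn0lt : N < (n₀ + 1) * (6 * Q) := by
    have := Nat.lt_div_mul_add (a := N) (b := 6 * Q) (by omega)
    rw [add_mul, one_mul]; exact this
  obtain ⟨r, hr1, hr2⟩ := Real.exists_rat_abs_sub_le_and_den_le α hn0p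
  set q : ℕ := r.den with hq
  have hq0 : 0 < q := r.den_pos
  have hq0' : (0 : ℝ) < q := by exact_mod_cast hq0
  have hrq : (r : ℝ) = (r.num : ℝ) / q := by exact_mod_cast (Rat.num_div_den r).symm
  rw [hrq] at hr1
  have hcop : IsCoprime r.num (q : ℤ) := by
    rw [Int.isCoprime_iff_gcd_eq_one]
    exact r.reduced
  have hlogu : ∀ x : ℕ, u ≤ x → x ≤ N → (1 + (z : ℝ)) ^ 12 / 4 ≤ Real.log x := by
    intro x hux hxN
    have hx0 : (0 : ℝ) < x := by exact_mod_cast hu0.trans_le hux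
    have h1 : (N : ℝ) ≤ 4 * x := by exact_mod_cast hNu.trans (by omega)
    have h2 := Real.log_le_log hN' h1
    rw [Real.log_mul (by norm_num) hx0.ne'] at h2
    have h3 : Real.log 4 ≤ 3 := by
      have := Real.log_le_sub_one_of_pos (show (0 : ℝ) < 4 by norm_num)
      linarith
    have h4 : (4 : ℝ) ≤ (1 + (z : ℝ)) ^ 12 := by
      have hz' : (3 : ℝ) ≤ z := by exact_mod_cast hz
      calc (4 : ℝ) ≤ (1 + 3) ^ 12 := by norm_num
        _ ≤ _ := by gcongr
    linarith
  by_cases hQq : Q ≤ q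
  · left
    have hqQ : q * Q * 6 ≤ N := by
      calc q * Q * 6 ≤ n₀ * Q * 6 := by gcongr
        _ = n₀ * (6 * Q) := by ring
        _ ≤ N := hn0Q
    have hQ3 : 4 * Q ^ 3 ≤ N := by
      refine le_trans ?_ hTTT
      gcongr
      omega
    have hap : |α - r.num / q| ≤ 1 / (q : ℝ) ^ 2 := by
      refine hr1.trans ?_
      rw [sq]
      have : (q : ℝ) ≤ (n₀ : ℝ) + 1 := by
        have : (q : ℝ) ≤ n₀ := by exact_mod_cast hr2
        linarith
      gcongr
    have hb : ∀ x : ℕ, u ≤ x → x ≤ N →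
        ‖pS x α‖ ≤ 130 * N * (1 + Real.log N) ^ 4 / √(2 ^ (z - 3)) := by
      intro x hux hxN
      have hx0 : (0 : ℝ) < x := by exact_mod_cast hu0.trans_le hux
      have hx1 : (1 : ℝ) ≤ x := by exact_mod_cast hu0.trans_le hux
      have hxN' : (x : ℝ) ≤ N := by exact_mod_cast hxN
      have h := norm_pS_le_minor hQ0 hQq (x := x) (by omega) (by omega) hcop hap
      have hQr : (Q : ℝ) = 2 ^ (z - 3) := by rw [hQ]; push_cast; rfl
      rw [hQr] at h
      refine h.trans ?_
      have h0 : 0 ≤ Real.log x := Real.log_nonneg hx1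
      have hl : Real.log x ≤ Real.log N := Real.log_le_log hx0 hxN'
      gcongr
    refine (norm_sub_le _ _).trans ?_
    have e1 := hb v huv hvN
    have e2 := hb u le_rfl (huv.trans hvN)
    calc _ ≤ _ := add_le_add e1 e2
      _ = _ := by ring
  · right
    push Not at hQq
    set β : ℝ := α - r.num / q with hβ
    have hNβ : N * |β| * q ≤ 6 * Q := by
      have h1 : (N : ℝ) ≤ ((n₀ : ℝ) + 1) * (6 * Q) := by exact_mod_cast hn0lt.le
      rw [le_div_iff₀ (by positivity)] at hr1
      calc (N : ℝ) * |β| * q = |β| * q * N := by ring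
        _ ≤ |β| * q * (((n₀ : ℝ) + 1) * (6 * Q)) := by gcongr
        _ = (|β| * (((n₀ : ℝ) + 1) * q)) * (6 * Q) := by ring
        _ ≤ 1 * (6 * Q) := by gcongr
        _ = _ := one_mul _
    have hq1 : (1 : ℝ) ≤ q := by exact_mod_cast hq0
    have hNβ2 : N * |β| ≤ T := by
      have h1 : N * |β| ≤ N * |β| * q := le_mul_of_one_le_right (by positivity) hq1
      have h2 : (6 : ℝ) * Q ≤ T := by exact_mod_cast (by omega : 6 * Q ≤ T)
      linarith
    have hqT : q ≤ T := by omega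
    have hnum : 0 ≤ r.num := by
      by_contra hneg
      push Not at hneg
      have h1 : (r.num : ℝ) ≤ -1 := by exact_mod_cast (by omega : r.num ≤ -1)
      have h2 : α * q - r.num = β * q := by rw [hβ]; field_simp
      have h3 : 1 ≤ |β| * q := by
        have : (0 : ℝ) ≤ α * q := by positivity
        have h4 := le_abs_self (β * q)
        rw [abs_mul, abs_of_pos hq0'] at h4
        linarith
      have h5 : (N : ℝ) ≤ 6 * Q := by
        calc (N : ℝ) ≤ N * (|β| * q) := le_mul_of_one_le_right hN'.le h3
          _ = N * |β| * q := by ring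
          _ ≤ _ := hNβ
      have h6 : N ≤ 6 * Q := by exact_mod_cast h5
      have h7 : 8 * T ^ 3 ≤ T * T ^ 3 := by gcongr
      have h8 : T ≤ T ^ 3 := Nat.le_self_pow (by norm_num) T
      have h9 : T * T ^ 3 = T ^ 4 := by ring
      omega
    obtain ⟨a, ha⟩ := Int.eq_ofNat_of_zero_le hnum
    have hac : a.Coprime q := by
      rw [ha] at hcop
      exact Nat.isCoprime_iff_coprime.1 hcop
    have hαβ : α = (a : ℝ) / q + β := by
      rw [hβ, ha]; push_cast; ring
    set V : ℝ := max (q : ℝ) (N * |β|) with hV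
    have hV1 : 1 ≤ V := hq1.trans (le_max_left _ _)
    have hVT : V ≤ 2 ^ z := by
      have : (T : ℝ) = 2 ^ z := by rw [hTdef]; push_cast; rfl
      rw [← this]
      exact max_le (by exact_mod_cast hqT) hNβ2
    have hVw : (16 : ℝ) ^ k₀ ≤ V := by
      by_contra hlt
      push Not at hlt
      have h1 : (q : ℝ) < 16 ^ k₀ := (le_max_left _ _).trans_lt hlt
      have h2 : N * |β| < 16 ^ k₀ := (le_max_right _ _).trans_lt hlt
      have h1' : q ≤ 16 ^ k₀ := by exact_mod_cast h1.le
      obtain ⟨m, hm⟩ := Nat.dvd_factorial hq0 h1'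
      have h3 := hmaj (a * m)
      have hm0 : (m : ℝ) ≠ 0 := by
        intro h
        have h' : m = 0 := by exact_mod_cast h
        rw [h', mul_zero] at hm
        exact Nat.factorial_ne_zero _ hm
      have h4 : α - ((a * m : ℕ) : ℝ) / ((16 ^ k₀).factorial : ℕ) = β := by
        rw [hm, hαβ]
        push_cast
        field_simp
        ring
      rw [h4, div_lt_iff₀ hN'] at h3
      linarith
    obtain ⟨j, hj1, hj2⟩ := exists_nat_pow_near hV1 (show (1 : ℝ) < 16 by norm_num)
    have hkj : k₀ ≤ j := by
      have := (pow_lt_pow_iff_right₀ (show (1 : ℝ) < 16 by norm_num)).1 (hVw.trans_lt hj2)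
      omega
    have hjz : 4 * j ≤ z := by
      have h1 : (2 : ℝ) ^ (4 * j) ≤ 2 ^ z := by
        rw [pow_mul]
        norm_num
        exact hj1.trans hVT
      exact (pow_le_pow_iff_right₀ (by norm_num)).1 h1
    refine ⟨j, hkj, hjz, ⟨q, r.num, hq0, ?_, ?_⟩, ?_⟩
    · have := (le_max_left _ _).trans hj2.le
      exact_mod_cast this
    · rw [le_div_iff₀ hN', mul_comm]
      exact (le_max_right _ _).trans hj2.le
    have hb : ∀ x : ℕ, u ≤ x → x ≤ N →
        ‖pS x α‖ ≤ C * N * (2 * (√(2 ^ j))⁻¹ + 2 * ((1 + (z : ℝ)) ^ 6)⁻¹) := by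
      intro x hux hxN
      have hx0 : (0 : ℝ) < x := by exact_mod_cast hu0.trans_le hux
      have hxN' : (x : ℝ) ≤ N := by exact_mod_cast hxN
      have hNx : (N : ℝ) ≤ 4 * x := by exact_mod_cast hNu.trans (by omega)
      have hl := hlogu x hux hxN
      have hz' : (3 : ℝ) ≤ z := by exact_mod_cast hz
      have h4 : (4 : ℝ) ≤ (1 + (z : ℝ)) ^ 6 := by
        calc (4 : ℝ) ≤ (1 + 3) ^ 6 := by norm_num
          _ ≤ _ := by gcongr
      have hsq : (1 + (z : ℝ)) ^ 12 = (1 + (z : ℝ)) ^ 6 * (1 + (z : ℝ)) ^ 6 := by ring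
      have h5 : 4 * (1 + (z : ℝ)) ^ 6 ≤ (1 + (z : ℝ)) ^ 6 * (1 + (z : ℝ)) ^ 6 := by gcongr
      have hpow : ((2 : ℝ) ^ (j - 1)) ^ 4 * 16 = 16 ^ j := by
        obtain ⟨i, rfl⟩ : ∃ i, j = i + 1 := ⟨j - 1, by omega⟩
        rw [Nat.add_sub_cancel, ← pow_mul, mul_comm i 4, pow_mul, pow_succ (16 : ℝ) i]
        norm_num
      have hor : (((2 : ℝ) ^ (j - 1)) ^ 4 ≤ q ∨ ((2 : ℝ) ^ (j - 1)) ^ 4 ≤ x * |β|) := by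
        have hp : (0 : ℝ) < ((2 : ℝ) ^ (j - 1)) ^ 4 := by positivity
        rcases le_total (q : ℝ) (N * |β|) with h | h
        · right
          have h6 : (16 : ℝ) ^ j ≤ N * |β| := by rw [hV, max_eq_right h] at hj1; exact hj1
          have h7 : (N : ℝ) * |β| ≤ 4 * x * |β| := by gcongr
          linarith
        · left
          rw [hV, max_eq_left h] at hj1
          linarith
      have h := H x z (j - 1) q a β (hu.trans hux) (by linarith) hq0 hac hqT
        (le_trans (by gcongr) ((le_max_right _ _).trans hVT)) hor
      rw [← hαβ] at h
      refine h.trans ?_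
      have e1 : (√(2 ^ (j - 1) : ℝ))⁻¹ ≤ 2 * (√(2 ^ j))⁻¹ := by
        rw [← div_eq_mul_inv, inv_eq_one_div, div_le_div_iff₀ (by positivity) (by positivity),
          one_mul]
        have : (2 : ℝ) ^ j ≤ 2 ^ 2 * 2 ^ (j - 1) := by
          rw [← pow_add]
          exact pow_le_pow_right₀ (by norm_num) (by omega)
        calc √(2 ^ j : ℝ) ≤ √(2 ^ 2 * 2 ^ (j - 1)) := Real.sqrt_le_sqrt this
          _ = _ := by rw [Real.sqrt_mul (by norm_num), Real.sqrt_sq (by norm_num)]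
      have e2 : (√(Real.log x))⁻¹ ≤ 2 * ((1 + (z : ℝ)) ^ 6)⁻¹ := by
        have h8 : (1 + (z : ℝ)) ^ 6 / 2 ≤ √(Real.log x) := by
          apply Real.le_sqrt_of_sq_le
          calc ((1 + (z : ℝ)) ^ 6 / 2) ^ 2 = (1 + (z : ℝ)) ^ 12 / 4 := by ring
            _ ≤ _ := hl
        calc _ ≤ ((1 + (z : ℝ)) ^ 6 / 2)⁻¹ := inv_anti₀ (by positivity) h8
          _ = _ := by rw [inv_div, div_eq_mul_inv]
      gcongr
    refine (norm_sub_le _ _).trans ?_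
    have e1 := hb v huv hvN
    have e2 := hb u le_rfl (huv.trans hvN)
    calc _ ≤ _ := add_le_add e1 e2
      _ = _ := by ring

lemma pS_sub_pS {u v : ℕ} (huv : u ≤ v) (α : ℝ) : pS v α - pS u α = esum (Ioc u v) lp α := by
  unfold pS esum
  rw [sub_eq_iff_eq_add', Finset.sum_Ioc_consecutive _ (Nat.zero_le u) huv]

lemma sum_lp_sq_le {u v N : ℕ} (hvN : v ≤ N) (hN : 0 < N) :
    ∑ n ∈ Ioc u v, lp n ^ 2 ≤ 2 * N * Real.log N := by
  have hN' : (1 : ℝ) ≤ N := by exact_mod_cast hN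
  have hl : 0 ≤ Real.log N := Real.log_nonneg hN'
  calc ∑ n ∈ Ioc u v, lp n ^ 2 ≤ ∑ n ∈ Ioc 0 N, lp n ^ 2 := by
        refine Finset.sum_le_sum_of_subset_of_nonneg (fun n hn => ?_) fun n _ _ => sq_nonneg _
        rw [Finset.mem_Ioc] at hn ⊢
        omega
    _ ≤ ∑ n ∈ Ioc 0 N, lp n * Real.log N := by
        refine Finset.sum_le_sum fun n hn => ?_
        rw [Finset.mem_Ioc] at hn
        rw [sq]
        have hn0 : (0 : ℝ) < n := by exact_mod_cast hn.1
        have h1 : lp n ≤ Real.log N := by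
          unfold lp
          split_ifs
          · exact Real.log_le_log hn0 (by exact_mod_cast hn.2)
          · exact hl
        exact mul_le_mul_of_nonneg_left h1 (lp_nonneg n)
    _ ≤ 2 * N * Real.log N := by
        rw [← Finset.sum_mul]
        exact mul_le_mul_of_nonneg_right (sum_lp_le N) hl

/-- Mean square of the exponential sum over primes on a set of arcs. -/
lemma sum_arcs_lp_sq_le {N z j u v M : ℕ} (hNu : N ≤ 4 * u) (hvN : v ≤ N) (hz : 3 ≤ z)
    (hN : 0 < N) (hzN : (1 + (z : ℝ)) ^ 12 ≤ Real.log N) (hj : 4 * j ≤ z) (hM : N < M)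
    (hMr : ∀ r, 1 ≤ r → r ^ 4 ≤ N → r ∣ M) {A : Finset ℕ} (hAM : A ⊆ range M)
    (hA : ∀ k ∈ A, ∃ q : ℕ, ∃ a : ℤ, 0 < q ∧ q ≤ 16 ^ (j + 1) ∧
      |(k : ℝ) / M - a / q| ≤ 16 ^ (j + 1) / N) :
    ∑ k ∈ A, ‖esum (Ioc u v) lp ((k : ℝ) / M)‖ ^ 2 ≤ 124416 * ((j : ℝ) + 2) ^ 4 * M * N := by
  have hT := two_pow_pow_le hz hN hzN
  have hN' : (0 : ℝ) < N := by exact_mod_cast hN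
  have hN1 : (1 : ℝ) ≤ N := by exact_mod_cast hN
  set T : ℕ := 2 ^ z with hTdef
  have hT8 : 8 ≤ T := by
    rw [hTdef, show (8 : ℕ) = 2 ^ 3 by norm_num]
    exact Nat.pow_le_pow_right (by norm_num) hz
  have h16T : 16 ^ (j + 1) ≤ T ^ 3 := by
    calc 16 ^ (j + 1) = 2 ^ (4 * j) * 16 := by rw [pow_succ, pow_mul]; norm_num
      _ ≤ 2 ^ z * 64 := by gcongr <;> norm_num
      _ = T * (8 * 8) := by rw [hTdef]
      _ ≤ T * (T * T) := by gcongr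
      _ = T ^ 3 := by ring
  set R : ℕ := N.sqrt.sqrt with hR
  have hR4 : R ^ 4 ≤ N := by
    have h1 : R ^ 2 ≤ N.sqrt := Nat.sqrt_le' _
    calc R ^ 4 = (R ^ 2) ^ 2 := by ring
      _ ≤ N.sqrt ^ 2 := by gcongr
      _ ≤ N := Nat.sqrt_le' _
  have hRlt : N < (R + 1) ^ 4 := by
    have h1 : N.sqrt < (R + 1) ^ 2 := Nat.lt_succ_sqrt' _
    have h2 : N < (N.sqrt + 1) ^ 2 := Nat.lt_succ_sqrt' _
    calc N < (N.sqrt + 1) ^ 2 := h2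
      _ ≤ ((R + 1) ^ 2) ^ 2 := by gcongr; omega
      _ = _ := by ring
  have hR8 : 8 ≤ R := by
    by_contra hlt
    push Not at hlt
    have h1 : (R + 1) ^ 4 ≤ 8 ^ 4 := by gcongr; omega
    have h2 : 8 ^ 5 ≤ T ^ 100 := (Nat.pow_le_pow_left hT8 5).trans
      (Nat.pow_le_pow_right (by omega) (by norm_num))
    norm_num at h1 h2
    omega
  have hlogR : Real.log N ≤ 8 * Real.log R := by
    have hRp : (0 : ℝ) < R := by exact_mod_cast (by omega : 0 < R)
    have h1 : (N : ℝ) ≤ (R : ℝ) ^ 8 := by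
      have : N ≤ R ^ 8 := by
        calc N ≤ (R + 1) ^ 4 := hRlt.le
          _ ≤ (R * R) ^ 4 := by gcongr; nlinarith
          _ = R ^ 8 := by ring
      exact_mod_cast this
    have := Real.log_le_log hN' h1
    rw [Real.log_pow] at this
    exact_mod_cast this
  have hlog0 : 0 < Real.log N := lt_of_lt_of_le (by positivity) hzN
  have hδ : 2 * ((16 : ℝ) ^ (j + 1) / N) * ((R : ℝ) * (16 ^ (j + 1) : ℕ)) ^ 2 < 1 := by
    have e1 : (2 * T ^ 9 * R ^ 2) ^ 2 < N ^ 2 := by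
      calc (2 * T ^ 9 * R ^ 2) ^ 2 = (4 * T ^ 18) * R ^ 4 := by ring
        _ ≤ (4 * T ^ 18) * N := by gcongr
        _ < T ^ 100 * N := by
          have : 4 * T ^ 18 < T ^ 100 := by
            calc 4 * T ^ 18 < T * T ^ 18 := by gcongr; omega
              _ = T ^ 19 := by ring
              _ ≤ T ^ 100 := Nat.pow_le_pow_right (by omega) (by norm_num)
          gcongr
        _ ≤ N * N := by gcongr
        _ = N ^ 2 := by ring
    have e2 : 2 * T ^ 9 * R ^ 2 < N := lt_of_pow_lt_pow_left₀ 2 (by positivity) e1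
    have e3 : 2 * (16 ^ (j + 1)) ^ 3 * R ^ 2 < N := by
      refine lt_of_le_of_lt ?_ e2
      calc 2 * (16 ^ (j + 1)) ^ 3 * R ^ 2 ≤ 2 * (T ^ 3) ^ 3 * R ^ 2 := by gcongr
        _ = _ := by ring
    have e4 : (2 : ℝ) * ((16 : ℝ) ^ (j + 1)) ^ 3 * (R : ℝ) ^ 2 < N := by exact_mod_cast e3
    push_cast
    calc 2 * ((16 : ℝ) ^ (j + 1) / N) * ((R : ℝ) * 16 ^ (j + 1)) ^ 2 =
        ((2 : ℝ) * ((16 : ℝ) ^ (j + 1)) ^ 3 * (R : ℝ) ^ 2) / N := by ring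
      _ < 1 := by rw [div_lt_one hN']; exact e4
  have h := sum_arcs_sq_le (M := M) (R := R) (Q := 16 ^ (j + 1)) (δ := 16 ^ (j + 1) / N)
    (hN.trans hM) (fun r h1 h2 => hMr r h1 ((Nat.pow_le_pow_left h2 4).trans hR4)) hδ hAM hA
    (s := Ioc u v) (f := lp)
    (by
      intro m hm n hn hmn
      rw [Finset.mem_Ioc] at hm hn
      rwa [Nat.ModEq, Nat.mod_eq_of_lt (by omega), Nat.mod_eq_of_lt (by omega)] at hmn)
    (by
      intro n hn h0 r hr
      have hnp : n.Prime := by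
        by_contra hnp
        exact h0 (by unfold lp; rw [if_neg hnp])
      refine coprime_rough_of_prime hnp ?_ hr
      rw [Finset.mem_Ioc] at hn
      have h1 : 4 * R ≤ R ^ 4 := by
        calc 4 * R ≤ R ^ 3 * R := by gcongr; nlinarith [Nat.pow_le_pow_left hR8 3]
          _ = R ^ 4 := by ring
      omega)
  have heul : eul (16 ^ (j + 1)) ≤ 3888 * ((j : ℝ) + 2) ^ 4 := by
    refine (eul_le_log (Nat.one_le_pow _ _ (by norm_num))).trans ?_
    have h1 : Real.log ((16 ^ (j + 1) : ℕ) : ℝ) ≤ 3 * (j + 1) := by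
      push_cast
      rw [Real.log_pow, show (16 : ℝ) = 2 ^ 4 by norm_num, Real.log_pow]
      have := Real.log_two_lt_d9
      push_cast
      nlinarith [(Nat.cast_nonneg j : (0 : ℝ) ≤ j)]
    have h0 : 0 ≤ Real.log ((16 ^ (j + 1) : ℕ) : ℝ) := Real.log_natCast_nonneg _
    calc 48 * (1 + Real.log ((16 ^ (j + 1) : ℕ) : ℝ)) ^ 4 ≤ 48 * (3 * ((j : ℝ) + 2)) ^ 4 := by
          gcongr; linarith
      _ = _ := by ring
  have hs := sum_lp_sq_le (u := u) hvN hN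
  set X := ∑ k ∈ A, ‖esum (Ioc u v) lp ((k : ℝ) / M)‖ ^ 2 with hX
  have hX0 : 0 ≤ X := Finset.sum_nonneg fun _ _ => sq_nonneg _
  have hY0 : 0 ≤ ∑ n ∈ Ioc u v, lp n ^ 2 := Finset.sum_nonneg fun _ _ => sq_nonneg _
  have h2 : X * Real.log N ≤ (124416 * ((j : ℝ) + 2) ^ 4 * M * N) * Real.log N := by
    calc X * Real.log N ≤ X * (8 * Real.log R) := by gcongr
      _ = 8 * (X * Real.log R) := by ring
      _ ≤ 8 * (2 * (3888 * ((j : ℝ) + 2) ^ 4) * (M * (2 * N * Real.log N))) := by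
          refine mul_le_mul_of_nonneg_left (h.trans ?_) (by norm_num)
          gcongr
      _ = _ := by ring
  exact le_of_mul_le_mul_right h2 hlog0

lemma exists_log_scale : ∃ z : ℕ → ℕ, Tendsto z atTop atTop ∧
    ∀ᶠ N : ℕ in atTop, (1 + (z N : ℝ)) ^ 12 ≤ Real.log N ∧ Real.log N ≤ (2 + (z N : ℝ)) ^ 12 := by
  have hlog : Tendsto (fun N : ℕ => Real.log N) atTop atTop :=
    Real.tendsto_log_atTop.comp tendsto_natCast_atTop_atTop
  have hy : Tendsto (fun N : ℕ => (Real.log N) ^ ((12 : ℝ)⁻¹)) atTop atTop :=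
    (tendsto_rpow_atTop (by norm_num)).comp hlog
  refine ⟨fun N => ⌊(Real.log N) ^ ((12 : ℝ)⁻¹)⌋₊ - 1,
    (tendsto_sub_atTop_nat 1).comp (tendsto_nat_floor_atTop.comp hy), ?_⟩
  filter_upwards [hy.eventually_ge_atTop 1, hlog.eventually_ge_atTop 0] with N h1 h0
  set y := (Real.log N) ^ ((12 : ℝ)⁻¹) with hydef
  have hy12 : y ^ 12 = Real.log N := by
    rw [hydef, ← Real.rpow_natCast, ← Real.rpow_mul h0]
    norm_num
  have hf1 : 1 ≤ ⌊y⌋₊ := Nat.one_le_floor_iff y |>.2 h1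
  have hf := Nat.floor_le (by linarith : 0 ≤ y)
  have hf2 := Nat.lt_floor_add_one y
  rw [Nat.cast_sub hf1, ← hy12]
  constructor
  · push_cast
    gcongr <;> linarith
  · push_cast
    gcongr
    linarith

/-- Multiples of `M` on which the circle is sampled that are far from `a / w!`. -/
def offMajor (w N M k : ℕ) : Prop :=
  ∀ a : ℕ, (w : ℝ) / N < |(k : ℝ) / M - a / (w.factorial : ℕ)|

lemma summable_pow_four_div : Summable fun j : ℕ => ((j : ℝ) + 2) ^ 4 * (√(2 ^ j))⁻¹ := by
  have hs : (√2 : ℝ) > 1 := by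
    rw [gt_iff_lt, Real.lt_sqrt (by norm_num)]; norm_num
  have h1 : ‖(√2 : ℝ)⁻¹‖ < 1 := by
    rw [Real.norm_of_nonneg (by positivity)]
    exact inv_lt_one_of_one_lt₀ hs
  have h2 := summable_pow_mul_geometric_of_norm_lt_one 4 h1
  have h3 := ((summable_nat_add_iff 2).2 h2).mul_left ((√2 : ℝ) ^ 2)
  refine h3.congr fun j => ?_
  have : √((2 : ℝ) ^ j) = (√2) ^ j := by
    rw [Real.sqrt_eq_iff_mul_self_eq (by positivity) (by positivity), ← mul_pow,
      Real.mul_self_sqrt (by norm_num)]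
  have h4 : (√2 : ℝ) ≠ 0 := by positivity
  rw [this, pow_add, inv_pow, inv_pow]
  push_cast
  field_simp

set_option maxHeartbeats 1000000 in
open scoped Classical in
theorem eventually_sum_offMajor_norm_cube_le {η : ℝ} (hη : 0 < η) : ∃ K : ℕ, ∀ k₀ ≥ K,
    ∀ᶠ N : ℕ in atTop, ∀ u v M : ℕ, N ≤ 4 * u → u ≤ v → v ≤ N → N < M →
      (∀ r, 1 ≤ r → r ^ 4 ≤ N → r ∣ M) →
      ∑ k ∈ (range M).filter (offMajor (16 ^ k₀) N M),
        ‖esum (Ioc u v) lp ((k : ℝ) / M)‖ ^ 3 ≤ η * M * (N : ℝ) ^ 2 := by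
  obtain ⟨C, hC, x₀, H⟩ := exists_norm_pS_sub_pS_le
  obtain ⟨zf, hzf, hzN⟩ := exists_log_scale
  set c : ℝ := C * 124416 with hc
  have hc0 : 0 < c := by positivity
  obtain ⟨s, hs⟩ := summable_iff_vanishing_norm.1 summable_pow_four_div (η / (3 * c)) (by positivity)
  refine ⟨s.sup id + 1, fun k₀ hk₀ => ?_⟩
  have hlim1 : Tendsto (fun z : ℕ => 520 * ((z : ℝ) + 3) ^ 60 / √(2 ^ (z - 3))) atTop (nhds 0) := by
    have hs2 : (√2 : ℝ) > 1 := by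
      rw [gt_iff_lt, Real.lt_sqrt (by norm_num)]; norm_num
    have h1 := (tendsto_pow_const_div_const_pow_of_one_lt 60 hs2).comp (tendsto_add_atTop_nat 3)
    have h2 := h1.const_mul (520 * (√2) ^ 6)
    rw [mul_zero] at h2
    refine h2.congr' ?_
    filter_upwards [eventually_ge_atTop 3] with z hz
    obtain ⟨t, rfl⟩ : ∃ t, z = t + 3 := ⟨z - 3, by omega⟩
    have : √((2 : ℝ) ^ t) = (√2) ^ t := by
      rw [Real.sqrt_eq_iff_mul_self_eq (by positivity) (by positivity), ← mul_pow,
        Real.mul_self_sqrt (by norm_num)]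
    simp only [Function.comp_apply, Nat.add_sub_cancel]
    rw [this, add_assoc t 3 3, pow_add]
    push_cast
    field_simp
    ring
  have hlim2 : Tendsto (fun z : ℕ => 16 * c / (z : ℝ)) atTop (nhds 0) :=
    tendsto_const_div_atTop_nhds_zero_nat _
  have ev1 := (hzf.eventually (hlim1.eventually_lt_const (show (0 : ℝ) < η / 3 by positivity)))
  have ev2 := (hzf.eventually (hlim2.eventually_lt_const (show (0 : ℝ) < η / 3 by positivity)))
  filter_upwards [ev1, ev2, hzN, hzf.eventually_ge_atTop 3, eventually_gt_atTop (4 * x₀ + 4)]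
    with N h1 h2 h3 hz hNx u v M hNu huv hvN hM hMr
  set z := zf N with hzdef
  have hN : 0 < N := by omega
  have hN' : (0 : ℝ) < N := by exact_mod_cast hN
  have hM0 : 0 < M := by omega
  have hM' : (0 : ℝ) < M := by exact_mod_cast hM0
  have hlog0 : 0 ≤ Real.log N := Real.log_natCast_nonneg N
  set F : ℕ → ℝ := fun k => ‖esum (Ioc u v) lp ((k : ℝ) / M)‖ with hF
  set m : ℝ := 260 * N * (1 + Real.log N) ^ 4 / √(2 ^ (z - 3)) with hm
  set sb : ℕ → ℝ := fun j => C * N * ((√(2 ^ j))⁻¹ + ((1 + (z : ℝ)) ^ 6)⁻¹) with hsb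
  set B := (range M).filter (offMajor (16 ^ k₀) N M) with hB
  set A : ℕ → Finset ℕ := fun j => (range M).filter fun k : ℕ => ∃ q : ℕ, ∃ a : ℤ, 0 < q ∧
    q ≤ 16 ^ (j + 1) ∧ |(k : ℝ) / M - a / q| ≤ 16 ^ (j + 1) / N with hA
  set J : Finset ℕ := (Finset.Icc k₀ z).filter fun j => 4 * j ≤ z with hJ
  have hm0 : 0 ≤ m := by positivity
  have hsb0 : ∀ j, 0 ≤ sb j := fun j => by positivity
  have hpt : ∀ k ∈ B, F k ^ 3 ≤ m * F k ^ 2 + ∑ j ∈ J, if k ∈ A j then sb j * F k ^ 2 else 0 := by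
    intro k hk
    rw [hB, Finset.mem_filter, Finset.mem_range] at hk
    have hterm : ∀ j ∈ J, 0 ≤ if k ∈ A j then sb j * F k ^ 2 else 0 := by
      intro j _
      split_ifs
      · exact mul_nonneg (hsb0 j) (sq_nonneg _)
      · exact le_rfl
    have hoff : ∀ a : ℕ, (16 : ℝ) ^ k₀ / N < |(k : ℝ) / M - a / ((16 ^ k₀).factorial : ℕ)| := by
      intro a
      have := hk.2 a
      push_cast at this
      exact this
    have hcl := H N z k₀ u v (by omega) (by omega) hNu huv hvN hz h3.1 (by omega) ((k : ℝ) / M)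
      (by positivity) hoff
    rw [pS_sub_pS huv] at hcl
    have hF3 : F k ^ 3 = F k * F k ^ 2 := by ring
    rw [hF3]
    rcases hcl with hcl | ⟨j, hkj, hjz, har, hcl⟩
    · have := Finset.sum_nonneg hterm
      have h5 : F k * F k ^ 2 ≤ m * F k ^ 2 := mul_le_mul_of_nonneg_right hcl (sq_nonneg _)
      linarith
    · have hjJ : j ∈ J := Finset.mem_filter.2 ⟨Finset.mem_Icc.2 ⟨hkj, by omega⟩, hjz⟩
      have hkA : k ∈ A j := Finset.mem_filter.2 ⟨Finset.mem_range.2 hk.1, har⟩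
      have h4 := Finset.single_le_sum hterm hjJ
      rw [if_pos hkA] at h4
      have h5 : F k * F k ^ 2 ≤ sb j * F k ^ 2 := mul_le_mul_of_nonneg_right hcl (sq_nonneg _)
      have h6 : 0 ≤ m * F k ^ 2 := mul_nonneg hm0 (sq_nonneg _)
      linarith
  have hpars : ∑ k ∈ range M, F k ^ 2 = M * ∑ n ∈ Ioc u v, lp n ^ 2 := by
    refine parseval hM0 lp ?_
    intro a ha b hb hab
    rw [Finset.mem_Ioc] at ha hb
    rwa [Nat.ModEq, Nat.mod_eq_of_lt (by omega), Nat.mod_eq_of_lt (by omega)] at hab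
  have hmin : ∑ k ∈ B, m * F k ^ 2 ≤ η / 3 * M * (N : ℝ) ^ 2 := by
    have e1 : ∑ k ∈ B, F k ^ 2 ≤ M * (2 * N * Real.log N) := by
      calc ∑ k ∈ B, F k ^ 2 ≤ ∑ k ∈ range M, F k ^ 2 :=
            Finset.sum_le_sum_of_subset_of_nonneg (Finset.filter_subset _ _)
              fun _ _ _ => sq_nonneg _
        _ ≤ _ := by
            rw [hpars]
            exact mul_le_mul_of_nonneg_left (sum_lp_sq_le hvN hN) hM'.le
    have e2 : Real.log N * (1 + Real.log N) ^ 4 ≤ ((z : ℝ) + 3) ^ 60 := by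
      have e3 : 1 + Real.log N ≤ ((z : ℝ) + 3) ^ 12 := by
        have hz0 : (0 : ℝ) ≤ z := Nat.cast_nonneg z
        have : (1 : ℝ) ^ 12 + (2 + (z : ℝ)) ^ 12 ≤ (1 + (2 + (z : ℝ))) ^ 12 :=
          pow_add_pow_le (by norm_num) (by positivity) (by norm_num)
        rw [show (z : ℝ) + 3 = 1 + (2 + z) by ring]
        linarith [h3.2]
      calc Real.log N * (1 + Real.log N) ^ 4 ≤ (1 + Real.log N) * (1 + Real.log N) ^ 4 := by
            gcongr; linarith
        _ = (1 + Real.log N) ^ 5 := by ring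
        _ ≤ (((z : ℝ) + 3) ^ 12) ^ 5 := by gcongr
        _ = _ := by ring
    rw [← Finset.mul_sum]
    calc m * ∑ k ∈ B, F k ^ 2 ≤ m * (M * (2 * N * Real.log N)) := by gcongr
      _ = (520 * (Real.log N * (1 + Real.log N) ^ 4) / √(2 ^ (z - 3))) * (M * (N : ℝ) ^ 2) := by
          rw [hm]; ring
      _ ≤ (520 * ((z : ℝ) + 3) ^ 60 / √(2 ^ (z - 3))) * (M * (N : ℝ) ^ 2) := by gcongr
      _ ≤ η / 3 * (M * (N : ℝ) ^ 2) := by gcongr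
      _ = _ := by ring
  have hmaj : ∑ k ∈ B, ∑ j ∈ J, (if k ∈ A j then sb j * F k ^ 2 else 0) ≤
      2 * (η / 3) * M * (N : ℝ) ^ 2 := by
    rw [Finset.sum_comm]
    have e1 : ∀ j ∈ J, ∑ k ∈ B, (if k ∈ A j then sb j * F k ^ 2 else 0) ≤
        (M * (N : ℝ) ^ 2) * (c * (((j : ℝ) + 2) ^ 4 * (√(2 ^ j))⁻¹ +
          ((j : ℝ) + 2) ^ 4 * ((1 + (z : ℝ)) ^ 6)⁻¹)) := by
      intro j hj
      have hjz := (Finset.mem_filter.1 hj).2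
      have e2 := sum_arcs_lp_sq_le (A := A j) hNu hvN hz hN h3.1 hjz hM hMr
        (Finset.filter_subset _ _) (fun k hk => (Finset.mem_filter.1 hk).2)
      calc _ ≤ ∑ k ∈ range M, (if k ∈ A j then sb j * F k ^ 2 else 0) := by
            refine Finset.sum_le_sum_of_subset_of_nonneg (Finset.filter_subset _ _) ?_
            intro k _ _
            split_ifs
            · exact mul_nonneg (hsb0 j) (sq_nonneg _)
            · exact le_rfl
        _ = sb j * ∑ k ∈ A j, F k ^ 2 := by
            rw [← Finset.sum_filter, Finset.mul_sum]
            refine Finset.sum_congr ?_ fun _ _ => rfl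
            ext k
            simp only [hA, Finset.mem_filter]
            tauto
        _ ≤ sb j * (124416 * ((j : ℝ) + 2) ^ 4 * M * N) := mul_le_mul_of_nonneg_left e2 (hsb0 j)
        _ = _ := by simp only [hsb, hc]; ring
    refine (Finset.sum_le_sum e1).trans ?_
    rw [← Finset.mul_sum, ← Finset.mul_sum, Finset.sum_add_distrib]
    have e3 : ∑ j ∈ J, ((j : ℝ) + 2) ^ 4 * (√(2 ^ j))⁻¹ ≤ η / (3 * c) := by
      have hd : Disjoint J s := by
        rw [Finset.disjoint_left]
        intro j hj hjs
        have h4 : j ≤ s.sup id := Finset.le_sup (f := id) hjs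
        have h5 := (Finset.mem_Icc.1 (Finset.mem_filter.1 hj).1).1
        omega
      exact (Real.le_norm_self _).trans (hs J hd).le
    have e4 : ∑ j ∈ J, ((j : ℝ) + 2) ^ 4 * ((1 + (z : ℝ)) ^ 6)⁻¹ ≤ 16 / (z : ℝ) := by
      have hz0 : (0 : ℝ) < z := by exact_mod_cast (by omega : 0 < z)
      have hcard : ((J.card : ℕ) : ℝ) ≤ 1 + z := by
        have h4 : J.card ≤ (Finset.Icc k₀ z).card := Finset.card_filter_le _ _
        rw [Nat.card_Icc] at h4
        have : J.card ≤ 1 + z := by omega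
        exact_mod_cast this
      calc ∑ j ∈ J, ((j : ℝ) + 2) ^ 4 * ((1 + (z : ℝ)) ^ 6)⁻¹ ≤
          ∑ j ∈ J, (2 * (1 + (z : ℝ))) ^ 4 * ((1 + (z : ℝ)) ^ 6)⁻¹ := by
            refine Finset.sum_le_sum fun j hj => ?_
            have h5 := (Finset.mem_Icc.1 (Finset.mem_filter.1 hj).1).2
            have h6 : (j : ℝ) ≤ z := by exact_mod_cast h5
            gcongr
            linarith
        _ = J.card * ((2 * (1 + (z : ℝ))) ^ 4 * ((1 + (z : ℝ)) ^ 6)⁻¹) := by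
            rw [Finset.sum_const, nsmul_eq_mul]
        _ ≤ (1 + z) * ((2 * (1 + (z : ℝ))) ^ 4 * ((1 + (z : ℝ)) ^ 6)⁻¹) := by gcongr
        _ = 16 / (1 + z) := by field_simp; ring
        _ ≤ 16 / z := by gcongr; linarith
    have e5 : c * (∑ j ∈ J, ((j : ℝ) + 2) ^ 4 * (√(2 ^ j))⁻¹ +
        ∑ j ∈ J, ((j : ℝ) + 2) ^ 4 * ((1 + (z : ℝ)) ^ 6)⁻¹) ≤ 2 * (η / 3) := by
      calc _ ≤ c * (η / (3 * c) + 16 / z) := by gcongr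
        _ = η / 3 + 16 * c / z := by field_simp
        _ ≤ η / 3 + η / 3 := by gcongr
        _ = _ := by ring
    calc _ ≤ (M * (N : ℝ) ^ 2) * (2 * (η / 3)) := mul_le_mul_of_nonneg_left e5 (by positivity)
      _ = _ := by ring
  calc ∑ k ∈ B, F k ^ 3 ≤ ∑ k ∈ B, (m * F k ^ 2 + ∑ j ∈ J, if k ∈ A j then sb j * F k ^ 2 else 0) :=
        Finset.sum_le_sum hpt
    _ ≤ η / 3 * M * (N : ℝ) ^ 2 + 2 * (η / 3) * M * (N : ℝ) ^ 2 := by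
        rw [Finset.sum_add_distrib]
        exact add_le_add hmin hmaj
    _ = _ := by ring

/-- Weighted number of representations of `N` as a sum of three elements of `(u, v]`. -/
noncomputable def rep (f : ℕ → ℝ) (N u v : ℕ) : ℝ :=
  ∑ a ∈ Ioc u v, ∑ b ∈ Ioc u v, ∑ c ∈ Ioc u v, if a + b + c = N then f a * f b * f c else 0

lemma mul_rep_eq {N u v M : ℕ} (hN : N < M) (hv : 3 * v < M) (f : ℕ → ℝ) :
    ((M * rep f N u v : ℝ) : ℂ) = ∑ k ∈ range M, esum (Ioc u v) f ((k : ℝ) / M) ^ 3 *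
      ex (-(N * ((k : ℝ) / M))) := by
  have h1 : ∀ k ∈ range M, esum (Ioc u v) f ((k : ℝ) / M) ^ 3 * ex (-(N * ((k : ℝ) / M))) =
      ∑ a ∈ Ioc u v, ∑ b ∈ Ioc u v, ∑ c ∈ Ioc u v, (f a * f b * f c : ℂ) *
        (ex ((a + b + c : ℕ) * ((k : ℝ) / M)) * ex (-(N * ((k : ℝ) / M)))) := by
    intro k _
    rw [pow_three', esum, Finset.sum_mul_sum, Finset.sum_mul, Finset.sum_mul]
    refine Finset.sum_congr rfl fun a _ => ?_
    rw [Finset.sum_mul, Finset.sum_mul]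
    refine Finset.sum_congr rfl fun b _ => ?_
    rw [Finset.mul_sum, Finset.sum_mul]
    refine Finset.sum_congr rfl fun c _ => ?_
    push_cast
    rw [add_mul, add_mul, ex_add, ex_add]
    ring
  rw [Finset.sum_congr rfl h1, Finset.sum_comm, rep, Complex.ofReal_mul, Complex.ofReal_sum,
    Finset.mul_sum]
  refine Finset.sum_congr rfl fun a ha => ?_
  rw [Complex.ofReal_sum, Finset.mul_sum, Finset.sum_comm]
  refine Finset.sum_congr rfl fun b hb => ?_
  rw [Complex.ofReal_sum, Finset.mul_sum, Finset.sum_comm]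
  refine Finset.sum_congr rfl fun c hc => ?_
  rw [← Finset.mul_sum, sum_range_ex_sub (by omega)]
  rw [Finset.mem_Ioc] at ha hb hc
  by_cases h : a + b + c = N
  · rw [if_pos h, if_pos (h ▸ Nat.ModEq.refl _)]
    push_cast
    ring
  · rw [if_neg h, if_neg fun h' => h (Nat.ModEq.eq_of_lt_of_lt h' (by omega) hN)]
    simp

lemma norm_pow_three_sub_le (x y : ℂ) : ‖x ^ 3 - y ^ 3‖ ≤ ‖x‖ ^ 3 + ‖y‖ ^ 3 := by
  exact (norm_sub_le _ _).trans (by rw [norm_pow, norm_pow])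

lemma norm_pow_three_sub_le_mul {x y : ℂ} {B : ℝ} (hx : ‖x‖ ≤ B) (hy : ‖y‖ ≤ B) :
    ‖x ^ 3 - y ^ 3‖ ≤ 3 * B ^ 2 * ‖x - y‖ := by
  have hB : 0 ≤ B := (norm_nonneg x).trans hx
  have h1 : x ^ 3 - y ^ 3 = (x ^ 2 + x * y + y ^ 2) * (x - y) := by ring
  rw [h1, norm_mul]
  gcongr
  calc ‖x ^ 2 + x * y + y ^ 2‖ ≤ ‖x‖ ^ 2 + ‖x‖ * ‖y‖ + ‖y‖ ^ 2 := by
        refine (norm_add₃_le).trans ?_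
        simp
    _ ≤ B ^ 2 + B * B + B ^ 2 := by gcongr
    _ = 3 * B ^ 2 := by ring

open scoped Classical in
lemma sum_offMajor_norm_esum_cw_le {w N u v M : ℕ} (hw : 0 < w) (hWN : w.factorial ≤ N)
    (huv : u ≤ v) (hv : v ≤ N) (hM : N < M) :
    ∑ k ∈ (range M).filter (offMajor w N M), ‖esum (Ioc u v) (cw w.factorial) ((k : ℝ) / M)‖ ^ 3
      ≤ eul w / w * M * (N : ℝ) ^ 2 := by
  set W := w.factorial with hWdef
  have hW : 0 < W := w.factorial_pos
  have hW' : (0 : ℝ) < W := by exact_mod_cast hW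
  have hw' : (0 : ℝ) < w := by exact_mod_cast hw
  have hN0 : (0 : ℝ) < N := by exact_mod_cast hW.trans_le hWN
  have hM0 : (0 : ℝ) < M := by exact_mod_cast (Nat.zero_le N).trans_lt hM
  have hpt : ∀ k ∈ (range M).filter (offMajor w N M),
      ‖esum (Ioc u v) (cw W) ((k : ℝ) / M)‖ ^ 3 ≤
        N / (2 * w) * ‖esum (Ioc u v) (cw W) ((k : ℝ) / M)‖ ^ 2 := by
    intro k hk
    have hoff := (Finset.mem_filter.1 hk).2
    set x : ℝ := (k : ℝ) / M with hx
    have hx0 : 0 ≤ x := by positivity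
    set a := round (W * x) with ha
    have ha0 : 0 ≤ a := by
      rw [ha, round_eq]
      exact Int.floor_nonneg.2 (by positivity)
    obtain ⟨b, hb⟩ := Int.eq_ofNat_of_zero_le ha0
    have hbig := hoff b
    rw [← hx, ← hWdef] at hbig
    have hab : (a : ℝ) = b := by rw [hb]; simp
    have hβ : |x - a / W| ≤ 1 / (2 * W) := by
      have h1 := abs_sub_round (W * x)
      have h2 : x - a / W = (W * x - a) / W := by field_simp
      rw [h2, abs_div, abs_of_pos hW', div_le_div_iff₀ hW' (by positivity)]
      nlinarith
    rw [← hab] at hbig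
    have hpos : 0 < |x - a / W| := (by positivity : (0 : ℝ) < w / N).trans hbig
    have h3 := norm_esum_cw_le hW u v a (abs_pos.1 hpos) hβ
    rw [add_sub_cancel] at h3
    have h4 : ‖esum (Ioc u v) (cw W) x‖ ≤ N / (2 * w) := by
      refine h3.trans ?_
      rw [div_le_div_iff₀ (by positivity) (by positivity)]
      rw [div_lt_iff₀ hN0] at hbig
      linarith
    rw [pow_succ, mul_comm]
    gcongr
  calc _ ≤ ∑ k ∈ (range M).filter (offMajor w N M),
        N / (2 * w) * ‖esum (Ioc u v) (cw W) ((k : ℝ) / M)‖ ^ 2 := Finset.sum_le_sum hpt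
    _ ≤ ∑ k ∈ range M, N / (2 * w) * ‖esum (Ioc u v) (cw W) ((k : ℝ) / M)‖ ^ 2 :=
        Finset.sum_le_sum_of_subset_of_nonneg (Finset.filter_subset _ _)
          fun _ _ _ => by positivity
    _ = N / (2 * w) * (M * ∑ n ∈ Ioc u v, cw W n ^ 2) := by
        rw [← Finset.mul_sum, parseval (by omega)]
        intro m hm n hn h
        rw [Finset.mem_Ioc] at hm hn
        exact Nat.ModEq.eq_of_lt_of_lt h (by omega) (by omega)
    _ ≤ N / (2 * w) * (M * (eul w * (N + N))) := by
        gcongr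
        refine (sum_cw_sq_le hW huv).trans ?_
        have hp : (0 : ℝ) < W.totient := by exact_mod_cast Nat.totient_pos.2 hW
        have h5 : (W : ℝ) / W.totient ≤ eul w := by
          rw [div_le_iff₀ hp, mul_comm]
          exact le_totient_mul_eul_of_forall_le fun p hp =>
            (Nat.prime_of_mem_primeFactors hp).dvd_factorial.1 (Nat.dvd_of_mem_primeFactors hp)
        have h6 : 0 ≤ (W : ℝ) / W.totient := by positivity
        have h7 : ((v - u : ℕ) : ℝ) ≤ N := by exact_mod_cast (by omega : v - u ≤ N)
        have h8 : (W : ℝ) ≤ N := by exact_mod_cast hWN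
        have h9 := h6.trans h5
        gcongr
    _ = _ := by field_simp; ring

lemma esum_Ioc_eq_sub {u v : ℕ} (huv : u ≤ v) (f : ℕ → ℝ) (α : ℝ) :
    esum (Ioc u v) f α = esum (Ioc 0 v) f α - esum (Ioc 0 u) f α := by
  rw [esum, esum, esum, ← Finset.sum_Ioc_consecutive _ (Nat.zero_le u) huv, add_sub_cancel_left]

open scoped Classical in
lemma card_not_offMajor_le {w N M : ℕ} (hN : 0 < N) (hNM : N < M) (hWN : w * w.factorial ≤ N) :
    (((range M).filter fun k => ¬ offMajor w N M k).card : ℝ) ≤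
      (w.factorial + 2) * (2 * w + 1) * M / N := by
  set W := w.factorial with hWdef
  have hW' : (0 : ℝ) < W := by exact_mod_cast w.factorial_pos
  have hN0 : (0 : ℝ) < N := by exact_mod_cast hN
  have hM0 : (0 : ℝ) < M := by exact_mod_cast hN.trans hNM
  have hsub : ((range M).filter fun k => ¬ offMajor w N M k) ⊆ (range (W + 2)).biUnion fun a =>
      (range M).filter fun k : ℕ => |(k : ℝ) - a * M / W| ≤ w * M / N := by
    intro k hk
    rw [Finset.mem_filter, Finset.mem_range] at hk
    obtain ⟨hkM, hk⟩ := hk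
    simp only [offMajor, not_forall, not_lt] at hk
    obtain ⟨a, ha⟩ := hk
    rw [← hWdef] at ha
    have hk1 : (k : ℝ) / M < 1 := (div_lt_one hM0).2 (by exact_mod_cast hkM)
    have h1 : (a : ℝ) / W < 1 + w / N := by linarith [(abs_le.1 ha).1]
    have h2 : (w : ℝ) / N ≤ 1 / W := by
      rw [div_le_div_iff₀ hN0 hW', one_mul]
      exact_mod_cast hWN
    have h3 : (a : ℝ) < W + 1 := by
      have : (a : ℝ) / W < (W + 1) / W := by
        rw [add_div, div_self hW'.ne']
        linarith
      exact (div_lt_div_iff_of_pos_right hW').1 this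
    have h4 : a < W + 1 := by exact_mod_cast h3
    rw [Finset.mem_biUnion]
    refine ⟨a, Finset.mem_range.2 (by omega), Finset.mem_filter.2 ⟨Finset.mem_range.2 hkM, ?_⟩⟩
    have h5 : (k : ℝ) - a * M / W = M * (k / M - a / W) := by field_simp
    rw [h5, abs_mul, abs_of_pos hM0]
    calc (M : ℝ) * |(k : ℝ) / M - a / W| ≤ M * (w / N) := by gcongr
      _ = _ := by ring
  calc (((range M).filter fun k => ¬ offMajor w N M k).card : ℝ)
      ≤ ∑ a ∈ range (W + 2),
        (((range M).filter fun k : ℕ => |(k : ℝ) - a * M / W| ≤ w * M / N).card : ℝ) := by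
        exact_mod_cast (Finset.card_le_card hsub).trans Finset.card_biUnion_le
    _ ≤ ∑ a ∈ range (W + 2), (2 * (w * M / N) + 1 : ℝ) :=
        Finset.sum_le_sum fun a _ => card_filter_abs_sub_le _ _ (by positivity)
    _ = (W + 2) * (2 * (w * M / N) + 1) := by simp; ring
    _ ≤ (W + 2) * (2 * (w * M / N) + M / N) := by
        gcongr
        rw [one_le_div hN0]
        exact_mod_cast hNM.le
    _ = _ := by ring

lemma eventually_eul_div_lt {η : ℝ} (hη : 0 < η) :
    ∀ᶠ k₀ : ℕ in atTop, eul (16 ^ k₀) / ((16 ^ k₀ : ℕ) : ℝ) < η := by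
  have h1 := ((tendsto_pow_const_div_const_pow_of_one_lt 4
    (by norm_num : (1 : ℝ) < 16)).const_mul (48 * 256))
  rw [mul_zero] at h1
  filter_upwards [h1.eventually_lt_const hη, eventually_ge_atTop 1] with k hk hk1
  refine lt_of_le_of_lt ?_ hk
  rw [← mul_div_assoc]
  push_cast
  gcongr
  refine (eul_le_log (Nat.one_le_pow _ _ (by norm_num))).trans ?_
  have h2 : Real.log ((16 ^ k : ℕ) : ℝ) ≤ 3 * k := by
    have h16 : Real.log 16 ≤ 3 := by
      rw [show (16 : ℝ) = 2 ^ 4 by norm_num, Real.log_pow]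
      push_cast
      linarith [Real.log_two_lt_d9]
    push_cast
    rw [Real.log_pow, mul_comm]
    gcongr
  have h3 : (1 : ℝ) ≤ k := by exact_mod_cast hk1
  have h0 : 0 ≤ Real.log ((16 ^ k : ℕ) : ℝ) := Real.log_natCast_nonneg _
  calc 48 * (1 + Real.log ((16 ^ k : ℕ) : ℝ)) ^ 4 ≤ 48 * (4 * (k : ℝ)) ^ 4 := by
        gcongr
        linarith
    _ = _ := by ring

open scoped Classical in
lemma eventually_norm_sub_le_of_not_offMajor (w : ℕ) {δ : ℝ} (hδ : 0 < δ) :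
    ∀ᶠ N : ℕ in atTop, ∀ u v M k : ℕ, u ≤ v → v ≤ N → ¬ offMajor w N M k →
      ‖esum (Ioc u v) lp ((k : ℝ) / M) - esum (Ioc u v) (cw w.factorial) ((k : ℝ) / M)‖ ≤ δ * N := by
  have hpi := Real.pi_pos
  have hD : 0 < 1 + 2 * Real.pi * w := by positivity
  filter_upwards [eventually_norm_pS_sub_esum_cw_le w.factorial_pos
    (show 0 < δ / (2 * (1 + 2 * Real.pi * w)) by positivity), eventually_gt_atTop 0]
    with N hN hN0 u v M k huv hv hk
  have hN0' : (0 : ℝ) < N := by exact_mod_cast hN0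
  simp only [offMajor, not_forall, not_lt] at hk
  obtain ⟨a, ha⟩ := hk
  set x := (k : ℝ) / M
  have key : ∀ y ≤ N, ‖esum (Ioc 0 y) lp x - esum (Ioc 0 y) (cw w.factorial) x‖ ≤ δ / 2 * N := by
    intro y hy
    have h := hN y hy a (x - a / w.factorial)
    rw [add_sub_cancel] at h
    refine h.trans ?_
    have h1 : |x - a / w.factorial| * N ≤ w := (le_div_iff₀ hN0').1 ha
    calc δ / (2 * (1 + 2 * Real.pi * w)) * N * (1 + 2 * Real.pi * |x - a / w.factorial| * N)
        = δ / (2 * (1 + 2 * Real.pi * w)) * N *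
          (1 + 2 * Real.pi * (|x - a / w.factorial| * N)) := by ring
      _ ≤ δ / (2 * (1 + 2 * Real.pi * w)) * N * (1 + 2 * Real.pi * w) := by gcongr
      _ = _ := by field_simp
  rw [esum_Ioc_eq_sub huv, esum_Ioc_eq_sub huv, sub_sub_sub_comm]
  refine (norm_sub_le _ _).trans ?_
  linarith [key v hv, key u (huv.trans hv)]

set_option maxHeartbeats 1000000 in
open scoped Classical in
/-- On a window comparable to `N`, the primes may be replaced by the integers coprime to `w!` when
counting representations of `N` as a sum of three elements. -/
theorem exists_eventually_abs_rep_sub_le {η : ℝ} (hη : 0 < η) : ∃ w : ℕ, ∀ᶠ N : ℕ in atTop,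
    ∀ u v : ℕ, N ≤ 4 * u → u ≤ v → v ≤ N →
      |rep lp N u v - rep (cw w.factorial) N u v| ≤ η * (N : ℝ) ^ 2 := by
  obtain ⟨K, hK⟩ := eventually_sum_offMajor_norm_cube_le (show 0 < η / 3 by positivity)
  obtain ⟨k₀, hk₀, hKk₀⟩ := ((eventually_eul_div_lt (show 0 < η / 3 by positivity)).and
    (eventually_ge_atTop K)).exists
  set w := 16 ^ k₀ with hw
  set W := w.factorial with hWdef
  have hw0 : 0 < w := by positivity
  set D : ℝ := 75 * (W + 2) * (2 * w + 1) with hD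
  have hD0 : 0 < D := by positivity
  set δ : ℝ := min 1 (η / 3 / D) with hδ
  have hδ0 : 0 < δ := lt_min one_pos (by positivity)
  refine ⟨w, ?_⟩
  filter_upwards [hK k₀ hKk₀, eventually_norm_sub_le_of_not_offMajor w hδ0,
    eventually_ge_atTop (w * W), eventually_gt_atTop 0] with N h1 h2 h3 hN u v hu huv hv
  have hN0 : (0 : ℝ) < N := by exact_mod_cast hN
  set M := (3 * N + 1) * N.factorial with hM
  have hfac := N.factorial_pos
  have hM3 : 3 * N < M := by
    rw [hM]; nlinarith
  have hNM : N < M := by omega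
  have hM0 : (0 : ℝ) < M := by exact_mod_cast (Nat.zero_le N).trans_lt hNM
  have hdvd : ∀ r, 1 ≤ r → r ^ 4 ≤ N → r ∣ M := fun r hr hrN =>
    dvd_mul_of_dvd_right (Nat.dvd_factorial hr ((Nat.le_self_pow (by norm_num) r).trans hrN)) _
  set F : ℕ → ℂ := fun k => esum (Ioc u v) lp ((k : ℝ) / M) with hF
  set G : ℕ → ℂ := fun k => esum (Ioc u v) (cw W) ((k : ℝ) / M) with hG
  have hoffF := h1 u v M hu huv hv hNM hdvd
  have hoffG := sum_offMajor_norm_esum_cw_le hw0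
    ((Nat.le_mul_of_pos_left _ hw0).trans h3) huv hv hNM
  have hFle : ∀ k, ‖F k‖ ≤ 4 * N := by
    intro k
    have hv' : (v : ℝ) ≤ N := by exact_mod_cast hv
    have hu' : (u : ℝ) ≤ N := by exact_mod_cast huv.trans hv
    rw [hF]
    simp only
    rw [← pS_sub_pS huv]
    refine (norm_sub_le _ _).trans ?_
    linarith [norm_pS_le v ((k : ℝ) / M), norm_pS_le u ((k : ℝ) / M)]
  have hmaj : ∑ k ∈ (range M).filter (fun k => ¬ offMajor w N M k), ‖F k ^ 3 - G k ^ 3‖ ≤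
      η / 3 * M * (N : ℝ) ^ 2 := by
    calc _ ≤ ∑ k ∈ (range M).filter (fun k => ¬ offMajor w N M k), 75 * (N : ℝ) ^ 2 * (δ * N) := by
          refine Finset.sum_le_sum fun k hk => ?_
          have h4 := h2 u v M k huv hv (Finset.mem_filter.1 hk).2
          have h5 : ‖G k‖ ≤ 5 * N := by
            have h6 := norm_sub_norm_le (G k) (F k)
            rw [norm_sub_rev] at h6
            have h7 : δ * N ≤ N := mul_le_of_le_one_left hN0.le (min_le_left _ _)
            linarith [hFle k]
          have h8 := norm_pow_three_sub_le_mul ((hFle k).trans (by linarith)) h5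
          refine h8.trans ?_
          calc 3 * (5 * (N : ℝ)) ^ 2 * ‖F k - G k‖ ≤ 3 * (5 * (N : ℝ)) ^ 2 * (δ * N) := by gcongr
            _ = _ := by ring
      _ = ((range M).filter fun k => ¬ offMajor w N M k).card * (75 * (N : ℝ) ^ 2 * (δ * N)) := by
          rw [Finset.sum_const, nsmul_eq_mul]
      _ ≤ (W + 2) * (2 * w + 1) * M / N * (75 * (N : ℝ) ^ 2 * (δ * N)) := by
          gcongr
          exact card_not_offMajor_le hN hNM h3
      _ = D * δ * M * (N : ℝ) ^ 2 := by
          rw [hD]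
          field_simp
      _ ≤ _ := by
          gcongr
          rw [mul_comm]
          exact (le_div_iff₀ hD0).1 (min_le_right _ _)
  have hoff : ∑ k ∈ (range M).filter (offMajor w N M), ‖F k ^ 3 - G k ^ 3‖ ≤
      η / 3 * M * (N : ℝ) ^ 2 + η / 3 * M * (N : ℝ) ^ 2 := by
    calc _ ≤ ∑ k ∈ (range M).filter (offMajor w N M), (‖F k‖ ^ 3 + ‖G k‖ ^ 3) :=
          Finset.sum_le_sum fun k _ => norm_pow_three_sub_le _ _
      _ ≤ _ := by
          rw [Finset.sum_add_distrib]
          refine add_le_add hoffF (hoffG.trans ?_)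
          gcongr
  have hid : ((M * (rep lp N u v - rep (cw W) N u v) : ℝ) : ℂ) =
      ∑ k ∈ range M, (F k ^ 3 - G k ^ 3) * ex (-(N * ((k : ℝ) / M))) := by
    rw [mul_sub, Complex.ofReal_sub, mul_rep_eq hNM (by omega), mul_rep_eq hNM (by omega),
      ← Finset.sum_sub_distrib]
    exact Finset.sum_congr rfl fun k _ => (sub_mul _ _ _).symm
  have hfin : M * |rep lp N u v - rep (cw W) N u v| ≤ M * (η * (N : ℝ) ^ 2) := by
    calc M * |rep lp N u v - rep (cw W) N u v|
        = ‖((M * (rep lp N u v - rep (cw W) N u v) : ℝ) : ℂ)‖ := by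
          rw [Complex.norm_real, Real.norm_eq_abs, abs_mul, abs_of_pos hM0]
      _ ≤ ∑ k ∈ range M, ‖F k ^ 3 - G k ^ 3‖ := by
          rw [hid]
          refine (norm_sum_le _ _).trans (Finset.sum_le_sum fun k _ => ?_)
          rw [norm_mul, norm_ex, mul_one]
      _ ≤ _ := by
          rw [← Finset.sum_filter_add_sum_filter_not _ (offMajor w N M)]
          linarith
  exact le_of_mul_le_mul_left hfin hM0

lemma sq_le_rep_cw {W N t h P : ℕ} (hW : 0 < W) (hP : P = ∏ p ∈ W.primeFactors, p)
    (hN : N.Coprime W) (hNt : 3 * t + 2 * (P * h) < N) :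
    ((h : ℝ) * P) ^ 2 ≤ rep (cw W) N t (N - 2 * t) := by
  have hcw : ∀ a b c, 0 ≤ if a + b + c = N then cw W a * cw W b * cw W c else 0 := by
    intro a b c
    split_ifs
    · exact mul_nonneg (mul_nonneg (cw_nonneg _ _) (cw_nonneg _ _)) (cw_nonneg _ _)
    · exact le_rfl
  have hsub : (Ioc t (t + P * h) : Finset ℕ) ⊆ Ioc t (N - 2 * t) :=
    Finset.Ioc_subset_Ioc_right (by omega)
  refine (sq_le_sum_cw (t := t) (h := h) hW hP hN (by omega)).trans ?_
  calc _ ≤ ∑ a ∈ Ioc t (t + P * h), ∑ b ∈ Ioc t (t + P * h), ∑ c ∈ Ioc t (N - 2 * t),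
        (if a + b + c = N then cw W a * cw W b * cw W c else 0) := by
        refine Finset.sum_le_sum fun a ha => Finset.sum_le_sum fun b hb => ?_
        rw [Finset.mem_Ioc] at ha hb
        refine le_trans ?_ (Finset.single_le_sum (fun c _ => hcw a b c)
          (Finset.mem_Ioc.2 ⟨?_, ?_⟩ : N - a - b ∈ Ioc t (N - 2 * t)))
        · rw [if_pos (by omega)]
        · omega
        · omega
    _ ≤ ∑ a ∈ Ioc t (t + P * h), ∑ b ∈ Ioc t (N - 2 * t), ∑ c ∈ Ioc t (N - 2 * t),
        (if a + b + c = N then cw W a * cw W b * cw W c else 0) :=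
        Finset.sum_le_sum fun a _ => Finset.sum_le_sum_of_subset_of_nonneg hsub
          fun b _ _ => Finset.sum_nonneg fun c _ => hcw a b c
    _ ≤ _ := Finset.sum_le_sum_of_subset_of_nonneg hsub
          fun a _ _ => Finset.sum_nonneg fun b _ => Finset.sum_nonneg fun c _ => hcw a b c

lemma exists_primes_of_rep_lp_ne_zero {N u v : ℕ} (h : rep lp N u v ≠ 0) :
    ∃ a b c, a.Prime ∧ b.Prime ∧ c.Prime ∧ a + b + c = N ∧ u < a ∧ u < b ∧ u < c := by
  obtain ⟨a, ha, h⟩ := Finset.exists_ne_zero_of_sum_ne_zero h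
  obtain ⟨b, hb, h⟩ := Finset.exists_ne_zero_of_sum_ne_zero h
  obtain ⟨c, hc, h⟩ := Finset.exists_ne_zero_of_sum_ne_zero h
  have hp : ∀ n, lp n ≠ 0 → n.Prime := fun n hn => by
    by_contra h'
    exact hn (if_neg h')
  obtain ⟨habc, h⟩ := ite_ne_right_iff.1 h
  exact ⟨a, b, c, hp a (left_ne_zero_of_mul (left_ne_zero_of_mul h)),
    hp b (right_ne_zero_of_mul (left_ne_zero_of_mul h)), hp c (right_ne_zero_of_mul h), habc,
    (Finset.mem_Ioc.1 ha).1, (Finset.mem_Ioc.1 hb).1, (Finset.mem_Ioc.1 hc).1⟩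

/-- Every large prime is a sum of three nearly equal primes. -/
theorem eventually_exists_three_primes {ε : ℝ} (hε : 0 < ε) (hε1 : ε ≤ 1) :
    ∀ᶠ N : ℕ in atTop, N.Prime → ∃ a b c, a.Prime ∧ b.Prime ∧ c.Prime ∧ a + b + c = N ∧
      (N : ℝ) ≤ (3 + ε) * a ∧ (N : ℝ) ≤ (3 + ε) * b ∧ (N : ℝ) ≤ (3 + ε) * c := by
  set ρ : ℝ := ε / 24 with hρ
  have hρ0 : 0 < ρ := by positivity
  obtain ⟨w, hw⟩ := exists_eventually_abs_rep_sub_le (show 0 < ρ ^ 2 / 8 by positivity)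
  set P := ∏ p ∈ w.factorial.primeFactors, p with hP
  have hP0 : 0 < P := Finset.prod_pos fun p hp => (Nat.prime_of_mem_primeFactors hp).pos
  filter_upwards [hw, eventually_gt_atTop w,
    tendsto_natCast_atTop_atTop.eventually_ge_atTop (2 * P / ρ),
    tendsto_natCast_atTop_atTop.eventually_ge_atTop (60 / ε)] with N hN hwN hNP hNε hNp
  rw [div_le_iff₀ (by positivity)] at hNP hNε
  have hN0 : (0 : ℝ) < N := by exact_mod_cast hNp.pos
  set h := ⌊ρ * N / P⌋₊ with hh
  have hP0' : (0 : ℝ) < P := by exact_mod_cast hP0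
  have hle : (h : ℝ) * P ≤ ρ * N := (le_div_iff₀ hP0').1 (Nat.floor_le (by positivity))
  have hge : ρ * N / 2 ≤ (h : ℝ) * P := by
    have := (div_lt_iff₀ hP0').1 (Nat.lt_floor_add_one (ρ * N / P))
    rw [← hh] at this
    linarith
  have hcop : N.Coprime w.factorial := by
    rw [hNp.coprime_iff_not_dvd, hNp.dvd_factorial]
    omega
  have hL : P * h * 24 ≤ N := by
    have h1 : ((P * h * 24 : ℕ) : ℝ) ≤ N := by
      push_cast
      nlinarith
    exact_mod_cast h1
  have hεN : 60 ≤ ε * N := by linarith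
  have hN60 : 60 ≤ N := by
    have : (60 : ℝ) ≤ N := by nlinarith
    exact_mod_cast this
  obtain ⟨t, ht⟩ : ∃ t, (N - 2 * (P * h)) / 3 = t + 1 := ⟨(N - 2 * (P * h)) / 3 - 1, by omega⟩
  have ht0 : N ≤ 3 * t + 5 + 2 * (P * h) := by omega
  have ht1 : (N : ℝ) ≤ 3 * t + 5 + 2 * (h * P) := by
    rw [mul_comm (h : ℝ)]
    exact_mod_cast ht0
  have htε : (N : ℝ) ≤ (3 + ε) * (t + 1) := by
    have h1 : ε * N ≤ ε * (3 * t + 5 + 2 * (h * P)) := by gcongr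
    have h2 : ε * (h * P) ≤ ρ * N := (mul_le_of_le_one_left (by positivity) hε1).trans hle
    nlinarith
  have hrep := sq_le_rep_cw w.factorial_pos hP hcop (t := t) (h := h) (by omega)
  have h4 : N ≤ 4 * t := by omega
  have habs := (abs_le.1 (hN t (N - 2 * t) h4 (by omega) (by omega))).1
  have hsq : (ρ * N / 2) ^ 2 ≤ ((h : ℝ) * P) ^ 2 := by gcongr
  have hpos : 0 < (ρ * N) ^ 2 := by positivity
  obtain ⟨a, b, c, ha, hb, hc, habc, hta, htb, htc⟩ :=
    exists_primes_of_rep_lp_ne_zero (N := N) (u := t) (v := N - 2 * t) (by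
      apply ne_of_gt
      nlinarith)
  have hfin : ∀ x : ℕ, t < x → (N : ℝ) ≤ (3 + ε) * x := fun x hx => by
    refine htε.trans ?_
    gcongr
    exact_mod_cast hx
  exact ⟨a, b, c, ha, hb, hc, habc, hfin a hta, hfin b htb, hfin c htc⟩

lemma tendsto_primeCounting_mul_log_div :
    Tendsto (fun n : ℕ => (n.primeCounting : ℝ) * Real.log n / n) atTop (nhds 1) := by
  have hlog : Tendsto (fun n : ℕ => Real.log n) atTop atTop :=
    Real.tendsto_log_atTop.comp tendsto_natCast_atTop_atTop
  have hθ : Tendsto (fun n : ℕ => Chebyshev.theta n / n) atTop (nhds 1) := by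
    have h := tendsto_sum_lp_modEq one_pos (Nat.coprime_one_right 0)
    simpa [Nat.modEq_one, sum_lp_eq_theta] using h
  obtain ⟨C, hC⟩ := Chebyshev.primeCounting_sub_theta_div_log_isBigO.bound
  have h0 : Tendsto (fun n : ℕ => (n.primeCounting : ℝ) * Real.log n / n -
      Chebyshev.theta n / n) atTop (nhds 0) := by
    refine squeeze_zero_norm' ?_ (hlog.const_div_atTop C)
    filter_upwards [tendsto_natCast_atTop_atTop.eventually hC, hlog.eventually_gt_atTop 0,
      eventually_gt_atTop 0] with n hn hl hn0
    have hn0' : (0 : ℝ) < n := by exact_mod_cast hn0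
    rw [Nat.floor_natCast, Real.norm_of_nonneg (by positivity : (0 : ℝ) ≤ n / Real.log n ^ 2)] at hn
    have h1 : (n.primeCounting : ℝ) * Real.log n / n - Chebyshev.theta n / n =
        (n.primeCounting - Chebyshev.theta n / Real.log n) * (Real.log n / n) := by
      field_simp
    rw [h1, norm_mul, Real.norm_of_nonneg (by positivity : (0 : ℝ) ≤ Real.log n / n)]
    calc _ ≤ C * (n / Real.log n ^ 2) * (Real.log n / n) := by gcongr
      _ = _ := by field_simp
  simpa using h0.add hθ

lemma tendsto_primeCounting_comp_div {f : ℕ → ℕ} {c : ℝ} (hc : 0 < c)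
    (hf : Tendsto (fun n => (f n : ℝ) / n) atTop (nhds c)) :
    Tendsto (fun n => ((f n).primeCounting : ℝ) / n.primeCounting) atTop (nhds c) := by
  have hlog : Tendsto (fun n : ℕ => Real.log n) atTop atTop :=
    Real.tendsto_log_atTop.comp tendsto_natCast_atTop_atTop
  have hf_top : Tendsto f atTop atTop := by
    rw [← tendsto_natCast_atTop_iff (R := ℝ)]
    refine (hf.pos_mul_atTop hc tendsto_natCast_atTop_atTop).congr' ?_
    filter_upwards [eventually_gt_atTop 0] with n hn
    field_simp
  have hl : Tendsto (fun n => Real.log (f n) / Real.log n) atTop (nhds 1) := by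
    have h1 := ((hf.log hc.ne').div_atTop hlog).const_add 1
    rw [add_zero] at h1
    refine h1.congr' ?_
    filter_upwards [hlog.eventually_gt_atTop 0, eventually_gt_atTop 0,
      hf_top.eventually_gt_atTop 0] with n hn hn0 hfn
    rw [Real.log_div (by positivity) (by positivity)]
    field_simp
    ring
  have hp := tendsto_primeCounting_mul_log_div
  have h := (((hp.comp hf_top).mul hf).div hl one_ne_zero).div hp one_ne_zero
  simp only [one_mul, div_one] at h
  refine h.congr' ?_
  filter_upwards [hlog.eventually_gt_atTop 0, eventually_gt_atTop 0,
    (hlog.comp hf_top).eventually_gt_atTop 0, hf_top.eventually_gt_atTop 0] with n h1 h2 h3 h4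
  simp only [Function.comp_apply, Pi.div_apply] at h3 ⊢
  field_simp

lemma eq_zero_or_prime_or_mem_add {n x : ℕ} (hx : x ∈ S n) :
    x = 0 ∨ (x.Prime ∧ nthPrime n ≤ x) ∨ (2 * nthPrime n ≤ x ∧
      x ∈ ((S n : Set ℕ) \ {0}) + ((S n : Set ℕ) \ {0})) := by
  induction hx using AddSubmonoid.closure_induction with
  | mem x hx => exact Or.inr (Or.inl hx)
  | zero => exact Or.inl rfl
  | add x y hx hy ihx ihy =>
    rcases Nat.eq_zero_or_pos x with rfl | hx0
    · rwa [zero_add]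
    rcases Nat.eq_zero_or_pos y with rfl | hy0
    · rwa [add_zero]
    exact Or.inr (Or.inr ⟨by omega, Set.add_mem_add ⟨hx, hx0.ne'⟩ ⟨hy, hy0.ne'⟩⟩)

lemma prime_of_mem_atoms {n x : ℕ} (hx : x ∈ atoms n) : x.Prime := by
  rcases eq_zero_or_prime_or_mem_add hx.1.1 with h | h | h
  · exact absurd h hx.1.2
  · exact h.1
  · exact absurd h.2 hx.2

lemma mem_atoms_of_prime {n q : ℕ} (hn : 2 < nthPrime n) (hq : q.Prime) (h1 : nthPrime n ≤ q)
    (h3 : q < 3 * nthPrime n) : q ∈ atoms n := by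
  refine ⟨⟨AddSubmonoid.subset_closure ⟨hq, h1⟩, hq.ne_zero⟩, ?_⟩
  rintro ⟨x, ⟨hx, hx0⟩, y, ⟨hy, hy0⟩, hxy⟩
  have hxy' : x + y = q := hxy
  have hx0' : x ≠ 0 := hx0
  have hy0' : y ≠ 0 := hy0
  have hx' := eq_zero_or_prime_or_mem_add hx
  have hy' := eq_zero_or_prime_or_mem_add hy
  obtain ⟨hxp, hxn⟩ : x.Prime ∧ nthPrime n ≤ x := by
    rcases hx' with h | h | h <;> [omega; exact h; omega]
  obtain ⟨hyp, hyn⟩ : y.Prime ∧ nthPrime n ≤ y := by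
    rcases hy' with h | h | h <;> [omega; exact h; omega]
  have h4 := hxp.eq_two_or_odd
  have h5 := hyp.eq_two_or_odd
  have h6 := hq.eq_two_or_odd
  omega

lemma tendsto_nthPrime : Tendsto nthPrime atTop atTop :=
  (Nat.nth_strictMono Nat.infinite_setOfPred_prime).tendsto_atTop.comp (tendsto_sub_atTop_nat 1)

lemma primeCounting_nthPrime {n : ℕ} (hn : 0 < n) : (nthPrime n).primeCounting = n := by
  rw [nthPrime, Nat.primeCounting, Nat.primeCounting',
    Nat.count_nth_succ_of_infinite Nat.infinite_setOfPred_prime]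
  omega

lemma eventually_le_of_mem_atoms {ε : ℝ} (hε : 0 < ε) (hε1 : ε ≤ 1) :
    ∀ᶠ n in atTop, ∀ q ∈ atoms n, q ≤ ⌊(3 + ε) * nthPrime n⌋₊ := by
  obtain ⟨N, hN⟩ := eventually_atTop.1 (eventually_exists_three_primes hε hε1)
  filter_upwards [tendsto_nthPrime.eventually_ge_atTop N] with n hn q hq
  by_contra! hlt
  have hlt' := (Nat.floor_lt (by positivity)).1 hlt
  have hNq : N ≤ q := by
    have h1 : (nthPrime n : ℝ) ≤ q :=
      (le_mul_of_one_le_left (Nat.cast_nonneg _) (by linarith)).trans hlt'.le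
    exact hn.trans (by exact_mod_cast h1)
  obtain ⟨a, b, c, ha, hb, hc, habc, ha', hb', hc'⟩ := hN q hNq (prime_of_mem_atoms hq)
  have hmem : ∀ x : ℕ, x.Prime → (q : ℝ) ≤ (3 + ε) * x → x ∈ S n := fun x hx hxq => by
    refine AddSubmonoid.subset_closure ⟨hx, ?_⟩
    have h1 := lt_of_mul_lt_mul_left (hlt'.trans_le hxq) (by positivity)
    exact_mod_cast h1.le
  refine hq.2 ⟨a + b, ⟨add_mem (hmem a ha ha') (hmem b hb hb'), ?_⟩, c, ⟨hmem c hc hc', ?_⟩, habc⟩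
  · have := ha.pos
    simp only [Set.mem_singleton_iff]
    omega
  · exact hc.ne_zero

lemma primeCounting_three_mul_le {n B : ℕ} (hB : ∀ q ∈ atoms n, q ≤ B) (hn : 2 < nthPrime n) :
    (3 * nthPrime n - 1).primeCounting ≤ (u n).primeCounting := by
  have hle : ∀ q ∈ atoms n, q ≤ u n := fun q hq => le_csSup ⟨B, hB⟩ hq
  rw [← Nat.primesLE_card_eq_primeCounting, ← Nat.primesLE_card_eq_primeCounting]
  refine Finset.card_le_card fun q hq => ?_
  rw [Nat.mem_primesLE] at hq ⊢
  refine ⟨?_, hq.2⟩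
  rcases le_or_gt (nthPrime n) q with h | h
  · exact hle q (mem_atoms_of_prime hn hq.2 h (by omega))
  · exact h.le.trans (hle _ (mem_atoms_of_prime hn
      (Nat.nth_mem_of_infinite Nat.infinite_setOfPred_prime _) le_rfl (by omega)))

end PrimeSemi

theorem primeCounting_u_asymptotic :
    Filter.Tendsto (fun n => (Nat.primeCounting (u n) : ℝ) / (n : ℝ))
      Filter.atTop (nhds 3) := by
  have hratio : ∀ {f : ℕ → ℕ} {c : ℝ}, 0 < c →
      Tendsto (fun n => (f n : ℝ) / n) atTop (nhds c) →
      Tendsto (fun n => ((f (nthPrime n)).primeCounting : ℝ) / n) atTop (nhds c) := by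
    intro f c hc hf
    refine ((PrimeSemi.tendsto_primeCounting_comp_div hc hf).comp
      PrimeSemi.tendsto_nthPrime).congr' ?_
    filter_upwards [eventually_gt_atTop 0] with n hn
    rw [Function.comp_apply, PrimeSemi.primeCounting_nthPrime hn]
  have hlow : Tendsto (fun n : ℕ => ((3 * n - 1 : ℕ) : ℝ) / n) atTop (nhds 3) := by
    have h := (tendsto_const_div_atTop_nhds_zero_nat (1 : ℝ)).const_sub 3
    rw [sub_zero] at h
    refine h.congr' ?_
    filter_upwards [eventually_gt_atTop 0] with n hn
    rw [Nat.cast_sub (by omega)]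
    push_cast
    field_simp
  refine tendsto_order.2 ⟨fun a ha => ?_, fun b hb => ?_⟩
  · filter_upwards [(hratio three_pos hlow).eventually_const_lt ha,
      PrimeSemi.eventually_le_of_mem_atoms one_pos le_rfl,
      PrimeSemi.tendsto_nthPrime.eventually_gt_atTop 2]
      with n h1 h2 h3
    refine h1.trans_le ?_
    gcongr
    exact PrimeSemi.primeCounting_three_mul_le h2 h3
  · have hε : 0 < min 1 ((b - 3) / 2) := lt_min one_pos (by linarith)
    have hεb : 3 + min 1 ((b - 3) / 2) < b := by linarith [min_le_right 1 ((b - 3) / 2)]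
    set ε := min 1 ((b - 3) / 2)
    have hup : Tendsto (fun n : ℕ => (⌊(3 + ε) * n⌋₊ : ℝ) / n) atTop (nhds (3 + ε)) :=
      (tendsto_nat_floor_mul_div_atTop (by positivity)).comp tendsto_natCast_atTop_atTop
    filter_upwards [(hratio (by positivity) hup).eventually_lt_const hεb,
      PrimeSemi.eventually_le_of_mem_atoms hε (min_le_left _ _)] with n h1 h2
    refine lt_of_le_of_lt ?_ h1
    gcongr
    exact Nat.monotone_primeCounting (csSup_le' h2)
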